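/- Let m ∈ ℕ and let 𝒢 be an m-linear Littlewood-Paley g-function with convolution-type kernel (i.e. K_t(x,y⃗) = t^{-mn}K((x−y₁)/t,…,(x−y_m)/t) with K a multilinear Littlewood-Paley kernel). Let 1 < p_k < ∞ with 1/p = Σ_{k=1}^m 1/p_k, ω⃗ ∈ A_{P⃗} ∩ (A_∞)^m with ν_{ω⃗} = ∏ᵢ ωᵢ^{p/pᵢ}, and let (φ⃗₁,φ₂) satisfy [φ⃗₁,φ₂]₂ < ∞. If b⃗ ∈ (BMO)^m, then the iterated commutator 𝒢_{Πb⃗} is bounded from ∏_{i=1}^m M^{pᵢ,φ₁ᵢ}(ωᵢ) to M^{p,φ₂}(ν_{ω⃗}). -/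

import Mathlib

open MeasureTheory Metric Set Filter Function
open scoped ENNReal NNReal BigOperators Topology FourierTransform

noncomputable section

/-- Euclidean space `ℝⁿ`. -/
abbrev Rn (n : ℕ) : Type := EuclideanSpace ℝ (Fin n)

namespace GWM

variable {n m : ℕ}

/-- The weighted measure `ω(E) = ∫_E ω(x) dx`. -/
def wMeas (ω : Rn n → ℝ) (E : Set (Rn n)) : ℝ≥0∞ :=
  ∫⁻ x in E, ENNReal.ofReal (ω x)

/-- `(∫_E g(x)^p ω(x) dx)^(1/p)` for an `ℝ≥0∞`-valued `g`. -/
def wLpNormE (p : ℝ) (ω : Rn n → ℝ) (E : Set (Rn n)) (g : Rn n → ℝ≥0∞) : ℝ≥0∞ :=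
  (∫⁻ x in E, g x ^ p * ENNReal.ofReal (ω x)) ^ (1 / p)

/-- The weighted Lebesgue norm `‖f‖_{L^p(E, ω dx)}`. -/
def wLpNorm (p : ℝ) (ω : Rn n → ℝ) (E : Set (Rn n)) (f : Rn n → ℝ) : ℝ≥0∞ :=
  wLpNormE p ω E fun x => ENNReal.ofReal |f x|

/-- The weak weighted Lebesgue norm, `ℝ≥0∞`-valued version. -/
def wWeakLpNormE (p : ℝ) (ω : Rn n → ℝ) (E : Set (Rn n)) (g : Rn n → ℝ≥0∞) : ℝ≥0∞ :=
  ⨆ (α : ℝ) (_ : 0 < α), ENNReal.ofReal α * wMeas ω {x ∈ E | ENNReal.ofReal α < g x} ^ (1 / p)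

/-- The weak weighted Lebesgue norm `‖f‖_{WL^p(E, ω dx)}`. -/
def wWeakLpNorm (p : ℝ) (ω : Rn n → ℝ) (E : Set (Rn n)) (f : Rn n → ℝ) : ℝ≥0∞ :=
  wWeakLpNormE p ω E fun x => ENNReal.ofReal |f x|

/-- The generalized weighted Morrey norm (`ℝ≥0∞`-valued function version). -/
def morreyNormE (p : ℝ) (φ : Rn n → ℝ → ℝ) (ω : Rn n → ℝ) (g : Rn n → ℝ≥0∞) : ℝ≥0∞ :=
  ⨆ (x : Rn n) (r : ℝ) (_ : 0 < r),
    (ENNReal.ofReal (φ x r))⁻¹ * wMeas ω (ball x r) ^ (-(1 / p)) * wLpNormE p ω (ball x r) g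

/-- The generalized weighted Morrey norm `‖f‖_{M^{p,φ}(ω)}`. -/
def morreyNorm (p : ℝ) (φ : Rn n → ℝ → ℝ) (ω : Rn n → ℝ) (f : Rn n → ℝ) : ℝ≥0∞ :=
  morreyNormE p φ ω fun x => ENNReal.ofReal |f x|

/-- The weak generalized weighted Morrey norm (`ℝ≥0∞`-valued version). -/
def weakMorreyNormE (p : ℝ) (φ : Rn n → ℝ → ℝ) (ω : Rn n → ℝ) (g : Rn n → ℝ≥0∞) : ℝ≥0∞ :=
  ⨆ (x : Rn n) (r : ℝ) (_ : 0 < r),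
    (ENNReal.ofReal (φ x r))⁻¹ * wMeas ω (ball x r) ^ (-(1 / p)) * wWeakLpNormE p ω (ball x r) g

/-- The weak generalized weighted Morrey norm `‖f‖_{WM^{p,φ}(ω)}`. -/
def weakMorreyNorm (p : ℝ) (φ : Rn n → ℝ → ℝ) (ω : Rn n → ℝ) (f : Rn n → ℝ) : ℝ≥0∞ :=
  weakMorreyNormE p φ ω fun x => ENNReal.ofReal |f x|

/-- The generalized local weighted Morrey norm at `x₀` (`ℝ≥0∞`-valued version). -/
def localMorreyNormE (x₀ : Rn n) (p : ℝ) (φ : Rn n → ℝ → ℝ) (ω : Rn n → ℝ)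
    (g : Rn n → ℝ≥0∞) : ℝ≥0∞ :=
  ⨆ (r : ℝ) (_ : 0 < r),
    (ENNReal.ofReal (φ x₀ r))⁻¹ * wMeas ω (ball x₀ r) ^ (-(1 / p)) * wLpNormE p ω (ball x₀ r) g

/-- The generalized local weighted Morrey norm `‖f‖_{M_{x₀}^{p,φ}(ω)}`. -/
def localMorreyNorm (x₀ : Rn n) (p : ℝ) (φ : Rn n → ℝ → ℝ) (ω : Rn n → ℝ)
    (f : Rn n → ℝ) : ℝ≥0∞ :=
  localMorreyNormE x₀ p φ ω fun x => ENNReal.ofReal |f x|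

/-- The weak generalized local weighted Morrey norm (`ℝ≥0∞`-valued version). -/
def localWeakMorreyNormE (x₀ : Rn n) (p : ℝ) (φ : Rn n → ℝ → ℝ) (ω : Rn n → ℝ)
    (g : Rn n → ℝ≥0∞) : ℝ≥0∞ :=
  ⨆ (r : ℝ) (_ : 0 < r),
    (ENNReal.ofReal (φ x₀ r))⁻¹ * wMeas ω (ball x₀ r) ^ (-(1 / p)) *
      wWeakLpNormE p ω (ball x₀ r) g

/-- The weak generalized local weighted Morrey norm `‖f‖_{WM_{x₀}^{p,φ}(ω)}`. -/
def localWeakMorreyNorm (x₀ : Rn n) (p : ℝ) (φ : Rn n → ℝ → ℝ) (ω : Rn n → ℝ)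
    (f : Rn n → ℝ) : ℝ≥0∞ :=
  localWeakMorreyNormE x₀ p φ ω fun x => ENNReal.ofReal |f x|

/-- Membership in the generalized weighted Morrey space `M^{p,φ}(ω)`. -/
def MemMorrey (p : ℝ) (φ : Rn n → ℝ → ℝ) (ω : Rn n → ℝ) (f : Rn n → ℝ) : Prop :=
  LocallyIntegrable f volume ∧ morreyNorm p φ ω f < ⊤

/-- Membership in the generalized local weighted Morrey space `M_{x₀}^{p,φ}(ω)`. -/
def MemLocalMorrey (x₀ : Rn n) (p : ℝ) (φ : Rn n → ℝ → ℝ) (ω : Rn n → ℝ)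
    (f : Rn n → ℝ) : Prop :=
  LocallyIntegrable f volume ∧ localMorreyNorm x₀ p φ ω f < ⊤

/-- A weight: a nonnegative locally integrable function, positive a.e. -/
def IsWeight (ω : Rn n → ℝ) : Prop :=
  LocallyIntegrable ω volume ∧ (∀ x, 0 ≤ ω x) ∧
    ∀ᵐ x ∂(volume : Measure (Rn n)), 0 < ω x

/-- The Muckenhoupt class `A₁`. -/
def IsA1 (ω : Rn n → ℝ) : Prop :=
  ∃ C : ℝ≥0, ∀ (x : Rn n) (r : ℝ), 0 < r →
    wMeas ω (ball x r) ≤ C * volume (ball x r) *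
      essInf (fun y => ENNReal.ofReal (ω y)) (volume.restrict (ball x r))

/-- The Muckenhoupt class `A_q`, `1 < q < ∞`. -/
def IsAq (q : ℝ) (ω : Rn n → ℝ) : Prop :=
  ∃ C : ℝ≥0, ∀ (x : Rn n) (r : ℝ), 0 < r →
    (volume (ball x r))⁻¹ * wMeas ω (ball x r) *
      ((volume (ball x r))⁻¹ *
        ∫⁻ y in ball x r, ENNReal.ofReal (ω y) ^ (-(1 / (q - 1)))) ^ (q - 1) ≤ C

/-- The Muckenhoupt class `A_∞ = ⋃_{1 ≤ q < ∞} A_q`. -/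
def IsAinf (ω : Rn n → ℝ) : Prop := IsA1 ω ∨ ∃ q : ℝ, 1 < q ∧ IsAq q ω

/-- The multiple weight `ν_{ω⃗} = ∏ ωᵢ^{p/pᵢ}`. -/
def nuw (p : ℝ) (ps : Fin m → ℝ) (ωs : Fin m → Rn n → ℝ) : Rn n → ℝ :=
  fun x => ∏ i, ωs i x ^ (p / ps i)

/-- The factor `(|B|⁻¹ ∫_B ωᵢ^{1-pᵢ'})^{1/pᵢ'}` in the `A_{P⃗}` condition, with the usual
modification `(essinf_B ωᵢ)⁻¹` when `pᵢ = 1`. -/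
def APfactor (q : ℝ) (ω : Rn n → ℝ) (E : Set (Rn n)) : ℝ≥0∞ :=
  if q = 1 then (essInf (fun y => ENNReal.ofReal (ω y)) (volume.restrict E))⁻¹
  else ((volume E)⁻¹ * ∫⁻ y in E, ENNReal.ofReal (ω y) ^ (-(1 / (q - 1)))) ^ ((q - 1) / q)

/-- The multiple Muckenhoupt condition `ω⃗ ∈ A_{P⃗}`. -/
def IsMultiAP (p : ℝ) (ps : Fin m → ℝ) (ωs : Fin m → Rn n → ℝ) : Prop :=
  ∃ C : ℝ≥0, ∀ (x : Rn n) (r : ℝ), 0 < r →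
    ((volume (ball x r))⁻¹ * wMeas (nuw p ps ωs) (ball x r)) ^ (1 / p) *
      ∏ i, APfactor (ps i) (ωs i) (ball x r) ≤ C

/-- The average `b_E = |E|⁻¹ ∫_E b`. -/
def ballAvg (b : Rn n → ℝ) (E : Set (Rn n)) : ℝ := (∫ y in E, b y) / (volume E).toReal

/-- The BMO norm `‖b‖_{BMO} = sup_B |B|⁻¹ ∫_B |b - b_B|`. -/
def bmoNorm (b : Rn n → ℝ) : ℝ≥0∞ :=
  ⨆ (x : Rn n) (r : ℝ) (_ : 0 < r),
    (volume (ball x r))⁻¹ * ∫⁻ y in ball x r, ENNReal.ofReal |b y - ballAvg b (ball x r)|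

/-- `b ∈ BMO`. -/
def MemBMO (b : Rn n → ℝ) : Prop := LocallyIntegrable b volume ∧ bmoNorm b < ⊤

/-- `f⁰ = f·χ_{2B}` for the ball `B = B(x₀,r)`. -/
def loc0 (x₀ : Rn n) (r : ℝ) (f : Rn n → ℝ) : Rn n → ℝ := (ball x₀ (2 * r)).indicator f

/-- `f^∞ = f·χ_{(2B)ᶜ}` for the ball `B = B(x₀,r)`. -/
def locInf (x₀ : Rn n) (r : ℝ) (f : Rn n → ℝ) : Rn n → ℝ := (ball x₀ (2 * r))ᶜ.indicator f

/-- `Σ_{j=1}^∞ ∏_{i=1}^m |2^{j+1}B|⁻¹ ∫_{2^{j+1}B} |fᵢ|`, for `B = B(x₀,r)`. -/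
def lsSum (x₀ : Rn n) (r : ℝ) (f : Fin m → Rn n → ℝ) : ℝ≥0∞ :=
  ∑' j : ℕ, ∏ i, (volume (ball x₀ (2 ^ (j + 2) * r)))⁻¹ *
    ∫⁻ y in ball x₀ (2 ^ (j + 2) * r), ENNReal.ofReal |f i y|

/-- The local size condition `T ∈ LS(∏ Xᵢ)`. -/
def LS (T : (Fin m → Rn n → ℝ) → Rn n → ℝ) (X : Fin m → (Rn n → ℝ) → Prop) : Prop :=
  ∃ C : ℝ≥0, ∀ (x₀ : Rn n) (r : ℝ), 0 < r → ∀ f : Fin m → Rn n → ℝ, (∀ i, X i (f i)) →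
    ∀ ℓ : ℕ, 1 ≤ ℓ → ℓ ≤ m →
      essSup
        (fun x => ENNReal.ofReal
          |T (fun i => if (i : ℕ) < ℓ then locInf x₀ r (f i) else loc0 x₀ r (f i)) x|)
        (volume.restrict (ball x₀ r)) ≤ C * lsSum x₀ r f

/-- The local boundedness condition `T ∈ LB(∏ Xᵢ → Y)`. -/
def LB (T : (Fin m → Rn n → ℝ) → Rn n → ℝ) (X : Fin m → (Rn n → ℝ) → Prop)
    (Xnorm : Fin m → (Rn n → ℝ) → ℝ≥0∞) (Ynorm : (Rn n → ℝ) → ℝ≥0∞) : Prop :=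
  ∃ C : ℝ≥0, ∀ (x₀ : Rn n) (r : ℝ), 0 < r → ∀ f : Fin m → Rn n → ℝ, (∀ i, X i (f i)) →
    Ynorm (T fun i => loc0 x₀ r (f i)) ≤ C * ∏ i, Xnorm i (f i)

/-- `T` is `m`-sublinear (subadditive in each entry). -/
def MSublinear (T : (Fin m → Rn n → ℝ) → Rn n → ℝ) : Prop :=
  ∀ (f : Fin m → Rn n → ℝ) (i : Fin m) (g h : Rn n → ℝ) (x : Rn n),
    |T (Function.update f i (g + h)) x| ≤
      |T (Function.update f i g) x| + |T (Function.update f i h) x|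

/-- Pointwise size condition `|T(f⃗)(x)| ≲ ∫ ∏|fᵢ(yᵢ)| (Σ|x-yⱼ|)^{-mn} dy⃗`
for `x ∉ ⋂ supp fⱼ`. -/
def PointwiseSize (T : (Fin m → Rn n → ℝ) → Rn n → ℝ)
    (X : Fin m → (Rn n → ℝ) → Prop) : Prop :=
  ∃ C : ℝ≥0, ∀ f : Fin m → Rn n → ℝ, (∀ i, X i (f i)) →
    ∀ x : Rn n, x ∉ ⋂ j, Function.support (f j) →
      ENNReal.ofReal |T f x| ≤
        C * ∫⁻ y : Fin m → Rn n,
          (∏ i, ENNReal.ofReal |f i (y i)|) *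
            ENNReal.ofReal (∑ j, dist x (y j)) ^ (-(m * n : ℝ))

/-- The iterated commutator `T_{Π b⃗}`. -/
def iterComm (T : (Fin m → Rn n → ℝ) → Rn n → ℝ) (b f : Fin m → Rn n → ℝ) : Rn n → ℝ :=
  fun x => T (fun i y => (b i x - b i y) * f i y) x

/-- The multilinear commutator `T_{Σ b⃗}`. -/
def sumComm (T : (Fin m → Rn n → ℝ) → Rn n → ℝ) (b f : Fin m → Rn n → ℝ) : Rn n → ℝ :=
  fun x => ∑ j, T (Function.update f j fun y => (b j x - b j y) * f j y) x

/-- `essinf_{t<η<∞} ∏ᵢ φ₁ᵢ(x,η) ωᵢ(B(x,η))^{1/pᵢ}`. -/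
def essInfProd (ps : Fin m → ℝ) (φ1 : Fin m → Rn n → ℝ → ℝ) (ωs : Fin m → Rn n → ℝ)
    (x : Rn n) (t : ℝ) : ℝ≥0∞ :=
  essInf (fun η => ∏ i, ENNReal.ofReal (φ1 i x η) * wMeas (ωs i) (ball x η) ^ (1 / ps i))
    (volume.restrict (Ioi t))

/-- The quantity inside the supremum in the conditions `[φ⃗₁,φ₂]` (with logarithmic factor
`(1+log(t/r))^k`). -/
def phiCondAt (k : ℕ) (ps : Fin m → ℝ) (φ1 : Fin m → Rn n → ℝ → ℝ)
    (ωs : Fin m → Rn n → ℝ) (φ2 : Rn n → ℝ → ℝ) (x : Rn n) (r : ℝ) : ℝ≥0∞ :=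
  (ENNReal.ofReal (φ2 x r))⁻¹ *
    ∫⁻ t in Ioi r,
      ENNReal.ofReal (1 + Real.log (t / r)) ^ k * essInfProd ps φ1 ωs x t *
        (∏ i, wMeas (ωs i) (ball x t) ^ (1 / ps i))⁻¹ * (ENNReal.ofReal t)⁻¹

/-- The condition `[φ⃗₁,φ₂] < ∞` (`k = 0`: condition `[·]₁`; `k = m`: condition `[·]₂`;
`k = 1`: condition `[·]₃`). -/
def phiCond (k : ℕ) (ps : Fin m → ℝ) (φ1 : Fin m → Rn n → ℝ → ℝ)
    (ωs : Fin m → Rn n → ℝ) (φ2 : Rn n → ℝ → ℝ) : Prop :=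
  (⨆ (x : Rn n) (r : ℝ) (_ : 0 < r), phiCondAt k ps φ1 ωs φ2 x r) < ⊤

/-- The local (at `x₀`) condition `[φ⃗₁,φ₂]' < ∞`. -/
def phiCondLoc (x₀ : Rn n) (k : ℕ) (ps : Fin m → ℝ) (φ1 : Fin m → Rn n → ℝ → ℝ)
    (ωs : Fin m → Rn n → ℝ) (φ2 : Rn n → ℝ → ℝ) : Prop :=
  (⨆ (r : ℝ) (_ : 0 < r), phiCondAt k ps φ1 ωs φ2 x₀ r) < ⊤



/-! ### Variable exponent spaces -/

/-- The Luxemburg norm `‖f‖_{L^{p(·)}}`. -/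
def luxNorm (p : Rn n → ℝ) (f : Rn n → ℝ) : ℝ≥0∞ :=
  ⨅ (lam : ℝ≥0∞) (_ : lam ≠ 0)
    (_ : (∫⁻ x, (ENNReal.ofReal |f x| / lam) ^ p x) ≤ 1), lam

/-- `‖f‖_{L^{p(·)}(E)} = ‖f χ_E‖_{L^{p(·)}}`. -/
def luxNormOn (p : Rn n → ℝ) (E : Set (Rn n)) (f : Rn n → ℝ) : ℝ≥0∞ :=
  luxNorm p (E.indicator f)

/-- `p(·) ∈ 𝒫`: measurable with `1 < p⁻ ≤ p⁺ < ∞`. -/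
def MemP (p : Rn n → ℝ) : Prop :=
  Measurable p ∧ ∃ a b : ℝ, 1 < a ∧ ∀ x, a ≤ p x ∧ p x ≤ b

/-- `p(·) ∈ LH`: global log-Hölder continuity. -/
def LogHolder (p : Rn n → ℝ) : Prop :=
  (∃ C : ℝ, ∀ x y : Rn n, 0 < dist x y → dist x y ≤ 1 / 2 →
    |p x - p y| ≤ C / (-Real.log (dist x y))) ∧
  (∃ C : ℝ, ∀ x y : Rn n, ‖x‖ ≤ ‖y‖ →
    |p x - p y| ≤ C / Real.log (Real.exp 1 + ‖x‖))

/-- The conjugate exponent function `p'(·) = p(·)/(p(·)-1)`. -/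
def conjExp (p : Rn n → ℝ) : Rn n → ℝ := fun x => p x / (p x - 1)

/-- The variable exponent Muckenhoupt class `A_{p(·)}`. -/
def IsAvar (p : Rn n → ℝ) (ω : Rn n → ℝ) : Prop :=
  ∃ C : ℝ≥0, ∀ (x : Rn n) (r : ℝ), 0 < r →
    (volume (ball x r))⁻¹ * luxNormOn p (ball x r) ω *
      luxNormOn (conjExp p) (ball x r) (fun y => (ω y)⁻¹) ≤ C

/-- The generalized weighted variable exponent Morrey norm `‖f‖_{M^{p(·),φ}(ω)}`. -/
def varMorreyNorm (p : Rn n → ℝ) (φ : Rn n → ℝ → ℝ) (ω f : Rn n → ℝ) : ℝ≥0∞ :=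
  ⨆ (x : Rn n) (r : ℝ) (_ : 0 < r),
    (ENNReal.ofReal (φ x r))⁻¹ * (luxNormOn p (ball x r) ω)⁻¹ *
      luxNormOn p (ball x r) (fun y => ω y * f y)

/-- Membership in `M^{p(·),φ}(ω)`. -/
def MemVarMorrey (p : Rn n → ℝ) (φ : Rn n → ℝ → ℝ) (ω f : Rn n → ℝ) : Prop :=
  LocallyIntegrable f volume ∧ varMorreyNorm p φ ω f < ⊤

/-- `essinf_{t<η<∞} ∏ᵢ φ₁ᵢ(x,η) ‖ωᵢ‖_{L^{pᵢ(·)}(B(x,η))}`. -/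
def varEssInfProd (ps : Fin m → Rn n → ℝ) (φ1 : Fin m → Rn n → ℝ → ℝ)
    (ωs : Fin m → Rn n → ℝ) (x : Rn n) (t : ℝ) : ℝ≥0∞ :=
  essInf (fun η => ∏ i, ENNReal.ofReal (φ1 i x η) * luxNormOn (ps i) (ball x η) (ωs i))
    (volume.restrict (Ioi t))

/-- The variable exponent condition `[φ⃗₁,φ₂]'' < ∞` (with log factor `(1+log(t/r))^k`). -/
def varPhiCond (k : ℕ) (ps : Fin m → Rn n → ℝ) (φ1 : Fin m → Rn n → ℝ → ℝ)
    (ωs : Fin m → Rn n → ℝ) (φ2 : Rn n → ℝ → ℝ) : Prop :=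
  (⨆ (x : Rn n) (r : ℝ) (_ : 0 < r),
    (ENNReal.ofReal (φ2 x r))⁻¹ *
      ∫⁻ t in Ioi r,
        ENNReal.ofReal (1 + Real.log (t / r)) ^ k * varEssInfProd ps φ1 ωs x t *
          (∏ i, luxNormOn (ps i) (ball x t) (ωs i))⁻¹ * (ENNReal.ofReal t)⁻¹) < ⊤

/-! ### Lebesgue norms on all of `ℝⁿ` -/

/-- `(∫ g^q)^(1/q)` for `ℝ≥0∞`-valued `g`. -/
def lpNormE (q : ℝ) (g : Rn n → ℝ≥0∞) : ℝ≥0∞ := (∫⁻ x, g x ^ q) ^ (1 / q)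

/-- The (unweighted) `L^q(ℝⁿ)` norm. -/
def lpNormRn (q : ℝ) (f : Rn n → ℝ) : ℝ≥0∞ := lpNormE q fun x => ENNReal.ofReal |f x|

/-! ### Quasi-Banach valued Calderón–Zygmund operators -/

/-- A quasi-norm making `E` a quasi-Banach space. -/
structure QBNorm (E : Type) [AddCommGroup E] [Module ℝ E] where
  N : E → ℝ
  nonneg : ∀ e, 0 ≤ N e
  eq_zero_iff : ∀ e, N e = 0 ↔ e = 0
  smul_eq : ∀ (c : ℝ) (e : E), N (c • e) = |c| * N e
  kappa : ℝ
  one_le_kappa : 1 ≤ kappa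
  quasi : ∀ e₁ e₂, N (e₁ + e₂) ≤ kappa * (N e₁ + N e₂)
  complete : ∀ u : ℕ → E,
    (∀ ε : ℝ, 0 < ε → ∃ M : ℕ, ∀ j k, M ≤ j → M ≤ k → N (u j - u k) < ε) →
    ∃ e : E, ∀ ε : ℝ, 0 < ε → ∃ M : ℕ, ∀ j, M ≤ j → N (u j - e) < ε

/-- An `m`-linear `𝔅`-valued Calderón–Zygmund operator on `ℝⁿ`, together with its kernel,
defined on products of generalized weighted Morrey spaces via the decomposition
`T(f⃗) = Σ_{α⃗} T(f₁^{α₁},…,f_m^{α_m})`. -/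
structure MultiCZB (n m : ℕ) (E : Type) [AddCommGroup E] [Module ℝ E] (Q : QBNorm E) where
  T : (Fin m → Rn n → ℝ) → Rn n → E
  K : Rn n → (Fin m → Rn n) → E
  add_coord : ∀ (f : Fin m → Rn n → ℝ) (i : Fin m) (g h : Rn n → ℝ) (x : Rn n),
    T (Function.update f i (g + h)) x = T (Function.update f i g) x + T (Function.update f i h) x
  smul_coord : ∀ (f : Fin m → Rn n → ℝ) (i : Fin m) (c : ℝ) (g : Rn n → ℝ) (x : Rn n),
    T (Function.update f i (c • g)) x = c • T (Function.update f i g) x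
  eps : ℝ
  eps_pos : 0 < eps
  A : ℝ≥0
  size : ∀ (x : Rn n) (y : Fin m → Rn n), 0 < ∑ j, dist x (y j) →
    ENNReal.ofReal (Q.N (K x y)) ≤ A * ENNReal.ofReal (∑ j, dist x (y j)) ^ (-(m * n : ℝ))
  reg_y : ∀ (x : Rn n) (y : Fin m → Rn n) (i : Fin m) (y' : Rn n),
    0 < ∑ j, dist x (y j) → dist (y i) y' ≤ (1 / 2) * ⨆ j, dist x (y j) →
    ENNReal.ofReal (Q.N (K x y - K x (Function.update y i y'))) ≤
      A * ENNReal.ofReal (dist (y i) y' ^ eps) *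
        ENNReal.ofReal (∑ j, dist x (y j)) ^ (-(m * n : ℝ) - eps)
  reg_x : ∀ (x x' : Rn n) (y : Fin m → Rn n),
    0 < ∑ j, dist x (y j) → dist x x' ≤ (1 / 2) * ∑ j, dist x (y j) →
    ENNReal.ofReal (Q.N (K x y - K x' y)) ≤
      A * ENNReal.ofReal (dist x x' ^ eps) *
        ENNReal.ofReal (∑ j, dist x (y j)) ^ (-(m * n : ℝ) - eps)
  dom : ∀ (f : Fin m → Rn n → ℝ) (x : Rn n), x ∉ ⋂ j, tsupport (f j) →
    ENNReal.ofReal (Q.N (T f x)) ≤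
      ∫⁻ y : Fin m → Rn n, (∏ i, ENNReal.ofReal |f i (y i)|) * ENNReal.ofReal (Q.N (K x y))
  decomp : ∀ (f : Fin m → Rn n → ℝ) (x₀ : Rn n) (r : ℝ), 0 < r → ∀ x ∈ ball x₀ r,
    T f x = ∑ α : Fin m → Bool,
      T (fun i => if α i then locInf x₀ r (f i) else loc0 x₀ r (f i)) x
  bddLq : ∃ (qs : Fin m → ℝ) (q : ℝ) (C : ℝ≥0), (∀ i, 1 ≤ qs i) ∧ q⁻¹ = ∑ i, (qs i)⁻¹ ∧
    ∀ f : Fin m → Rn n → ℝ,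
      lpNormE q (fun x => ENNReal.ofReal (Q.N (T f x))) ≤ C * ∏ i, lpNormRn (qs i) (f i)

/-! ### Multilinear Littlewood–Paley square operators -/

/-- `K_t(x,y⃗) = t^{-mn} K(x/t, y₁/t, …, y_m/t)`. -/
def Kt (m : ℕ) (K : Rn n → (Fin m → Rn n) → ℝ) (t : ℝ) (x : Rn n)
    (y : Fin m → Rn n) : ℝ :=
  t ^ (-(m * n : ℝ)) * K (t⁻¹ • x) fun i => t⁻¹ • y i

/-- The multilinear square operator
`T(f⃗)(x) = (∫₀^∞ |∫ K_t(x,y⃗) ∏ fⱼ(yⱼ) dy⃗|² dt/t)^{1/2}`. -/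
def sqFn (K : Rn n → (Fin m → Rn n) → ℝ) (f : Fin m → Rn n → ℝ) (x : Rn n) : ℝ≥0∞ :=
  (∫⁻ t in Ioi (0 : ℝ),
      ENNReal.ofReal |∫ y : Fin m → Rn n, Kt m K t x y * ∏ i, f i (y i)| ^ (2 : ℝ) *
        (ENNReal.ofReal t)⁻¹) ^ (1 / 2 : ℝ)

/-- `θ ∈ Dini(1)`: nondecreasing on `[0,∞)`, `0 < θ(1) < ∞`, `∫₀¹ θ(t)/t dt < ∞`. -/
def IsDiniFn (θ : ℝ → ℝ) : Prop :=
  (∀ t, 0 ≤ θ t) ∧ MonotoneOn θ (Ici 0) ∧ 0 < θ 1 ∧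
    (∫⁻ t in Ioo (0 : ℝ) 1, ENNReal.ofReal (θ t) * (ENNReal.ofReal t)⁻¹) < ⊤

/-- `K` is a square-function kernel of type `θ`. -/
def SqKernelType (K : Rn n → (Fin m → Rn n) → ℝ) (θ : ℝ → ℝ) : Prop :=
  ∃ A : ℝ≥0,
    (∀ (x : Rn n) (y : Fin m → Rn n), 0 < ∑ j, dist x (y j) →
      (∫⁻ t in Ioi (0 : ℝ),
          ENNReal.ofReal |Kt m K t x y| ^ (2 : ℝ) * (ENNReal.ofReal t)⁻¹) ^ (1 / 2 : ℝ) ≤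
        A * ENNReal.ofReal (∑ j, dist x (y j)) ^ (-(m * n : ℝ))) ∧
    (∀ (x : Rn n) (y : Fin m → Rn n) (i : Fin m) (y' : Rn n), 0 < ∑ j, dist x (y j) →
      dist (y i) y' ≤ (1 / 2) * ⨆ j, dist x (y j) →
      (∫⁻ t in Ioi (0 : ℝ),
          ENNReal.ofReal |Kt m K t x y - Kt m K t x (Function.update y i y')| ^ (2 : ℝ) *
            (ENNReal.ofReal t)⁻¹) ^ (1 / 2 : ℝ) ≤
        A * ENNReal.ofReal (∑ j, dist x (y j)) ^ (-(m * n : ℝ)) *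
          ENNReal.ofReal (θ (dist (y i) y' / ∑ j, dist x (y j)))) ∧
    (∀ (x z : Rn n) (y : Fin m → Rn n), 0 < ∑ j, dist x (y j) →
      dist z x ≤ (1 / 2) * ⨆ j, dist x (y j) →
      (∫⁻ t in Ioi (0 : ℝ),
          ENNReal.ofReal |Kt m K t z y - Kt m K t x y| ^ (2 : ℝ) *
            (ENNReal.ofReal t)⁻¹) ^ (1 / 2 : ℝ) ≤
        A * ENNReal.ofReal (∑ j, dist x (y j)) ^ (-(m * n : ℝ)) *
          ENNReal.ofReal (θ (dist z x / ∑ j, dist x (y j))))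

/-- The assumed `L^{q₁} × ⋯ × L^{q_m} → L^q` boundedness of the square operator. -/
def SqBddLq (K : Rn n → (Fin m → Rn n) → ℝ) : Prop :=
  ∃ (qs : Fin m → ℝ) (q : ℝ) (C : ℝ≥0), (∀ i, 1 < qs i) ∧ q⁻¹ = ∑ i, (qs i)⁻¹ ∧
    ∀ f : Fin m → Rn n → ℝ, lpNormE q (sqFn K f) ≤ C * ∏ i, lpNormRn (qs i) (f i)

/-- A multilinear Littlewood–Paley kernel. -/
def IsMLPKernel (K : Rn n → (Fin m → Rn n) → ℝ) : Prop :=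
  ∃ A γ δ B₁ : ℝ, 0 < A ∧ 0 < γ ∧ 0 < δ ∧ 0 < B₁ ∧
    (∀ (x : Rn n) (y : Fin m → Rn n),
      |K x y| ≤ A * (1 + ∑ j, dist x (y j)) ^ (-(m * n : ℝ) - δ)) ∧
    (∀ (x : Rn n) (y : Fin m → Rn n) (i : Fin m) (y' : Rn n),
      dist (y i) y' ≤ dist x (y i) / B₁ →
      |K x y - K x (Function.update y i y')| ≤
        A * dist (y i) y' ^ γ * (1 + ∑ j, dist x (y j)) ^ (-(m * n : ℝ) - δ - γ)) ∧
    (∀ (x x' : Rn n) (y : Fin m → Rn n),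
      dist x x' ≤ (⨆ j, dist x (y j)) / B₁ →
      |K x y - K x' y| ≤
        A * dist x x' ^ γ * (1 + ∑ j, dist x (y j)) ^ (-(m * n : ℝ) - δ - γ))

/-- The multilinear Littlewood–Paley `g*_λ` function. -/
def glam (K : Rn n → (Fin m → Rn n) → ℝ) (lam : ℝ) (f : Fin m → Rn n → ℝ)
    (x : Rn n) : ℝ≥0∞ :=
  (∫⁻ t in Ioi (0 : ℝ), ∫⁻ z : Rn n,
      ENNReal.ofReal (t / (dist x z + t)) ^ (n * lam) *
        ENNReal.ofReal |∫ y : Fin m → Rn n, Kt m K t z y * ∏ i, f i (y i)| ^ (2 : ℝ) *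
          (ENNReal.ofReal t) ^ (-(n : ℝ) - 1)) ^ (1 / 2 : ℝ)

/-- The assumed `L^{q₁} × ⋯ × L^{q_m} → L^q` boundedness of the `g*_λ` function. -/
def GlamBddLq (K : Rn n → (Fin m → Rn n) → ℝ) (lam : ℝ) : Prop :=
  ∃ (qs : Fin m → ℝ) (q : ℝ) (C : ℝ≥0), (∀ i, 1 < qs i) ∧ q⁻¹ = ∑ i, (qs i)⁻¹ ∧
    ∀ f : Fin m → Rn n → ℝ, lpNormE q (glam K lam f) ≤ C * ∏ i, lpNormRn (qs i) (f i)

/-- A multilinear Marcinkiewicz kernel. -/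
def IsMarcinkiewiczKernel (K : Rn n → (Fin m → Rn n) → ℝ) : Prop :=
  ∃ A γ δ B₁ : ℝ, 0 < A ∧ 0 < γ ∧ 0 < δ ∧ δ < m * n ∧ 0 < B₁ ∧
    (∀ (x : Rn n) (y : Fin m → Rn n), ¬ (∑ j, dist x (y j) ^ 2) ≤ 1 → K x y = 0) ∧
    (∀ (x : Rn n) (y : Fin m → Rn n), 0 < ∑ j, dist x (y j) →
      |K x y| ≤ A * (∑ j, dist x (y j)) ^ (-(m * n : ℝ) + δ)) ∧
    (∀ (x : Rn n) (y : Fin m → Rn n) (i : Fin m) (y' : Rn n),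
      (∑ j, dist x (y j) ^ 2) ≤ 1 → 0 < ∑ j, dist x (y j) →
      dist (y i) y' ≤ dist x (y i) / B₁ →
      |K x y - K x (Function.update y i y')| ≤
        A * dist (y i) y' ^ γ * (∑ j, dist x (y j)) ^ (-(m * n : ℝ) + δ - γ)) ∧
    (∀ (x x' : Rn n) (y : Fin m → Rn n),
      (∑ j, dist x (y j) ^ 2) ≤ 1 → 0 < ∑ j, dist x (y j) →
      dist x x' ≤ (⨆ j, dist x (y j)) / B₁ →
      |K x y - K x' y| ≤
        A * dist x x' ^ γ * (∑ j, dist x (y j)) ^ (-(m * n : ℝ) + δ - γ))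

/-- `|z⃗| = (Σ |zᵢ|²)^{1/2}` on `(ℝⁿ)^m`. -/
def rho (m : ℕ) (z : Fin m → Rn n) : ℝ := Real.sqrt (∑ i, ‖z i‖ ^ 2)

/-- A multilinear Marcinkiewicz kernel of convolution type with homogeneous `Ω`. -/
def IsConvHomogMarcinkiewicz (K : Rn n → (Fin m → Rn n) → ℝ) : Prop :=
  IsMarcinkiewiczKernel K ∧
  ∃ (Kc : (Fin m → Rn n) → ℝ) (Ω : (Fin m → Rn n) → ℝ) (δ : ℝ),
    0 < δ ∧ δ < m * n ∧
    (∀ (x : Rn n) (y : Fin m → Rn n), K x y = Kc fun i => x - y i) ∧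
    (∀ (c : ℝ) (z : Fin m → Rn n), 0 < c → Ω (c • z) = Ω z) ∧
    (∀ z : Fin m → Rn n, Kc z = if rho m z ≤ 1 then Ω z * rho m z ^ (δ - m * n) else 0)
/-! ### Scalar (complex) multilinear operators: norms, commutators, conclusions -/

/-- View a real function as a complex one. -/
def cToC (f : Rn n → ℝ) : Rn n → ℂ := fun y => (f y : ℂ)

/-- `x ↦ |T(f⃗)(x)|` for a complex-valued multilinear operator applied to real data. -/
def cNorm (Tc : (Fin m → Rn n → ℂ) → Rn n → ℂ) (f : Fin m → Rn n → ℝ) : Rn n → ℝ≥0∞ :=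
  fun x => ENNReal.ofReal ‖Tc (fun i => cToC (f i)) x‖

/-- `x ↦ |T_{Πb⃗}(f⃗)(x)|`. -/
def cIterComm (Tc : (Fin m → Rn n → ℂ) → Rn n → ℂ) (b f : Fin m → Rn n → ℝ) :
    Rn n → ℝ≥0∞ :=
  fun x => ENNReal.ofReal ‖Tc (fun i y => (((b i x - b i y) * f i y : ℝ) : ℂ)) x‖

/-- `x ↦ |T_{Σb⃗}(f⃗)(x)|`. -/
def cSumComm (Tc : (Fin m → Rn n → ℂ) → Rn n → ℂ) (b f : Fin m → Rn n → ℝ) :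
    Rn n → ℝ≥0∞ :=
  fun x => ENNReal.ofReal
    ‖∑ j, Tc (Function.update (fun i => cToC (f i)) j
        fun y => (((b j x - b j y) * f j y : ℝ) : ℂ)) x‖

/-- The boundedness conclusions of Theorems 4.1–4.3 for a complex `m`-linear operator:
strong and weak type on generalized weighted Morrey spaces under `[φ⃗₁,φ₂]₁ < ∞`, and
boundedness of the iterated/multilinear commutators under `[φ⃗₁,φ₂]₂ < ∞` resp.
`[φ⃗₁,φ₂]₃ < ∞`. -/
def Thm41to43Concl (m : ℕ) (Tc : (Fin m → Rn n → ℂ) → Rn n → ℂ) : Prop :=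
  ∀ (ps : Fin m → ℝ) (p : ℝ) (ωs : Fin m → Rn n → ℝ)
    (φ1 : Fin m → Rn n → ℝ → ℝ) (φ2 : Rn n → ℝ → ℝ),
    (∀ k, 1 ≤ ps k) → p⁻¹ = ∑ k, (ps k)⁻¹ → (∀ i, IsWeight (ωs i)) →
    IsMultiAP p ps ωs → (∀ i, IsAinf (ωs i)) →
    (∀ i x r, 0 < r → 0 ≤ φ1 i x r) → (∀ x r, 0 < r → 0 ≤ φ2 x r) →
    ((phiCond 0 ps φ1 ωs φ2 →
      ((∀ k, 1 < ps k) → ∃ C : ℝ≥0, ∀ f : Fin m → Rn n → ℝ,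
        (∀ i, MemMorrey (ps i) (φ1 i) (ωs i) (f i)) →
        morreyNormE p φ2 (nuw p ps ωs) (cNorm Tc f) ≤
          C * ∏ i, morreyNorm (ps i) (φ1 i) (ωs i) (f i)) ∧
      ((∃ k, ps k = 1) → ∃ C : ℝ≥0, ∀ f : Fin m → Rn n → ℝ,
        (∀ i, MemMorrey (ps i) (φ1 i) (ωs i) (f i)) →
        weakMorreyNormE p φ2 (nuw p ps ωs) (cNorm Tc f) ≤
          C * ∏ i, morreyNorm (ps i) (φ1 i) (ωs i) (f i))) ∧
    ((∀ k, 1 < ps k) → ∀ b : Fin m → Rn n → ℝ, (∀ j, MemBMO (b j)) →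
      (phiCond m ps φ1 ωs φ2 → ∃ C : ℝ≥0, ∀ f : Fin m → Rn n → ℝ,
        (∀ i, MemMorrey (ps i) (φ1 i) (ωs i) (f i)) →
        morreyNormE p φ2 (nuw p ps ωs) (cIterComm Tc b f) ≤
          C * ∏ i, morreyNorm (ps i) (φ1 i) (ωs i) (f i)) ∧
      (phiCond 1 ps φ1 ωs φ2 → ∃ C : ℝ≥0, ∀ f : Fin m → Rn n → ℝ,
        (∀ i, MemMorrey (ps i) (φ1 i) (ωs i) (f i)) →
        morreyNormE p φ2 (nuw p ps ωs) (cSumComm Tc b f) ≤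
          C * ∏ i, morreyNorm (ps i) (φ1 i) (ωs i) (f i))))

/-! ### Multilinear pseudo-differential operators -/

/-- Standard basis directions in `ℝⁿ × (ℝⁿ)^m`: `inl i` is the `i`-th direction in the
`x`-variable, `inr (j,i)` the `i`-th direction in the `j`-th `ξ`-variable. -/
def dirVec (n m : ℕ) : Fin n ⊕ Fin m × Fin n → Rn n × (Fin m → Rn n)
  | Sum.inl i => (EuclideanSpace.single i 1, 0)
  | Sum.inr ji => (0, Pi.single ji.1 (EuclideanSpace.single ji.2 1))

/-- The multilinear Hörmander class `S⁰`: smooth with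
`|∂_x^α ∂_{ξ⃗}^{β⃗} σ| ≤ C (1+Σ|ξᵢ|)^{|α| - |β⃗|}`. -/
def SymbolClass (m : ℕ) (σ : Rn n × (Fin m → Rn n) → ℂ) : Prop :=
  ContDiff ℝ (⊤ : ℕ∞) σ ∧
  ∀ (k : ℕ) (d : Fin k → Fin n ⊕ Fin m × Fin n), ∃ C : ℝ,
    ∀ (x : Rn n) (ξ : Fin m → Rn n),
      ‖iteratedFDeriv ℝ k σ (x, ξ) fun j => dirVec n m (d j)‖ ≤
        C * (1 + ∑ i, ‖ξ i‖) ^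
          (((Finset.univ.filter fun j => (d j).isLeft = true).card : ℝ) -
            ((Finset.univ.filter fun j => (d j).isRight = true).card : ℝ))

/-- The `m`-linear pseudo-differential operator with symbol `σ`. -/
def Tpseudo (m : ℕ) (σ : Rn n × (Fin m → Rn n) → ℂ) (f : Fin m → Rn n → ℂ)
    (x : Rn n) : ℂ :=
  ∫ ξ : Fin m → Rn n,
    σ (x, ξ) * (∏ i, 𝓕 (f i) (ξ i)) *
      Complex.exp (2 * Real.pi * Complex.I * ((∑ i, (inner ℝ x (ξ i) : ℝ) : ℝ) : ℂ))

/-- `T'` is the `j`-th transpose of `T`. -/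
def IsTransposeOf (m : ℕ) (T T' : (Fin m → Rn n → ℂ) → Rn n → ℂ) (j : Fin m) : Prop :=
  ∀ (f : Fin m → Rn n → ℂ) (g : Rn n → ℂ),
    (∀ i, ContDiff ℝ (⊤ : ℕ∞) (f i) ∧ HasCompactSupport (f i)) →
    ContDiff ℝ (⊤ : ℕ∞) g → HasCompactSupport g →
    ∫ x, T f x * g x = ∫ x, T' (Function.update f j g) x * f j x

/-! ### Paraproducts -/

/-- `Ψ_t(x) = t^{-n} Ψ(x/t)`. -/
def dilat (Ψ : Rn n → ℂ) (t : ℝ) : Rn n → ℂ :=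
  fun x => ((t ^ (-(n : ℝ)) : ℝ) : ℂ) * Ψ (t⁻¹ • x)

/-- The Littlewood–Paley piece `Δ_j^Ψ f = f * Ψ_{2^{-j}}`. -/
def DeltaJ (Ψ : Rn n → ℂ) (j : ℤ) (f : Rn n → ℂ) : Rn n → ℂ :=
  fun x => ∫ y, f y * dilat Ψ ((2 : ℝ) ^ (-j)) (x - y)

/-- The partial sum `S_j f = Σ_{k ≤ j} Δ_k^Ψ f`. -/
def SJ (Ψ : Rn n → ℂ) (j : ℤ) (f : Rn n → ℂ) : Rn n → ℂ :=
  fun x => ∑' k : ℤ, if k ≤ j then DeltaJ Ψ k f x else 0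

/-- The bilinear paraproduct `Π₂(f₁,f₂) = Σ_j Δ_j^Ψ(f₁) S_j(f₂)`. -/
def paraprod2 (Ψ : Rn n → ℂ) : (Fin 2 → Rn n → ℂ) → Rn n → ℂ :=
  fun f x => ∑' j : ℤ, DeltaJ Ψ j (f 0) x * SJ Ψ j (f 1) x

/-- The trilinear paraproduct `Π₃(f₁,f₂,f₃) = Σ_j Δ_j^Ψ(f₁) S_j(f₂) S_j(f₃)`. -/
def paraprod3 (Ψ : Rn n → ℂ) : (Fin 3 → Rn n → ℂ) → Rn n → ℂ :=
  fun f x => ∑' j : ℤ, DeltaJ Ψ j (f 0) x * SJ Ψ j (f 1) x * SJ Ψ j (f 2) x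

/-- `Ψ` is a Schwartz function whose Fourier transform is supported in the annulus
`6/7 ≤ |ξ| ≤ 2` and equal to `1` on `1 ≤ |ξ| ≤ 12/7`. -/
def IsLPBump (Ψ : Rn n → ℂ) : Prop :=
  (∃ S : SchwartzMap (Rn n) ℂ, Ψ = ⇑S) ∧
  Function.support (𝓕 Ψ) ⊆ {ξ : Rn n | 6 / 7 ≤ ‖ξ‖ ∧ ‖ξ‖ ≤ 2} ∧
  ∀ ξ : Rn n, 1 ≤ ‖ξ‖ → ‖ξ‖ ≤ 12 / 7 → 𝓕 Ψ ξ = 1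

section Cubes

/-- The half-open cube with centre `c` and side length `s`. -/
def cube (c : Rn n) (s : ℝ) : Set (Rn n) := {y | ∀ i, c i - s / 2 ≤ y i ∧ y i < c i + s / 2}

/-- The closed cube with centre `c` and side length `s`. -/
def closedCube (c : Rn n) (s : ℝ) : Set (Rn n) :=
  {y | ∀ i, c i - s / 2 ≤ y i ∧ y i ≤ c i + s / 2}

lemma cube_subset_closedCube (c : Rn n) (s : ℝ) : cube c s ⊆ closedCube c s :=
  fun _ hy i => ⟨(hy i).1, (hy i).2.le⟩

lemma cube_eq_preimage (c : Rn n) (s : ℝ) :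
    cube c s = (WithLp.ofLp : Rn n → Fin n → ℝ) ⁻¹'
      (Set.univ.pi fun i => Ico (c i - s / 2) (c i + s / 2)) := by
  ext y
  simp [cube, Set.mem_pi]

lemma closedCube_eq_preimage (c : Rn n) (s : ℝ) :
    closedCube c s = (WithLp.ofLp : Rn n → Fin n → ℝ) ⁻¹'
      (Set.univ.pi fun i => Icc (c i - s / 2) (c i + s / 2)) := by
  ext y
  rw [closedCube, mem_preimage, Set.mem_univ_pi]
  rfl

lemma measurableSet_cube (c : Rn n) (s : ℝ) : MeasurableSet (cube c s) := by
  rw [cube_eq_preimage]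
  exact (PiLp.volume_preserving_ofLp (Fin n)).measurable
    (MeasurableSet.univ_pi fun i => measurableSet_Ico)

lemma isClosed_closedCube (c : Rn n) (s : ℝ) : IsClosed (closedCube c s) := by
  simp only [closedCube, ofPred_forall, ofPred_and]
  refine isClosed_iInter fun i => IsClosed.inter ?_ ?_
  · exact isClosed_le continuous_const (by fun_prop)
  · exact isClosed_le (by fun_prop) continuous_const

lemma volume_cube (c : Rn n) (s : ℝ) : volume (cube c s) = ENNReal.ofReal s ^ n := by
  rw [cube_eq_preimage,
    (PiLp.volume_preserving_ofLp (Fin n)).measure_preimage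
      (MeasurableSet.univ_pi fun i => measurableSet_Ico).nullMeasurableSet, volume_pi_pi]
  simp [Real.volume_Ico]

lemma volume_closedCube (c : Rn n) (s : ℝ) :
    volume (closedCube c s) = ENNReal.ofReal s ^ n := by
  rw [closedCube_eq_preimage,
    (PiLp.volume_preserving_ofLp (Fin n)).measure_preimage
      (MeasurableSet.univ_pi fun i => measurableSet_Icc).nullMeasurableSet, volume_pi_pi]
  simp [Real.volume_Icc]

lemma volume_cube_pos {c : Rn n} {s : ℝ} (hs : 0 < s) : 0 < volume (cube c s) := by
  rw [volume_cube]
  exact ENNReal.pow_pos (by simpa using hs) _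

lemma volume_cube_ne_top (c : Rn n) (s : ℝ) : volume (cube c s) ≠ ⊤ := by
  rw [volume_cube]; finiteness

lemma abs_coord_sub_le (x y : Rn n) (i : Fin n) : |x i - y i| ≤ dist x y := by
  rw [dist_eq_norm]
  exact PiLp.norm_apply_le (x - y) i

lemma dist_le_sum_abs (x y : Rn n) : dist x y ≤ ∑ i, |x i - y i| := by
  rw [EuclideanSpace.dist_eq]
  refine Real.sqrt_le_iff.2 ⟨by positivity, ?_⟩
  simp only [Real.dist_eq]
  exact Finset.sum_sq_le_sq_sum_of_nonneg fun i _ => abs_nonneg _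

lemma ball_subset_cube (c : Rn n) (s : ℝ) : ball c (s / 2) ⊆ cube c s := by
  intro y hy i
  have h := (abs_coord_sub_le y c i).trans_lt hy
  rw [abs_lt] at h
  constructor <;> linarith

lemma closedCube_subset_closedBall (c : Rn n) (s : ℝ) :
    closedCube c s ⊆ closedBall c (n * (s / 2)) := by
  intro y hy
  refine (dist_le_sum_abs y c).trans ?_
  refine (Finset.sum_le_sum (g := fun _ => s / 2) fun i _ => ?_).trans (by simp)
  have := hy i
  rw [abs_le]
  constructor <;> linarith

lemma cube_subset_ball [NeZero n] (c : Rn n) {s : ℝ} (hs : 0 < s) :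
    cube c s ⊆ ball c (n * s) := by
  refine (cube_subset_closedCube c s).trans
    ((closedCube_subset_closedBall c s).trans (closedBall_subset_ball ?_))
  have : (0 : ℝ) < n := by exact_mod_cast Nat.pos_of_ne_zero (NeZero.ne n)
  nlinarith

lemma center_mem_cube (c : Rn n) {s : ℝ} (hs : 0 < s) : c ∈ cube c s := fun i =>
  ⟨by linarith, by linarith⟩

end Cubes

section CalderonZygmund

/-- The integer label of the level-`k` dyadic subcube (relative to `cube c s`) containing `y`. -/
def dkey (c : Rn n) (s : ℝ) (k : ℕ) (y : Rn n) (i : Fin n) : ℤ :=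
  ⌊2 ^ k * ((y i - c i) / s + 1 / 2)⌋

/-- The centre of the level-`k` dyadic subcube with label `v`. -/
def dctr (c : Rn n) (s : ℝ) (k : ℕ) (v : Fin n → ℤ) : Rn n :=
  WithLp.toLp 2 fun i => c i + s * ((v i + 1 / 2) / 2 ^ k - 1 / 2)

lemma mem_dcube_iff {c : Rn n} {s : ℝ} (hs : 0 < s) (k : ℕ) (v : Fin n → ℤ) (y : Rn n) :
    y ∈ cube (dctr c s k v) (s / 2 ^ k) ↔ dkey c s k y = v := by
  simp only [cube, dctr, dkey, funext_iff, mem_ofPred_eq, Int.floor_eq_iff]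
  refine forall_congr' fun i => ?_
  have h2 : (0 : ℝ) < 2 ^ k := by positivity
  refine and_congr ?_ ?_
  · have : c i + s * (((v i : ℝ) + 1 / 2) / 2 ^ k - 1 / 2) - s / 2 ^ k / 2
        = c i - s / 2 + s * (v i / 2 ^ k) := by field_simp; ring
    rw [this]
    have h3 : 2 ^ k * ((y i - c i) / s + 1 / 2) - v i
      = (2 ^ k / s) * (y i - (c i - s / 2 + s * (v i / 2 ^ k))) := by field_simp; ring
    rw [← sub_nonneg, ← sub_nonneg (b := (v i : ℝ)), h3, mul_nonneg_iff_of_pos_left (by positivity)]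
  · have : c i + s * (((v i : ℝ) + 1 / 2) / 2 ^ k - 1 / 2) + s / 2 ^ k / 2
        = c i - s / 2 + s * ((v i + 1) / 2 ^ k) := by field_simp; ring
    rw [this]
    have h3 : v i + 1 - 2 ^ k * ((y i - c i) / s + 1 / 2)
      = (2 ^ k / s) * ((c i - s / 2 + s * ((v i + 1) / 2 ^ k)) - y i) := by field_simp; ring
    rw [← sub_pos, ← sub_pos (b := (2 ^ k * ((y i - c i) / s + 1 / 2) : ℝ)), h3,
      mul_pos_iff_of_pos_left (by positivity)]

lemma dkey_succ_eq {c : Rn n} {s : ℝ} {k : ℕ} {y z : Rn n}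
    (h : dkey c s (k + 1) y = dkey c s (k + 1) z) : dkey c s k y = dkey c s k z := by
  have key : ∀ (w : Rn n) i, dkey c s k w i = dkey c s (k + 1) w i / 2 := by
    intro w i
    simp only [dkey]
    have := Int.floor_div_natCast (2 ^ (k + 1) * ((w i - c i) / s + 1 / 2)) 2
    push_cast at this
    rw [← this]
    congr 1
    ring
  funext i
  rw [key, key, h]

lemma dkey_eq_of_le {c : Rn n} {s : ℝ} {j k : ℕ} (hjk : j ≤ k) {y z : Rn n}
    (h : dkey c s k y = dkey c s k z) : dkey c s j y = dkey c s j z := by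
  induction k, hjk using Nat.le_induction with
  | base => exact h
  | succ k _ ih => exact ih (dkey_succ_eq h)

lemma dcube_zero_eq {c : Rn n} {s : ℝ} (hs : 0 < s) {y : Rn n} (hy : y ∈ cube c s) :
    dctr c s 0 (dkey c s 0 y) = c := by
  have h : dkey c s 0 y = 0 := by
    rw [← mem_dcube_iff hs]
    convert hy using 1
    congr 1
    · ext i
      simp only [dctr]
      simp
    · simp
  rw [h]
  ext i
  simp only [dctr]
  simp

lemma closedCube_subset_closedBall_of_mem {c y : Rn n} {s : ℝ} (hy : y ∈ closedCube c s) :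
    closedCube c s ⊆ closedBall y (n * s) := by
  intro z hz
  have h1 := closedCube_subset_closedBall _ _ hy
  have h2 := closedCube_subset_closedBall _ _ hz
  rw [mem_closedBall] at *
  linarith [dist_triangle_right z y c]

lemma volume_closedBall_eq (x : Rn n) {r : ℝ} (hr : 0 ≤ r) :
    volume (closedBall x r) = ENNReal.ofReal r ^ n * volume (ball (0 : Rn n) 1) := by
  rw [Measure.addHaar_closedBall _ _ hr, finrank_euclideanSpace_fin, ENNReal.ofReal_pow hr]

lemma volume_ball_eq (x : Rn n) {r : ℝ} (hr : 0 < r) :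
    volume (ball x r) = ENNReal.ofReal r ^ n * volume (ball (0 : Rn n) 1) := by
  rw [Measure.addHaar_ball_of_pos _ _ hr, finrank_euclideanSpace_fin, ENNReal.ofReal_pow hr.le]

lemma volume_ball_pos (x : Rn n) {r : ℝ} (hr : 0 < r) : 0 < volume (ball x r) :=
  measure_ball_pos _ _ hr

lemma volume_ball_ne_top (x : Rn n) (r : ℝ) : volume (ball x r) ≠ ⊤ := measure_ball_lt_top.ne

/-- Lebesgue differentiation along shrinking dyadic cubes. -/
lemma ae_le_of_forall_dcube {g : Rn n → ℝ≥0∞} (hg : Measurable g) (hfin : ∫⁻ y, g y ≠ ⊤)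
    {l : ℝ≥0∞} {s : ℝ} (hs : 0 < s) (z : ℕ → Rn n → Rn n) :
    ∀ᵐ y : Rn n, (∀ k, y ∈ closedCube (z k y) (s / 2 ^ k) ∧
      ∫⁻ w in closedCube (z k y) (s / 2 ^ k), g w ≤ l * volume (closedCube (z k y) (s / 2 ^ k))) →
      g y ≤ l := by
  set v1 : ℝ≥0∞ := volume (ball (0 : Rn n) 1)
  have hv1 : v1 ≠ ⊤ := volume_ball_ne_top _ _
  set C : ℝ≥0 := ((3 * n : ℝ≥0) ^ n * v1.toNNReal + 3 ^ n)
  have hC : (C : ℝ≥0∞) = (3 * n) ^ n * v1 + 3 ^ n := by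
    simp only [C]
    push_cast
    rw [ENNReal.coe_toNNReal hv1]
  have h : ∀ x : Rn n, ∃ᶠ r in 𝓝[>] (0 : ℝ),
      volume (closedBall x (3 * r)) ≤ C * volume (closedBall x r) := by
    intro x
    refine Eventually.frequently ?_
    filter_upwards [self_mem_nhdsWithin] with r hr
    have hr' : (0 : ℝ) < r := hr
    rw [volume_closedBall_eq _ hr'.le, volume_closedBall_eq _ (by positivity), hC,
      ENNReal.ofReal_mul (by norm_num), mul_pow, mul_assoc]
    gcongr
    simp
  filter_upwards [VitaliFamily.ae_tendsto_lintegral_div (Vitali.vitaliFamily volume C h)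
    hg.aemeasurable hfin] with y hy hk
  have hpos : ∀ k : ℕ, (0 : ℝ) < s / 2 ^ k := fun k => by positivity
  have htend : Tendsto (fun k : ℕ => closedCube (z k y) (s / 2 ^ k)) atTop
      ((Vitali.vitaliFamily volume C h).filterAt y) := by
    rw [VitaliFamily.tendsto_filterAt_iff]
    refine ⟨Eventually.of_forall fun k => ?_, fun ε hε => ?_⟩
    · refine ⟨isClosed_closedCube _ _, ?_, n * (s / 2 ^ k),
        closedCube_subset_closedBall_of_mem (hk k).1, ?_⟩
      · refine ⟨z k y, mem_interior.2 ⟨ball (z k y) (s / 2 ^ k / 2),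
          (ball_subset_cube _ _).trans (cube_subset_closedCube _ _), isOpen_ball,
          mem_ball_self (by have := hpos k; positivity)⟩⟩
      · have := hpos k
        rw [volume_closedBall_eq _ (by positivity), volume_closedCube, hC, ← mul_assoc,
          ENNReal.ofReal_mul (by positivity), mul_pow, mul_right_comm]
        gcongr
        refine le_trans (le_of_eq ?_) le_self_add
        rw [ENNReal.ofReal_mul (by positivity)]
        simp
        rfl
    · have hlim : Tendsto (fun k : ℕ => (n : ℝ) * (s / 2 ^ k)) atTop (𝓝 0) := by
        have h1 := (tendsto_pow_atTop_nhds_zero_of_lt_one (r := (1 / 2 : ℝ)) (by norm_num)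
          (by norm_num)).const_mul (n * s)
        rw [mul_zero] at h1
        refine h1.congr fun k => ?_
        rw [one_div, inv_pow]
        ring
      filter_upwards [hlim.eventually_le_const hε] with k hk'
      exact (closedCube_subset_closedBall_of_mem (hk k).1).trans (closedBall_subset_closedBall hk')
  refine le_of_tendsto (hy.comp htend) (Eventually.of_forall fun k => ?_)
  exact ENNReal.div_le_of_le_mul (hk k).2

lemma cube_ae_eq_closedCube (c : Rn n) (s : ℝ) :
    (cube c s : Set (Rn n)) =ᵐ[volume] closedCube c s :=
  ae_eq_of_subset_of_measure_ge (cube_subset_closedCube c s)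
    (by rw [volume_cube, volume_closedCube]) (measurableSet_cube c s).nullMeasurableSet
    (by rw [volume_closedCube]; finiteness)

/-- Calderón–Zygmund decomposition of a cube at height `l`. -/
theorem exists_cz_cubes {g : Rn n → ℝ≥0∞} (hg : Measurable g) {l : ℝ≥0∞} (hl : l ≠ ⊤)
    {c : Rn n} {s : ℝ} (hs : 0 < s) (hQ : ∫⁻ y in cube c s, g y ≤ l * volume (cube c s)) :
    ∃ S : Set (Rn n × ℝ), S.Countable ∧ S.PairwiseDisjoint (fun P => cube P.1 P.2) ∧
      (∀ P ∈ S, 0 < P.2 ∧ P.2 ≤ s / 2 ∧ cube P.1 P.2 ⊆ cube c s ∧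
        l * volume (cube P.1 P.2) < ∫⁻ y in cube P.1 P.2, g y ∧
        ∫⁻ y in cube P.1 P.2, g y ≤ 2 ^ n * l * volume (cube P.1 P.2)) ∧
      ∀ᵐ y : Rn n, y ∈ cube c s → y ∉ ⋃ P ∈ S, cube P.1 P.2 → g y ≤ l := by
  set D : ℕ × (Fin n → ℤ) → Rn n × ℝ := fun q => (dctr c s q.1 q.2, s / 2 ^ q.1)
  set bad : ℕ → (Fin n → ℤ) → Prop := fun k v =>
    l * volume (cube (dctr c s k v) (s / 2 ^ k)) < ∫⁻ y in cube (dctr c s k v) (s / 2 ^ k), g y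
  set T : Set (ℕ × (Fin n → ℤ)) := {q | ∃ y ∈ cube c s, dkey c s q.1 y = q.2 ∧ bad q.1 q.2 ∧
    ∀ j < q.1, ¬ bad j (dkey c s j y)}
  have hzero : ∀ y ∈ cube c s, cube (dctr c s 0 (dkey c s 0 y)) (s / 2 ^ 0) = cube c s := by
    intro y hy
    rw [dcube_zero_eq hs hy, pow_zero, div_one]
  have hnb0 : ∀ y ∈ cube c s, ¬ bad 0 (dkey c s 0 y) := by
    intro y hy
    simp only [bad]
    rw [hzero y hy, not_lt]
    exact hQ
  refine ⟨D '' T, (to_countable T).image D, ?_, ?_, ?_⟩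
  · rintro _ ⟨q, ⟨y, hy, hqy, hqb, hqj⟩, rfl⟩ _ ⟨q', ⟨y', hy', hqy', hqb', hqj'⟩, rfl⟩ hne
    rw [Function.onFun, Set.disjoint_left]
    intro w hw hw'
    have h1 := (mem_dcube_iff hs _ _ _).1 hw
    have h2 := (mem_dcube_iff hs _ _ _).1 hw'
    apply hne
    rcases lt_trichotomy q.1 q'.1 with h | h | h
    · refine absurd ?_ (hqj' q.1 h)
      rw [← dkey_eq_of_le h.le (h2.trans hqy'.symm), h1]
      exact hqb
    · have : q = q' := Prod.ext h (by rw [← h1, ← h2, h])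
      rw [this]
    · refine absurd ?_ (hqj q'.1 h)
      rw [← dkey_eq_of_le h.le (h1.trans hqy.symm), h2]
      exact hqb'
  · rintro _ ⟨⟨k, v⟩, ⟨y, hy, hqy, hqb, hqj⟩, rfl⟩
    simp only [D] at *
    obtain _ | k := k
    · rw [← hqy] at hqb
      exact absurd hqb (hnb0 y hy)
    have hsub : ∀ j ≤ k + 1, cube (dctr c s (k + 1) v) (s / 2 ^ (k + 1)) ⊆
        cube (dctr c s j (dkey c s j y)) (s / 2 ^ j) := by
      intro j hj w hw
      rw [mem_dcube_iff hs] at hw ⊢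
      exact dkey_eq_of_le hj (hw.trans hqy.symm)
    refine ⟨by positivity, ?_, ?_, hqb, ?_⟩
    · rw [pow_succ]
      have : (1 : ℝ) ≤ 2 ^ k := one_le_pow₀ (by norm_num)
      gcongr
      nlinarith
    · have := hsub 0 (by omega)
      rwa [hzero y hy] at this
    · refine (lintegral_mono_set (hsub k (by omega))).trans ?_
      refine (not_lt.1 (hqj k (by omega))).trans (le_of_eq ?_)
      rw [volume_cube, volume_cube]
      have : s / 2 ^ k = 2 * (s / 2 ^ (k + 1)) := by field_simp; ring
      rw [this, ENNReal.ofReal_mul (by norm_num), mul_pow]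
      simp
      ring
  · set g' := (cube c s).indicator g
    have hg' : Measurable g' := hg.indicator (measurableSet_cube c s)
    have hfin : ∫⁻ y, g' y ≠ ⊤ := by
      rw [lintegral_indicator (measurableSet_cube c s)]
      refine ne_top_of_le_ne_top ?_ hQ
      exact ENNReal.mul_ne_top hl (volume_cube_ne_top c s)
    filter_upwards [ae_le_of_forall_dcube hg' hfin (l := l) hs
      (fun k y => dctr c s k (dkey c s k y))] with y hy hyQ hyS
    have hnb : ∀ k, ¬ bad k (dkey c s k y) := by
      intro k
      induction k using Nat.strong_induction_on with
      | _ k ih =>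
        intro hb
        apply hyS
        simp only [mem_iUnion]
        refine ⟨D (k, dkey c s k y), ⟨(k, dkey c s k y), ⟨y, hyQ, rfl, hb, ih⟩, rfl⟩, ?_⟩
        exact (mem_dcube_iff hs _ _ _).2 rfl
    have := hy fun k => ⟨cube_subset_closedCube _ _ ((mem_dcube_iff hs _ _ _).2 rfl), ?_⟩
    · simpa [g', hyQ] using this
    · rw [← setLIntegral_congr (cube_ae_eq_closedCube _ _),
        ← measure_congr (cube_ae_eq_closedCube _ _)]
      refine le_trans (lintegral_mono fun w => ?_) (not_lt.1 (hnb k))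
      exact indicator_le_self _ _ _

end CalderonZygmund

section Maximal

/-- The uncentred Hardy–Littlewood maximal function with respect to a measure. -/
def maxFn (μ : Measure (Rn n)) (h : Rn n → ℝ≥0∞) (x : Rn n) : ℝ≥0∞ :=
  ⨆ (c : Rn n) (r : ℝ) (_ : x ∈ ball c r), (∫⁻ y in ball c r, h y ∂μ) / μ (ball c r)

lemma lintegral_div_le_maxFn (μ : Measure (Rn n)) (h : Rn n → ℝ≥0∞) {x c : Rn n} {r : ℝ}
    (hx : x ∈ ball c r) : (∫⁻ y in ball c r, h y ∂μ) / μ (ball c r) ≤ maxFn μ h x :=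
  le_iSup₂_of_le c r (le_iSup_of_le hx le_rfl)

lemma lt_maxFn_iff {μ : Measure (Rn n)} {h : Rn n → ℝ≥0∞} {x : Rn n} {l : ℝ≥0∞} :
    l < maxFn μ h x ↔ ∃ c r, x ∈ ball c r ∧ l < (∫⁻ y in ball c r, h y ∂μ) / μ (ball c r) := by
  simp only [maxFn, lt_iSup_iff, exists_prop]

lemma isOpen_lt_maxFn (μ : Measure (Rn n)) (h : Rn n → ℝ≥0∞) (l : ℝ≥0∞) :
    IsOpen {x | l < maxFn μ h x} := by
  rw [isOpen_iff_mem_nhds]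
  intro x hx
  obtain ⟨c, r, hxc, hl⟩ := lt_maxFn_iff.1 hx
  filter_upwards [isOpen_ball.mem_nhds hxc] with y hy
  exact lt_maxFn_iff.2 ⟨c, r, hy, hl⟩

lemma measurable_maxFn (μ : Measure (Rn n)) (h : Rn n → ℝ≥0∞) : Measurable (maxFn μ h) :=
  measurable_of_Ioi fun l => (isOpen_lt_maxFn μ h l).measurableSet

/-- Weak type `(1,1)` of the maximal function of a doubling measure. -/
theorem maxFn_weak_type {μ : Measure (Rn n)} {D : ℝ≥0∞}
    (hD : ∀ c r, 0 < r → μ (closedBall c (5 * r)) ≤ D * μ (ball c r))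
    (h : Rn n → ℝ≥0∞) (l : ℝ≥0∞) :
    l * μ {x | l < maxFn μ h x} ≤ D * ∫⁻ y, h y ∂μ := by
  set A : ℕ → Set (Rn n) := fun N => {x | ∃ c : Rn n, ∃ r : ℝ, r ≤ N ∧ x ∈ ball c r ∧
    l < (∫⁻ y in ball c r, h y ∂μ) / μ (ball c r)}
  have hA : {x | l < maxFn μ h x} = ⋃ N, A N := by
    ext x
    simp only [mem_ofPred_eq, lt_maxFn_iff, mem_iUnion, A]
    constructor
    · rintro ⟨c, r, hx, hl⟩
      obtain ⟨N, hN⟩ := exists_nat_ge r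
      exact ⟨N, c, r, hN, hx, hl⟩
    · rintro ⟨N, c, r, -, hx, hl⟩
      exact ⟨c, r, hx, hl⟩
  have hmono : Monotone A := by
    rintro N N' hN x ⟨c, r, hr, hx⟩
    exact ⟨c, r, hr.trans (by exact_mod_cast hN), hx⟩
  rw [hA, hmono.measure_iUnion, ENNReal.mul_iSup]
  refine iSup_le fun N => ?_
  set t : Set (Rn n × ℝ) := {q | q.2 ≤ N ∧ 0 < q.2 ∧
    l < (∫⁻ y in ball q.1 q.2, h y ∂μ) / μ (ball q.1 q.2)}
  obtain ⟨u, hut, hdisj, hcov⟩ := Vitali.exists_disjoint_subfamily_covering_enlargement_closedBall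
    t (fun q => q.1) (fun q => q.2) N (fun q hq => hq.1) 5 (by norm_num)
  have hucount : u.Countable := by
    refine hdisj.countable_of_nonempty_interior fun q hq => ?_
    exact ⟨q.1, ball_subset_interior_closedBall (mem_ball_self (hut hq).2.1)⟩
  have hsub : A N ⊆ ⋃ q ∈ u, closedBall q.1 (5 * q.2) := by
    rintro x ⟨c, r, hr, hx, hl⟩
    have hr0 : 0 < r := pos_of_mem_ball hx
    obtain ⟨b, hb, hb'⟩ := hcov (c, r) ⟨hr, hr0, hl⟩
    exact mem_biUnion hb (hb' (ball_subset_closedBall hx))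
  have hudisj : u.PairwiseDisjoint fun q => ball q.1 q.2 :=
    hdisj.mono fun q => ball_subset_closedBall
  calc l * μ (A N) ≤ l * ∑' q : u, μ (closedBall q.1.1 (5 * q.1.2)) := by
        gcongr
        exact (measure_mono hsub).trans (measure_biUnion_le μ hucount _)
    _ ≤ l * ∑' q : u, D * μ (ball q.1.1 q.1.2) := by
        gcongr with q
        exact hD _ _ (hut q.2).2.1
    _ = D * ∑' q : u, l * μ (ball q.1.1 q.1.2) := by
        rw [ENNReal.tsum_mul_left, ENNReal.tsum_mul_left]; ring
    _ ≤ D * ∑' q : u, ∫⁻ y in ball q.1.1 q.1.2, h y ∂μ := by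
        gcongr with q
        exact (ENNReal.mul_lt_of_lt_div (hut q.2).2.2).le
    _ = D * ∫⁻ y in ⋃ q ∈ u, ball q.1 q.2, h y ∂μ := by
        rw [lintegral_biUnion hucount (fun q _ => measurableSet_ball) hudisj]
    _ ≤ D * ∫⁻ y, h y ∂μ := by
        gcongr
        exact Measure.restrict_le_self

lemma maxFn_mono {μ : Measure (Rn n)} {h h' : Rn n → ℝ≥0∞} (hh : ∀ y, h y ≤ h' y) (x : Rn n) :
    maxFn μ h x ≤ maxFn μ h' x :=
  iSup₂_mono fun c r => iSup_mono fun _ =>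
    ENNReal.div_le_div_right (lintegral_mono hh) _

lemma maxFn_add_const_le {μ : Measure (Rn n)} (h : Rn n → ℝ≥0∞) (a : ℝ≥0∞) (x : Rn n) :
    maxFn μ (fun y => h y + a) x ≤ maxFn μ h x + a := by
  refine iSup₂_le fun c r => iSup_le fun hx => ?_
  rw [lintegral_add_right _ measurable_const, setLIntegral_const, ENNReal.add_div]
  gcongr
  · exact lintegral_div_le_maxFn μ h hx
  · exact ENNReal.div_le_of_le_mul le_rfl

lemma lintegral_Ioo_rpow {q a : ℝ} (hq : -1 < q) (ha : 0 ≤ a) :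
    ∫⁻ t in Ioo 0 a, ENNReal.ofReal (t ^ q) = ENNReal.ofReal (a ^ (q + 1) / (q + 1)) := by
  rw [← ofReal_integral_eq_lintegral_ofReal]
  · rw [← integral_Ioc_eq_integral_Ioo, ← intervalIntegral.integral_of_le ha,
      integral_rpow (Or.inl hq), Real.zero_rpow (by linarith), sub_zero]
  · have := intervalIntegral.intervalIntegrable_rpow' (a := 0) (b := a) hq
    rw [intervalIntegrable_iff_integrableOn_Ioo_of_le ha] at this
    exact this
  · filter_upwards [ae_restrict_mem measurableSet_Ioo] with t ht
    exact Real.rpow_nonneg ht.1.le _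

lemma lintegral_ofReal_lt {q : ℝ} (hq : -1 < q) {a : ℝ≥0∞} (ha : a ≠ ⊤) :
    ∫⁻ t in Ioi (0 : ℝ), (if ENNReal.ofReal t < a then ENNReal.ofReal (t ^ q) else 0) =
      a ^ (q + 1) / ENNReal.ofReal (q + 1) := by
  have h1 : ∫⁻ t in Ioi (0 : ℝ), (if ENNReal.ofReal t < a then ENNReal.ofReal (t ^ q) else 0)
      = ∫⁻ t in Ioo 0 a.toReal, ENNReal.ofReal (t ^ q) := by
    rw [← lintegral_indicator measurableSet_Ioi, ← lintegral_indicator measurableSet_Ioo]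
    congr 1
    funext t
    simp only [indicator, mem_Ioi, mem_Ioo]
    by_cases ht : 0 < t
    · simp only [ht, if_true, true_and]
      simp only [ENNReal.ofReal_lt_iff_lt_toReal ht.le ha]
    · simp [ht]
  rw [h1, lintegral_Ioo_rpow hq ENNReal.toReal_nonneg, ENNReal.ofReal_div_of_pos (by linarith),
    ← ENNReal.ofReal_rpow_of_nonneg ENNReal.toReal_nonneg (by linarith), ENNReal.ofReal_toReal ha]

lemma rpow_le_lintegral {p : ℝ} (hp : 0 < p) (a : ℝ≥0∞) :
    a ^ p ≤ ENNReal.ofReal p *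
      ∫⁻ t in Ioi (0 : ℝ), (if ENNReal.ofReal t < a then ENNReal.ofReal (t ^ (p - 1)) else 0) := by
  have hp0 : ENNReal.ofReal p ≠ 0 := by simpa using hp
  have hfin : ∀ a : ℝ≥0∞, a ≠ ⊤ → a ^ p ≤ ENNReal.ofReal p *
      ∫⁻ t in Ioi (0 : ℝ), (if ENNReal.ofReal t < a then ENNReal.ofReal (t ^ (p - 1)) else 0) := by
    intro a ha
    rw [lintegral_ofReal_lt (by linarith) ha, sub_add_cancel,
      ENNReal.mul_div_cancel hp0 ENNReal.ofReal_ne_top]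
  by_cases ha : a = ⊤
  · subst ha
    rw [ENNReal.top_rpow_of_pos hp, top_le_iff]
    refine ENNReal.eq_top_of_forall_nnreal_le fun r => ?_
    have h2 := hfin ((r : ℝ≥0∞) ^ p⁻¹) (by finiteness)
    rw [ENNReal.rpow_inv_rpow hp.ne'] at h2
    refine h2.trans ?_
    gcongr with t
    split_ifs <;> simp_all
  · exact hfin a ha

/-- Strong type of the maximal function of a doubling measure. -/
theorem maxFn_strong_type {D : ℝ≥0∞} (hDt : D ≠ ⊤) {p : ℝ} (hp : 1 < p) :
    ∃ C : ℝ≥0∞, C ≠ ⊤ ∧ ∀ (μ : Measure (Rn n)) [SFinite μ],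
      (∀ c r, 0 < r → μ (closedBall c (5 * r)) ≤ D * μ (ball c r)) →
      ∀ h : Rn n → ℝ≥0∞, Measurable h →
        ∫⁻ x, maxFn μ h x ^ p ∂μ ≤ C * ∫⁻ x, h x ^ p ∂μ := by
  have hp0 : 0 < p := by linarith
  refine ⟨ENNReal.ofReal p * (2 * D * (2 ^ (p - 1) / ENNReal.ofReal (p - 1))), ?_, ?_⟩
  · have : ENNReal.ofReal (p - 1) ≠ 0 := by simpa using hp
    have h3 := ENNReal.div_ne_top (x := (2 : ℝ≥0∞) ^ (p - 1)) (by finiteness) this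
    finiteness
  intro μ _ hD h hh
  have hweak : ∀ t : ℝ, 0 < t → μ {x | ENNReal.ofReal t < maxFn μ h x} * ENNReal.ofReal (t ^ (p - 1))
      ≤ 2 * D * ∫⁻ y, (if ENNReal.ofReal t < 2 * h y then ENNReal.ofReal (t ^ (p - 2)) else 0) * h y
        ∂μ := by
    intro t ht
    set h1 : Rn n → ℝ≥0∞ := fun y => if ENNReal.ofReal t < 2 * h y then h y else 0
    have hle : ∀ y, h y ≤ h1 y + ENNReal.ofReal (t / 2) := by
      intro y
      simp only [h1]
      split_ifs with hy
      · exact le_self_add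
      · rw [zero_add, ENNReal.ofReal_div_of_pos (by norm_num)]
        rw [ENNReal.le_div_iff_mul_le (by simp) (by simp), mul_comm]
        simpa using not_lt.1 hy
    have hsub : {x | ENNReal.ofReal t < maxFn μ h x} ⊆
        {x | ENNReal.ofReal (t / 2) < maxFn μ h1 x} := by
      intro x hx
      have h3 := lt_of_lt_of_le hx ((maxFn_mono hle x).trans (maxFn_add_const_le h1 _ x))
      have h4 : ENNReal.ofReal t = ENNReal.ofReal (t / 2) + ENNReal.ofReal (t / 2) := by
        rw [← ENNReal.ofReal_add (by positivity) (by positivity), add_halves]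
      rw [h4] at h3
      exact lt_of_add_lt_add_right h3
    have hw := maxFn_weak_type hD h1 (ENNReal.ofReal (t / 2))
    have h5 : ENNReal.ofReal (t ^ (p - 1)) =
        2 * ENNReal.ofReal (t ^ (p - 2)) * ENNReal.ofReal (t / 2) := by
      rw [mul_assoc, ← ENNReal.ofReal_mul (by positivity),
        show (2 : ℝ≥0∞) = ENNReal.ofReal 2 by simp, ← ENNReal.ofReal_mul (by norm_num)]
      congr 1
      rw [show p - 1 = (p - 2) + 1 by ring, Real.rpow_add_one ht.ne']
      ring
    calc μ {x | ENNReal.ofReal t < maxFn μ h x} * ENNReal.ofReal (t ^ (p - 1))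
        ≤ μ {x | ENNReal.ofReal (t / 2) < maxFn μ h1 x} * ENNReal.ofReal (t ^ (p - 1)) := by
          gcongr
      _ = 2 * ENNReal.ofReal (t ^ (p - 2)) *
          (ENNReal.ofReal (t / 2) * μ {x | ENNReal.ofReal (t / 2) < maxFn μ h1 x}) := by
          rw [h5]; ring
      _ ≤ 2 * ENNReal.ofReal (t ^ (p - 2)) * (D * ∫⁻ y, h1 y ∂μ) := by gcongr
      _ = 2 * D * ∫⁻ y, ENNReal.ofReal (t ^ (p - 2)) * h1 y ∂μ := by
          rw [lintegral_const_mul' _ _ (by finiteness)]; ring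
      _ = _ := by
          congr 2
          funext y
          simp only [h1]
          split_ifs <;> simp
  have hm1 : Measurable (fun q : Rn n × ℝ => if ENNReal.ofReal q.2 < maxFn μ h q.1 then
      ENNReal.ofReal (q.2 ^ (p - 1)) else 0) := by
    refine Measurable.ite (measurableSet_lt (by fun_prop) ?_) (by fun_prop) measurable_const
    exact (measurable_maxFn μ h).comp measurable_fst
  have hm2 : Measurable (fun q : ℝ × Rn n => (if ENNReal.ofReal q.1 < 2 * h q.2 then
      ENNReal.ofReal (q.1 ^ (p - 2)) else 0) * h q.2) := by
    refine Measurable.mul ?_ (by fun_prop)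
    exact Measurable.ite (measurableSet_lt (by fun_prop) (by fun_prop)) (by fun_prop)
      measurable_const
  calc ∫⁻ x, maxFn μ h x ^ p ∂μ
      ≤ ∫⁻ x, (ENNReal.ofReal p * ∫⁻ t in Ioi (0 : ℝ),
        (if ENNReal.ofReal t < maxFn μ h x then ENNReal.ofReal (t ^ (p - 1)) else 0)) ∂μ :=
        lintegral_mono fun x => rpow_le_lintegral hp0 _
    _ = ENNReal.ofReal p * ∫⁻ t in Ioi (0 : ℝ), ∫⁻ x,
        (if ENNReal.ofReal t < maxFn μ h x then ENNReal.ofReal (t ^ (p - 1)) else 0) ∂μ := by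
        rw [lintegral_const_mul' _ _ (by finiteness), lintegral_lintegral_swap hm1.aemeasurable]
    _ ≤ ENNReal.ofReal p * ∫⁻ t in Ioi (0 : ℝ), 2 * D * ∫⁻ y,
        (if ENNReal.ofReal t < 2 * h y then ENNReal.ofReal (t ^ (p - 2)) else 0) * h y ∂μ := by
        gcongr ENNReal.ofReal p * ?_
        refine setLIntegral_mono' measurableSet_Ioi fun t ht => ?_
        refine le_trans (le_of_eq ?_) (hweak t ht)
        rw [mul_comm, ← lintegral_indicator_const (isOpen_lt_maxFn μ h _).measurableSet]
        refine lintegral_congr fun x => ?_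
        simp only [indicator, mem_ofPred_eq]
    _ = ENNReal.ofReal p * (2 * D * ∫⁻ y, (∫⁻ t in Ioi (0 : ℝ),
        (if ENNReal.ofReal t < 2 * h y then ENNReal.ofReal (t ^ (p - 2)) else 0)) * h y ∂μ) := by
        rw [lintegral_const_mul' _ _ (by finiteness), lintegral_lintegral_swap hm2.aemeasurable]
        congr 3
        funext y
        rw [lintegral_mul_const]
        exact Measurable.ite (measurableSet_lt (by fun_prop) (by fun_prop)) (by fun_prop)
          measurable_const
    _ ≤ ENNReal.ofReal p * (2 * D * ∫⁻ y,
        (2 ^ (p - 1) / ENNReal.ofReal (p - 1)) * h y ^ p ∂μ) := by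
        gcongr ENNReal.ofReal p * (2 * D * ?_)
        refine lintegral_mono fun y => ?_
        by_cases hy : h y = ⊤
        · have h0 : (2 : ℝ≥0∞) ^ (p - 1) / ENNReal.ofReal (p - 1) ≠ 0 :=
            (ENNReal.div_pos (by simp) ENNReal.ofReal_ne_top).ne'
          rw [hy, ENNReal.top_rpow_of_pos hp0, ENNReal.mul_top h0]
          exact le_top
        rw [lintegral_ofReal_lt (by linarith) (by finiteness), show p - 2 + 1 = p - 1 by ring,
          ENNReal.mul_rpow_of_nonneg _ _ (by linarith)]
        refine le_of_eq ?_
        rw [ENNReal.mul_div_right_comm, mul_assoc]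
        congr 1
        nth_rewrite 2 [← ENNReal.rpow_one (h y)]
        rw [← ENNReal.rpow_add_of_nonneg _ _ (by linarith) zero_le_one, sub_add_cancel]
    _ = _ := by
        rw [lintegral_const_mul' _ _ ?_]
        · ring
        · refine ENNReal.div_ne_top (by finiteness) (by simpa using hp)

end Maximal

section AinfMeasures

/-- Quantitative mutual absolute continuity with Lebesgue measure on balls. -/
structure IsAinfMeas (μ : Measure (Rn n)) : Prop where
  ac : μ ≪ volume
  ball_ne_zero : ∀ c r, 0 < r → μ (ball c r) ≠ 0
  ball_ne_top : ∀ c r, μ (ball c r) ≠ ⊤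
  comparison : ∀ M : ℝ≥0∞, M ≠ ⊤ → ∃ C : ℝ≥0∞, C ≠ ⊤ ∧ ∀ c r, 0 < r → ∀ E ⊆ ball c r,
    MeasurableSet E → volume (ball c r) ≤ M * volume E → μ (ball c r) ≤ C * μ E

lemma volume_ball_mul_le (c c' : Rn n) {a r : ℝ} (ha : 0 < a) (hr : 0 < r) :
    volume (ball c (a * r)) = ENNReal.ofReal a ^ n * volume (ball c' r) := by
  rw [volume_ball_eq _ (by positivity), volume_ball_eq _ hr, ENNReal.ofReal_mul ha.le, mul_pow,
    mul_assoc]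

lemma IsAinfMeas.exists_ball_le {μ : Measure (Rn n)} (hμ : IsAinfMeas μ) {a : ℝ} (ha : 0 < a) :
    ∃ D : ℝ≥0∞, D ≠ ⊤ ∧ ∀ c c' r, 0 < r → ball c' r ⊆ ball c (a * r) →
      μ (ball c (a * r)) ≤ D * μ (ball c' r) := by
  obtain ⟨C, hC, h⟩ := hμ.comparison (ENNReal.ofReal a ^ n) (by finiteness)
  exact ⟨C, hC, fun c c' r hr hsub => h c _ (by positivity) _ hsub measurableSet_ball
    (volume_ball_mul_le c c' ha hr).le⟩

lemma IsAinfMeas.exists_doubling {μ : Measure (Rn n)} (hμ : IsAinfMeas μ) :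
    ∃ D : ℝ≥0∞, D ≠ ⊤ ∧ ∀ c r, 0 < r → μ (closedBall c (5 * r)) ≤ D * μ (ball c r) := by
  obtain ⟨D, hD, h⟩ := hμ.exists_ball_le (a := 6) (by norm_num)
  refine ⟨D, hD, fun c r hr => le_trans (measure_mono ?_) (h c c r hr ?_)⟩
  · exact closedBall_subset_ball (by linarith)
  · exact ball_subset_ball (by linarith)

lemma IsAinfMeas.isLocallyFinite {μ : Measure (Rn n)} (hμ : IsAinfMeas μ) :
    IsLocallyFiniteMeasure μ :=
  ⟨fun x => ⟨ball x 1, ball_mem_nhds x one_pos, (hμ.ball_ne_top x 1).lt_top⟩⟩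

/-- Comparison of a cube with the subsets of it which are large. -/
lemma IsAinfMeas.exists_cube_le [NeZero n] {μ : Measure (Rn n)} (hμ : IsAinfMeas μ) {a : ℝ}
    (ha : (n : ℝ) ≤ a) {M : ℝ≥0∞} (hM : M ≠ ⊤) :
    ∃ C : ℝ≥0∞, C ≠ ⊤ ∧ ∀ c s, 0 < s → ∀ E ⊆ cube c s, MeasurableSet E →
      volume (cube c s) ≤ M * volume E → μ (ball c (a * s)) ≤ C * μ E := by
  have hn : (0 : ℝ) < n := by exact_mod_cast Nat.pos_of_ne_zero (NeZero.ne n)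
  have ha0 : 0 < a := hn.trans_le ha
  obtain ⟨C, hC, h⟩ := hμ.comparison (ENNReal.ofReal (2 * a) ^ n * M) (by finiteness)
  refine ⟨C, hC, fun c s hs E hE hEm hv => h c _ (by positivity) E ?_ hEm ?_⟩
  · exact hE.trans ((cube_subset_ball c hs).trans (ball_subset_ball (by gcongr)))
  · rw [show a * s = (2 * a) * (s / 2) by ring, volume_ball_mul_le c c (by positivity)
      (by positivity), mul_assoc]
    gcongr
    exact (measure_mono (ball_subset_cube c s)).trans hv

lemma IsAinfMeas.cube_ne_top [NeZero n] {μ : Measure (Rn n)} (hμ : IsAinfMeas μ) {c : Rn n}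
    {s : ℝ} (hs : 0 < s) : μ (cube c s) ≠ ⊤ :=
  ne_top_of_le_ne_top (hμ.ball_ne_top c _) (measure_mono (cube_subset_ball c hs))

/-- Subsets of a cube with at most half its volume carry at most a fixed fraction of its mass. -/
lemma IsAinfMeas.exists_measure_le_of_half [NeZero n] {μ : Measure (Rn n)} (hμ : IsAinfMeas μ) :
    ∃ β : ℝ≥0∞, β < 1 ∧ ∀ c s, 0 < s → ∀ E ⊆ cube c s, MeasurableSet E →
      2 * volume E ≤ volume (cube c s) → μ E ≤ β * μ (cube c s) := by
  obtain ⟨C, hC, h⟩ := hμ.exists_cube_le (le_refl (n : ℝ)) (M := 2) (by simp)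
  have hC0 : C + 1 ≠ 0 := by simp
  have hC1 : C + 1 ≠ ⊤ := by finiteness
  refine ⟨1 - (C + 1)⁻¹, ENNReal.sub_lt_self (by simp) (by simp) (by simpa using hC1), ?_⟩
  intro c s hs E hE hEm hv
  have hQ := volume_cube_ne_top c s
  have hμQ := hμ.cube_ne_top (c := c) hs
  have hEt : volume E ≠ ⊤ := ne_top_of_le_ne_top hQ (measure_mono hE)
  have hadd : volume E + volume (cube c s \ E) = volume (cube c s) := by
    rw [add_comm, ← measure_sdiff_add_inter (cube c s) hEm, inter_eq_self_of_subset_right hE]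
  have hle : volume E ≤ volume (cube c s \ E) := by
    rw [← hadd, two_mul] at hv
    exact (ENNReal.add_le_add_iff_left hEt).1 hv
  have h1 := h c s hs (cube c s \ E) sdiff_subset ((measurableSet_cube c s).diff hEm) (by
    rw [← hadd, two_mul]
    gcongr)
  have h2 : μ (cube c s) ≤ (C + 1) * μ (cube c s \ E) :=
    (measure_mono (cube_subset_ball c hs)).trans (h1.trans (by gcongr; exact le_self_add))
  have h3 : (C + 1)⁻¹ * μ (cube c s) ≤ μ (cube c s \ E) := by
    rw [mul_comm, ← div_eq_mul_inv]
    exact ENNReal.div_le_of_le_mul' h2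
  have h4 : μ (cube c s \ E) + μ E = μ (cube c s) := by
    rw [← measure_sdiff_add_inter (cube c s) hEm, inter_eq_self_of_subset_right hE]
  have hEt' : μ E ≠ ⊤ := ne_top_of_le_ne_top hμQ (measure_mono hE)
  rw [ENNReal.sub_mul (fun _ _ => hμQ), one_mul]
  refine ENNReal.le_sub_of_add_le_left (by finiteness) ?_
  rw [← h4] at h3 ⊢
  gcongr

/-- Reverse Hölder-type conditions on products of averages produce `IsAinfMeas`. -/
lemma isAinfMeas_of_prod_lintegral {J : Type*} [Fintype J] [DecidableEq J] (g : J → Rn n → ℝ≥0∞)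
    (hg : ∀ j, Measurable (g j)) (θ : J → ℝ) (hθ : ∀ j, 0 < θ j) (hsum : ∑ j, θ j = 1)
    (hone : ∀ᵐ x : Rn n, 1 ≤ ∏ j, g j x ^ θ j) {K : ℝ≥0∞} (hK : K ≠ ⊤)
    (hAP : ∀ c r, 0 < r → ∏ j, (∫⁻ y in ball c r, g j y) ^ θ j ≤ K * volume (ball c r)) (i : J) :
    IsAinfMeas (volume.withDensity (g i)) := by
  have hold : ∀ E : Set (Rn n), MeasurableSet E →
      volume E ≤ ∏ j, (∫⁻ y in E, g j y) ^ θ j := by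
    intro E hE
    refine le_trans ?_ (ENNReal.lintegral_prod_norm_pow_le (μ := volume.restrict E) Finset.univ
      (f := g) (fun j _ => (hg j).aemeasurable) hsum (fun j _ => (hθ j).le))
    calc volume E = ∫⁻ y in E, 1 := by simp
      _ ≤ _ := lintegral_mono_ae (ae_restrict_of_ae hone)
  have hne0 : ∀ c r, 0 < r → ∀ j, ∫⁻ y in ball c r, g j y ≠ 0 := by
    intro c r hr j h0
    have := hold (ball c r) measurableSet_ball
    rw [Finset.prod_eq_zero (Finset.mem_univ j) (by rw [h0, ENNReal.zero_rpow_of_pos (hθ j)])] at this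
    exact (volume_ball_pos c hr).ne' (le_zero_iff.1 this)
  have hnt : ∀ c r, 0 < r → ∀ j, ∫⁻ y in ball c r, g j y ≠ ⊤ := by
    intro c r hr j ht
    have := hAP c r hr
    rw [← Finset.mul_prod_erase _ _ (Finset.mem_univ j), ht, ENNReal.top_rpow_of_pos (hθ j),
      ENNReal.top_mul] at this
    · exact ENNReal.mul_ne_top hK (volume_ball_ne_top c r) (top_le_iff.1 this)
    · refine Finset.prod_ne_zero_iff.2 fun k _ => ?_
      simp [hne0 c r hr k, (hθ k).le, (hθ k).not_gt]
  refine ⟨withDensity_absolutelyContinuous _ _, ?_, ?_, ?_⟩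
  · intro c r hr
    rw [withDensity_apply _ measurableSet_ball]
    exact hne0 c r hr i
  · intro c r
    rw [withDensity_apply _ measurableSet_ball]
    rcases le_or_gt r 0 with hr | hr
    · simp [ball_eq_empty.2 hr]
    · exact hnt c r hr i
  · intro M hM
    refine ⟨(K * M) ^ (θ i)⁻¹, ENNReal.rpow_ne_top_of_nonneg (inv_nonneg.2 (hθ i).le)
      (by finiteness), ?_⟩
    intro c r hr E hE hEm hv
    rw [withDensity_apply _ measurableSet_ball, withDensity_apply _ hEm]
    set P := ∏ j ∈ Finset.univ.erase i, (∫⁻ y in ball c r, g j y) ^ θ j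
    have hP0 : P ≠ 0 := by
      refine Finset.prod_ne_zero_iff.2 fun k _ => ?_
      simp [hne0 c r hr k, hnt c r hr k]
    have hPt : P ≠ ⊤ := by
      refine ENNReal.prod_ne_top fun k _ => ?_
      exact ENNReal.rpow_ne_top_of_nonneg (hθ k).le (hnt c r hr k)
    have h1 : (∫⁻ y in ball c r, g i y) ^ θ i * P ≤ K * M * (∫⁻ y in E, g i y) ^ θ i * P := by
      calc (∫⁻ y in ball c r, g i y) ^ θ i * P
          = ∏ j, (∫⁻ y in ball c r, g j y) ^ θ j := Finset.mul_prod_erase Finset.univ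
            (fun j => (∫⁻ y in ball c r, g j y) ^ θ j) (Finset.mem_univ i)
        _ ≤ K * volume (ball c r) := hAP c r hr
        _ ≤ K * (M * ∏ j, (∫⁻ y in E, g j y) ^ θ j) := by
            gcongr
            exact hv.trans (by gcongr; exact hold E hEm)
        _ = K * M * ((∫⁻ y in E, g i y) ^ θ i *
            ∏ j ∈ Finset.univ.erase i, (∫⁻ y in E, g j y) ^ θ j) := by
            rw [Finset.mul_prod_erase Finset.univ
              (fun j => (∫⁻ y in E, g j y) ^ θ j) (Finset.mem_univ i), mul_assoc]
        _ ≤ K * M * ((∫⁻ y in E, g i y) ^ θ i * P) := by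
            gcongr
            exact Finset.prod_le_prod' fun j _ =>
              ENNReal.rpow_le_rpow (lintegral_mono_set hE) (hθ j).le
        _ = _ := by ring
    have h2 := (ENNReal.mul_le_mul_iff_left hP0 hPt).1 h1
    have h3 := ENNReal.rpow_le_rpow h2 (inv_nonneg.2 (hθ i).le)
    rwa [ENNReal.rpow_rpow_inv (hθ i).ne', ENNReal.mul_rpow_of_nonneg _ _
      (inv_nonneg.2 (hθ i).le), ENNReal.rpow_rpow_inv (hθ i).ne'] at h3

lemma prod_mul_rpow_const {J : Type*} [Fintype J] (a : J → ℝ≥0∞) (v : ℝ≥0∞) (θ : J → ℝ)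
    (hθ : ∀ j, 0 < θ j) (hsum : ∑ j, θ j = 1) :
    ∏ j, (v * a j) ^ θ j = v * ∏ j, a j ^ θ j := by
  have h : ∀ S : Finset J, ∏ j ∈ S, v ^ θ j = v ^ ∑ j ∈ S, θ j := by
    classical
    intro S
    induction S using Finset.induction_on with
    | empty => simp
    | insert j S hj ih =>
      rw [Finset.prod_insert hj, Finset.sum_insert hj, ih, ENNReal.rpow_add_of_nonneg _ _ (hθ j).le
        (Finset.sum_nonneg fun k _ => (hθ k).le)]
  simp_rw [fun j => ENNReal.mul_rpow_of_nonneg v (a j) (hθ j).le]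
  rw [Finset.prod_mul_distrib, h, hsum, ENNReal.rpow_one]

lemma isAinfMeas_of_prod_avg {J : Type*} [Fintype J] [DecidableEq J] (g : J → Rn n → ℝ≥0∞)
    (hg : ∀ j, Measurable (g j)) (θ : J → ℝ) (hθ : ∀ j, 0 < θ j) (hsum : ∑ j, θ j = 1)
    (hone : ∀ᵐ x : Rn n, 1 ≤ ∏ j, g j x ^ θ j) {K : ℝ≥0∞} (hK : K ≠ ⊤)
    (hAP : ∀ c r, 0 < r →
      ∏ j, ((volume (ball c r))⁻¹ * ∫⁻ y in ball c r, g j y) ^ θ j ≤ K) (i : J) :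
    IsAinfMeas (volume.withDensity (g i)) := by
  refine isAinfMeas_of_prod_lintegral g hg θ hθ hsum hone hK (fun c r hr => ?_) i
  have := hAP c r hr
  rw [prod_mul_rpow_const _ _ _ hθ hsum, mul_comm, ← div_eq_mul_inv] at this
  rwa [ENNReal.div_le_iff (volume_ball_pos c hr).ne' (volume_ball_ne_top c r)] at this

/-- The density of the dual weight `ω^{1-q'}`. -/
def dualWeight (q : ℝ) (ω : Rn n → ℝ) (x : Rn n) : ℝ≥0∞ := ENNReal.ofReal (ω x) ^ (-(1 / (q - 1)))

lemma measurable_dualWeight {q : ℝ} {ω : Rn n → ℝ} (h : Measurable ω) :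
    Measurable (dualWeight q ω) := by
  unfold dualWeight
  fun_prop

/-- The measure with density `ω`. -/
def weightMeas (ω : Rn n → ℝ) : Measure (Rn n) := volume.withDensity fun x => ENNReal.ofReal (ω x)

lemma weightMeas_apply {ω : Rn n → ℝ} {E : Set (Rn n)} (hE : MeasurableSet E) :
    weightMeas ω E = wMeas ω E := withDensity_apply _ hE

lemma wMeas_ball_ne_top {ω : Rn n → ℝ} (hloc : LocallyIntegrable ω volume)
    (c : Rn n) (r : ℝ) : wMeas ω (ball c r) ≠ ⊤ := by
  have h1 : IntegrableOn ω (ball c r) volume :=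
    (hloc.integrableOn_isCompact (isCompact_closedBall c r)).mono_set ball_subset_closedBall
  refine ne_top_of_le_ne_top h1.2.ne (lintegral_mono fun x => ?_)
  rw [← ofReal_norm]
  exact ENNReal.ofReal_le_ofReal (le_abs_self _)

lemma isAinfMeas_of_isA1 {ω : Rn n → ℝ} (hm : Measurable ω) (hpos : ∀ x, 0 < ω x)
    (hloc : LocallyIntegrable ω volume) (h : IsA1 ω) : IsAinfMeas (weightMeas ω) := by
  obtain ⟨C, hC⟩ := h
  refine ⟨withDensity_absolutelyContinuous _ _, fun c r hr => ?_, fun c r => ?_, fun M hM => ?_⟩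
  · rw [weightMeas_apply measurableSet_ball, wMeas, ← pos_iff_ne_zero,
      setLIntegral_pos_iff (by fun_prop)]
    convert volume_ball_pos c hr
    refine inter_eq_self_of_subset_right fun x _ => ?_
    simpa using hpos x
  · rw [weightMeas_apply measurableSet_ball]
    exact wMeas_ball_ne_top hloc c r
  · refine ⟨C * M, by finiteness, fun c r hr E hE hEm hv => ?_⟩
    rw [weightMeas_apply measurableSet_ball, weightMeas_apply hEm]
    refine (hC c r hr).trans ?_
    have h1 : volume E * essInf (fun y => ENNReal.ofReal (ω y)) (volume.restrict (ball c r))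
        ≤ wMeas ω E := by
      rw [mul_comm, ← setLIntegral_const]
      refine lintegral_mono_ae ?_
      exact ae_restrict_of_ae_restrict_of_subset hE ae_essInf_le
    calc _ ≤ C * (M * volume E) *
        essInf (fun y => ENNReal.ofReal (ω y)) (volume.restrict (ball c r)) := by gcongr
      _ = C * M * (volume E *
        essInf (fun y => ENNReal.ofReal (ω y)) (volume.restrict (ball c r))) := by ring
      _ ≤ _ := by gcongr

lemma isAinfMeas_of_isAq {ω : Rn n → ℝ} (hm : Measurable ω) (hpos : ∀ x, 0 < ω x)
    {q : ℝ} (hq : 1 < q) (h : IsAq q ω) : IsAinfMeas (weightMeas ω) := by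
  obtain ⟨C, hC⟩ := h
  have hq0 : 0 < q := by linarith
  have hq1 : 0 < q - 1 := by linarith
  refine isAinfMeas_of_prod_avg
    (fun j : Bool => if j then fun x => ENNReal.ofReal (ω x) else dualWeight q ω) ?_
    (fun j => if j then 1 / q else (q - 1) / q) ?_ ?_ ?_ (K := (C : ℝ≥0∞) ^ (1 / q))
    (by finiteness) ?_ true
  · rintro (_ | _)
    · simpa using measurable_dualWeight hm
    · simpa using hm.ennreal_ofReal
  · rintro (_ | _) <;> simp <;> positivity
  · simp
    field_simp
    ring
  · refine Eventually.of_forall fun x => le_of_eq ?_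
    simp only [Fintype.prod_bool, if_true, Bool.false_eq_true, if_false, dualWeight]
    rw [← ENNReal.rpow_mul, ← ENNReal.rpow_add]
    · rw [show 1 / q + -(1 / (q - 1)) * ((q - 1) / q) = 0 by field_simp; ring, ENNReal.rpow_zero]
    · simpa using hpos x
    · simp
  · intro c r hr
    simp only [Fintype.prod_bool, if_true, Bool.false_eq_true, if_false]
    have h1 := ENNReal.rpow_le_rpow (hC c r hr) (z := 1 / q) (by positivity)
    rw [ENNReal.mul_rpow_of_nonneg _ _ (by positivity), ← ENNReal.rpow_mul, mul_one_div] at h1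
    exact h1

lemma isAinfMeas_of_isAinf {ω : Rn n → ℝ} (hm : Measurable ω) (hpos : ∀ x, 0 < ω x)
    (hloc : LocallyIntegrable ω volume) (h : IsAinf ω) : IsAinfMeas (weightMeas ω) := by
  rcases h with h | ⟨q, hq, h⟩
  · exact isAinfMeas_of_isA1 hm hpos hloc h
  · exact isAinfMeas_of_isAq hm hpos hq h

lemma measurable_nuw {p : ℝ} {ps : Fin m → ℝ} {ωs : Fin m → Rn n → ℝ}
    (hm : ∀ i, Measurable (ωs i)) : Measurable (nuw p ps ωs) := by
  unfold nuw
  fun_prop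

/-- Pointwise duality between the product weight and the dual weights. -/
lemma nuw_rpow_mul_prod_dualWeight {p : ℝ} {ps : Fin m → ℝ} {ωs : Fin m → Rn n → ℝ}
    (hpos : ∀ i x, 0 < ωs i x) (hp : 0 < p) (hps : ∀ i, 1 < ps i) (x : Rn n) :
    ENNReal.ofReal (nuw p ps ωs x) ^ (1 / p) *
      ∏ i, dualWeight (ps i) (ωs i) x ^ ((ps i - 1) / ps i) = 1 := by
  rw [nuw, ENNReal.ofReal_prod_of_nonneg (fun i _ => (Real.rpow_pos_of_pos (hpos i x) _).le),
    ← ENNReal.prod_rpow_of_nonneg (by positivity), ← Finset.prod_mul_distrib]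
  refine Finset.prod_eq_one fun i _ => ?_
  have h1 := hps i
  have h2 : 0 < ps i - 1 := by linarith
  have h3 : 0 < ps i := by linarith
  rw [dualWeight, ← ENNReal.ofReal_rpow_of_pos (hpos i x), ← ENNReal.rpow_mul, ← ENNReal.rpow_mul,
    ← ENNReal.rpow_add]
  · rw [show p / ps i * (1 / p) + -(1 / (ps i - 1)) * ((ps i - 1) / ps i) = 0 by field_simp; ring,
      ENNReal.rpow_zero]
  · simpa using hpos i x
  · simp

lemma isAinfMeas_of_isMultiAP [NeZero m] {p : ℝ} {ps : Fin m → ℝ} {ωs : Fin m → Rn n → ℝ}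
    (hm : ∀ i, Measurable (ωs i)) (hpos : ∀ i x, 0 < ωs i x) (hp0 : 0 < p)
    (hps : ∀ i, 1 < ps i) (hp : p⁻¹ = ∑ k, (ps k)⁻¹) (h : IsMultiAP p ps ωs) :
    IsAinfMeas (weightMeas (nuw p ps ωs)) ∧
      ∀ i, IsAinfMeas (volume.withDensity (dualWeight (ps i) (ωs i))) := by
  obtain ⟨C, hC⟩ := h
  have hm0 : (0 : ℝ) < m := by exact_mod_cast Nat.pos_of_ne_zero (NeZero.ne m)
  have key := isAinfMeas_of_prod_avg
    (fun j : Option (Fin m) => j.elim (fun x => ENNReal.ofReal (nuw p ps ωs x))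
      fun i => dualWeight (ps i) (ωs i)) ?_
    (fun j => j.elim (1 / p * (1 / m)) fun i => (ps i - 1) / ps i * (1 / m)) ?_ ?_ ?_
    (K := (C : ℝ≥0∞) ^ (1 / (m : ℝ))) (by finiteness) ?_
  · exact ⟨key none, fun i => key (some i)⟩
  · rintro (_ | i)
    · exact (measurable_nuw hm).ennreal_ofReal
    · exact measurable_dualWeight (hm i)
  · rintro (_ | i)
    · simp only [Option.elim]; positivity
    · have := hps i
      have : 0 < ps i - 1 := by linarith
      simp only [Option.elim]; positivity
  · simp only [Fintype.sum_option, Option.elim]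
    rw [one_div p, hp, ← Finset.sum_mul, ← add_mul, ← Finset.sum_add_distrib]
    rw [Finset.sum_congr rfl (g := fun _ => (1 : ℝ))]
    · simp [hm0.ne']
    · intro i _
      have := hps i
      field_simp
      ring
  · refine Eventually.of_forall fun x => le_of_eq ?_
    simp only [Fintype.prod_option, Option.elim, ENNReal.rpow_mul]
    rw [ENNReal.prod_rpow_of_nonneg (by positivity), ← ENNReal.mul_rpow_of_nonneg _ _ (by positivity),
      nuw_rpow_mul_prod_dualWeight hpos hp0 hps, ENNReal.one_rpow]
  · intro c r hr
    simp only [Fintype.prod_option, Option.elim, ENNReal.rpow_mul]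
    rw [ENNReal.prod_rpow_of_nonneg (by positivity), ← ENNReal.mul_rpow_of_nonneg _ _ (by positivity)]
    refine ENNReal.rpow_le_rpow ?_ (by positivity)
    refine le_trans (le_of_eq ?_) (hC c r hr)
    congr 1
    refine Finset.prod_congr rfl fun i _ => ?_
    rw [APfactor, if_neg (hps i).ne']
    rfl

/-- The set where an `A_∞` density is much smaller than its average is small. -/
lemma IsAinfMeas.exists_small_density {ω : Rn n → ℝ} (hm : Measurable ω)
    (h : IsAinfMeas (weightMeas ω)) {M : ℝ≥0∞} (hM : M ≠ ⊤) :
    ∃ η : ℝ≥0∞, η ≠ 0 ∧ η ≠ ⊤ ∧ ∀ c r, 0 < r →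
      M * volume {x ∈ ball c r | ENNReal.ofReal (ω x) <
        η * (wMeas ω (ball c r) / volume (ball c r))} ≤ volume (ball c r) := by
  obtain ⟨C, hC, h1⟩ := h.comparison M hM
  refine ⟨(2 * (C + 1))⁻¹, ENNReal.inv_ne_zero.2 (by finiteness), by simp, fun c r hr => ?_⟩
  set η : ℝ≥0∞ := (2 * (C + 1))⁻¹
  set E := {x ∈ ball c r | ENNReal.ofReal (ω x) < η * (wMeas ω (ball c r) / volume (ball c r))}
  have hE : MeasurableSet E :=
    measurableSet_ball.inter (measurableSet_lt hm.ennreal_ofReal measurable_const)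
  have hEs : E ⊆ ball c r := fun x hx => hx.1
  by_contra hcon
  have h2 := h1 c r hr E hEs hE (not_le.1 hcon).le
  have hB0 := h.ball_ne_zero c r hr
  have hBt := h.ball_ne_top c r
  rw [weightMeas_apply measurableSet_ball] at h2 hB0 hBt
  have hv0 := (volume_ball_pos c hr).ne'
  have hvt := volume_ball_ne_top c r
  rw [weightMeas_apply hE] at h2
  have h3 : wMeas ω E ≤ η * wMeas ω (ball c r) := by
    calc wMeas ω E ≤ ∫⁻ x in E, η * (wMeas ω (ball c r) / volume (ball c r)) :=
          setLIntegral_mono' hE fun x hx => hx.2.le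
      _ = η * (wMeas ω (ball c r) / volume (ball c r)) * volume E := setLIntegral_const _ _
      _ ≤ η * (wMeas ω (ball c r) / volume (ball c r)) * volume (ball c r) := by gcongr
      _ = η * wMeas ω (ball c r) := by
          rw [mul_assoc, ENNReal.div_mul_cancel hv0 hvt]
  have h4 : C * η ≤ 2⁻¹ := by
    simp only [η]
    rw [ENNReal.mul_inv (by simp) (by simp), mul_left_comm]
    refine mul_le_of_le_one_right' ?_
    rw [← div_eq_mul_inv]
    exact ENNReal.div_le_of_le_mul (by rw [one_mul]; exact le_self_add)
  have h5 : wMeas ω (ball c r) ≤ 2⁻¹ * wMeas ω (ball c r) :=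
    calc _ ≤ C * wMeas ω E := h2
      _ ≤ C * (η * wMeas ω (ball c r)) := by gcongr
      _ = (C * η) * wMeas ω (ball c r) := by ring
      _ ≤ _ := by gcongr
  have h6 : 2⁻¹ * wMeas ω (ball c r) < wMeas ω (ball c r) := by
    rw [mul_comm, ← div_eq_mul_inv]
    exact ENNReal.half_lt_self hB0 hBt
  exact absurd h5 (not_le.2 h6)

/-- The product of the masses of the weights is controlled by the mass of the product weight. -/
lemma prod_wMeas_le_nuw [NeZero m] {p : ℝ} {ps : Fin m → ℝ} {ωs : Fin m → Rn n → ℝ}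
    (hm : ∀ i, Measurable (ωs i)) (hpos : ∀ i x, 0 < ωs i x) (hp0 : 0 < p)
    (hps : ∀ i, 1 < ps i) (hp : p⁻¹ = ∑ k, (ps k)⁻¹) (hA : ∀ i, IsAinfMeas (weightMeas (ωs i))) :
    ∃ C : ℝ≥0∞, C ≠ ⊤ ∧ ∀ c r, 0 < r →
      ∏ i, wMeas (ωs i) (ball c r) ^ (1 / ps i) ≤ C * wMeas (nuw p ps ωs) (ball c r) ^ (1 / p) := by
  choose η hη0 hηt hη using fun i =>
    (hA i).exists_small_density (hm i) (M := 2 * m) (by finiteness)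
  have hm0 : (m : ℝ≥0∞) ≠ 0 := by exact_mod_cast NeZero.ne m
  have hpi : ∀ i, 0 < 1 / ps i := fun i => by have := hps i; positivity
  set P : ℝ≥0∞ := ∏ i, η i ^ (1 / ps i)
  have hP0 : P ≠ 0 := Finset.prod_ne_zero_iff.2 fun i _ => by simp [hη0 i, hηt i]
  have hPt : P ≠ ⊤ := ENNReal.prod_ne_top fun i _ =>
    ENNReal.rpow_ne_top_of_nonneg (hpi i).le (hηt i)
  have h2p : (2 : ℝ≥0∞) ^ (1 / p) ≠ ⊤ := by finiteness
  refine ⟨2 ^ (1 / p) * P⁻¹, ENNReal.mul_ne_top h2p (by simpa using hP0), fun c r hr => ?_⟩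
  set v := volume (ball c r)
  have hv0 : v ≠ 0 := (volume_ball_pos c hr).ne'
  have hvt : v ≠ ⊤ := volume_ball_ne_top c r
  set E : Fin m → Set (Rn n) := fun i => {x ∈ ball c r | ENNReal.ofReal (ωs i x) <
        η i * (wMeas (ωs i) (ball c r) / v)}
  have hEm : ∀ i, MeasurableSet (E i) := fun i =>
    measurableSet_ball.inter (measurableSet_lt (hm i).ennreal_ofReal measurable_const)
  set G := ball c r \ ⋃ i, E i
  have hGm : MeasurableSet G := measurableSet_ball.diff (MeasurableSet.iUnion hEm)
  have hU : 2 * volume (⋃ i, E i) ≤ v := by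
    have h1 : volume (⋃ i, E i) ≤ ∑ i, volume (E i) := measure_iUnion_fintype_le _ _
    have h2 : (m : ℝ≥0∞) * (2 * ∑ i, volume (E i)) ≤ m * v := by
      calc (m : ℝ≥0∞) * (2 * ∑ i, volume (E i)) = ∑ i, (2 * m * volume (E i)) := by
            rw [← Finset.mul_sum]; ring
        _ ≤ ∑ i : Fin m, v := Finset.sum_le_sum fun i _ => hη i c r hr
        _ = m * v := by simp
    have h3 := (ENNReal.mul_le_mul_iff_right hm0 (by simp)).1 h2
    exact le_trans (by gcongr) h3
  have hG : v ≤ 2 * volume G := by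
    have h1 : v ≤ volume G + volume (⋃ i, E i) := by
      refine (measure_sdiff_add_inter (ball c r) (MeasurableSet.iUnion hEm)).symm.le.trans ?_
      gcongr
      exact inter_subset_right
    have h2 : v + v ≤ 2 * volume G + v := by
      calc v + v = 2 * v := (two_mul v).symm
        _ ≤ 2 * volume G + 2 * volume (⋃ i, E i) := by rw [← mul_add]; gcongr
        _ ≤ _ := by gcongr
    exact (ENNReal.add_le_add_iff_right hvt).1 h2
  have hnu : ∀ x ∈ G, (∏ i, (η i * (wMeas (ωs i) (ball c r) / v)) ^ (1 / ps i)) ^ p ≤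
      ENNReal.ofReal (nuw p ps ωs x) := by
    intro x hx
    rw [nuw, ENNReal.ofReal_prod_of_nonneg (fun i _ => (Real.rpow_pos_of_pos (hpos i x) _).le),
      ← ENNReal.prod_rpow_of_nonneg hp0.le]
    refine Finset.prod_le_prod' fun i _ => ?_
    rw [← ENNReal.rpow_mul, ← ENNReal.ofReal_rpow_of_pos (hpos i x), one_div_mul_eq_div]
    refine ENNReal.rpow_le_rpow ?_ (by have := hps i; positivity)
    by_contra hcon
    exact hx.2 (mem_iUnion.2 ⟨i, hx.1, not_le.1 hcon⟩)
  set A := ∏ i, (η i * (wMeas (ωs i) (ball c r) / v)) ^ (1 / ps i)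
  have hA1 : A ^ p * v ≤ 2 * wMeas (nuw p ps ωs) (ball c r) := by
    calc A ^ p * v ≤ A ^ p * (2 * volume G) := by gcongr
      _ = 2 * ∫⁻ x in G, A ^ p := by rw [setLIntegral_const]; ring
      _ ≤ 2 * ∫⁻ x in G, ENNReal.ofReal (nuw p ps ωs x) := by
          gcongr 2 * ?_
          exact setLIntegral_mono' hGm hnu
      _ ≤ _ := by
          gcongr 2 * ?_
          exact lintegral_mono_set sdiff_subset
  have hA2 := ENNReal.rpow_le_rpow hA1 (z := 1 / p) (by positivity)
  rw [ENNReal.mul_rpow_of_nonneg _ _ (by positivity), ENNReal.mul_rpow_of_nonneg _ _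
    (by positivity), ← ENNReal.rpow_mul, mul_one_div_cancel hp0.ne', ENNReal.rpow_one] at hA2
  have hvp : v ^ (1 / p) = ∏ i, v ^ (1 / ps i) := by
    rw [one_div p, hp]
    have : ∀ S : Finset (Fin m), v ^ (∑ k ∈ S, (ps k)⁻¹) = ∏ i ∈ S, v ^ (1 / ps i) := by
      intro S
      induction S using Finset.induction_on with
      | empty => simp
      | insert j S hj ih =>
        rw [Finset.prod_insert hj, Finset.sum_insert hj, ENNReal.rpow_add _ _ hv0 hvt, ih, one_div]
    exact this _
  have hA3 : A * v ^ (1 / p) = P * ∏ i, wMeas (ωs i) (ball c r) ^ (1 / ps i) := by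
    rw [hvp, ← Finset.prod_mul_distrib, ← Finset.prod_mul_distrib]
    refine Finset.prod_congr rfl fun i _ => ?_
    rw [← ENNReal.mul_rpow_of_nonneg _ _ (hpi i).le, ← ENNReal.mul_rpow_of_nonneg _ _ (hpi i).le,
      mul_assoc, ENNReal.div_mul_cancel hv0 hvt]
  rw [hA3] at hA2
  calc ∏ i, wMeas (ωs i) (ball c r) ^ (1 / ps i)
      = P⁻¹ * (P * ∏ i, wMeas (ωs i) (ball c r) ^ (1 / ps i)) := by
        rw [← mul_assoc, ENNReal.inv_mul_cancel hP0 hPt, one_mul]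
    _ ≤ P⁻¹ * (2 ^ (1 / p) * wMeas (nuw p ps ωs) (ball c r) ^ (1 / p)) := by gcongr
    _ = _ := by ring

end AinfMeasures

section JohnNirenberg

lemma ofReal_abs_sub_le (a b c : ℝ) :
    ENNReal.ofReal |a - c| ≤ ENNReal.ofReal |a - b| + ENNReal.ofReal |b - c| := by
  rw [← ENNReal.ofReal_add (abs_nonneg _) (abs_nonneg _)]
  exact ENNReal.ofReal_le_ofReal (abs_sub_le a b c)

lemma ofReal_abs_const_sub_mul_le {E : Set (Rn n)} (b : Rn n → ℝ) (hb : Measurable b) (k k' : ℝ) :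
    ENNReal.ofReal |k - k'| * volume E ≤
      (∫⁻ y in E, ENNReal.ofReal |b y - k|) + ∫⁻ y in E, ENNReal.ofReal |b y - k'| := by
  rw [← setLIntegral_const, ← lintegral_add_left (by fun_prop)]
  refine lintegral_mono fun y => ?_
  rw [abs_sub_comm (b y) k]
  exact ofReal_abs_sub_le k (b y) k'

lemma ofReal_abs_ballAvg_sub_mul_le {b : Rn n → ℝ} {E : Set (Rn n)} (hb : IntegrableOn b E)
    (hE0 : volume E ≠ 0) (hEt : volume E ≠ ⊤) (k : ℝ) :
    ENNReal.ofReal |ballAvg b E - k| * volume E ≤ ∫⁻ y in E, ENNReal.ofReal |b y - k| := by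
  have hpos : 0 < (volume E).toReal := ENNReal.toReal_pos hE0 hEt
  have h1 : (ballAvg b E - k) * (volume E).toReal = ∫ y in E, (b y - k) := by
    rw [integral_sub hb (integrableOn_const hEt), setIntegral_const, ballAvg, sub_mul,
      div_mul_cancel₀ _ hpos.ne', smul_eq_mul, Measure.real, mul_comm k]
  calc ENNReal.ofReal |ballAvg b E - k| * volume E
      = ENNReal.ofReal |∫ y in E, (b y - k)| := by
        rw [← h1, abs_mul, abs_of_pos hpos, ENNReal.ofReal_mul (abs_nonneg _),
          ENNReal.ofReal_toReal hEt]
    _ ≤ ∫⁻ y in E, ‖b y - k‖ₑ := by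
        rw [← Real.norm_eq_abs, ofReal_norm]
        exact enorm_integral_le_lintegral_enorm _
    _ = _ := by
        refine lintegral_congr fun y => ?_
        rw [← ofReal_norm, Real.norm_eq_abs]

lemma lintegral_osc_le_bmoNorm (b : Rn n → ℝ) (c : Rn n) {r : ℝ} (hr : 0 < r) :
    ∫⁻ y in ball c r, ENNReal.ofReal |b y - ballAvg b (ball c r)| ≤
      bmoNorm b * volume (ball c r) := by
  have h : (volume (ball c r))⁻¹ * ∫⁻ y in ball c r,
      ENNReal.ofReal |b y - ballAvg b (ball c r)| ≤ bmoNorm b :=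
    le_iSup₂_of_le c r (le_iSup_of_le hr le_rfl)
  rwa [mul_comm, ← div_eq_mul_inv, ENNReal.div_le_iff (volume_ball_pos c hr).ne'
    (volume_ball_ne_top c r)] at h

lemma ofReal_abs_ballAvg_sub_le {b : Rn n → ℝ} (hb : MemBMO b) {c c' : Rn n} {r a : ℝ}
    (hr : 0 < r) (ha : 0 < a) (hsub : ball c' r ⊆ ball c (a * r)) :
    ENNReal.ofReal |ballAvg b (ball c' r) - ballAvg b (ball c (a * r))| ≤
      bmoNorm b * ENNReal.ofReal a ^ n := by
  have hv0 := (volume_ball_pos c' hr).ne'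
  have hvt := volume_ball_ne_top c' r
  have hint : IntegrableOn b (ball c' r) :=
    (hb.1.integrableOn_isCompact (isCompact_closedBall c' r)).mono_set ball_subset_closedBall
  have h1 := ofReal_abs_ballAvg_sub_mul_le hint hv0 hvt (ballAvg b (ball c (a * r)))
  have h2 := h1.trans ((lintegral_mono_set hsub).trans
    (lintegral_osc_le_bmoNorm b c (by positivity : 0 < a * r)))
  rw [volume_ball_mul_le c c' ha hr, ← mul_assoc] at h2
  exact (ENNReal.mul_le_mul_iff_left hv0 hvt).1 h2

lemma ofReal_abs_ballAvg_two_pow_le {b : Rn n → ℝ} (hb : MemBMO b) (c : Rn n) {r : ℝ}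
    (hr : 0 < r) (k : ℕ) :
    ENNReal.ofReal |ballAvg b (ball c (2 ^ k * r)) - ballAvg b (ball c r)| ≤
      k * (bmoNorm b * 2 ^ n) := by
  induction k with
  | zero => simp
  | succ k ih =>
    have h1 := ofReal_abs_ballAvg_sub_le hb (c := c) (c' := c) (r := 2 ^ k * r) (a := 2)
      (by positivity) (by norm_num) (ball_subset_ball (by nlinarith [pow_pos two_pos k (M₀ := ℝ)]))
    rw [← mul_assoc, ← pow_succ', abs_sub_comm] at h1
    refine (ofReal_abs_sub_le _ _ _).trans ((add_le_add h1 ih).trans (le_of_eq ?_))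
    push_cast
    simp
    ring

/-- Exponential decay of the level sets of a function of bounded mean oscillation with respect to
an `A_∞` measure. -/
lemma exists_level_decay [NeZero n] {b : Rn n → ℝ} (hb : MemBMO b) (hbm : Measurable b)
    {μ : Measure (Rn n)} (hμ : IsAinfMeas μ) :
    ∃ l β : ℝ≥0∞, l ≠ 0 ∧ l ≠ ⊤ ∧ β < 1 ∧ ∀ (k : ℕ) (c : Rn n) (s : ℝ), 0 < s →
      μ {x ∈ cube c s | k * l < ENNReal.ofReal |b x - ballAvg b (ball c (n * s))|} ≤
        β ^ k * μ (cube c s) := by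
  have hn : (0 : ℝ) < n := by exact_mod_cast Nat.pos_of_ne_zero (NeZero.ne n)
  obtain ⟨β, hβ, hhalf⟩ := hμ.exists_measure_le_of_half
  set N : ℝ≥0∞ := bmoNorm b * ENNReal.ofReal (2 * n) ^ n
  have hN : N ≠ ⊤ := ENNReal.mul_ne_top hb.2.ne (by finiteness)
  have hosc : ∀ (c : Rn n) (s : ℝ), 0 < s →
      ∫⁻ y in cube c s, ENNReal.ofReal |b y - ballAvg b (ball c (n * s))| ≤
        N * volume (cube c s) := by
    intro c s hs
    refine (lintegral_mono_set (cube_subset_ball c hs)).trans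
      ((lintegral_osc_le_bmoNorm b c (by positivity)).trans ?_)
    rw [show n * s = (2 * n) * (s / 2) by ring, volume_ball_mul_le c c (by positivity)
      (by positivity), ← mul_assoc]
    gcongr
    exact ball_subset_cube c s
  set h : ℝ≥0∞ := 2 * (N + 1)
  have hh0 : h ≠ 0 := by simp [h]
  have hht : h ≠ ⊤ := by finiteness
  refine ⟨N + 2 ^ n * h, β, by simp [hh0], by finiteness, hβ, fun k => ?_⟩
  set l := N + 2 ^ n * h
  induction k with
  | zero =>
    intro c s hs
    simp only [pow_zero, one_mul]
    exact measure_mono fun x hx => hx.1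
  | succ k ih =>
    intro c s hs
    set kQ := ballAvg b (ball c (n * s))
    obtain ⟨S, hScount, hSdisj, hS, hae⟩ := exists_cz_cubes
      (g := fun y => ENNReal.ofReal |b y - kQ|) (by fun_prop) hht hs ((hosc c s hs).trans (by
        gcongr
        simp only [h]
        rw [two_mul]
        exact le_trans le_self_add le_self_add))
    set Ω := ⋃ P ∈ S, cube P.1 P.2
    have hΩm : MeasurableSet Ω := MeasurableSet.biUnion hScount fun P _ => measurableSet_cube _ _
    have hΩs : Ω ⊆ cube c s := iUnion₂_subset fun P hP => (hS P hP).2.2.1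
    have hΩv : 2 * volume Ω ≤ volume (cube c s) := by
      have h1 : h * volume Ω ≤ N * volume (cube c s) := by
        calc h * volume Ω ≤ h * ∑' P : S, volume (cube P.1.1 P.1.2) := by
              gcongr; exact measure_biUnion_le _ hScount _
          _ = ∑' P : S, h * volume (cube P.1.1 P.1.2) := ENNReal.tsum_mul_left.symm
          _ ≤ ∑' P : S, ∫⁻ y in cube P.1.1 P.1.2, ENNReal.ofReal |b y - kQ| :=
              ENNReal.tsum_le_tsum fun P => (hS P.1 P.2).2.2.2.1.le
          _ = ∫⁻ y in Ω, ENNReal.ofReal |b y - kQ| :=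
              (lintegral_biUnion hScount (fun P _ => measurableSet_cube _ _) hSdisj _).symm
          _ ≤ _ := (lintegral_mono_set hΩs).trans (hosc c s hs)
      have h2 : (N + 1) * (2 * volume Ω) ≤ (N + 1) * volume (cube c s) := by
        calc (N + 1) * (2 * volume Ω) = h * volume Ω := by simp only [h]; ring
          _ ≤ N * volume (cube c s) := h1
          _ ≤ _ := by gcongr; exact le_self_add
      exact (ENNReal.mul_le_mul_iff_right (by simp) (by finiteness)).1 h2
    have hk : ∀ P ∈ S, ENNReal.ofReal |ballAvg b (ball P.1 (n * P.2)) - kQ| ≤ l := by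
      intro P hP
      obtain ⟨hP0, -, -, -, hP5⟩ := hS P hP
      have h1 := (ofReal_abs_const_sub_mul_le (E := cube P.1 P.2) b hbm
        (ballAvg b (ball P.1 (n * P.2))) kQ).trans (add_le_add (hosc P.1 P.2 hP0) hP5)
      rw [← add_mul] at h1
      exact (ENNReal.mul_le_mul_iff_left (volume_cube_pos hP0).ne' (volume_cube_ne_top _ _)).1 h1
    have hsub : {x ∈ cube c s | (k + 1 : ℕ) * l < ENNReal.ofReal |b x - kQ|} ⊆
        {x | ¬ (x ∈ cube c s → x ∉ Ω → ENNReal.ofReal |b x - kQ| ≤ h)} ∪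
        ⋃ P ∈ S, {x ∈ cube P.1 P.2 |
          k * l < ENNReal.ofReal |b x - ballAvg b (ball P.1 (n * P.2))|} := by
      rintro x ⟨hxQ, hx⟩
      by_cases hxΩ : x ∈ Ω
      · right
        obtain ⟨P, hP, hxP⟩ := mem_iUnion₂.1 hxΩ
        refine mem_iUnion₂.2 ⟨P, hP, hxP, ?_⟩
        have h1 := hx.trans_le ((ofReal_abs_sub_le (b x) (ballAvg b (ball P.1 (n * P.2))) kQ).trans
          (add_le_add le_rfl (hk P hP)))
        push_cast at h1
        rw [add_mul, one_mul] at h1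
        exact lt_of_add_lt_add_right h1
      · left
        intro hcon
        have h1 := hx.trans_le (hcon hxQ hxΩ)
        refine absurd h1 (not_lt.2 ?_)
        have h2 : h ≤ l := by
          calc h = 1 * h := (one_mul h).symm
            _ ≤ 2 ^ n * h := by gcongr; exact one_le_pow₀ (by norm_num)
            _ ≤ l := le_add_self
        push_cast
        calc h ≤ 1 * l := by rwa [one_mul]
          _ ≤ (k + 1) * l := by gcongr; exact le_add_self
    calc μ {x ∈ cube c s | (k + 1 : ℕ) * l < ENNReal.ofReal |b x - kQ|}
        ≤ μ {x | ¬ (x ∈ cube c s → x ∉ Ω → ENNReal.ofReal |b x - kQ| ≤ h)} +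
          ∑' P : S, μ {x ∈ cube P.1.1 P.1.2 |
            k * l < ENNReal.ofReal |b x - ballAvg b (ball P.1.1 (n * P.1.2))|} := by
          refine (measure_mono hsub).trans ((measure_union_le _ _).trans ?_)
          gcongr
          exact measure_biUnion_le _ hScount _
      _ ≤ 0 + ∑' P : S, β ^ k * μ (cube P.1.1 P.1.2) := by
          gcongr with P
          · exact le_of_eq (hμ.ac hae)
          · exact ih P.1.1 P.1.2 (hS P.1 P.2).1
      _ = β ^ k * μ Ω := by
          rw [zero_add, ENNReal.tsum_mul_left,
            measure_biUnion hScount hSdisj fun P _ => measurableSet_cube _ _]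
      _ ≤ β ^ k * (β * μ (cube c s)) := by
          gcongr
          exact hhalf c s hs Ω hΩs hΩm hΩv
      _ = β ^ (k + 1) * μ (cube c s) := by rw [pow_succ, mul_assoc]

lemma tsum_natCast_rpow_mul_geometric_ne_top {β : ℝ≥0∞} (hβ : β < 1) {v : ℝ} :
    ∑' k : ℕ, ((k : ℝ≥0∞) + 1) ^ v * β ^ k ≠ ⊤ := by
  obtain ⟨N, hN⟩ := exists_nat_ge v
  have hβt : β ≠ ⊤ := hβ.ne_top
  have hβ1 : ‖β.toReal‖ < 1 := by
    rw [Real.norm_eq_abs, abs_of_nonneg ENNReal.toReal_nonneg]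
    exact ENNReal.toReal_lt_of_lt_ofReal (by simpa using hβ)
  have hs : Summable fun k : ℕ => ((k : ℝ) + 1) ^ N * β.toReal ^ k := by
    refine (summable_pow_mul_geometric_of_norm_lt_one N hβ1 |>.mul_left (2 ^ N) |>.add
      (summable_geometric_of_norm_lt_one hβ1)).of_nonneg_of_le (fun k => by positivity) fun k => ?_
    rcases Nat.eq_zero_or_pos k with rfl | hk
    · simp
    · have h1 : ((k : ℝ) + 1) ^ N ≤ (2 * k) ^ N := by
        gcongr
        have : (1 : ℝ) ≤ k := by exact_mod_cast hk
        linarith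
      have h2 : (0 : ℝ) ≤ β.toReal ^ k := by positivity
      calc ((k : ℝ) + 1) ^ N * β.toReal ^ k ≤ (2 * k) ^ N * β.toReal ^ k := by gcongr
        _ = 2 ^ N * ((k : ℝ) ^ N * β.toReal ^ k) := by rw [mul_pow, mul_assoc]
        _ ≤ _ := le_add_of_nonneg_right h2
  refine ne_top_of_le_ne_top hs.tsum_ofReal_ne_top (ENNReal.tsum_le_tsum fun k => ?_)
  rw [ENNReal.ofReal_mul (by positivity), ENNReal.ofReal_pow (by positivity),
    ENNReal.ofReal_pow (by positivity), ENNReal.ofReal_toReal hβt,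
    ENNReal.ofReal_add (by positivity) (by positivity), ENNReal.ofReal_natCast, ENNReal.ofReal_one]
  gcongr
  exact (ENNReal.rpow_le_rpow_of_exponent_le le_add_self hN).trans_eq (ENNReal.rpow_natCast _ _)

lemma rpow_le_tsum_levels {l : ℝ≥0∞} (hl0 : l ≠ 0) (hlt : l ≠ ⊤) {v : ℝ} (hv : 0 < v) {u : ℝ≥0∞}
    (hu : u ≠ ⊤) :
    u ^ v ≤ ∑' k : ℕ, if k * l < u then (((k : ℝ≥0∞) + 1) * l) ^ v else 0 := by
  rcases eq_or_ne u 0 with rfl | hu0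
  · simp [hv]
  have hex : ∃ k : ℕ, u ≤ ((k : ℝ≥0∞) + 1) * l := by
    obtain ⟨k, hk⟩ := ENNReal.exists_nat_gt (ENNReal.div_ne_top hu hl0)
    refine ⟨k, ?_⟩
    rw [ENNReal.div_lt_iff (Or.inl hl0) (Or.inl hlt)] at hk
    exact hk.le.trans (by gcongr; exact le_self_add)
  classical
  have h1 : (Nat.find hex : ℝ≥0∞) * l < u := by
    rcases h : Nat.find hex with _ | j
    · simpa using pos_iff_ne_zero.2 hu0
    · have := Nat.find_min hex (m := j) (by omega)
      push_cast
      exact not_le.1 this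
  refine le_trans ?_ (ENNReal.le_tsum (Nat.find hex))
  rw [if_pos h1]
  exact ENNReal.rpow_le_rpow (Nat.find_spec hex) hv.le

/-- Weighted John–Nirenberg inequality. -/
theorem exists_weighted_jn [NeZero n] {b : Rn n → ℝ} (hb : MemBMO b) (hbm : Measurable b)
    {μ : Measure (Rn n)} (hμ : IsAinfMeas μ) {v : ℝ} (hv : 0 < v) :
    ∃ C : ℝ≥0∞, C ≠ ⊤ ∧ ∀ c r, 0 < r →
      ∫⁻ y in ball c r, ENNReal.ofReal |b y - ballAvg b (ball c r)| ^ v ∂μ ≤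
        C * μ (ball c r) := by
  have hn : (0 : ℝ) < n := by exact_mod_cast Nat.pos_of_ne_zero (NeZero.ne n)
  obtain ⟨l, β, hl0, hlt, hβ, hdec⟩ := exists_level_decay hb hbm hμ
  set A : ℝ≥0∞ := l ^ v * ∑' k : ℕ, ((k : ℝ≥0∞) + 1) ^ v * β ^ k
  have hA : A ≠ ⊤ := ENNReal.mul_ne_top (by finiteness)
    (tsum_natCast_rpow_mul_geometric_ne_top hβ)
  have hcube : ∀ (c : Rn n) (s : ℝ), 0 < s →
      ∫⁻ y in cube c s, ENNReal.ofReal |b y - ballAvg b (ball c (n * s))| ^ v ∂μ ≤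
        A * μ (cube c s) := by
    intro c s hs
    set kQ := ballAvg b (ball c (n * s))
    calc ∫⁻ y in cube c s, ENNReal.ofReal |b y - kQ| ^ v ∂μ
        ≤ ∫⁻ y in cube c s, ∑' k : ℕ, (if k * l < ENNReal.ofReal |b y - kQ| then
          (((k : ℝ≥0∞) + 1) * l) ^ v else 0) ∂μ :=
          lintegral_mono fun y => rpow_le_tsum_levels hl0 hlt hv ENNReal.ofReal_ne_top
      _ = ∑' k : ℕ, ∫⁻ y in cube c s, (if k * l < ENNReal.ofReal |b y - kQ| then
          (((k : ℝ≥0∞) + 1) * l) ^ v else 0) ∂μ := by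
          refine lintegral_tsum fun k => Measurable.aemeasurable ?_
          exact Measurable.ite (measurableSet_lt measurable_const (by fun_prop)) measurable_const
            measurable_const
      _ ≤ ∑' k : ℕ, (((k : ℝ≥0∞) + 1) * l) ^ v * (β ^ k * μ (cube c s)) := by
          refine ENNReal.tsum_le_tsum fun k => ?_
          have hms : MeasurableSet {y | k * l < ENNReal.ofReal |b y - kQ|} :=
            measurableSet_lt measurable_const (by fun_prop)
          have h1 : ∫⁻ y in cube c s, (if k * l < ENNReal.ofReal |b y - kQ| then
              (((k : ℝ≥0∞) + 1) * l) ^ v else 0) ∂μ = (((k : ℝ≥0∞) + 1) * l) ^ v *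
              μ {x ∈ cube c s | k * l < ENNReal.ofReal |b x - kQ|} := by
            calc _ = ∫⁻ y in cube c s, {y | k * l < ENNReal.ofReal |b y - kQ|}.indicator
                  (fun _ => (((k : ℝ≥0∞) + 1) * l) ^ v) y ∂μ := by
                  refine lintegral_congr fun y => ?_
                  simp only [indicator, mem_ofPred_eq]
              _ = _ := by
                  rw [lintegral_indicator_const hms, Measure.restrict_apply hms, inter_comm]
                  rfl
          rw [h1]
          gcongr
          exact hdec k c s hs
      _ = A * μ (cube c s) := by
          simp only [A]
          rw [mul_assoc, ← ENNReal.tsum_mul_right, ← ENNReal.tsum_mul_left]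
          refine tsum_congr fun k => ?_
          rw [ENNReal.mul_rpow_of_nonneg _ _ hv.le]
          ring
  obtain ⟨D, hD, hDle⟩ := hμ.exists_ball_le (a := 2 * n) (by positivity)
  set N : ℝ≥0∞ := bmoNorm b * ENNReal.ofReal (2 * n) ^ n
  have hN : N ≠ ⊤ := ENNReal.mul_ne_top hb.2.ne (by finiteness)
  refine ⟨2 ^ v * (A * D + N ^ v), ?_, fun c r hr => ?_⟩
  · have : N ^ v ≠ ⊤ := ENNReal.rpow_ne_top_of_nonneg hv.le hN
    finiteness
  have hn1 : (1 : ℝ) ≤ n := by exact_mod_cast Nat.pos_of_ne_zero (NeZero.ne n)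
  have hsub1 : ball c r ⊆ cube c (2 * r) := by
    have := ball_subset_cube c (2 * r)
    rwa [mul_div_cancel_left₀ _ two_ne_zero] at this
  have hsub2 : ball c r ⊆ ball c (2 * n * r) := ball_subset_ball (by nlinarith)
  have hk := ofReal_abs_ballAvg_sub_le hb hr (by positivity : (0 : ℝ) < 2 * n) hsub2
  set k := ballAvg b (ball c r)
  set k' := ballAvg b (ball c (2 * n * r)) with hk'
  have hpt : ∀ y, ENNReal.ofReal |b y - k| ^ v ≤
      2 ^ v * (ENNReal.ofReal |b y - k'| ^ v + N ^ v) := by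
    intro y
    have h1 : ENNReal.ofReal |b y - k| ≤ ENNReal.ofReal |b y - k'| + N := by
      refine (ofReal_abs_sub_le (b y) k' k).trans ?_
      rw [abs_sub_comm k' k]
      gcongr
    have h2 : ENNReal.ofReal |b y - k| ≤ 2 * max (ENNReal.ofReal |b y - k'|) N := by
      refine h1.trans ?_
      rw [two_mul]
      exact add_le_add (le_max_left _ _) (le_max_right _ _)
    refine (ENNReal.rpow_le_rpow h2 hv.le).trans ?_
    rw [ENNReal.mul_rpow_of_nonneg _ _ hv.le]
    gcongr
    rcases le_total (ENNReal.ofReal |b y - k'|) N with h | h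
    · rw [max_eq_right h]; exact le_add_self
    · rw [max_eq_left h]; exact le_self_add
  calc ∫⁻ y in ball c r, ENNReal.ofReal |b y - k| ^ v ∂μ
      ≤ ∫⁻ y in ball c r, 2 ^ v * (ENNReal.ofReal |b y - k'| ^ v + N ^ v) ∂μ :=
        lintegral_mono hpt
    _ = 2 ^ v * ((∫⁻ y in ball c r, ENNReal.ofReal |b y - k'| ^ v ∂μ) + N ^ v * μ (ball c r)) := by
        rw [lintegral_const_mul' _ _ (by finiteness), lintegral_add_right _ measurable_const,
          setLIntegral_const]
    _ ≤ 2 ^ v * (A * (D * μ (ball c r)) + N ^ v * μ (ball c r)) := by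
        gcongr
        refine (lintegral_mono_set hsub1).trans ?_
        have h1 := hcube c (2 * r) (by positivity)
        rw [show (n : ℝ) * (2 * r) = 2 * n * r by ring] at h1
        refine h1.trans ?_
        gcongr
        refine (measure_mono ((cube_subset_ball c (by positivity : 0 < 2 * r)).trans_eq ?_)).trans
          (hDle c c r hr hsub2)
        rw [show (n : ℝ) * (2 * r) = 2 * n * r by ring]
    _ = _ := by ring

end JohnNirenberg

section SqNorm

/-- The `L²(dt/t)` norm of a function on `(0,∞)`. -/
def sqNorm (u : ℝ → ℝ≥0∞) : ℝ≥0∞ :=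
  (∫⁻ t in Ioi (0 : ℝ), u t ^ (2 : ℝ) * (ENNReal.ofReal t)⁻¹) ^ (1 / 2 : ℝ)

lemma sqNorm_mono {u v : ℝ → ℝ≥0∞} (h : ∀ t, 0 < t → u t ≤ v t) : sqNorm u ≤ sqNorm v := by
  refine ENNReal.rpow_le_rpow (setLIntegral_mono' measurableSet_Ioi fun t ht => ?_) (by norm_num)
  gcongr
  exact h t ht

lemma sqNorm_congr {u v : ℝ → ℝ≥0∞} (h : ∀ t, 0 < t → u t = v t) : sqNorm u = sqNorm v :=
  le_antisymm (sqNorm_mono fun t ht => (h t ht).le) (sqNorm_mono fun t ht => (h t ht).ge)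

lemma sqNorm_zero : sqNorm (fun _ => 0) = 0 := by simp [sqNorm]

lemma sqNorm_const_mul {c : ℝ≥0∞} (hc : c ≠ ⊤) (u : ℝ → ℝ≥0∞) :
    sqNorm (fun t => c * u t) = c * sqNorm u := by
  unfold sqNorm
  simp only [ENNReal.mul_rpow_of_nonneg _ _ (zero_le_two (α := ℝ)), mul_assoc]
  rw [lintegral_const_mul' _ _ (ENNReal.rpow_ne_top_of_nonneg zero_le_two hc),
    ENNReal.mul_rpow_of_nonneg _ _ (by norm_num), ← ENNReal.rpow_mul]
  norm_num

lemma sqNorm_add_le {u v : ℝ → ℝ≥0∞} (hu : Measurable u) (hv : Measurable v) :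
    sqNorm (fun t => u t + v t) ≤ sqNorm u + sqNorm v := by
  have key : ∀ w : ℝ → ℝ≥0∞, sqNorm w = (∫⁻ t, w t ^ (2 : ℝ)
      ∂(volume.restrict (Ioi (0 : ℝ))).withDensity fun t => (ENNReal.ofReal t)⁻¹) ^ (1 / 2 : ℝ) := by
    intro w
    rw [lintegral_withDensity_eq_lintegral_mul_non_measurable _ (by fun_prop)]
    · simp only [Pi.mul_apply, sqNorm, mul_comm]
    · refine (ae_restrict_mem measurableSet_Ioi).mono fun t ht => ?_
      simpa using ht
  simp only [key]
  exact ENNReal.lintegral_Lp_add_le hu.aemeasurable hv.aemeasurable one_le_two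

lemma sqNorm_finset_sum_le {ι : Type*} (s : Finset ι) {u : ι → ℝ → ℝ≥0∞}
    (hu : ∀ k, Measurable (u k)) :
    sqNorm (fun t => ∑ k ∈ s, u k t) ≤ ∑ k ∈ s, sqNorm (u k) := by
  classical
  induction s using Finset.induction_on with
  | empty => simp [sqNorm_zero]
  | insert k s hk ih =>
    simp only [Finset.sum_insert hk]
    exact (sqNorm_add_le (hu k) (Finset.measurable_fun_sum _ fun i _ => hu i)).trans
      (by gcongr)

lemma sqNorm_tsum_le {ι : Type*} [Countable ι] {u : ι → ℝ → ℝ≥0∞} (hu : ∀ k, Measurable (u k)) :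
    sqNorm (fun t => ∑' k, u k t) ≤ ∑' k, sqNorm (u k) := by
  have hfin : ∀ s : Finset ι, sqNorm (fun t => ∑ k ∈ s, u k t) ≤ ∑' k, sqNorm (u k) := fun s =>
    (sqNorm_finset_sum_le s hu).trans (ENNReal.sum_le_tsum s)
  have hmono : ∀ t : ℝ, Monotone fun s : Finset ι => ∑ k ∈ s, u k t := fun t s s' h =>
    Finset.sum_le_sum_of_subset h
  have h2 : ∀ t : ℝ, (∑' k, u k t) ^ (2 : ℝ) * (ENNReal.ofReal t)⁻¹ =
      ⨆ s : Finset ι, (∑ k ∈ s, u k t) ^ (2 : ℝ) * (ENNReal.ofReal t)⁻¹ := by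
    intro t
    rw [ENNReal.tsum_eq_iSup_sum, ← ENNReal.iSup_mul]
    congr 1
    exact (ENNReal.orderIsoRpow 2 zero_lt_two).map_iSup _
  unfold sqNorm
  simp only [h2]
  rw [lintegral_iSup_directed]
  · rw [← ENNReal.orderIsoRpow_apply (1 / 2) (by norm_num), OrderIso.map_iSup]
    exact iSup_le hfin
  · exact fun s => (((Finset.measurable_fun_sum _ fun i _ => hu i).pow_const _).mul
      (by fun_prop)).aemeasurable
  · refine Monotone.directed_le fun s s' h t => ?_
    have := hmono t h
    dsimp only at this ⊢
    gcongr

lemma sqNorm_scale_le {a δ : ℝ} (ha : 0 < a) (hδ : 0 < δ) :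
    ∃ C : ℝ≥0∞, C ≠ ⊤ ∧ ∀ R : ℝ, 0 < R →
      sqNorm (fun t => ENNReal.ofReal (t ^ δ * (t + R) ^ (-(a + δ)))) ≤
        C * ENNReal.ofReal (R ^ (-a)) := by
  refine ⟨ENNReal.ofReal (1 / (2 * δ) + 1 / (2 * a)) ^ (1 / 2 : ℝ),
    ENNReal.rpow_ne_top_of_nonneg (by norm_num) ENNReal.ofReal_ne_top, fun R hR => ?_⟩
  have hR2 : ENNReal.ofReal (R ^ (-a)) = ENNReal.ofReal (R ^ (-(2 * a))) ^ (1 / 2 : ℝ) := by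
    rw [ENNReal.ofReal_rpow_of_nonneg (by positivity) (by norm_num), ← Real.rpow_mul hR.le]
    congr 2
    ring
  rw [hR2, ← ENNReal.mul_rpow_of_nonneg _ _ (by norm_num), ← ENNReal.ofReal_mul (by positivity)]
  refine ENNReal.rpow_le_rpow ?_ (by norm_num)
  have hsq : ∀ t : ℝ, 0 < t →
      ENNReal.ofReal (t ^ δ * (t + R) ^ (-(a + δ))) ^ (2 : ℝ) * (ENNReal.ofReal t)⁻¹ =
        ENNReal.ofReal (t ^ (2 * δ - 1) * (t + R) ^ (-(2 * a + 2 * δ))) := by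
    intro t ht
    rw [ENNReal.ofReal_rpow_of_nonneg (by positivity) (by norm_num),
      ← ENNReal.ofReal_inv_of_pos ht, ← ENNReal.ofReal_mul (by positivity)]
    congr 1
    rw [Real.mul_rpow (by positivity) (by positivity), ← Real.rpow_mul ht.le,
      ← Real.rpow_mul (by positivity), Real.rpow_sub_one ht.ne']
    rw [show -(a + δ) * 2 = -(2 * a + 2 * δ) by ring, mul_comm δ 2]
    field_simp
  have hsplit : Ioi (0 : ℝ) ⊆ Ioo 0 R ∪ Ici R := by
    intro t ht
    rcases lt_or_ge t R with h | h
    exacts [Or.inl ⟨ht, h⟩, Or.inr h]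
  calc ∫⁻ t in Ioi (0 : ℝ), ENNReal.ofReal (t ^ δ * (t + R) ^ (-(a + δ))) ^ (2 : ℝ) *
        (ENNReal.ofReal t)⁻¹
      = ∫⁻ t in Ioi (0 : ℝ), ENNReal.ofReal (t ^ (2 * δ - 1) * (t + R) ^ (-(2 * a + 2 * δ))) :=
        setLIntegral_congr_fun measurableSet_Ioi hsq
    _ ≤ ∫⁻ t in Ioo 0 R ∪ Ici R, ENNReal.ofReal (t ^ (2 * δ - 1) * (t + R) ^ (-(2 * a + 2 * δ))) :=
        lintegral_mono_set hsplit
    _ ≤ (∫⁻ t in Ioo 0 R, ENNReal.ofReal (t ^ (2 * δ - 1) * (t + R) ^ (-(2 * a + 2 * δ)))) +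
        ∫⁻ t in Ici R, ENNReal.ofReal (t ^ (2 * δ - 1) * (t + R) ^ (-(2 * a + 2 * δ))) :=
        lintegral_union_le _ _ _
    _ ≤ (∫⁻ t in Ioo 0 R, ENNReal.ofReal (R ^ (-(2 * a + 2 * δ))) * ENNReal.ofReal (t ^ (2 * δ - 1))) +
        ∫⁻ t in Ici R, ENNReal.ofReal (t ^ (-(2 * a) - 1)) := by
        refine add_le_add (setLIntegral_mono' measurableSet_Ioo fun t ht => ?_)
          (setLIntegral_mono' measurableSet_Ici fun t ht => ?_)
        · have ht0 : 0 < t := ht.1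
          rw [← ENNReal.ofReal_mul (by positivity), mul_comm]
          refine ENNReal.ofReal_le_ofReal (mul_le_mul_of_nonneg_right ?_ (by positivity))
          exact Real.rpow_le_rpow_of_nonpos hR (by linarith) (by linarith)
        · have ht0 : 0 < t := hR.trans_le ht
          refine ENNReal.ofReal_le_ofReal ?_
          rw [show -(2 * a) - 1 = (2 * δ - 1) + -(2 * a + 2 * δ) by ring, Real.rpow_add ht0]
          refine mul_le_mul_of_nonneg_left ?_ (by positivity)
          exact Real.rpow_le_rpow_of_nonpos ht0 (by linarith) (by linarith)
    _ = ENNReal.ofReal (R ^ (-(2 * a + 2 * δ))) * ENNReal.ofReal (R ^ (2 * δ) / (2 * δ)) +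
        ENNReal.ofReal (R ^ (-(2 * a)) / (2 * a)) := by
        rw [lintegral_const_mul' _ _ ENNReal.ofReal_ne_top, lintegral_Ioo_rpow (by linarith) hR.le,
          setLIntegral_congr Ioi_ae_eq_Ici.symm, ← ofReal_integral_eq_lintegral_ofReal,
          integral_Ioi_rpow_of_lt (by linarith) hR]
        · rw [show -(2 * a) - 1 + 1 = -(2 * a) by ring, neg_div_neg_eq, sub_add_cancel]
        · exact integrableOn_Ioi_rpow_of_lt (by linarith) hR
        · refine (ae_restrict_mem measurableSet_Ioi).mono fun t ht => ?_
          have : 0 < t := hR.trans ht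
          positivity
    _ ≤ _ := by
        rw [← ENNReal.ofReal_mul (by positivity), ← ENNReal.ofReal_add (by positivity)
          (by positivity)]
        refine ENNReal.ofReal_le_ofReal (le_of_eq ?_)
        have : R ^ (-(2 * a + 2 * δ)) * R ^ (2 * δ) = R ^ (-(2 * a)) := by
          rw [← Real.rpow_add hR]
          congr 1
          ring
        rw [← mul_div_assoc, this]
        ring

end SqNorm

section DyadicKernel

lemma lintegral_pi_prod_eq : ∀ {k : ℕ} {G : Fin k → Rn n → ℝ≥0∞}, (∀ i, Measurable (G i)) →
    ∫⁻ y : Fin k → Rn n, ∏ i, G i (y i) = ∏ i, ∫⁻ y, G i y := by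
  intro k
  induction k with
  | zero =>
    intro G _
    simp [lintegral_unique, volume_pi, Measure.pi_of_empty]
  | succ k ih =>
    intro G hG
    have hmp := (volume_preserving_piFinSuccAbove (fun _ : Fin (k + 1) => Rn n) 0).symm
    rw [← hmp.lintegral_comp (by fun_prop)]
    simp only [MeasurableEquiv.piFinSuccAbove_symm_apply, Fin.insertNthEquiv_zero,
      Fin.consEquiv_apply, Fin.prod_univ_succ, Fin.cons_zero, Fin.cons_succ]
    rw [← ih fun i => hG i.succ]
    exact lintegral_prod_mul (μ := volume) (ν := volume) (g := fun y : Fin k → Rn n => ∏ i, G i.succ (y i))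
      (hG 0).aemeasurable (Finset.measurable_fun_prod _ fun i _ =>
        (hG i.succ).comp (measurable_pi_apply i)).aemeasurable

lemma setLIntegral_pi_prod_eq {G : Fin m → Rn n → ℝ≥0∞} (hG : ∀ i, Measurable (G i))
    {B : Fin m → Set (Rn n)} (hB : ∀ i, MeasurableSet (B i)) :
    ∫⁻ y in univ.pi B, ∏ i, G i (y i) = ∏ i, ∫⁻ y in B i, G i y := by
  rw [← lintegral_indicator (MeasurableSet.univ_pi hB)]
  simp only [← lintegral_indicator (hB _)]
  rw [← lintegral_pi_prod_eq fun i => (hG i).indicator (hB i)]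
  refine lintegral_congr fun y => ?_
  by_cases hy : y ∈ univ.pi B
  · rw [indicator_of_mem hy]
    exact Finset.prod_congr rfl fun i _ => (indicator_of_mem (hy i (mem_univ i)) _).symm
  · rw [indicator_of_notMem hy]
    simp only [Set.mem_univ_pi, not_forall] at hy
    obtain ⟨i, hi⟩ := hy
    exact (Finset.prod_eq_zero (Finset.mem_univ i) (indicator_of_notMem hi _)).symm

lemma lintegral_antitone_mul_prod_le {G : Fin m → Rn n → ℝ≥0∞} (hG : ∀ i, Measurable (G i))
    {Φ : ℝ → ℝ≥0∞} {R : ℝ} (hR : 0 < R) (hΦ : AntitoneOn Φ (Ici R)) (x : Rn n) :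
    ∫⁻ y : Fin m → Rn n, Φ (R + ∑ j, dist x (y j)) * ∏ i, G i (y i) ≤
      ∑' k : ℕ, Φ (2 ^ k * R) * ∏ i, ∫⁻ y in ball x (2 ^ (k + 1) * R), G i y := by
  have hterm : ∀ k : ℕ, Φ (2 ^ k * R) * ∏ i, ∫⁻ y in ball x (2 ^ (k + 1) * R), G i y =
      ∫⁻ y, Φ (2 ^ k * R) * (univ.pi fun _ : Fin m => ball x (2 ^ (k + 1) * R)).indicator
        (fun y => ∏ i, G i (y i)) y := by
    intro k
    have hm : MeasurableSet (univ.pi fun _ : Fin m => ball x (2 ^ (k + 1) * R)) :=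
      MeasurableSet.univ_pi fun _ => measurableSet_ball
    rw [lintegral_const_mul _ (Measurable.indicator (by fun_prop) hm), lintegral_indicator hm,
      setLIntegral_pi_prod_eq hG fun _ => measurableSet_ball]
  simp only [hterm]
  rw [← lintegral_tsum fun k => (Measurable.const_mul (Measurable.indicator (by fun_prop)
    (MeasurableSet.univ_pi fun _ => measurableSet_ball)) _).aemeasurable]
  refine lintegral_mono fun y => ?_
  have hS : 0 ≤ ∑ j, dist x (y j) := Finset.sum_nonneg fun _ _ => dist_nonneg
  obtain ⟨k, hk1, hk2⟩ := exists_nat_pow_near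
    (show 1 ≤ (R + ∑ j, dist x (y j)) / R by rw [le_div_iff₀ hR]; linarith) one_lt_two
  rw [le_div_iff₀ hR] at hk1
  rw [div_lt_iff₀ hR] at hk2
  refine le_trans ?_ (ENNReal.le_tsum k)
  have hy : y ∈ univ.pi fun _ : Fin m => ball x (2 ^ (k + 1) * R) := by
    intro j _
    have := Finset.single_le_sum (f := fun j => dist x (y j)) (fun _ _ => dist_nonneg)
      (Finset.mem_univ j)
    rw [mem_ball']
    linarith
  rw [indicator_of_mem hy]
  gcongr
  refine hΦ ?_ ?_ hk1
  · have : (1 : ℝ) ≤ 2 ^ k := one_le_pow₀ one_le_two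
    exact le_mul_of_one_le_left hR.le this
  · exact le_add_of_nonneg_right hS

/-- If each `G i` has averages of size `a i` on balls about `x` of radius at least `R`, then so
does the product integrated against a kernel of homogeneity `-(m n + e)`. -/
lemma exists_lintegral_kernel_prod_le (n m : ℕ) {e : ℝ} (he : 0 < e) :
    ∃ C : ℝ≥0∞, C ≠ ⊤ ∧ ∀ (G : Fin m → Rn n → ℝ≥0∞), (∀ i, Measurable (G i)) →
      ∀ (a : Fin m → ℝ≥0∞) (x : Rn n) (R : ℝ), 0 < R →
      (∀ i, ∀ r, R ≤ r → ∫⁻ y in ball x r, G i y ≤ a i * ENNReal.ofReal r ^ n) →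
      ∫⁻ y : Fin m → Rn n, ENNReal.ofReal ((R + ∑ j, dist x (y j)) ^ (-(m * n + e))) *
        ∏ i, G i (y i) ≤ C * ENNReal.ofReal (R ^ (-e)) * ∏ i, a i := by
  have hsum : Summable fun k : ℕ => (2 : ℝ) ^ (m * n : ℝ) * ((2 : ℝ) ^ (-e)) ^ k := by
    refine (summable_geometric_of_lt_one (by positivity) ?_).mul_left _
    exact Real.rpow_lt_one_of_one_lt_of_neg one_lt_two (by linarith)
  refine ⟨∑' k : ℕ, ENNReal.ofReal ((2 : ℝ) ^ (m * n : ℝ) * ((2 : ℝ) ^ (-e)) ^ k),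
    hsum.tsum_ofReal_ne_top, fun G hG a x R hR h => ?_⟩
  have hanti : AntitoneOn (fun S : ℝ => ENNReal.ofReal (S ^ (-(m * n + e)))) (Ici R) := by
    intro S hS S' hS' hSS
    refine ENNReal.ofReal_le_ofReal (Real.rpow_le_rpow_of_nonpos (hR.trans_le hS) hSS ?_)
    have : (0 : ℝ) ≤ m * n := by positivity
    linarith
  refine (lintegral_antitone_mul_prod_le hG hR hanti x).trans ?_
  rw [mul_assoc, ← ENNReal.tsum_mul_right]
  refine ENNReal.tsum_le_tsum fun k => ?_
  have hk : R ≤ 2 ^ (k + 1) * R := le_mul_of_one_le_left hR.le (one_le_pow₀ one_le_two)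
  calc ENNReal.ofReal ((2 ^ k * R) ^ (-(m * n + e))) * ∏ i, ∫⁻ y in ball x (2 ^ (k + 1) * R), G i y
      ≤ ENNReal.ofReal ((2 ^ k * R) ^ (-(m * n + e))) *
        ∏ i, (a i * ENNReal.ofReal (2 ^ (k + 1) * R) ^ n) := by
        gcongr with i
        exact h i _ hk
    _ = ENNReal.ofReal ((2 ^ k * R) ^ (-(m * n + e))) *
        ENNReal.ofReal ((2 ^ (k + 1) * R) ^ (m * n : ℝ)) * ∏ i, a i := by
        rw [Finset.prod_mul_distrib, Finset.prod_const, Finset.card_univ, Fintype.card_fin, mul_assoc,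
          mul_comm (∏ i, a i), ← pow_mul, ← ENNReal.ofReal_pow (by positivity), mul_comm n m,
          ← Real.rpow_natCast (2 ^ (k + 1) * R)]
        push_cast
        rfl
    _ = _ := by
        rw [← ENNReal.ofReal_mul (by positivity), ← mul_assoc, ← ENNReal.ofReal_mul (by positivity)]
        congr 2
        rw [pow_succ, show (2 : ℝ) ^ k * 2 * R = (2 ^ k * R) * 2 by ring,
          Real.mul_rpow (by positivity) zero_le_two, ← mul_assoc, ← Real.rpow_add (by positivity),
          show -((m : ℝ) * n + e) + m * n = -e by ring, Real.mul_rpow (by positivity) hR.le,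
          ← Real.rpow_natCast, ← Real.rpow_natCast, ← Real.rpow_mul zero_le_two,
          ← Real.rpow_mul zero_le_two, mul_comm (k : ℝ)]
        ring

end DyadicKernel

section Kernel

/-- A measurable version of a multilinear Littlewood–Paley kernel of convolution type. -/
structure LPKernel (k : (Fin m → Rn n) → ℝ) (A γ δ B : ℝ) : Prop where
  measurable : Measurable k
  A_pos : 0 < A
  γ_pos : 0 < γ
  δ_pos : 0 < δ
  two_le : 2 ≤ B
  size : ∀ z, |k z| ≤ A * (1 + ∑ j, ‖z j‖) ^ (-(m * n : ℝ) - δ)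
  reg_one : ∀ (z : Fin m → Rn n) i w, ‖z i - w‖ ≤ ‖z i‖ / B →
    |k z - k (Function.update z i w)| ≤
      A * ‖z i - w‖ ^ γ * (1 + ∑ j, ‖z j‖) ^ (-(m * n : ℝ) - δ - γ)
  reg_all : ∀ (z : Fin m → Rn n) w, (∀ j, z j ≠ 0) → (∀ j, z j + w ≠ 0) →
    (∃ j, ‖w‖ ≤ ‖z j‖ / B) →
    |k z - k (fun j => z j + w)| ≤
      A * ‖w‖ ^ γ * (1 + ∑ j, ‖z j‖) ^ (-(m * n : ℝ) - δ - γ)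

/-- The dilated kernel `t^{-mn} k((x - y₁)/t, …, (x - y_m)/t)`. -/
def kt (k : (Fin m → Rn n) → ℝ) (t : ℝ) (x : Rn n) (y : Fin m → Rn n) : ℝ :=
  t ^ (-(m * n : ℝ)) * k (fun i => t⁻¹ • (x - y i))

/-- The square function of the kernel `k` with the integration restricted to `S`. -/
def gOn (k : (Fin m → Rn n) → ℝ) (S : Set (Fin m → Rn n)) (F : Fin m → Rn n → ℝ) (x : Rn n) :
    ℝ≥0∞ :=
  sqNorm fun t => ENNReal.ofReal |∫ y in S, kt k t x y * ∏ i, F i (y i)|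

lemma abs_sub_piecewise_le {Kc : (Fin m → Rn n) → ℝ} {A γ B e : ℝ} (hA : 0 < A) (he : 0 ≤ e)
    (hreg : ∀ (z : Fin m → Rn n) i w, ‖z i - w‖ ≤ ‖z i‖ / B →
      |Kc z - Kc (Function.update z i w)| ≤ A * ‖z i - w‖ ^ γ * (1 + ∑ j, ‖z j‖) ^ (-e))
    {z w : Fin m → Rn n} (hzw : ∀ i, ‖z i - w i‖ ≤ ‖z i‖ / B) (s : Finset (Fin m)) :
    |Kc z - Kc (s.piecewise w z)| ≤ ∑ i ∈ s, A * ‖z i - w i‖ ^ γ := by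
  induction s using Finset.induction_on with
  | empty => simp
  | insert i s hi ih =>
    rw [Finset.sum_insert hi, Finset.piecewise_insert, add_comm]
    refine (abs_sub_le _ (Kc (s.piecewise w z)) _).trans (add_le_add ih ?_)
    have hzi : s.piecewise w z i = z i := Finset.piecewise_eq_of_notMem _ _ _ hi
    refine (hreg _ i (w i) (by rw [hzi]; exact hzw i)).trans ?_
    rw [hzi]
    refine mul_le_of_le_one_right (by positivity) ?_
    refine Real.rpow_le_one_of_one_le_of_nonpos ?_ (by linarith)
    have : 0 ≤ ∑ j, ‖s.piecewise w z j‖ := Finset.sum_nonneg fun _ _ => norm_nonneg _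
    linarith

lemma continuousOn_of_reg {Kc : (Fin m → Rn n) → ℝ} {A γ B e : ℝ} (hA : 0 < A) (hγ : 0 < γ)
    (hB : 0 < B) (he : 0 ≤ e)
    (hreg : ∀ (z : Fin m → Rn n) i w, ‖z i - w‖ ≤ ‖z i‖ / B →
      |Kc z - Kc (Function.update z i w)| ≤ A * ‖z i - w‖ ^ γ * (1 + ∑ j, ‖z j‖) ^ (-e)) :
    ContinuousOn Kc {z | ∀ j, z j ≠ 0} := by
  intro z hz
  refine ContinuousAt.continuousWithinAt ?_
  rw [ContinuousAt, tendsto_iff_dist_tendsto_zero]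
  have hlim : Tendsto (fun w : Fin m → Rn n => ∑ i, A * ‖z i - w i‖ ^ γ) (𝓝 z) (𝓝 0) := by
    have : Continuous fun w : Fin m → Rn n => ∑ i, A * ‖z i - w i‖ ^ γ :=
      continuous_finsetSum _ fun i _ => continuous_const.mul
        (Continuous.rpow_const (by fun_prop) fun _ => Or.inr hγ.le)
    simpa [Real.zero_rpow hγ.ne'] using this.tendsto z
  have hnear : ∀ᶠ w in 𝓝 z, ∀ i, ‖z i - w i‖ ≤ ‖z i‖ / B := by
    rw [eventually_all]
    intro i
    have h1 : Tendsto (fun w : Fin m → Rn n => ‖z i - w i‖) (𝓝 z) (𝓝 0) := by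
      have : Continuous fun w : Fin m → Rn n => ‖z i - w i‖ := by fun_prop
      simpa using this.tendsto z
    exact (h1.eventually (gt_mem_nhds (div_pos (norm_pos_iff.2 (hz i)) hB))).mono fun w hw => hw.le
  refine squeeze_zero' (Eventually.of_forall fun _ => dist_nonneg) ?_ hlim
  filter_upwards [hnear] with w hw
  have := abs_sub_piecewise_le hA he hreg hw Finset.univ
  rwa [Finset.piecewise_univ, abs_sub_comm] at this

lemma IsMLPKernel.exists_lpKernel [NeZero n] {Kc : (Fin m → Rn n) → ℝ}
    (hker : IsMLPKernel fun (x : Rn n) (y : Fin m → Rn n) => Kc fun i => x - y i) :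
    ∃ k A γ δ B, LPKernel (n := n) (m := m) k A γ δ B ∧ ∀ f x,
      sqFn (fun (x : Rn n) (y : Fin m → Rn n) => Kc fun i => x - y i) f x = gOn k univ f x := by
  obtain ⟨A, γ, δ, B₁, hA, hγ, hδ, hB, hsize, hreg, hregx⟩ := hker
  have hmn : (0 : ℝ) ≤ m * n := by positivity
  have hsize' : ∀ z, |Kc z| ≤ A * (1 + ∑ j, ‖z j‖) ^ (-(m * n : ℝ) - δ) := fun z => by
    simpa using hsize 0 fun j => -z j
  have hreg' : ∀ (z : Fin m → Rn n) i w, ‖z i - w‖ ≤ ‖z i‖ / B₁ →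
      |Kc z - Kc (Function.update z i w)| ≤
        A * ‖z i - w‖ ^ γ * (1 + ∑ j, ‖z j‖) ^ (-(m * n : ℝ) - δ - γ) := by
    intro z i w h
    have hd : dist (-z i) (-w) = ‖z i - w‖ := by rw [dist_neg_neg, dist_eq_norm]
    have := hreg 0 (fun j => -z j) i (-w) (by rw [hd]; simpa using h)
    rw [hd] at this
    have hu : (fun j => 0 - Function.update (fun j => -z j) i (-w) j) = Function.update z i w := by
      funext j
      rcases eq_or_ne j i with rfl | hj <;> simp [*]
    simp only [hu] at this
    simpa using this
  have hU : MeasurableSet {z : Fin m → Rn n | ∀ j, z j ≠ 0} := by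
    have : {z : Fin m → Rn n | ∀ j, z j ≠ 0} = ⋂ j, {z | z j ≠ 0} := by ext; simp
    rw [this]
    exact MeasurableSet.iInter fun j => (measurableSet_eq_fun (by fun_prop) (by fun_prop)).compl
  set k : (Fin m → Rn n) → ℝ := {z | ∀ j, z j ≠ 0}.indicator Kc with hk
  have hkz : ∀ z, (∀ j, z j ≠ 0) → k z = Kc z := fun z hz =>
    indicator_of_mem (mem_ofPred_eq ▸ hz) _
  have hkz0 : ∀ z, (¬ ∀ j, z j ≠ 0) → k z = 0 := fun z hz =>
    indicator_of_notMem (mem_ofPred_eq ▸ hz) _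
  have hBB : ∀ d : ℝ, 0 ≤ d → d / max B₁ 2 ≤ d / B₁ := fun d hd =>
    div_le_div_of_nonneg_left hd hB (le_max_left _ _)
  refine ⟨k, A, γ, δ, max B₁ 2, ⟨?_, hA, hγ, hδ, le_max_right _ _, ?_, ?_, ?_⟩, ?_⟩
  · have hc : ContinuousOn Kc {z | ∀ j, z j ≠ 0} := continuousOn_of_reg (e := m * n + δ + γ)
      hA hγ hB (by positivity) fun z i w h => by
        rw [show -((m : ℝ) * n + δ + γ) = -(m * n : ℝ) - δ - γ by ring]
        exact hreg' z i w h
    have := (hc.measurable_piecewise (g := 0) continuousOn_const hU)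
    rwa [piecewise_eq_indicator] at this
  · intro z
    by_cases hz : ∀ j, z j ≠ 0
    · rw [hkz z hz]
      exact hsize' z
    · rw [hkz0 z hz, abs_zero]
      positivity
  · intro z i w h
    have h' := h.trans (hBB _ (norm_nonneg _))
    by_cases hz : ∀ j, z j ≠ 0
    · have hw : ∀ j, Function.update z i w j ≠ 0 := by
        intro j
        rcases eq_or_ne j i with rfl | hj
        · rw [Function.update_self]
          rintro rfl
          rw [sub_zero, le_div_iff₀ (by positivity)] at h
          have h1 := norm_pos_iff.2 (hz j)
          have h2 : (2 : ℝ) ≤ max B₁ 2 := le_max_right _ _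
          nlinarith
        · rw [Function.update_of_ne hj]
          exact hz j
      rw [hkz z hz, hkz _ hw]
      exact hreg' z i w h'
    · have hR : 0 ≤ A * ‖z i - w‖ ^ γ * (1 + ∑ j, ‖z j‖) ^ (-(m * n : ℝ) - δ - γ) := by positivity
      by_cases hw : ∀ j, Function.update z i w j ≠ 0
      · have hzi : z i = 0 := by
          by_contra hzi
          refine hz fun j => ?_
          rcases eq_or_ne j i with rfl | hj
          · exact hzi
          · simpa [Function.update_of_ne hj] using hw j
        have : w = 0 := by simpa [hzi] using h'
        exact absurd this (by simpa using hw i)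
      · rw [hkz0 z hz, hkz0 _ hw, sub_zero, abs_zero]
        exact hR
  · rintro z w hz hzw ⟨j, hj⟩
    rw [hkz z hz, hkz _ hzw]
    have hle : ‖z j‖ ≤ ⨆ j, dist (0 : Rn n) (-z j) := by
      have := le_ciSup (f := fun j => dist (0 : Rn n) (-z j)) (Finite.bddAbove_range _) j
      simpa using this
    have := hregx 0 w (fun j => -z j) (by
      rw [dist_zero_left]
      refine (hj.trans (hBB _ (norm_nonneg _))).trans ?_
      gcongr)
    simpa [add_comm] using this
  · intro f x
    unfold sqFn gOn
    refine sqNorm_congr fun t ht => ?_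
    congr 2
    rw [Measure.restrict_univ]
    refine integral_congr_ae ?_
    have hne : ∀ᵐ y : Fin m → Rn n, ∀ j, y j ≠ x := by
      rw [ae_all_iff]
      exact fun j => Measure.ae_eval_ne (α := fun _ => Rn n) (fun _ => volume) j x
    filter_upwards [hne] with y hy
    simp only [Kt, kt]
    rw [hkz]
    · simp only [smul_sub]
    · intro j
      exact smul_ne_zero (inv_ne_zero ht.ne') (sub_ne_zero.2 (hy j).symm)

lemma scale_rpow {t S : ℝ} (ht : 0 < t) (hS : 0 ≤ S) (q e : ℝ) :
    t ^ (-q) * (1 + S / t) ^ (-q - e) = t ^ e * (t + S) ^ (-(q + e)) := by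
  rw [show 1 + S / t = (t + S) / t by field_simp, Real.div_rpow (by positivity) ht.le,
    show -q - e = -(q + e) by ring, mul_div_assoc', mul_comm (t ^ (-q)), mul_div_assoc,
    ← Real.rpow_sub ht, mul_comm]
  congr 2
  ring

variable {k : (Fin m → Rn n) → ℝ} {A γ δ B : ℝ}

lemma sum_norm_smul_sub {t : ℝ} (ht : 0 < t) (x : Rn n) (y : Fin m → Rn n) :
    ∑ j, ‖t⁻¹ • (x - y j)‖ = (∑ j, dist x (y j)) / t := by
  simp only [norm_smul, norm_inv, Real.norm_of_nonneg ht.le, dist_eq_norm, Finset.sum_div]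
  exact Finset.sum_congr rfl fun j _ => by rw [div_eq_inv_mul]

lemma LPKernel.abs_kt_le (hk : LPKernel k A γ δ B) {t : ℝ} (ht : 0 < t) (x : Rn n)
    (y : Fin m → Rn n) :
    |kt k t x y| ≤ A * (t ^ δ * (t + ∑ j, dist x (y j)) ^ (-(m * n + δ))) := by
  have h := hk.size fun i => t⁻¹ • (x - y i)
  rw [sum_norm_smul_sub ht] at h
  have hS : 0 ≤ ∑ j, dist x (y j) := Finset.sum_nonneg fun _ _ => dist_nonneg
  rw [← scale_rpow ht hS, kt, abs_mul, abs_of_pos (by positivity)]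
  calc _ ≤ t ^ (-(m * n : ℝ)) * (A * (1 + (∑ j, dist x (y j)) / t) ^ (-(m * n : ℝ) - δ)) := by gcongr
    _ = _ := by ring

lemma scale_reg_bound {t S d : ℝ} (ht : 0 < t) (hS : 0 ≤ S) (hd : 0 ≤ d) (q : ℝ) :
    t ^ (-q) * (A * (t⁻¹ * d) ^ γ * (1 + S / t) ^ (-q - δ - γ)) =
      A * d ^ γ * (t ^ δ * (t + S) ^ (-(q + (γ + δ)))) := by
  have h := scale_rpow ht hS (q + γ) δ
  rw [show -(q + γ) - δ = -q - δ - γ by ring, show q + γ + δ = q + (γ + δ) by ring] at h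
  rw [← h, Real.mul_rpow (by positivity) hd, Real.inv_rpow ht.le, ← Real.rpow_neg ht.le,
    show -(q + γ) = -q + -γ by ring, Real.rpow_add ht]
  ring

lemma LPKernel.abs_kt_sub_update_le (hk : LPKernel k A γ δ B) {t : ℝ} (ht : 0 < t) {x : Rn n}
    {y : Fin m → Rn n} {i : Fin m} {w : Rn n} (h : dist (y i) w ≤ dist x (y i) / B) :
    |kt k t x y - kt k t x (Function.update y i w)| ≤
      A * dist (y i) w ^ γ * (t ^ δ * (t + ∑ j, dist x (y j)) ^ (-(m * n + (γ + δ)))) := by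
  have hS : 0 ≤ ∑ j, dist x (y j) := Finset.sum_nonneg fun _ _ => dist_nonneg
  have hd : ‖t⁻¹ • (x - y i) - t⁻¹ • (x - w)‖ = t⁻¹ * dist (y i) w := by
    rw [← smul_sub, norm_smul, norm_inv, Real.norm_of_nonneg ht.le, dist_comm, dist_eq_norm]
    congr 2
    abel
  have hr := hk.reg_one (fun j => t⁻¹ • (x - y j)) i (t⁻¹ • (x - w)) (by
    rw [hd, norm_smul, norm_inv, Real.norm_of_nonneg ht.le, ← dist_eq_norm, mul_div_assoc]
    gcongr)
  have hu : Function.update (fun j => t⁻¹ • (x - y j)) i (t⁻¹ • (x - w)) =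
      fun j => t⁻¹ • (x - Function.update y i w j) := by
    funext j
    rcases eq_or_ne j i with rfl | hj <;> simp [*]
  rw [hd, sum_norm_smul_sub ht, hu] at hr
  rw [← scale_reg_bound ht hS dist_nonneg, kt, kt, ← mul_sub, abs_mul, abs_of_pos (by positivity)]
  gcongr

lemma LPKernel.abs_kt_sub_le (hk : LPKernel k A γ δ B) {t : ℝ} (ht : 0 < t) {x x' : Rn n}
    {y : Fin m → Rn n} (hy : ∀ j, y j ≠ x) (hy' : ∀ j, y j ≠ x')
    (h : ∃ j, dist x x' ≤ dist x (y j) / B) :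
    |kt k t x y - kt k t x' y| ≤
      A * dist x x' ^ γ * (t ^ δ * (t + ∑ j, dist x (y j)) ^ (-(m * n + (γ + δ)))) := by
  have hS : 0 ≤ ∑ j, dist x (y j) := Finset.sum_nonneg fun _ _ => dist_nonneg
  have hd : ‖t⁻¹ • (x' - x)‖ = t⁻¹ * dist x x' := by
    rw [norm_smul, norm_inv, Real.norm_of_nonneg ht.le, dist_comm, dist_eq_norm]
  have hadd : ∀ j, t⁻¹ • (x - y j) + t⁻¹ • (x' - x) = t⁻¹ • (x' - y j) := fun j => by
    rw [← smul_add]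
    congr 1
    abel
  have hr := hk.reg_all (fun j => t⁻¹ • (x - y j)) (t⁻¹ • (x' - x))
    (fun j => smul_ne_zero (inv_ne_zero ht.ne') (sub_ne_zero.2 (hy j).symm))
    (fun j => by
      rw [hadd]
      exact smul_ne_zero (inv_ne_zero ht.ne') (sub_ne_zero.2 (hy' j).symm))
    (by
      obtain ⟨j, hj⟩ := h
      refine ⟨j, ?_⟩
      rw [hd, norm_smul, norm_inv, Real.norm_of_nonneg ht.le, ← dist_eq_norm, mul_div_assoc]
      gcongr)
  simp only [hadd] at hr
  rw [hd, sum_norm_smul_sub ht] at hr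
  rw [← scale_reg_bound ht hS dist_nonneg, kt, kt, ← mul_sub, abs_mul, abs_of_pos (by positivity)]
  gcongr

lemma LPKernel.measurable_kt (hk : LPKernel k A γ δ B) :
    Measurable fun p : (ℝ × Rn n) × (Fin m → Rn n) => kt k p.1.1 p.1.2 p.2 := by
  unfold kt
  refine Measurable.mul (by fun_prop) (hk.measurable.comp ?_)
  rw [measurable_pi_iff]
  intro i
  fun_prop

lemma LPKernel.measurable_integral (hk : LPKernel k A γ δ B) (S : Set (Fin m → Rn n))
    {F : Fin m → Rn n → ℝ} (hF : ∀ i, Measurable (F i)) :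
    Measurable fun p : ℝ × Rn n => ∫ y in S, kt k p.1 p.2 y * ∏ i, F i (y i) := by
  refine (StronglyMeasurable.integral_prod_right
    (f := fun (p : ℝ × Rn n) y => kt k p.1 p.2 y * ∏ i, F i (y i)) ?_).measurable
  refine Measurable.stronglyMeasurable (hk.measurable_kt.mul ?_)
  exact Finset.measurable_fun_prod _ fun i _ =>
    (hF i).comp ((measurable_pi_apply i).comp measurable_snd)

lemma LPKernel.measurable_integral_left (hk : LPKernel k A γ δ B) (S : Set (Fin m → Rn n))
    {F : Fin m → Rn n → ℝ} (hF : ∀ i, Measurable (F i)) (x : Rn n) :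
    Measurable fun t : ℝ => ENNReal.ofReal |∫ y in S, kt k t x y * ∏ i, F i (y i)| :=
  ENNReal.measurable_ofReal.comp (measurable_norm.comp
    ((hk.measurable_integral S hF).comp (measurable_id.prodMk measurable_const)))

lemma LPKernel.measurable_gOn (hk : LPKernel k A γ δ B) (S : Set (Fin m → Rn n))
    {F : Fin m → Rn n → ℝ} (hF : ∀ i, Measurable (F i)) : Measurable (gOn k S F) := by
  unfold gOn sqNorm
  refine Measurable.pow_const (Measurable.lintegral_prod_left'
    (f := fun p : ℝ × Rn n => ENNReal.ofReal |∫ y in S, kt k p.1 p.2 y * ∏ i, F i (y i)| ^ (2 : ℝ) *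
      (ENNReal.ofReal p.1)⁻¹) ?_) _
  refine Measurable.mul (Measurable.pow_const (ENNReal.measurable_ofReal.comp (measurable_norm.comp
    (hk.measurable_integral S hF))) _) (by fun_prop)

lemma LPKernel.integrableOn (hk : LPKernel k A γ δ B) {t : ℝ} (ht : 0 < t) (x : Rn n)
    {D : Fin m → Set (Rn n)} {F : Fin m → Rn n → ℝ}
    (hFi : ∀ i, IntegrableOn (F i) (D i)) {S : Set (Fin m → Rn n)} (hS : S ⊆ univ.pi D) :
    IntegrableOn (fun y => kt k t x y * ∏ i, F i (y i)) S := by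
  have h1 : IntegrableOn (fun y : Fin m → Rn n => ∏ i, F i (y i)) (univ.pi D) := by
    rw [IntegrableOn, volume_pi, Measure.restrict_pi_pi]
    exact Integrable.fintype_prod hFi
  refine (h1.mono_set hS).bdd_mul (c := A * (t ^ δ * t ^ (-(m * n + δ)))) ?_ ?_
  · exact (hk.measurable_kt.comp
      (measurable_const.prodMk measurable_id : Measurable fun y => ((t, x), y))).aestronglyMeasurable
  · refine Eventually.of_forall fun y => (hk.abs_kt_le ht x y).trans ?_
    have hA := hk.A_pos
    have hS : 0 ≤ ∑ j, dist x (y j) := Finset.sum_nonneg fun _ _ => dist_nonneg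
    have hδ := hk.δ_pos
    have : (0 : ℝ) ≤ m * n := by positivity
    gcongr ?_ * (_ * ?_)
    exact Real.rpow_le_rpow_of_nonpos ht (by linarith) (by linarith)

end Kernel

section BadTerm

lemma ofReal_abs_integral_le {X : Type*} [MeasurableSpace X] (μ : Measure X) (f : X → ℝ) :
    ENNReal.ofReal |∫ y, f y ∂μ| ≤ ∫⁻ y, ENNReal.ofReal |f y| ∂μ := by
  simpa only [Real.enorm_eq_ofReal_abs] using enorm_integral_le_lintegral_enorm (μ := μ) f

lemma exists_sqNorm_kernel_le (n m : ℕ) {γ δ : ℝ} (hγ : 0 < γ) (hδ : 0 < δ) :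
    ∃ C : ℝ≥0∞, C ≠ ⊤ ∧ ∀ (G : Fin m → Rn n → ℝ≥0∞), (∀ i, Measurable (G i)) →
      ∀ (a : Fin m → ℝ≥0∞) (x : Rn n) (R : ℝ), 0 < R → (∀ i, a i ≠ ⊤) →
      (∀ i, ∀ r, R ≤ r → ∫⁻ y in ball x r, G i y ≤ a i * ENNReal.ofReal r ^ n) →
      ∀ D : Set (Fin m → Rn n), MeasurableSet D → (∀ y ∈ D, R ≤ ∑ j, dist x (y j)) →
      sqNorm (fun t => ∫⁻ y in D, ENNReal.ofReal
        (t ^ δ * (t + ∑ j, dist x (y j)) ^ (-(m * n + (γ + δ)))) * ∏ i, G i (y i)) ≤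
        C * ENNReal.ofReal (R ^ (-γ)) * ∏ i, a i := by
  obtain ⟨C₁, hC₁, h₁⟩ := exists_lintegral_kernel_prod_le n m (add_pos hγ hδ)
  obtain ⟨C₂, hC₂, h₂⟩ := sqNorm_scale_le hγ hδ
  set q : ℝ := m * n + (γ + δ) with hq
  have hq0 : 0 ≤ q := by positivity
  refine ⟨ENNReal.ofReal (2 ^ q) * C₁ * C₂, by finiteness, ?_⟩
  intro G hG a x R hR ha hav D hD hDR
  have hpt : ∀ t : ℝ, 0 < t → ∫⁻ y in D, ENNReal.ofReal
      (t ^ δ * (t + ∑ j, dist x (y j)) ^ (-q)) * ∏ i, G i (y i) ≤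
        (ENNReal.ofReal (2 ^ q) * C₁ * ∏ i, a i) *
          ENNReal.ofReal (t ^ δ * (t + R) ^ (-(γ + δ))) := by
    intro t ht
    calc ∫⁻ y in D, ENNReal.ofReal (t ^ δ * (t + ∑ j, dist x (y j)) ^ (-q)) * ∏ i, G i (y i)
        ≤ ∫⁻ y in D, ENNReal.ofReal (2 ^ q * t ^ δ) *
          (ENNReal.ofReal ((t + R + ∑ j, dist x (y j)) ^ (-q)) * ∏ i, G i (y i)) := by
          refine setLIntegral_mono' hD fun y hy => ?_
          have hS := hDR y hy
          rw [← mul_assoc, ← ENNReal.ofReal_mul (by positivity)]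
          refine mul_le_mul' (ENNReal.ofReal_le_ofReal ?_) le_rfl
          have : (t + ∑ j, dist x (y j)) ^ (-q) ≤ 2 ^ q * (t + R + ∑ j, dist x (y j)) ^ (-q) := by
            have h2 : (t + ∑ j, dist x (y j)) ^ (-q) ≤
                ((t + R + ∑ j, dist x (y j)) / 2) ^ (-q) :=
              Real.rpow_le_rpow_of_nonpos (by linarith) (by linarith) (by linarith)
            rwa [Real.div_rpow (by linarith) zero_le_two, Real.rpow_neg zero_le_two, div_inv_eq_mul,
              mul_comm] at h2
          calc _ ≤ t ^ δ * (2 ^ q * (t + R + ∑ j, dist x (y j)) ^ (-q)) :=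
                mul_le_mul_of_nonneg_left this (by positivity)
            _ = _ := by ring
      _ ≤ ENNReal.ofReal (2 ^ q * t ^ δ) * ∫⁻ y : Fin m → Rn n,
          (ENNReal.ofReal ((t + R + ∑ j, dist x (y j)) ^ (-q)) * ∏ i, G i (y i)) := by
          rw [lintegral_const_mul' _ _ ENNReal.ofReal_ne_top]
          gcongr
          exact Measure.restrict_le_self
      _ ≤ ENNReal.ofReal (2 ^ q * t ^ δ) *
          (C₁ * ENNReal.ofReal ((t + R) ^ (-(γ + δ))) * ∏ i, a i) := by
          gcongr
          exact h₁ G hG a x (t + R) (by positivity) fun i r hr => hav i r (by linarith)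
      _ = _ := by
          rw [ENNReal.ofReal_mul (by positivity), ENNReal.ofReal_mul (by positivity)]
          ring
  have hprod : ∏ i, a i ≠ ⊤ := ENNReal.prod_ne_top fun i _ => ha i
  calc _ ≤ sqNorm (fun t => (ENNReal.ofReal (2 ^ q) * C₁ * ∏ i, a i) *
          ENNReal.ofReal (t ^ δ * (t + R) ^ (-(γ + δ)))) := sqNorm_mono hpt
    _ = (ENNReal.ofReal (2 ^ q) * C₁ * ∏ i, a i) *
          sqNorm (fun t => ENNReal.ofReal (t ^ δ * (t + R) ^ (-(γ + δ)))) :=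
        sqNorm_const_mul (by finiteness) _
    _ ≤ (ENNReal.ofReal (2 ^ q) * C₁ * ∏ i, a i) * (C₂ * ENNReal.ofReal (R ^ (-γ))) := by
        gcongr
        exact h₂ R hR
    _ = _ := by ring

lemma setIntegral_update_mul_prod_eq_zero (Φ : (Fin m → Rn n) → ℝ) (F : Fin m → Rn n → ℝ)
    (i : Fin m) (c : Rn n) {P : Set (Rn n)} (hP : MeasurableSet P) (h0 : ∫ y in P, F i y = 0) :
    ∫ y in {y : Fin m → Rn n | y i ∈ P}, Φ (Function.update y i c) * ∏ j, F j (y j) = 0 := by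
  obtain ⟨l, rfl⟩ : ∃ l, m = l + 1 := ⟨m - 1, by have := i.pos; omega⟩
  have hW : MeasurableSet {y : Fin (l + 1) → Rn n | y i ∈ P} := measurable_pi_apply i hP
  rw [← integral_indicator hW]
  have hmp := (volume_preserving_piFinSuccAbove (fun _ : Fin (l + 1) => Rn n) i).symm
  rw [← hmp.integral_comp' (g := indicator {y : Fin (l + 1) → Rn n | y i ∈ P}
    fun y => Φ (Function.update y i c) * ∏ j, F j (y j))]
  have : ∀ z : Rn n × (Fin l → Rn n), indicator {y : Fin (l + 1) → Rn n | y i ∈ P}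
      (fun y => Φ (Function.update y i c) * ∏ j, F j (y j))
        ((MeasurableEquiv.piFinSuccAbove (fun _ : Fin (l + 1) => Rn n) i).symm z) =
      P.indicator (F i) z.1 * (Φ (i.insertNth c z.2) * ∏ j, F (i.succAbove j) (z.2 j)) := by
    rintro ⟨u, v⟩
    have he : (MeasurableEquiv.piFinSuccAbove (fun _ : Fin (l + 1) => Rn n) i).symm (u, v) =
      i.insertNth u v := rfl
    rw [he]
    by_cases hu : u ∈ P
    · rw [indicator_of_mem (by simpa using hu), indicator_of_mem hu, Fin.prod_univ_succAbove _ i]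
      simp only [Fin.update_insertNth, Fin.insertNth_apply_same, Fin.insertNth_apply_succAbove]
      ring
    · rw [indicator_of_notMem (by simpa using hu), indicator_of_notMem hu, zero_mul]
  simp only [this]
  rw [Measure.volume_eq_prod, integral_prod_mul (P.indicator (F i))
    (fun v => Φ (i.insertNth c v) * ∏ j, F (i.succAbove j) (v j)), integral_indicator hP, h0,
    zero_mul]

variable {k : (Fin m → Rn n) → ℝ} {A γ δ B : ℝ}

lemma LPKernel.integrable_update (hk : LPKernel k A γ δ B) {t : ℝ} (ht : 0 < t) (x : Rn n)
    {h : Fin m → Rn n → ℝ} (hint : ∀ j, Integrable (h j)) (i : Fin m) (c : Rn n) :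
    Integrable (fun y => kt k t x (Function.update y i c) * ∏ j, h j (y j)) := by
  have h1 : Integrable (fun y : Fin m → Rn n => ∏ j, h j (y j)) := by
    rw [volume_pi]
    exact Integrable.fintype_prod hint
  have hu : Measurable fun y : Fin m → Rn n => Function.update y i c := by
    rw [measurable_pi_iff]
    intro j
    rcases eq_or_ne j i with rfl | hj
    · simp only [Function.update_self]
      exact measurable_const
    · simp only [Function.update_of_ne hj]
      exact measurable_pi_apply j
  have hM : Measurable fun y : Fin m → Rn n => kt k t x (Function.update y i c) :=
    hk.measurable_kt.comp (measurable_const.prodMk hu : Measurable fun y => ((t, x), _))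
  refine Integrable.bdd_mul (f := fun y : Fin m → Rn n => kt k t x (Function.update y i c))
    (c := A * (t ^ δ * t ^ (-(m * n + δ)))) h1 hM.aestronglyMeasurable ?_
  · refine Eventually.of_forall fun y => (hk.abs_kt_le ht x _).trans ?_
    have hS : 0 ≤ ∑ j, dist x (Function.update y i c j) :=
      Finset.sum_nonneg fun _ _ => dist_nonneg
    have hδ := hk.δ_pos
    have hA := hk.A_pos
    have : (0 : ℝ) ≤ m * n := by positivity
    refine mul_le_mul_of_nonneg_left (mul_le_mul_of_nonneg_left ?_ (by positivity)) hA.le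
    exact Real.rpow_le_rpow_of_nonpos ht (by linarith) (by linarith)

lemma LPKernel.ofReal_abs_setIntegral_cancel_le (hk : LPKernel k A γ δ B) {t : ℝ} (ht : 0 < t)
    {x c : Rn n} {h : Fin m → Rn n → ℝ} (i : Fin m) (hm : ∀ j, Measurable (h j))
    (hint : ∀ j, Integrable (h j)) {Q : Set (Rn n)} (hQ : MeasurableSet Q)
    (hmean : ∫ y in Q, h i y = 0) {ρ : ℝ} (hρ : 0 ≤ ρ) (hQc : ∀ y ∈ Q, dist y c ≤ ρ)
    (hxy : ∀ y ∈ Q, B * ρ ≤ dist x y) :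
    ENNReal.ofReal |∫ y in {y : Fin m → Rn n | y i ∈ Q}, kt k t x y * ∏ j, h j (y j)| ≤
      ENNReal.ofReal (A * ρ ^ γ) * ∫⁻ y in {y : Fin m → Rn n | y i ∈ Q}, ENNReal.ofReal
        (t ^ δ * (t + ∑ j, dist x (y j)) ^ (-(m * n + (γ + δ)))) *
        ∏ j, ENNReal.ofReal |Function.update h i (Q.indicator (h i)) j (y j)| := by
  have hA := hk.A_pos
  have hγ := hk.γ_pos
  have hB := hk.two_le
  set W : Set (Fin m → Rn n) := {y | y i ∈ Q} with hWdef
  have hWm : MeasurableSet W := measurable_pi_apply i hQ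
  have hI : IntegrableOn (fun y => kt k t x y * ∏ j, h j (y j)) W :=
    hk.integrableOn ht x (D := fun _ => univ) (fun j => (hint j).integrableOn) (by simp)
  have hbound : ∀ y ∈ W, |kt k t x y - kt k t x (Function.update y i c)| ≤
      A * ρ ^ γ * (t ^ δ * (t + ∑ j, dist x (y j)) ^ (-(m * n + (γ + δ)))) := by
    intro y hy
    have hy' : y i ∈ Q := hy
    refine (hk.abs_kt_sub_update_le ht (x := x) (y := y) (i := i) (w := c) ?_).trans ?_
    · rw [le_div_iff₀ (by linarith)]
      calc dist (y i) c * B ≤ ρ * B := by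
            refine mul_le_mul_of_nonneg_right (hQc _ hy') (by linarith)
        _ ≤ _ := by linarith [hxy _ hy']
    · have hS : 0 ≤ ∑ j, dist x (y j) := Finset.sum_nonneg fun _ _ => dist_nonneg
      refine mul_le_mul_of_nonneg_right (mul_le_mul_of_nonneg_left ?_ hA.le) (by positivity)
      exact Real.rpow_le_rpow dist_nonneg (hQc _ hy') hγ.le
  have hz := setIntegral_update_mul_prod_eq_zero (kt k t x) h i c hQ hmean
  have hdiff : ∫ y in W, kt k t x y * ∏ j, h j (y j) =
      ∫ y in W, (kt k t x y - kt k t x (Function.update y i c)) * ∏ j, h j (y j) := by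
    simp only [sub_mul]
    rw [integral_sub hI (hk.integrable_update ht x hint i c).integrableOn, hz, sub_zero]
  rw [hdiff, ← lintegral_const_mul' _ _ ENNReal.ofReal_ne_top]
  refine (ofReal_abs_integral_le _ _).trans (setLIntegral_mono' hWm fun y hy => ?_)
  have hprod : ∏ j, ENNReal.ofReal |Function.update h i (Q.indicator (h i)) j (y j)| =
      ENNReal.ofReal |∏ j, h j (y j)| := by
    rw [Finset.abs_prod, ENNReal.ofReal_prod_of_nonneg fun _ _ => abs_nonneg _]
    refine Finset.prod_congr rfl fun j _ => ?_
    rcases eq_or_ne j i with rfl | hj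
    · rw [Function.update_self, indicator_of_mem (by exact hy)]
    · rw [Function.update_of_ne hj]
  rw [hprod, ← mul_assoc, ← ENNReal.ofReal_mul (by positivity), abs_mul,
    ENNReal.ofReal_mul (abs_nonneg _)]
  exact mul_le_mul' (ENNReal.ofReal_le_ofReal (hbound y hy)) le_rfl

/-- Off the dilated cubes, replacing one entry by a sum of mean zero atoms gains decay. -/
lemma LPKernel.exists_gOn_update_le [NeZero n] (hk : LPKernel k A γ δ B) :
    ∃ C : ℝ≥0∞, C ≠ ⊤ ∧ ∀ (S : Set (Rn n × ℝ)), S.Countable →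
      S.PairwiseDisjoint (fun P => cube P.1 P.2) → (∀ P ∈ S, 0 < P.2) →
      ∀ (h : Fin m → Rn n → ℝ) (i : Fin m), (∀ j, Measurable (h j)) → (∀ j, Integrable (h j)) →
      (∀ y, y ∉ ⋃ P ∈ S, cube P.1 P.2 → h i y = 0) →
      (∀ P ∈ S, ∫ y in cube P.1 P.2, h i y = 0) →
      ∀ (a : Fin m → ℝ≥0∞) (x : Rn n), (∀ j, a j ≠ ⊤) →
      (∀ P ∈ S, n * (B + 1) * P.2 ≤ dist x P.1) →
      (∀ j, j ≠ i → ∀ r, 0 < r → ∫⁻ y in ball x r, ENNReal.ofReal |h j y| ≤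
        a j * ENNReal.ofReal r ^ n) →
      gOn k univ h x ≤ C * (∏ j ∈ Finset.univ \ {i}, a j) * ∑' P : S,
        ENNReal.ofReal (P.1.2 ^ γ * dist x P.1.1 ^ (-(γ + n))) *
          ∫⁻ y in cube P.1.1 P.1.2, ENNReal.ofReal |h i y| := by
  obtain ⟨C₁, hC₁, h₁⟩ := exists_sqNorm_kernel_le n m hk.γ_pos hk.δ_pos
  have hA := hk.A_pos
  have hγ := hk.γ_pos
  have hB := hk.two_le
  have hn : (1 : ℝ) ≤ n := by exact_mod_cast NeZero.one_le
  refine ⟨ENNReal.ofReal (A * n ^ γ) * C₁ * ENNReal.ofReal (2 ^ (γ + n)), by finiteness, ?_⟩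
  intro S hSc hSd hSpos h i hm hint hoff hmean a x ha hx hav
  have := hSc.to_subtype
  set W : S → Set (Fin m → Rn n) := fun P => {y | y i ∈ cube P.1.1 P.1.2} with hWdef
  have hWm : ∀ P, MeasurableSet (W P) := fun P => measurable_pi_apply i (measurableSet_cube _ _)
  have hWd : Pairwise (Disjoint on W) := by
    intro P P' hPP
    rw [Function.onFun, Set.disjoint_left]
    intro y hy hy'
    exact Set.disjoint_left.1 (hSd P.2 P'.2 fun h => hPP (Subtype.ext h)) hy hy'
  have hsum : ∀ t : ℝ, 0 < t → ENNReal.ofReal |∫ y in univ, kt k t x y * ∏ j, h j (y j)| ≤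
      ∑' P : S, ENNReal.ofReal |∫ y in W P, kt k t x y * ∏ j, h j (y j)| := by
    intro t ht
    have hI : Integrable (fun y => kt k t x y * ∏ j, h j (y j)) := by
      have := hk.integrableOn ht x (D := fun _ => univ) (F := h) (S := univ)
        (fun j => (hint j).integrableOn) (by simp)
      rwa [integrableOn_univ] at this
    have h2 : ∫ y in univ, kt k t x y * ∏ j, h j (y j) =
        ∫ y in ⋃ P, W P, kt k t x y * ∏ j, h j (y j) := by
      rw [Measure.restrict_univ]
      refine (setIntegral_eq_integral_of_forall_compl_eq_zero fun y hy => ?_).symm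
      have hy' : y i ∉ ⋃ P ∈ S, cube P.1 P.2 := by
        intro hmem
        apply hy
        simp only [mem_iUnion, exists_prop] at hmem ⊢
        obtain ⟨P, hP, hyP⟩ := hmem
        exact ⟨⟨P, hP⟩, hyP⟩
      rw [Finset.prod_eq_zero (Finset.mem_univ i) (hoff _ hy'), mul_zero]
    have h3 := hasSum_integral_iUnion hWm hWd hI.integrableOn
    rw [h2, ← h3.tsum_eq]
    simp only [← Real.enorm_eq_ofReal_abs]
    exact enorm_tsum_le_tsum_enorm
  have hterm : ∀ P : S, sqNorm (fun t => ENNReal.ofReal |∫ y in W P, kt k t x y * ∏ j, h j (y j)|) ≤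
      ENNReal.ofReal (A * n ^ γ) * C₁ * ENNReal.ofReal (2 ^ (γ + n)) *
        (∏ j ∈ Finset.univ \ {i}, a j) * (ENNReal.ofReal (P.1.2 ^ γ * dist x P.1.1 ^ (-(γ + n))) *
          ∫⁻ y in cube P.1.1 P.1.2, ENNReal.ofReal |h i y|) := by
    intro P
    have hs := hSpos P.1 P.2
    set s := P.1.2
    set c := P.1.1
    set Q := cube c s
    have hd : 0 < dist x c := lt_of_lt_of_le (by positivity) (hx P.1 P.2)
    have hxc : n * (B + 1) * s ≤ dist x c := hx P.1 P.2
    have hQc : ∀ y ∈ Q, dist y c ≤ n * s := fun y hy => (mem_ball.1 (cube_subset_ball c hs hy)).le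
    have hns : 0 < n * s := by positivity
    have hxy : ∀ y ∈ Q, dist x c - n * s ≤ dist x y := fun y hy => by
      have := dist_triangle x y c
      linarith [hQc y hy]
    have hpt : ∀ t : ℝ, 0 < t → ENNReal.ofReal |∫ y in W P, kt k t x y * ∏ j, h j (y j)| ≤
        ENNReal.ofReal (A * (n * s) ^ γ) * ∫⁻ y in W P, ENNReal.ofReal
          (t ^ δ * (t + ∑ j, dist x (y j)) ^ (-(m * n + (γ + δ)))) *
          ∏ j, ENNReal.ofReal |Function.update h i (Q.indicator (h i)) j (y j)| := fun t ht =>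
      hk.ofReal_abs_setIntegral_cancel_le ht i hm hint (measurableSet_cube c s) (hmean P.1 P.2)
        hns.le hQc fun y hy => by
          have h2 := hxy y hy
          linarith [(by ring : n * (B + 1) * s = B * (n * s) + n * s)]
    have hL1 : ∫⁻ y in Q, ENNReal.ofReal |h i y| ≠ ⊤ := by
      have := (hint i).integrableOn (s := Q) |>.2
      simpa only [HasFiniteIntegral, Real.enorm_eq_ofReal_abs] using this.ne
    have hfin : ∫⁻ y, ENNReal.ofReal |Q.indicator (h i) y| = ∫⁻ y in Q, ENNReal.ofReal |h i y| := by
      rw [← lintegral_indicator (measurableSet_cube c s)]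
      refine lintegral_congr fun y => ?_
      by_cases hy : y ∈ Q
      · rw [indicator_of_mem hy, indicator_of_mem hy]
      · rw [indicator_of_notMem hy, indicator_of_notMem hy, abs_zero, ENNReal.ofReal_zero]
    have hd2 : 0 < ENNReal.ofReal (dist x c / 2) := by simpa using hd
    have hker := h₁ (fun j y => ENNReal.ofReal |Function.update h i (Q.indicator (h i)) j y|)
      (fun j => by
        refine ENNReal.measurable_ofReal.comp (Measurable.abs ?_)
        rcases eq_or_ne j i with rfl | hj
        · rw [Function.update_self]
          exact (hm j).indicator (measurableSet_cube c s)
        · rw [Function.update_of_ne hj]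
          exact hm j)
      (Function.update a i ((∫⁻ y in Q, ENNReal.ofReal |h i y|) *
        (ENNReal.ofReal (dist x c / 2) ^ n)⁻¹)) x (dist x c / 2) (by positivity)
      (fun j => by
        rcases eq_or_ne j i with rfl | hj
        · rw [Function.update_self]
          exact ENNReal.mul_ne_top hL1 (ENNReal.inv_ne_top.2 (by positivity))
        · rw [Function.update_of_ne hj]
          exact ha j)
      (fun j r hr => by
        rcases eq_or_ne j i with rfl | hj
        · simp only [Function.update_self]
          calc ∫⁻ y in ball x r, ENNReal.ofReal |Q.indicator (h j) y|
              ≤ ∫⁻ y in Q, ENNReal.ofReal |h j y| := by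
                rw [← hfin]
                exact setLIntegral_le_lintegral _ _
            _ = (∫⁻ y in Q, ENNReal.ofReal |h j y|) * (ENNReal.ofReal (dist x c / 2) ^ n)⁻¹ *
                ENNReal.ofReal (dist x c / 2) ^ n := by
                rw [mul_assoc, ENNReal.inv_mul_cancel (by positivity) (by finiteness), mul_one]
            _ ≤ _ := by gcongr
        · simp only [Function.update_of_ne hj]
          exact hav j hj r (lt_of_lt_of_le (by positivity) hr))
      (W P) (hWm P) (fun y hy => by
        have h1 := hxy _ hy
        have h2 : dist x (y i) ≤ ∑ j, dist x (y j) :=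
          Finset.single_le_sum (f := fun j => dist x (y j)) (fun _ _ => dist_nonneg)
            (Finset.mem_univ i)
        have h3 : n * s * 3 ≤ dist x c := by nlinarith
        linarith)
    calc _ ≤ sqNorm (fun t => ENNReal.ofReal (A * (n * s) ^ γ) * ∫⁻ y in W P, ENNReal.ofReal
          (t ^ δ * (t + ∑ j, dist x (y j)) ^ (-(m * n + (γ + δ)))) *
          ∏ j, ENNReal.ofReal |Function.update h i (Q.indicator (h i)) j (y j)|) := sqNorm_mono hpt
      _ ≤ ENNReal.ofReal (A * (n * s) ^ γ) * (C₁ * ENNReal.ofReal ((dist x c / 2) ^ (-γ)) *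
          ∏ j, Function.update a i ((∫⁻ y in Q, ENNReal.ofReal |h i y|) *
            (ENNReal.ofReal (dist x c / 2) ^ n)⁻¹) j) := by
          rw [sqNorm_const_mul ENNReal.ofReal_ne_top]
          gcongr
      _ = (ENNReal.ofReal (A * (n * s) ^ γ) * ENNReal.ofReal ((dist x c / 2) ^ (-γ)) *
          ENNReal.ofReal ((dist x c / 2) ^ (-(n : ℝ)))) * C₁ * (∏ j ∈ Finset.univ \ {i}, a j) *
          (∫⁻ y in Q, ENNReal.ofReal |h i y|) := by
          rw [Finset.prod_update_of_mem (Finset.mem_univ i), ← ENNReal.ofReal_pow (by positivity),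
            ← ENNReal.ofReal_inv_of_pos (by positivity), Real.rpow_neg (by positivity) (n : ℝ),
            Real.rpow_natCast]
          ring
      _ = _ := by
          rw [← ENNReal.ofReal_mul (by positivity), ← ENNReal.ofReal_mul (by positivity)]
          have : A * (n * s) ^ γ * (dist x c / 2) ^ (-γ) * (dist x c / 2) ^ (-(n : ℝ)) =
              A * n ^ γ * (2 ^ (γ + n) * (s ^ γ * dist x c ^ (-(γ + n)))) := by
            rw [mul_assoc, ← Real.rpow_add (by positivity), ← neg_add, Real.div_rpow hd.le zero_le_two,
              Real.rpow_neg zero_le_two, div_inv_eq_mul, Real.mul_rpow (by positivity) hs.le]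
            ring
          rw [this, ENNReal.ofReal_mul (p := A * n ^ γ) (by positivity),
            ENNReal.ofReal_mul (p := 2 ^ (γ + n)) (by positivity)]
          ring
  calc gOn k univ h x ≤ sqNorm (fun t => ∑' P : S,
        ENNReal.ofReal |∫ y in W P, kt k t x y * ∏ j, h j (y j)|) := sqNorm_mono hsum
    _ ≤ ∑' P : S, sqNorm (fun t => ENNReal.ofReal |∫ y in W P, kt k t x y * ∏ j, h j (y j)|) :=
        sqNorm_tsum_le fun P => hk.measurable_integral_left (W P) hm x
    _ ≤ _ := by
        rw [← ENNReal.tsum_mul_left]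
        exact ENNReal.tsum_le_tsum hterm

end BadTerm

section Decomposition

lemma integral_sub_ne {μ : Measure (Rn n)} {f : Rn n → ℝ} (hf : ∫⁻ y, ENNReal.ofReal |f y| ∂μ ≠ ⊤)
    (hm : Measurable f) : Integrable f μ := by
  refine ⟨hm.aestronglyMeasurable, ?_⟩
  simpa only [HasFiniteIntegral, Real.enorm_eq_ofReal_abs] using hf.lt_top

/-- Calderón–Zygmund decomposition of a function supported in a cube. -/
lemma exists_cz_decomposition {F : Rn n → ℝ} (hF : Measurable F) {l : ℝ≥0∞} (hl : l ≠ ⊤)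
    {c : Rn n} {s : ℝ} (hs : 0 < s) (hoff : ∀ y, y ∉ cube c s → F y = 0)
    (hav : ∫⁻ y in cube c s, ENNReal.ofReal |F y| ≤ l * volume (cube c s)) :
    ∃ (S : Set (Rn n × ℝ)) (G : Rn n → ℝ), S.Countable ∧
      S.PairwiseDisjoint (fun P => cube P.1 P.2) ∧ (∀ P ∈ S, 0 < P.2) ∧ Measurable G ∧
      (∀ᵐ y, ENNReal.ofReal |G y| ≤ 2 ^ n * l) ∧ (∀ y, y ∉ cube c s → G y = 0) ∧
      (∀ y, y ∉ ⋃ P ∈ S, cube P.1 P.2 → F y - G y = 0) ∧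
      (∀ P ∈ S, ∫ y in cube P.1 P.2, (F y - G y) = 0) ∧
      (∀ P ∈ S, ∫⁻ y in cube P.1 P.2, ENNReal.ofReal |F y - G y| ≤
        2 * (2 ^ n * l) * volume (cube P.1 P.2)) ∧
      l * ∑' P : S, volume (cube P.1.1 P.1.2) ≤ ∫⁻ y, ENNReal.ofReal |F y| := by
  have hFa : Measurable fun y => ENNReal.ofReal |F y| := ENNReal.measurable_ofReal.comp hF.abs
  obtain ⟨S, hSc, hSd, hS, hae⟩ := exists_cz_cubes hFa hl hs hav
  have := hSc.to_subtype
  have hU : MeasurableSet (⋃ P ∈ S, cube P.1 P.2) :=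
    MeasurableSet.biUnion hSc fun P _ => measurableSet_cube _ _
  set avg : Rn n × ℝ → ℝ := fun P => (volume (cube P.1 P.2)).toReal⁻¹ * ∫ y in cube P.1 P.2, F y
    with havg
  obtain ⟨G, hGm, hG⟩ := exists_measurable_piecewise (ι := Option S)
    (fun o => o.elim (⋃ P ∈ S, cube P.1 P.2)ᶜ fun P => cube P.1.1 P.1.2)
    (by rintro (_ | P); exacts [hU.compl, measurableSet_cube _ _])
    (fun o => o.elim F fun P _ => avg P.1)
    (by rintro (_ | P); exacts [hF, measurable_const])
    (by
      rintro (_ | P) (_ | P') hne y ⟨h1, h2⟩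
      · exact absurd rfl hne
      · exact absurd (mem_biUnion P'.2 h2) h1
      · exact absurd (mem_biUnion P.2 h1) h2
      · exact absurd h2 (Set.disjoint_left.1
          (hSd P.2 P'.2 fun h => hne (congrArg some (Subtype.ext h))) h1))
  have hGoff : ∀ y, y ∉ ⋃ P ∈ S, cube P.1 P.2 → G y = F y := fun y hy => hG none hy
  have hGon : ∀ P ∈ S, ∀ y ∈ cube P.1 P.2, G y = avg P := fun P hP y hy => hG (some ⟨P, hP⟩) hy
  have hsub : ∀ P ∈ S, cube P.1 P.2 ⊆ cube c s := fun P hP => (hS P hP).2.2.1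
  have havgle : ∀ P ∈ S, ENNReal.ofReal |avg P| ≤ 2 ^ n * l := by
    intro P hP
    have hv0 := (volume_cube_pos (c := P.1) (hS P hP).1).ne'
    have hvt := volume_cube_ne_top P.1 P.2
    have h1 : ENNReal.ofReal |∫ y in cube P.1 P.2, F y| ≤ 2 ^ n * l * volume (cube P.1 P.2) :=
      (ofReal_abs_integral_le _ _).trans (hS P hP).2.2.2.2
    rw [havg]
    simp only
    rw [abs_mul, abs_inv, abs_of_nonneg ENNReal.toReal_nonneg, ENNReal.ofReal_mul (by positivity),
      ENNReal.ofReal_inv_of_pos (ENNReal.toReal_pos hv0 hvt), ENNReal.ofReal_toReal hvt]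
    calc (volume (cube P.1 P.2))⁻¹ * ENNReal.ofReal |∫ y in cube P.1 P.2, F y|
        ≤ (volume (cube P.1 P.2))⁻¹ * (2 ^ n * l * volume (cube P.1 P.2)) := by gcongr
      _ = 2 ^ n * l * ((volume (cube P.1 P.2))⁻¹ * volume (cube P.1 P.2)) := by ring
      _ = 2 ^ n * l := by rw [ENNReal.inv_mul_cancel hv0 hvt, mul_one]
  have hFint : ∀ P ∈ S, IntegrableOn F (cube P.1 P.2) := fun P hP => by
    refine integral_sub_ne ((hS P hP).2.2.2.2.trans_lt ?_).ne hF
    exact ENNReal.mul_lt_top (by finiteness) (volume_cube_ne_top P.1 P.2).lt_top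
  refine ⟨S, G, hSc, hSd, fun P hP => (hS P hP).1, hGm, ?_, ?_, ?_, ?_, ?_, ?_⟩
  · filter_upwards [hae] with y hy
    by_cases hyU : y ∈ ⋃ P ∈ S, cube P.1 P.2
    · obtain ⟨P, hP, hyP⟩ := mem_iUnion₂.1 hyU
      rw [hGon P hP y hyP]
      exact havgle P hP
    · rw [hGoff y hyU]
      by_cases hyc : y ∈ cube c s
      · exact (hy hyc hyU).trans (le_mul_of_one_le_left' (one_le_pow₀ one_le_two))
      · rw [hoff y hyc, abs_zero, ENNReal.ofReal_zero]
        exact zero_le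
  · intro y hy
    rw [hGoff y, hoff y hy]
    intro hyU
    obtain ⟨P, hP, hyP⟩ := mem_iUnion₂.1 hyU
    exact hy (hsub P hP hyP)
  · intro y hy
    rw [hGoff y hy, sub_self]
  · intro P hP
    have hv0 := (volume_cube_pos (c := P.1) (hS P hP).1).ne'
    have hvt := volume_cube_ne_top P.1 P.2
    have h1 : ∫ y in cube P.1 P.2, (F y - G y) = ∫ y in cube P.1 P.2, (F y - avg P) :=
      setIntegral_congr_fun (measurableSet_cube _ _) fun y hy => by rw [hGon P hP y hy]
    have hvi : IntegrableOn (fun _ : Rn n => avg P) (cube P.1 P.2) :=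
      integrableOn_const hvt
    rw [h1, integral_sub (hFint P hP) hvi, setIntegral_const, smul_eq_mul, havg]
    simp only [measureReal_def]
    rw [mul_inv_cancel_left₀ (ENNReal.toReal_pos hv0 hvt).ne', sub_self]
  · intro P hP
    calc ∫⁻ y in cube P.1 P.2, ENNReal.ofReal |F y - G y|
        ≤ ∫⁻ y in cube P.1 P.2, (ENNReal.ofReal |F y| + 2 ^ n * l) := by
          refine setLIntegral_mono' (measurableSet_cube _ _) fun y hy => ?_
          rw [hGon P hP y hy]
          refine (ENNReal.ofReal_le_ofReal (abs_sub _ _)).trans ?_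
          rw [ENNReal.ofReal_add (abs_nonneg _) (abs_nonneg _)]
          gcongr
          exact havgle P hP
      _ = (∫⁻ y in cube P.1 P.2, ENNReal.ofReal |F y|) + 2 ^ n * l * volume (cube P.1 P.2) := by
          rw [lintegral_add_right _ measurable_const, setLIntegral_const]
      _ ≤ 2 ^ n * l * volume (cube P.1 P.2) + 2 ^ n * l * volume (cube P.1 P.2) := by
          gcongr
          exact (hS P hP).2.2.2.2
      _ = _ := by ring
  · rw [← ENNReal.tsum_mul_left]
    calc ∑' P : S, l * volume (cube P.1.1 P.1.2)
        ≤ ∑' P : S, ∫⁻ y in cube P.1.1 P.1.2, ENNReal.ofReal |F y| :=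
          ENNReal.tsum_le_tsum fun P => (hS P.1 P.2).2.2.2.1.le
      _ = ∫⁻ y in ⋃ P ∈ S, cube P.1 P.2, ENNReal.ofReal |F y| :=
          (lintegral_biUnion hSc (fun P _ => measurableSet_cube _ _) hSd _).symm
      _ ≤ _ := setLIntegral_le_lintegral _ _

lemma exists_lintegral_tail_le (n : ℕ) {γ : ℝ} (hγ : 0 < γ) :
    ∃ C : ℝ≥0∞, C ≠ ⊤ ∧ ∀ (c : Rn n) (s : ℝ), 0 < s →
      ∫⁻ x in (ball c s)ᶜ, ENNReal.ofReal (dist x c ^ (-(γ + n))) ≤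
        C * ENNReal.ofReal (s ^ (-γ)) := by
  obtain ⟨C, hC, h⟩ := exists_lintegral_kernel_prod_le n 1 hγ
  have hv : volume (ball (0 : Rn n) 1) ≠ ⊤ := volume_ball_ne_top _ _
  refine ⟨ENNReal.ofReal (2 ^ (γ + n)) * (C * volume (ball (0 : Rn n) 1)), by finiteness, ?_⟩
  intro c s hs
  have h1 := h (fun _ _ => 1) (fun _ => measurable_const)
    (fun _ => volume (ball (0 : Rn n) 1)) c s hs (fun _ r hr => by
      rw [setLIntegral_one, volume_ball_eq c (hs.trans_le hr), mul_comm])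
  have h2 := (volume_preserving_funUnique (Fin 1) (Rn n)).lintegral_comp
    (f := fun y => ENNReal.ofReal ((s + dist c y) ^ (-(γ + n)))) (by fun_prop)
  have h3 : ∫⁻ x, ENNReal.ofReal ((s + dist c x) ^ (-(γ + n))) ≤
      C * ENNReal.ofReal (s ^ (-γ)) * volume (ball (0 : Rn n) 1) := by
    rw [← h2]
    have h1' : ∫⁻ y : Fin 1 → Rn n, ENNReal.ofReal ((s + dist c (y 0)) ^ (-(γ + n))) ≤
        C * ENNReal.ofReal (s ^ (-γ)) * volume (ball (0 : Rn n) 1) := by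
      simpa [add_comm] using h1
    convert h1'
    rfl
  calc ∫⁻ x in (ball c s)ᶜ, ENNReal.ofReal (dist x c ^ (-(γ + n)))
      ≤ ∫⁻ x in (ball c s)ᶜ, ENNReal.ofReal (2 ^ (γ + n)) *
        ENNReal.ofReal ((s + dist c x) ^ (-(γ + n))) := by
        refine setLIntegral_mono' measurableSet_ball.compl fun x hx => ?_
        have hd : s ≤ dist x c := by simpa using hx
        rw [← ENNReal.ofReal_mul (by positivity)]
        refine ENNReal.ofReal_le_ofReal ?_
        have h2 : dist x c ^ (-(γ + n)) ≤ ((s + dist c x) / 2) ^ (-(γ + n)) :=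
          Real.rpow_le_rpow_of_nonpos (by positivity) (by rw [dist_comm c x]; linarith)
            (neg_nonpos.2 (by positivity))
        rwa [Real.div_rpow (by positivity) zero_le_two, Real.rpow_neg zero_le_two, div_inv_eq_mul,
          mul_comm] at h2
    _ ≤ ENNReal.ofReal (2 ^ (γ + n)) * ∫⁻ x, ENNReal.ofReal ((s + dist c x) ^ (-(γ + n))) := by
        rw [lintegral_const_mul' _ _ ENNReal.ofReal_ne_top]
        gcongr
        exact Measure.restrict_le_self
    _ ≤ ENNReal.ofReal (2 ^ (γ + n)) *
        (C * ENNReal.ofReal (s ^ (-γ)) * volume (ball (0 : Rn n) 1)) := by gcongr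
    _ = _ := by ring

lemma measure_lt_le_of_lintegral_le {X : Type*} [MeasurableSpace X] {μ : Measure X}
    {T : X → ℝ≥0∞} (hT : Measurable T) {K ε V : ℝ≥0∞} (hK0 : K ≠ 0) (hK : K ≠ ⊤) (hε : ε ≠ 0)
    (hεt : ε ≠ ⊤) (h : ∫⁻ x, T x ∂μ ≤ K * V) : μ {x | K / ε < T x} ≤ ε * V := by
  have h1 : K / ε * μ {x | K / ε < T x} ≤ K * V :=
    (mul_le_mul' le_rfl (measure_mono (t := {x | K / ε ≤ T x}) fun x hx => by
      simp only [mem_ofPred_eq] at hx ⊢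
      exact hx.le)).trans ((mul_meas_ge_le_lintegral hT _).trans h)
  have h2 : K * (ε⁻¹ * μ {x | K / ε < T x}) ≤ K * V := by
    rwa [← mul_assoc, ← div_eq_mul_inv]
  rw [ENNReal.mul_le_mul_iff_right hK0 hK] at h2
  calc μ {x | K / ε < T x} = ε * (ε⁻¹ * μ {x | K / ε < T x}) := by
        rw [← mul_assoc, ENNReal.mul_inv_cancel hε hεt, one_mul]
    _ ≤ _ := by gcongr

lemma gOn_univ_pi (k : (Fin m → Rn n) → ℝ) {D : Fin m → Set (Rn n)}
    (hD : ∀ i, MeasurableSet (D i)) (F : Fin m → Rn n → ℝ) (x : Rn n) :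
    gOn k (univ.pi D) F x = gOn k univ (fun i => (D i).indicator (F i)) x := by
  unfold gOn
  congr 1
  ext t
  congr 2
  rw [Measure.restrict_univ, ← integral_indicator (MeasurableSet.univ_pi hD)]
  refine integral_congr_ae (Eventually.of_forall fun y => ?_)
  by_cases hy : y ∈ univ.pi D
  · simp only [indicator_of_mem hy]
    congr 1
    exact Finset.prod_congr rfl fun i _ => (indicator_of_mem (hy i (mem_univ i)) _).symm
  · simp only [indicator_of_notMem hy]
    simp only [mem_univ_pi, not_forall] at hy
    obtain ⟨i, hi⟩ := hy
    rw [Finset.prod_eq_zero (Finset.mem_univ i) (indicator_of_notMem hi _), mul_zero]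

variable {k : (Fin m → Rn n) → ℝ} {A γ δ B : ℝ}

lemma LPKernel.gOn_piecewise_le (hk : LPKernel k A γ δ B) {F G : Fin m → Rn n → ℝ}
    (hF : ∀ i, Measurable (F i)) (hG : ∀ i, Measurable (G i)) (hFi : ∀ i, Integrable (F i))
    (hGi : ∀ i, Integrable (G i)) (x : Rn n) (U : Fin m → ℝ≥0∞)
    (hU : ∀ (s : Finset (Fin m)) i,
      gOn k univ (Function.update (s.piecewise G F) i fun y => F i y - G i y) x ≤ U i)
    (s : Finset (Fin m)) :
    gOn k univ F x ≤ gOn k univ (s.piecewise G F) x + ∑ i ∈ s, U i := by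
  classical
  induction s using Finset.induction_on with
  | empty => simp
  | insert i s hi ih =>
    refine ih.trans ?_
    rw [Finset.sum_insert hi, ← add_assoc]
    gcongr
    refine le_trans ?_ (add_le_add_right (hU s i) _)
    have hpm : ∀ (s : Finset (Fin m)) j, Measurable (s.piecewise G F j) := fun s j => by
      by_cases hj : j ∈ s
      · rw [Finset.piecewise_eq_of_mem _ _ _ hj]; exact hG j
      · rw [Finset.piecewise_eq_of_notMem _ _ _ hj]; exact hF j
    have hpi : ∀ (s : Finset (Fin m)) j, Integrable (s.piecewise G F j) := fun s j => by
      by_cases hj : j ∈ s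
      · rw [Finset.piecewise_eq_of_mem _ _ _ hj]; exact hGi j
      · rw [Finset.piecewise_eq_of_notMem _ _ _ hj]; exact hFi j
    set H := Function.update (s.piecewise G F) i fun y => F i y - G i y with hH
    have hHm : ∀ j, Measurable (H j) := fun j => by
      rcases eq_or_ne j i with rfl | hj
      · rw [hH, Function.update_self]; exact (hF j).sub (hG j)
      · rw [hH, Function.update_of_ne hj]; exact hpm s j
    have hHi : ∀ j, Integrable (H j) := fun j => by
      rcases eq_or_ne j i with rfl | hj
      · rw [hH, Function.update_self]; exact (hFi j).sub (hGi j)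
      · rw [hH, Function.update_of_ne hj]; exact hpi s j
    refine le_trans (sqNorm_mono fun t ht => ?_) (sqNorm_add_le
      (hk.measurable_integral_left univ (hpm (insert i s)) x)
      (hk.measurable_integral_left univ hHm x))
    rw [← ENNReal.ofReal_add (abs_nonneg _) (abs_nonneg _)]
    refine ENNReal.ofReal_le_ofReal ((le_of_eq ?_).trans (abs_add_le _ _))
    congr 1
    have hI : ∀ {f : Fin m → Rn n → ℝ}, (∀ j, Integrable (f j)) →
        IntegrableOn (fun y => kt k t x y * ∏ j, f j (y j)) univ := fun hf =>
      hk.integrableOn ht x (D := fun _ => univ) (fun j => (hf j).integrableOn) (by simp)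
    rw [← integral_add (hI (hpi _)) (hI hHi)]
    refine integral_congr_ae (Eventually.of_forall fun y => ?_)
    simp only
    rw [← mul_add]
    congr 1
    rw [← Finset.mul_prod_erase _ _ (Finset.mem_univ i),
      ← Finset.mul_prod_erase _ (fun j => (insert i s).piecewise G F j (y j)) (Finset.mem_univ i),
      ← Finset.mul_prod_erase _ (fun j => H j (y j)) (Finset.mem_univ i)]
    have e1 : ∏ j ∈ Finset.univ.erase i, (insert i s).piecewise G F j (y j) =
        ∏ j ∈ Finset.univ.erase i, s.piecewise G F j (y j) :=
      Finset.prod_congr rfl fun j hj => by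
        rw [Finset.piecewise_insert, Function.update_of_ne (Finset.ne_of_mem_erase hj)]
    have e2 : ∏ j ∈ Finset.univ.erase i, H j (y j) =
        ∏ j ∈ Finset.univ.erase i, s.piecewise G F j (y j) :=
      Finset.prod_congr rfl fun j hj => by
        rw [hH, Function.update_of_ne (Finset.ne_of_mem_erase hj)]
    rw [e1, e2, Finset.piecewise_eq_of_notMem _ _ _ hi,
      Finset.piecewise_eq_of_mem _ _ _ (Finset.mem_insert_self i s), hH, Function.update_self]
    ring

end Decomposition

section WeakType

lemma prod_rpow_eq_rpow_sum {ι : Type*} (s : Finset ι) (x : ℝ≥0∞) {e : ι → ℝ}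
    (he : ∀ i ∈ s, 0 ≤ e i) : ∏ i ∈ s, x ^ e i = x ^ ∑ i ∈ s, e i := by
  classical
  induction s using Finset.induction_on with
  | empty => simp
  | insert i s hi ih =>
    rw [Finset.prod_insert hi, Finset.sum_insert hi,
      ih fun j hj => he j (Finset.mem_insert_of_mem hj),
      ENNReal.rpow_add_of_nonneg _ _ (he i (Finset.mem_insert_self _ _))
        (Finset.sum_nonneg fun j hj => he j (Finset.mem_insert_of_mem hj))]

lemma lpNormRn_le_of_bound {q : ℝ} (hq : 0 < q) {f : Rn n → ℝ} {M : ℝ≥0∞} {Q : Set (Rn n)}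
    (hQ : MeasurableSet Q) (hf : ∀ᵐ y, ENNReal.ofReal |f y| ≤ M) (hoff : ∀ y, y ∉ Q → f y = 0) :
    lpNormRn q f ≤ M * volume Q ^ q⁻¹ := by
  unfold lpNormRn lpNormE
  have h1 : ∫⁻ x, ENNReal.ofReal |f x| ^ q ≤ M ^ q * volume Q := by
    calc ∫⁻ x, ENNReal.ofReal |f x| ^ q ≤ ∫⁻ x, Q.indicator (fun _ => M ^ q) x := by
          refine lintegral_mono_ae ?_
          filter_upwards [hf] with y hy
          by_cases hyQ : y ∈ Q
          · rw [indicator_of_mem hyQ]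
            exact ENNReal.rpow_le_rpow hy hq.le
          · rw [hoff y hyQ, abs_zero, ENNReal.ofReal_zero, ENNReal.zero_rpow_of_pos hq]
            exact zero_le
      _ = _ := by rw [lintegral_indicator hQ, setLIntegral_const]
  calc _ ≤ (M ^ q * volume Q) ^ (1 / q) := ENNReal.rpow_le_rpow h1 (by positivity)
    _ = _ := by
      rw [ENNReal.mul_rpow_of_nonneg _ _ (by positivity), ← ENNReal.rpow_mul, one_div,
        mul_inv_cancel₀ hq.ne', ENNReal.rpow_one]

lemma exists_tail_sum_le (n : ℕ) {γ : ℝ} (hγ : 0 < γ) :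
    ∃ C : ℝ≥0∞, C ≠ ⊤ ∧ ∀ (κ : ℝ), 1 ≤ κ → ∀ (S : Set (Rn n × ℝ)), S.Countable →
      (∀ P ∈ S, 0 < P.2) →
      ∫⁻ x, ∑' P : S, (ball P.1.1 (κ * P.1.2))ᶜ.indicator (fun x =>
        ENNReal.ofReal (P.1.2 ^ γ * dist x P.1.1 ^ (-(γ + n))) * volume (cube P.1.1 P.1.2)) x ≤
        C * ∑' P : S, volume (cube P.1.1 P.1.2) := by
  obtain ⟨C, hC, h⟩ := exists_lintegral_tail_le n hγ
  refine ⟨C, hC, ?_⟩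
  intro κ hκ S hSc hS
  have := hSc.to_subtype
  rw [lintegral_tsum fun P => ((Measurable.indicator (by fun_prop)
    measurableSet_ball.compl).aemeasurable), ← ENNReal.tsum_mul_left]
  refine ENNReal.tsum_le_tsum fun P => ?_
  have hs := hS P.1 P.2
  rw [lintegral_indicator measurableSet_ball.compl,
    lintegral_mul_const _ (by fun_prop)]
  gcongr
  calc ∫⁻ x in (ball P.1.1 (κ * P.1.2))ᶜ, ENNReal.ofReal (P.1.2 ^ γ * dist x P.1.1 ^ (-(γ + n)))
      ≤ ∫⁻ x in (ball P.1.1 P.1.2)ᶜ, ENNReal.ofReal (P.1.2 ^ γ * dist x P.1.1 ^ (-(γ + n))) := by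
        refine lintegral_mono_set (compl_subset_compl.2 (ball_subset_ball ?_))
        nlinarith
    _ = ENNReal.ofReal (P.1.2 ^ γ) *
        ∫⁻ x in (ball P.1.1 P.1.2)ᶜ, ENNReal.ofReal (dist x P.1.1 ^ (-(γ + n))) := by
        rw [← lintegral_const_mul' _ _ ENNReal.ofReal_ne_top]
        simp only [ENNReal.ofReal_mul (show 0 ≤ P.1.2 ^ γ by positivity)]
    _ ≤ ENNReal.ofReal (P.1.2 ^ γ) * (C * ENNReal.ofReal (P.1.2 ^ (-γ))) := by
        gcongr
        exact h _ _ hs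
    _ = C := by
        rw [mul_left_comm, ← ENNReal.ofReal_mul (by positivity), ← Real.rpow_add hs,
          add_neg_cancel, Real.rpow_zero, ENNReal.ofReal_one, mul_one]

variable {k : (Fin m → Rn n) → ℝ} {A γ δ B : ℝ}

/-- Boundedness of the square function between Lebesgue spaces. -/
def GBdd (k : (Fin m → Rn n) → ℝ) : Prop :=
  ∃ (qs : Fin m → ℝ) (q : ℝ) (C : ℝ≥0∞), C ≠ ⊤ ∧ (∀ i, 1 < qs i) ∧ q⁻¹ = ∑ i, (qs i)⁻¹ ∧
    ∀ f : Fin m → Rn n → ℝ, lpNormE q (gOn k univ f) ≤ C * ∏ i, lpNormRn (qs i) (f i)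

lemma LPKernel.exists_bounded_part_le [NeZero m] (hk : LPKernel k A γ δ B) (hbd : GBdd k)
    {ε M : ℝ≥0∞} (hε : ε ≠ 0) (hεt : ε ≠ ⊤) (hM : M ≠ ⊤) :
    ∃ L : ℝ≥0∞, L ≠ ⊤ ∧ ∀ (Q : Set (Rn n)) (G : Fin m → Rn n → ℝ) (a : Fin m → ℝ≥0∞),
      MeasurableSet Q → (∀ i, Measurable (G i)) → (∀ i, a i ≠ 0) → (∀ i, a i ≠ ⊤) →
      (∀ i, ∀ᵐ y, ENNReal.ofReal |G i y| ≤ M * a i) → (∀ i y, y ∉ Q → G i y = 0) →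
      volume {x | L * ∏ i, a i < gOn k univ G x} ≤ ε * volume Q := by
  obtain ⟨qs, q, C₀, hC₀, hqs, hq, hb⟩ := hbd
  have hq0 : 0 < q := by
    rw [← inv_pos, hq]
    exact Finset.sum_pos (fun i _ => inv_pos.2 (zero_lt_one.trans (hqs i)))
      ⟨0, Finset.mem_univ _⟩
  set K₀ : ℝ≥0∞ := C₀ * M ^ m + 1 with hK₀
  have hK₀t : K₀ ≠ ⊤ := by finiteness
  have hK₀0 : K₀ ≠ 0 := by simp [hK₀]
  refine ⟨K₀ * (ε ^ q⁻¹)⁻¹, ?_, ?_⟩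
  · refine ENNReal.mul_ne_top hK₀t (ENNReal.inv_ne_top.2 ?_)
    simp [hε, hεt]
  intro Q G a hQ hG ha0 hat hbdd hoff
  have hP0 : ∏ i, a i ≠ 0 := Finset.prod_ne_zero_iff.2 fun i _ => ha0 i
  have hPt : ∏ i, a i ≠ ⊤ := ENNReal.prod_ne_top fun i _ => hat i
  have hint : ∫⁻ x, gOn k univ G x ^ q ≤ (K₀ * ∏ i, a i) ^ q * volume Q := by
    have h1 : lpNormE q (gOn k univ G) ≤ K₀ * (∏ i, a i) * volume Q ^ q⁻¹ := by
      calc lpNormE q (gOn k univ G) ≤ C₀ * ∏ i, lpNormRn (qs i) (G i) := hb G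
        _ ≤ C₀ * ∏ i, (M * a i * volume Q ^ (qs i)⁻¹) := by
            gcongr with i _
            exact lpNormRn_le_of_bound (zero_lt_one.trans (hqs i)) hQ (hbdd i) (hoff i)
        _ = C₀ * M ^ m * (∏ i, a i) * volume Q ^ q⁻¹ := by
            rw [Finset.prod_mul_distrib, Finset.prod_mul_distrib, Finset.prod_const,
              Finset.card_univ, Fintype.card_fin, hq, prod_rpow_eq_rpow_sum _ _ fun i _ =>
                (inv_pos.2 (zero_lt_one.trans (hqs i))).le]
            ring
        _ ≤ _ := by
            gcongr
            exact le_self_add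
    have h2 := ENNReal.rpow_le_rpow h1 hq0.le
    rwa [lpNormE, ← ENNReal.rpow_mul, one_div, inv_mul_cancel₀ hq0.ne', ENNReal.rpow_one,
      ENNReal.mul_rpow_of_nonneg _ _ hq0.le, ← ENNReal.rpow_mul, inv_mul_cancel₀ hq0.ne',
      ENNReal.rpow_one] at h2
  have hcheb := measure_lt_le_of_lintegral_le ((hk.measurable_gOn univ hG).pow_const q)
    (K := (K₀ * ∏ i, a i) ^ q) (ε := ε) (V := volume Q)
    (by simp [hq0.le, hK₀0, hP0, hq0.not_gt]) (ENNReal.rpow_ne_top_of_nonneg hq0.le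
      (ENNReal.mul_ne_top hK₀t hPt)) hε hεt hint
  refine (measure_mono fun x hx => ?_).trans hcheb
  simp only [mem_ofPred_eq] at hx ⊢
  have h3 := ENNReal.rpow_lt_rpow hx hq0
  refine lt_of_eq_of_lt ?_ h3
  rw [mul_right_comm, ENNReal.mul_rpow_of_nonneg _ (ε ^ q⁻¹)⁻¹ hq0.le, ENNReal.inv_rpow,
    ← ENNReal.rpow_mul,    inv_mul_cancel₀ hq0.ne', ENNReal.rpow_one, div_eq_mul_inv]

/-- The error term produced by the atoms supported on a family of cubes. -/
def tailSum (γ κ : ℝ) (S : Set (Rn n × ℝ)) (x : Rn n) : ℝ≥0∞ :=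
  ∑' P : S, (ball P.1.1 (κ * P.1.2))ᶜ.indicator (fun x =>
    ENNReal.ofReal (P.1.2 ^ γ * dist x P.1.1 ^ (-(γ + n))) * volume (cube P.1.1 P.1.2)) x

lemma measurable_tailSum (γ κ : ℝ) {S : Set (Rn n × ℝ)} (hS : S.Countable) :
    Measurable (tailSum γ κ S) := by
  have := hS.to_subtype
  exact Measurable.tsum fun P => Measurable.indicator (by fun_prop)
    measurableSet_ball.compl

lemma LPKernel.exists_gOn_le_add_tailSum [NeZero n] (hk : LPKernel k A γ δ B) (N : ℕ) :
    ∃ C : ℝ≥0∞, C ≠ ⊤ ∧ ∀ (S : Fin m → Set (Rn n × ℝ)) (F G : Fin m → Rn n → ℝ)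
      (a : Fin m → ℝ≥0∞) (x : Rn n), (∀ i, (S i).Countable) →
      (∀ i, (S i).PairwiseDisjoint (fun P => cube P.1 P.2)) → (∀ i, ∀ P ∈ S i, 0 < P.2) →
      (∀ i, Measurable (F i)) → (∀ i, Measurable (G i)) → (∀ i, Integrable (F i)) →
      (∀ i, Integrable (G i)) → (∀ i, a i ≠ ⊤) →
      (∀ i, ∀ᵐ y, ENNReal.ofReal |G i y| ≤ 2 ^ n * (N * a i)) →
      (∀ i y, y ∉ ⋃ P ∈ S i, cube P.1 P.2 → F i y - G i y = 0) →
      (∀ i, ∀ P ∈ S i, ∫ y in cube P.1 P.2, (F i y - G i y) = 0) →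
      (∀ i, ∀ P ∈ S i, ∫⁻ y in cube P.1 P.2, ENNReal.ofReal |F i y - G i y| ≤
        2 * (2 ^ n * (N * a i)) * volume (cube P.1 P.2)) →
      (∀ i, ∀ P ∈ S i, x ∉ ball P.1 (n * (B + 1) * P.2)) →
      (∀ i, maxFn volume (fun y => ENNReal.ofReal |F i y|) x ≤ N * a i) →
      gOn k univ F x ≤ gOn k univ G x +
        ∑ i, C * (∏ j, a j) * tailSum γ (n * (B + 1)) (S i) x := by
  classical
  obtain ⟨C₁, hC₁, h₁⟩ := hk.exists_gOn_update_le
  set v := volume (ball (0 : Rn n) 1) with hv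
  have hvt : v ≠ ⊤ := volume_ball_ne_top _ _
  set w : ℝ≥0∞ := (1 + v) * (2 ^ n * N) with hw
  have hwt : w ≠ ⊤ := by finiteness
  refine ⟨C₁ * 2 * w ^ m, by finiteness, ?_⟩
  intro S F G a x hSc hSd hS hF hG hFi hGi ha hGb hoff hmean hL1 hx hmax
  have key := hk.gOn_piecewise_le hF hG hFi hGi x
    (fun i => C₁ * 2 * w ^ m * (∏ j, a j) * tailSum γ (n * (B + 1)) (S i) x) ?_ Finset.univ
  · simpa using key
  intro s i
  have hvol : ∀ r : ℝ, 0 < r → volume (ball x r) = v * ENNReal.ofReal r ^ n := fun r hr => by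
    rw [volume_ball_eq x hr, mul_comm]
  have hFav : ∀ j r, 0 < r → ∫⁻ y in ball x r, ENNReal.ofReal |F j y| ≤
      w * a j * ENNReal.ofReal r ^ n := by
    intro j r hr
    have h1 := (lintegral_div_le_maxFn volume (fun y => ENNReal.ofReal |F j y|)
      (mem_ball_self (x := x) hr)).trans (hmax j)
    rw [ENNReal.div_le_iff (volume_ball_pos x hr).ne' (volume_ball_ne_top x r), hvol r hr] at h1
    refine h1.trans ?_
    calc N * a j * (v * ENNReal.ofReal r ^ n) = v * (1 * N) * a j * ENNReal.ofReal r ^ n := by ring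
      _ ≤ _ := by
        rw [hw]
        gcongr
        · exact le_add_self
        · exact one_le_pow₀ one_le_two
  have hGav : ∀ j r, 0 < r → ∫⁻ y in ball x r, ENNReal.ofReal |G j y| ≤
      w * a j * ENNReal.ofReal r ^ n := by
    intro j r hr
    calc ∫⁻ y in ball x r, ENNReal.ofReal |G j y| ≤ ∫⁻ y in ball x r, 2 ^ n * (N * a j) :=
          lintegral_mono_ae (ae_restrict_of_ae (hGb j))
      _ = v * (2 ^ n * N) * a j * ENNReal.ofReal r ^ n := by
          rw [setLIntegral_const, hvol r hr]
          ring
      _ ≤ _ := by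
        rw [hw]
        gcongr
        exact le_add_self
  set H := Function.update (s.piecewise G F) i fun y => F i y - G i y with hH
  have hHi : H i = fun y => F i y - G i y := by rw [hH, Function.update_self]
  have hHc : ∀ {p : (Rn n → ℝ) → Prop} j, p (F j) → p (G j) → j ≠ i → p (H j) := by
    intro p j h1 h2 hj
    rw [hH, Function.update_of_ne hj]
    by_cases hjs : j ∈ s
    · rwa [Finset.piecewise_eq_of_mem _ _ _ hjs]
    · rwa [Finset.piecewise_eq_of_notMem _ _ _ hjs]
  have hHm : ∀ j, Measurable (H j) := fun j => by
    rcases eq_or_ne j i with rfl | hj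
    · rw [hHi]; exact (hF j).sub (hG j)
    · exact hHc (p := Measurable) j (hF j) (hG j) hj
  have hHint : ∀ j, Integrable (H j) := fun j => by
    rcases eq_or_ne j i with rfl | hj
    · rw [hHi]; exact (hFi j).sub (hGi j)
    · exact hHc (p := fun f => Integrable f) j (hFi j) (hGi j) hj
  have h2 := h₁ (S i) (hSc i) (hSd i) (hS i) H i hHm hHint (by rw [hHi]; exact hoff i)
    (by rw [hHi]; exact hmean i) (fun j => w * a j) x (fun j => ENNReal.mul_ne_top hwt (ha j))
    (fun P hP => by simpa using hx i P hP)
    (fun j hj r hr => hHc (p := fun f => ∫⁻ y in ball x r, ENNReal.ofReal |f y| ≤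
      w * a j * ENNReal.ofReal r ^ n) j (hFav j r hr) (hGav j r hr) hj)
  refine h2.trans ?_
  have hsum : ∑' P : S i, ENNReal.ofReal (P.1.2 ^ γ * dist x P.1.1 ^ (-(γ + n))) *
      ∫⁻ y in cube P.1.1 P.1.2, ENNReal.ofReal |H i y| ≤
      2 * (w * a i) * tailSum γ (n * (B + 1)) (S i) x := by
    rw [tailSum, ← ENNReal.tsum_mul_left]
    refine ENNReal.tsum_le_tsum fun P => ?_
    rw [indicator_of_mem (hx i P.1 P.2), hHi]
    calc _ ≤ ENNReal.ofReal (P.1.2 ^ γ * dist x P.1.1 ^ (-(γ + n))) *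
          (2 * (2 ^ n * (N * a i)) * volume (cube P.1.1 P.1.2)) :=
          mul_le_mul' le_rfl (hL1 i P.1 P.2)
      _ = 2 * (1 * (2 ^ n * N) * a i) * (ENNReal.ofReal (P.1.2 ^ γ * dist x P.1.1 ^ (-(γ + n))) *
          volume (cube P.1.1 P.1.2)) := by ring
      _ ≤ _ := by
        rw [hw]
        refine mul_le_mul' (mul_le_mul' le_rfl (mul_le_mul' (mul_le_mul' ?_ le_rfl) le_rfl)) le_rfl
        exact le_self_add
  have hprod : ∏ j, (w * a j) = w ^ m * ∏ j, a j := by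
    rw [Finset.prod_mul_distrib, Finset.prod_const, Finset.card_univ, Fintype.card_fin]
  have hprod2 : (∏ j ∈ Finset.univ \ {i}, w * a j) * (w * a i) = ∏ j, (w * a j) := by
    rw [Finset.sdiff_singleton_eq_erase, Finset.prod_erase_mul _ _ (Finset.mem_univ i)]
  calc _ ≤ C₁ * (∏ j ∈ Finset.univ \ {i}, w * a j) *
        (2 * (w * a i) * tailSum γ (n * (B + 1)) (S i) x) := mul_le_mul' le_rfl hsum
    _ = C₁ * 2 * ((∏ j ∈ Finset.univ \ {i}, w * a j) * (w * a i)) *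
        tailSum γ (n * (B + 1)) (S i) x := by ring
    _ = _ := by
      rw [hprod2, hprod]
      ring

end WeakType

section WeakTypeMain

variable {k : (Fin m → Rn n) → ℝ} {A γ δ B : ℝ}

lemma gOn_eq_zero_of_ae_zero (k : (Fin m → Rn n) → ℝ) {F : Fin m → Rn n → ℝ} {i : Fin m}
    (h : F i =ᵐ[volume] 0) (x : Rn n) : gOn k univ F x = 0 := by
  have hy : ∀ᵐ y : Fin m → Rn n, F i (y i) = 0 :=
    (Measure.quasiMeasurePreserving_eval (fun _ : Fin m => (volume : Measure (Rn n))) i).ae h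
  unfold gOn
  have : ∀ t, ∫ y in univ, kt k t x y * ∏ j, F j (y j) = 0 := by
    intro t
    rw [Measure.restrict_univ]
    refine integral_eq_zero_of_ae ?_
    filter_upwards [hy] with y hy
    rw [Finset.prod_eq_zero (Finset.mem_univ i) hy, mul_zero, Pi.zero_apply]
  simp only [this, abs_zero, ENNReal.ofReal_zero]
  exact sqNorm_zero

lemma volume_closedBall_five_mul_le (c : Rn n) {r : ℝ} (hr : 0 < r) :
    volume (closedBall c (5 * r)) ≤ 5 ^ n * volume (ball c r) := by
  rw [volume_closedBall_eq c (by positivity), volume_ball_eq c hr,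
    ENNReal.ofReal_mul (by norm_num), mul_pow, mul_assoc]
  norm_num

/-- Local weak type estimate with an arbitrarily small exceptional set. -/
theorem LPKernel.exists_weak_type [NeZero n] [NeZero m] (hk : LPKernel k A γ δ B) (hbd : GBdd k)
    {ε : ℝ≥0∞} (hε : ε ≠ 0) (hεt : ε ≠ ⊤) :
    ∃ L : ℝ≥0∞, L ≠ ⊤ ∧ ∀ (c : Rn n) (ρ : ℝ) (F : Fin m → Rn n → ℝ) (a : Fin m → ℝ≥0∞), 0 < ρ →
      (∀ i, Measurable (F i)) → (∀ i, a i ≠ ⊤) →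
      (∀ i, ∫⁻ y in ball c ρ, ENNReal.ofReal |F i y| ≤ a i * volume (ball c ρ)) →
      volume {x | L * ∏ i, a i < gOn k (univ.pi fun _ => ball c ρ) F x} ≤
        ε * volume (ball c ρ) := by
  have hB := hk.two_le
  have hn : (1 : ℝ) ≤ n := by exact_mod_cast NeZero.one_le
  set v := volume (ball (0 : Rn n) 1) with hv
  have hvt : v ≠ ⊤ := volume_ball_ne_top _ _
  have hv0 : v ≠ 0 := (volume_ball_pos _ zero_lt_one).ne'
  set κ : ℝ := n * (B + 1) with hκ
  have hκ1 : 1 ≤ κ := by nlinarith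
  set Cv : ℝ≥0∞ := 2 ^ n * v⁻¹ with hCv
  have hCvt : Cv ≠ ⊤ := ENNReal.mul_ne_top (by finiteness) (ENNReal.inv_ne_top.2 hv0)
  set T : ℝ≥0∞ := Cv + m + m with hT
  have hTt : T ≠ ⊤ := by finiteness
  have hT0 : T ≠ 0 := by
    simp [hT, NeZero.ne m]
  set ε' : ℝ≥0∞ := ε / T with hε'
  have hε'0 : ε' ≠ 0 := (ENNReal.div_pos hε hTt).ne'
  have hε't : ε' ≠ ⊤ := ENNReal.div_ne_top hεt hT0
  set κ' : ℝ≥0∞ := ENNReal.ofReal κ ^ n * v with hκ'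
  have hκ't : κ' ≠ ⊤ := by finiteness
  obtain ⟨N, hN⟩ := ENNReal.exists_nat_gt
    (ENNReal.div_ne_top (show κ' + 5 ^ n ≠ ⊤ by finiteness) hε'0)
  have hN0 : (N : ℝ≥0∞) ≠ 0 := (zero_le.trans_lt hN).ne'
  have hN1 : (1 : ℝ≥0∞) ≤ N := by
    have : N ≠ 0 := by exact_mod_cast hN0
    exact_mod_cast Nat.one_le_iff_ne_zero.2 this
  have hNt : (N : ℝ≥0∞) ≠ ⊤ := ENNReal.natCast_ne_top N
  have hNε : κ' + 5 ^ n ≤ N * ε' := (ENNReal.div_le_iff hε'0 hε't).1 hN.le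
  obtain ⟨L₀, hL₀, hgood⟩ := hk.exists_bounded_part_le hbd hε'0 hε't
    (M := 2 ^ n * N) (by finiteness)
  obtain ⟨C₁, hC₁, hbad⟩ := hk.exists_gOn_le_add_tailSum (n := n) N
  obtain ⟨C₂, hC₂, htail⟩ := exists_tail_sum_le n hk.γ_pos
  set K : ℝ≥0∞ := C₂ + 1 with hK
  have hKt : K ≠ ⊤ := by finiteness
  refine ⟨L₀ + m * (C₁ * (K / ε')), ?_, ?_⟩
  · have := ENNReal.div_ne_top hKt hε'0
    finiteness
  intro c ρ F' a hρ hF' ha hav'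
  simp only [gOn_univ_pi k fun _ => measurableSet_ball]
  set F : Fin m → Rn n → ℝ := fun i => (ball c ρ).indicator (F' i) with hFdef
  have hF : ∀ i, Measurable (F i) := fun i => (hF' i).indicator measurableSet_ball
  set V := volume (ball c ρ) with hV
  have hVt : V ≠ ⊤ := volume_ball_ne_top _ _
  have hav : ∀ i, ∫⁻ y, ENNReal.ofReal |F i y| ≤ a i * V := fun i => by
    refine le_trans (le_of_eq ?_) (hav' i)
    rw [← lintegral_indicator measurableSet_ball]
    refine lintegral_congr fun y => ?_
    by_cases hy : y ∈ ball c ρ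
    · simp only [hFdef, indicator_of_mem hy]
    · simp only [hFdef, indicator_of_notMem hy, abs_zero, ENNReal.ofReal_zero]
  by_cases hz : ∃ i, a i = 0
  · obtain ⟨i, hi⟩ := hz
    have h0 : ∫⁻ y, ENNReal.ofReal |F i y| = 0 := by
      have := hav i
      rwa [hi, zero_mul, nonpos_iff_eq_zero] at this
    have hFa : Measurable fun y => ENNReal.ofReal |F i y| := ENNReal.measurable_ofReal.comp (hF i).abs
    rw [lintegral_eq_zero_iff hFa] at h0
    have h1 : F i =ᵐ[volume] 0 := by
      filter_upwards [h0] with y hy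
      simpa using hy
    have : {x | (L₀ + m * (C₁ * (K / ε'))) * ∏ i, a i < gOn k univ F x} = ∅ := by
      ext x
      simp [gOn_eq_zero_of_ae_zero k h1 x]
    rw [this, measure_empty]
    exact zero_le
  push Not at hz
  set Q := cube c (2 * ρ) with hQ
  have hBQ : ball c ρ ⊆ Q := by
    have := ball_subset_cube c (2 * ρ)
    rwa [mul_div_cancel_left₀ _ (two_ne_zero)] at this
  have hQV : volume Q = Cv * V := by
    rw [hQ, volume_cube, hV, volume_ball_eq c hρ, hCv, ENNReal.ofReal_mul zero_le_two, mul_pow]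
    calc _ = ENNReal.ofReal 2 ^ n * ENNReal.ofReal ρ ^ n * (v⁻¹ * v) := by
          rw [ENNReal.inv_mul_cancel hv0 hvt, mul_one]
      _ = _ := by
          rw [ENNReal.ofReal_ofNat]
          ring
  have hcz := fun i => exists_cz_decomposition (hF i) (l := N * a i)
    (ENNReal.mul_ne_top hNt (ha i)) (c := c) (s := 2 * ρ) (by positivity)
    (fun y hy => indicator_of_notMem (fun h => hy (hBQ h)) _)
    (calc ∫⁻ y in cube c (2 * ρ), ENNReal.ofReal |F i y| ≤ ∫⁻ y, ENNReal.ofReal |F i y| :=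
          setLIntegral_le_lintegral _ _
      _ ≤ a i * V := hav i
      _ ≤ _ := mul_le_mul' (le_mul_of_one_le_left' hN1) (measure_mono hBQ))
  choose S G hSc hSd hS hG hGb hGoff hFG hmean hL1 hsumS using hcz
  have hFint : ∀ i, Integrable (F i) := fun i =>
    integral_sub_ne ((hav i).trans_lt (ENNReal.mul_lt_top (ha i).lt_top hVt.lt_top)).ne (hF i)
  have hGint : ∀ i, Integrable (G i) := fun i => by
    refine integral_sub_ne (ne_top_of_le_ne_top (b := 2 ^ n * (N * a i) * volume Q) ?_ ?_) (hG i)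
    · have := ha i
      have := volume_cube_ne_top c (2 * ρ)
      finiteness
    · have h1 := lpNormRn_le_of_bound one_pos (measurableSet_cube c (2 * ρ)) (hGb i) (hGoff i)
      simpa [lpNormRn, lpNormE] using h1
  have hsumV : ∀ i, N * ∑' P : S i, volume (cube P.1.1 P.1.2) ≤ V := fun i => by
    have h1 := (hsumS i).trans (hav i)
    rwa [mul_comm (N : ℝ≥0∞), mul_assoc, ENNReal.mul_le_mul_iff_right (hz i) (ha i)] at h1
  set X₁ : Fin m → Set (Rn n) := fun i => ⋃ P ∈ S i, ball P.1 (κ * P.2) with hX₁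
  set X₂ : Fin m → Set (Rn n) := fun i =>
    {x | N * a i < maxFn volume (fun y => ENNReal.ofReal |F i y|) x} with hX₂
  have hX₁v : ∀ i, N * volume (X₁ i) ≤ κ' * V := fun i => by
    have := (hSc i).to_subtype
    calc N * volume (X₁ i) ≤ N * ∑' P : S i, volume (ball P.1.1 (κ * P.1.2)) := by
          gcongr
          exact measure_biUnion_le _ (hSc i) _
      _ = N * ∑' P : S i, κ' * volume (cube P.1.1 P.1.2) := by
          congr 1
          refine tsum_congr fun P => ?_
          have hs := hS i P.1 P.2
          rw [volume_ball_eq _ (by positivity), volume_cube, ENNReal.ofReal_mul (by positivity),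
            mul_pow, hκ']
          ring
      _ = κ' * (N * ∑' P : S i, volume (cube P.1.1 P.1.2)) := by
          rw [ENNReal.tsum_mul_left]
          ring
      _ ≤ _ := by
          gcongr
          exact hsumV i
  have hX₂v : ∀ i, N * volume (X₂ i) ≤ 5 ^ n * V := fun i => by
    have h1 := maxFn_weak_type (μ := volume) (fun c r hr => volume_closedBall_five_mul_le c hr)
      (fun y => ENNReal.ofReal |F i y|) (N * a i)
    have h2 : a i * (N * volume (X₂ i)) ≤ a i * (5 ^ n * V) := by
      calc a i * (N * volume (X₂ i)) = N * a i * volume (X₂ i) := by ring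
        _ ≤ 5 ^ n * ∫⁻ y, ENNReal.ofReal |F i y| := h1
        _ ≤ 5 ^ n * (a i * V) := by
            gcongr
            exact hav i
        _ = _ := by ring
    rwa [ENNReal.mul_le_mul_iff_right (hz i) (ha i)] at h2
  have hX : ∀ i, volume (X₁ i ∪ X₂ i) ≤ ε' * V := fun i => by
    have h1 : N * volume (X₁ i ∪ X₂ i) ≤ N * (ε' * V) := by
      calc N * volume (X₁ i ∪ X₂ i) ≤ N * (volume (X₁ i) + volume (X₂ i)) := by
            gcongr
            exact measure_union_le _ _
        _ ≤ (κ' + 5 ^ n) * V := by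
            rw [mul_add, add_mul]
            exact add_le_add (hX₁v i) (hX₂v i)
        _ ≤ N * ε' * V := by gcongr
        _ = _ := by ring
    rwa [ENNReal.mul_le_mul_iff_right hN0 hNt] at h1
  set Y : Fin m → Set (Rn n) := fun i => {x | K / ε' < tailSum γ κ (S i) x} with hY
  have hYv : ∀ i, volume (Y i) ≤ ε' * V := fun i => by
    refine measure_lt_le_of_lintegral_le (measurable_tailSum γ κ (hSc i)) (by simp [hK]) hKt hε'0
      hε't ?_
    calc ∫⁻ x, tailSum γ κ (S i) x ≤ C₂ * ∑' P : S i, volume (cube P.1.1 P.1.2) :=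
          htail κ hκ1 (S i) (hSc i) (hS i)
      _ ≤ K * V := by
          gcongr
          · exact le_self_add
          · exact (le_mul_of_one_le_left' hN1).trans (hsumV i)
  set Z : Set (Rn n) := {x | L₀ * ∏ i, a i < gOn k univ G x} with hZ
  have hZv : volume Z ≤ ε' * (Cv * V) := by
    rw [← hQV]
    exact hgood Q G a (measurableSet_cube _ _) hG hz ha
      (fun i => by simpa only [mul_assoc] using hGb i) hGoff
  have hsub : {x | (L₀ + m * (C₁ * (K / ε'))) * ∏ i, a i < gOn k univ F x} ⊆
      Z ∪ (⋃ i, X₁ i ∪ X₂ i) ∪ ⋃ i, Y i := by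
    intro x hx
    by_contra hcon
    simp only [mem_union, mem_iUnion, not_or, not_exists] at hcon
    obtain ⟨⟨hxZ, hxX⟩, hxY⟩ := hcon
    rw [hZ, mem_ofPred_eq, not_lt] at hxZ
    simp only [hY, mem_ofPred_eq, not_lt] at hxY
    simp only [hX₁, hX₂, mem_iUnion, not_exists, mem_ofPred_eq, not_lt] at hxX
    rw [mem_ofPred_eq] at hx
    refine hx.not_ge ?_
    calc gOn k univ F x ≤ gOn k univ G x + ∑ i, C₁ * (∏ j, a j) * tailSum γ κ (S i) x :=
          hbad S F G a x hSc hSd hS hF hG hFint hGint ha hGb hFG hmean hL1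
            (fun i P hP => (hxX i).1 P hP) (fun i => (hxX i).2)
      _ ≤ L₀ * ∏ i, a i + ∑ _i : Fin m, C₁ * (∏ j, a j) * (K / ε') := by
          gcongr with i _
          exact hxY i
      _ = _ := by
          rw [Finset.sum_const, Finset.card_univ, Fintype.card_fin, nsmul_eq_mul]
          ring
  calc _ ≤ volume (Z ∪ (⋃ i, X₁ i ∪ X₂ i) ∪ ⋃ i, Y i) := measure_mono hsub
    _ ≤ volume Z + volume (⋃ i, X₁ i ∪ X₂ i) + volume (⋃ i, Y i) :=
        (measure_union_le _ _).trans (add_le_add (measure_union_le _ _) le_rfl)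
    _ ≤ ε' * (Cv * V) + ∑ _i : Fin m, ε' * V + ∑ _i : Fin m, ε' * V := by
        gcongr
        · exact (measure_iUnion_fintype_le _ _).trans (Finset.sum_le_sum fun i _ => hX i)
        · exact (measure_iUnion_fintype_le _ _).trans (Finset.sum_le_sum fun i _ => hYv i)
    _ = ε' * T * V := by
        rw [Finset.sum_const, Finset.card_univ, Fintype.card_fin, nsmul_eq_mul, hT]
        ring
    _ = ε * V := by rw [hε', ENNReal.div_mul_cancel hT0 hTt]

end WeakTypeMain

section SparseStep

variable {k : (Fin m → Rn n) → ℝ} {A γ δ B : ℝ}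

/-- The dilation factor attached to the regularity constant of a kernel. -/
def dil (n : ℕ) (B : ℝ) : ℝ := n * (2 * B + 2)

lemma LPKernel.ofReal_abs_setIntegral_sub_le [NeZero n] (hk : LPKernel k A γ δ B) {t ρ : ℝ} (ht : 0 < t)
    {x x' : Rn n} {D : Set (Rn n)} {T : Set (Fin m → Rn n)} {F : Fin m → Rn n → ℝ}
    (hT : MeasurableSet T) (hTD : T ⊆ univ.pi fun _ => D) (hFi : ∀ i, IntegrableOn (F i) D)
    (hρ : 0 ≤ ρ) (hxx : dist x' x ≤ ρ) (hfar : ∀ y ∈ T, ∃ j, B * ρ ≤ dist x' (y j)) :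
    ENNReal.ofReal |(∫ y in T, kt k t x y * ∏ i, F i (y i)) -
        ∫ y in T, kt k t x' y * ∏ i, F i (y i)| ≤
      ENNReal.ofReal (A * ρ ^ γ) * ∫⁻ y in T, ENNReal.ofReal
        (t ^ δ * (t + ∑ j, dist x' (y j)) ^ (-(m * n + (γ + δ)))) *
          ∏ i, D.indicator (fun y => ENNReal.ofReal |F i y|) (y i) := by
  have hA := hk.A_pos
  have hB : 0 < B := by linarith [hk.two_le]
  have hI : ∀ x : Rn n, IntegrableOn (fun y => kt k t x y * ∏ i, F i (y i)) T := fun x =>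
    hk.integrableOn ht x (D := fun _ => D) hFi hTD
  rw [← integral_sub (hI x) (hI x'), ← lintegral_const_mul' _ _ ENNReal.ofReal_ne_top]
  refine (ofReal_abs_integral_le _ _).trans (lintegral_mono_ae ?_)
  have hae : ∀ u : Rn n, ∀ᵐ y : Fin m → Rn n, ∀ j, y j ≠ u := fun u =>
    ae_all_iff.2 fun j => Measure.ae_eval_ne (α := fun _ => Rn n) (fun _ => volume) j u
  filter_upwards [ae_restrict_of_ae (hae x), ae_restrict_of_ae (hae x'),
    ae_restrict_mem hT] with y hyx hyx' hy
  obtain ⟨j, hj⟩ := hfar y hy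
  have hS : 0 ≤ ∑ j, dist x' (y j) := Finset.sum_nonneg fun _ _ => dist_nonneg
  have hw : 0 ≤ t ^ δ * (t + ∑ j, dist x' (y j)) ^ (-(m * n + (γ + δ))) :=
    mul_nonneg (Real.rpow_nonneg ht.le _) (Real.rpow_nonneg (by linarith) _)
  have hk1 : |kt k t x' y - kt k t x y| ≤ A * ρ ^ γ *
      (t ^ δ * (t + ∑ j, dist x' (y j)) ^ (-(m * n + (γ + δ)))) := by
    have hd : dist x' x ≤ dist x' (y j) / B := by
      rw [le_div_iff₀ hB]
      exact (mul_comm _ _).trans_le ((mul_le_mul_of_nonneg_left hxx hB.le).trans hj)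
    exact (hk.abs_kt_sub_le ht hyx' hyx ⟨j, hd⟩).trans (mul_le_mul_of_nonneg_right
      (mul_le_mul_of_nonneg_left (Real.rpow_le_rpow dist_nonneg hxx hk.γ_pos.le) hA.le) hw)
  have hprod : ∏ i, D.indicator (fun y => ENNReal.ofReal |F i y|) (y i) =
      ENNReal.ofReal |∏ i, F i (y i)| := by
    rw [Finset.abs_prod, ENNReal.ofReal_prod_of_nonneg fun _ _ => abs_nonneg _]
    exact Finset.prod_congr rfl fun i _ => indicator_of_mem (hTD hy i (mem_univ i)) _
  rw [hprod, ← mul_assoc, ← ENNReal.ofReal_mul (mul_nonneg hA.le (Real.rpow_nonneg hρ _)),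
    ← sub_mul, abs_mul, ENNReal.ofReal_mul (abs_nonneg _), abs_sub_comm]
  exact mul_le_mul' (ENNReal.ofReal_le_ofReal hk1) le_rfl

lemma LPKernel.exists_gOn_diff_le [NeZero n] [NeZero m] (hk : LPKernel k A γ δ B) :
    ∃ C : ℝ≥0∞, C ≠ ⊤ ∧ ∀ (z x x' : Rn n) (s : ℝ) (D : Set (Rn n)) (F : Fin m → Rn n → ℝ)
      (a : Fin m → ℝ≥0∞), 0 < s → x ∈ ball z (n * s) → x' ∈ ball z (n * s) → MeasurableSet D →
      ball z (dil n B * s) ⊆ D → (∀ i, Measurable (F i)) → (∀ i, IntegrableOn (F i) D) →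
      (∀ i, a i ≠ ⊤) →
      (∀ i r, 0 < r → ∫⁻ y in ball x' r, D.indicator (fun y => ENNReal.ofReal |F i y|) y ≤
        a i * ENNReal.ofReal r ^ n) →
      gOn k ((univ.pi fun _ => D) \ (univ.pi fun _ => ball z (dil n B * s))) F x ≤
        gOn k (univ.pi fun _ => ball z (dil n B * s)) F x' + gOn k (univ.pi fun _ => D) F x' +
          C * ∏ i, a i := by
  obtain ⟨C₁, hC₁, h₁⟩ := exists_sqNorm_kernel_le n m hk.γ_pos hk.δ_pos
  have hA := hk.A_pos
  have hγ := hk.γ_pos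
  have hB := hk.two_le
  have hn : (1 : ℝ) ≤ n := by exact_mod_cast NeZero.one_le
  refine ⟨ENNReal.ofReal (A * (2 * n) ^ γ) * C₁, by finiteness, ?_⟩
  intro z x x' s D F a hs hx hx' hD hsub hF hFi ha hav
  set U : Set (Fin m → Rn n) := univ.pi fun _ => D with hU
  set W : Set (Fin m → Rn n) := univ.pi fun _ => ball z (dil n B * s) with hW
  have hUm : MeasurableSet U := MeasurableSet.univ_pi fun _ => hD
  have hWm : MeasurableSet W := MeasurableSet.univ_pi fun _ => measurableSet_ball
  have hWU : W ⊆ U := Set.pi_mono fun _ _ => hsub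
  have hI : ∀ (x : Rn n) {t : ℝ}, 0 < t → ∀ {X : Set (Fin m → Rn n)}, X ⊆ U →
      IntegrableOn (fun y => kt k t x y * ∏ i, F i (y i)) X := fun x t ht X hX =>
    hk.integrableOn ht x (D := fun _ => D) hFi hX
  have hns : 0 < n * s := by positivity
  have hxx : dist x' x ≤ 2 * n * s := by
    have h1 := mem_ball.1 hx
    have h2 := mem_ball.1 hx'
    have := dist_triangle_right x' x z
    linarith
  have hfar : ∀ y ∈ U \ W, ∃ j, 2 * B * (n * s) ≤ dist x' (y j) := by
    rintro y ⟨-, hy⟩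
    simp only [hW, Set.mem_univ_pi, not_forall, mem_ball, not_lt] at hy
    obtain ⟨j, hj⟩ := hy
    refine ⟨j, ?_⟩
    have h2 := mem_ball.1 hx'
    have h3 := dist_triangle_left (y j) z x'
    have : dil n B * s = 2 * B * (n * s) + 2 * (n * s) := by
      unfold dil
      ring
    linarith
  set Ψ : ℝ → ℝ≥0∞ := fun t => ENNReal.ofReal (A * (2 * n * s) ^ γ) *
    ∫⁻ y in U \ W, ENNReal.ofReal
      (t ^ δ * (t + ∑ j, dist x' (y j)) ^ (-(m * n + (γ + δ)))) *
        ∏ i, D.indicator (fun y => ENNReal.ofReal |F i y|) (y i) with hΨ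
  have hdiff : ∀ t : ℝ, 0 < t →
      ENNReal.ofReal |(∫ y in U \ W, kt k t x y * ∏ i, F i (y i)) -
        ∫ y in U \ W, kt k t x' y * ∏ i, F i (y i)| ≤ Ψ t := by
    intro t ht
    exact hk.ofReal_abs_setIntegral_sub_le ht (hUm.diff hWm) sdiff_subset hFi (by positivity) hxx
      fun y hy => by
        obtain ⟨j, hj⟩ := hfar y hy
        exact ⟨j, le_trans (le_of_eq (by ring)) hj⟩
  have hΨle : sqNorm Ψ ≤ ENNReal.ofReal (A * (2 * n) ^ γ) * C₁ * ∏ i, a i := by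
    rw [hΨ, sqNorm_const_mul ENNReal.ofReal_ne_top]
    have h2 := h₁ (fun i => D.indicator fun y => ENNReal.ofReal |F i y|)
      (fun i => (ENNReal.measurable_ofReal.comp (hF i).abs).indicator hD) a x' s hs ha
      (fun i r hr => hav i r (hs.trans_le hr)) (U \ W) (hUm.diff hWm) (fun y hy => by
        obtain ⟨j, hj⟩ := hfar y hy
        have h3 : dist x' (y j) ≤ ∑ j, dist x' (y j) :=
          Finset.single_le_sum (f := fun j => dist x' (y j)) (fun _ _ => dist_nonneg)
            (Finset.mem_univ j)
        have h4 : 1 * s ≤ B * n * s :=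
          mul_le_mul_of_nonneg_right (one_le_mul_of_one_le_of_one_le (by linarith) hn) hs.le
        linarith)
    calc _ ≤ ENNReal.ofReal (A * (2 * n * s) ^ γ) * (C₁ * ENNReal.ofReal (s ^ (-γ)) * ∏ i, a i) :=
          mul_le_mul' le_rfl h2
      _ = ENNReal.ofReal (A * (2 * n * s) ^ γ) * ENNReal.ofReal (s ^ (-γ)) * C₁ * ∏ i, a i := by
          ring
      _ = _ := by
          rw [← ENNReal.ofReal_mul (by positivity), Real.mul_rpow (by positivity) hs.le,
            ← mul_assoc, mul_assoc _ (s ^ γ), ← Real.rpow_add hs, add_neg_cancel, Real.rpow_zero,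
            mul_one]
  have hm1 := hk.measurable_integral_left W hF x'
  have hm2 := hk.measurable_integral_left U hF x'
  have hm3 := hk.measurable_integral_left (U \ W) hF x
  have hm4 := hk.measurable_integral_left (U \ W) hF x'
  set Ξ : ℝ → ℝ≥0∞ := fun t => ENNReal.ofReal |(∫ y in U \ W, kt k t x y * ∏ i, F i (y i)) -
        ∫ y in U \ W, kt k t x' y * ∏ i, F i (y i)| with hΞ
  calc gOn k (U \ W) F x ≤ sqNorm (fun t => (ENNReal.ofReal |∫ y in W, kt k t x' y * ∏ i, F i (y i)| +
        ENNReal.ofReal |∫ y in U, kt k t x' y * ∏ i, F i (y i)|) + Ξ t) := by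
        refine sqNorm_mono fun t ht => ?_
        rw [hΞ]
        simp only
        rw [← ENNReal.ofReal_add (abs_nonneg _) (abs_nonneg _),
          ← ENNReal.ofReal_add (by positivity) (abs_nonneg _)]
        refine ENNReal.ofReal_le_ofReal ?_
        have h3 : ∫ y in U \ W, kt k t x' y * ∏ i, F i (y i) =
            (∫ y in U, kt k t x' y * ∏ i, F i (y i)) - ∫ y in W, kt k t x' y * ∏ i, F i (y i) :=
          setIntegral_sdiff hWm (hI x' ht le_rfl) hWU
        set u := ∫ y in U \ W, kt k t x y * ∏ i, F i (y i)
        set u' := ∫ y in U \ W, kt k t x' y * ∏ i, F i (y i)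
        have h4 : |u| ≤ |u - u'| + |u'| := by
          simpa using abs_add_le (u - u') u'
        have h5 := abs_sub (∫ y in U, kt k t x' y * ∏ i, F i (y i))
          (∫ y in W, kt k t x' y * ∏ i, F i (y i))
        rw [← h3] at h5
        linarith
    _ ≤ sqNorm (fun t => ENNReal.ofReal |∫ y in W, kt k t x' y * ∏ i, F i (y i)| +
        ENNReal.ofReal |∫ y in U, kt k t x' y * ∏ i, F i (y i)|) + sqNorm Ξ := by
        refine sqNorm_add_le (hm1.add hm2) ?_
        exact ENNReal.measurable_ofReal.comp ((((hk.measurable_integral (U \ W) hF).comp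
          (measurable_id.prodMk measurable_const)).sub ((hk.measurable_integral (U \ W) hF).comp
          (measurable_id.prodMk measurable_const))).abs)
    _ ≤ _ := add_le_add (sqNorm_add_le hm1 hm2) ((sqNorm_mono hdiff).trans hΨle)

end SparseStep

section SparseStepMain

lemma exists_stopping_cubes {E : Set (Rn n)} (hE : MeasurableSet E) (c : Rn n) {s : ℝ} (hs : 0 < s)
    (h : 2 ^ (n + 2) * volume (E ∩ cube c s) ≤ volume (cube c s)) :
    ∃ S : Set (Rn n × ℝ), S.Countable ∧ S.PairwiseDisjoint (fun P => cube P.1 P.2) ∧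
      (∀ P ∈ S, 0 < P.2 ∧ P.2 ≤ s / 2 ∧ cube P.1 P.2 ⊆ cube c s ∧
        2 * volume (E ∩ cube P.1 P.2) ≤ volume (cube P.1 P.2)) ∧
      2 * volume (⋃ P ∈ S, cube P.1 P.2) ≤ volume (cube c s) ∧
      ∀ᵐ y, y ∈ cube c s → y ∉ ⋃ P ∈ S, cube P.1 P.2 → y ∉ E := by
  set l : ℝ≥0∞ := (2 ^ (n + 1))⁻¹ with hl
  have h20 : (2 : ℝ≥0∞) ^ (n + 1) ≠ 0 := by positivity
  have h2t : (2 : ℝ≥0∞) ^ (n + 1) ≠ ⊤ := by finiteness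
  have hl2 : 2 ^ (n + 1) * l = 1 := ENNReal.mul_inv_cancel h20 h2t
  have hlt : l ≠ ⊤ := ENNReal.inv_ne_top.2 h20
  have hint : ∀ X : Set (Rn n), ∫⁻ y in X, E.indicator 1 y = volume (E ∩ X) := fun X => by
    rw [lintegral_indicator_one hE, Measure.restrict_apply hE]
  have key : volume (E ∩ cube c s) * 2 ≤ l * volume (cube c s) := by
    calc volume (E ∩ cube c s) * 2 = (2 ^ (n + 1) * l) * (volume (E ∩ cube c s) * 2) := by
          rw [hl2, one_mul]
      _ = l * (2 ^ (n + 2) * volume (E ∩ cube c s)) := by ring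
      _ ≤ _ := by gcongr
  obtain ⟨S, hSc, hSd, hS, hoff⟩ := exists_cz_cubes (g := E.indicator 1) (l := l) (c := c)
    (measurable_one.indicator hE) hlt hs (by
      rw [hint]
      exact (le_mul_of_one_le_right' one_le_two).trans key)
  have := hSc.to_subtype
  refine ⟨S, hSc, hSd, fun P hP => ?_, ?_, ?_⟩
  · obtain ⟨h1, h2, h3, -, h5⟩ := hS P hP
    refine ⟨h1, h2, h3, ?_⟩
    rw [hint] at h5
    calc 2 * volume (E ∩ cube P.1 P.2) ≤ 2 * (2 ^ n * l * volume (cube P.1 P.2)) := by gcongr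
      _ = (2 ^ (n + 1) * l) * volume (cube P.1 P.2) := by ring
      _ = _ := by rw [hl2, one_mul]
  · have h1 : l * volume (⋃ P ∈ S, cube P.1 P.2) ≤ volume (E ∩ cube c s) := by
      rw [measure_biUnion hSc hSd fun P _ => measurableSet_cube _ _, ← ENNReal.tsum_mul_left]
      calc _ ≤ ∑' P : S, volume (E ∩ cube P.1.1 P.1.2) :=
            ENNReal.tsum_le_tsum fun P => by
              have := (hS P.1 P.2).2.2.2.1
              rw [hint] at this
              exact this.le
        _ = volume (⋃ P ∈ S, E ∩ cube P.1 P.2) := by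
            rw [measure_biUnion hSc (hSd.mono fun P => inter_subset_right)
              fun P _ => hE.inter (measurableSet_cube _ _)]
        _ ≤ _ := measure_mono (iUnion₂_subset fun P hP =>
            inter_subset_inter_right _ (hS P hP).2.2.1)
    have h2 : l * (2 * volume (⋃ P ∈ S, cube P.1 P.2)) ≤ l * volume (cube c s) := by
      calc _ = (l * volume (⋃ P ∈ S, cube P.1 P.2)) * 2 := by ring
        _ ≤ volume (E ∩ cube c s) * 2 := by gcongr
        _ ≤ _ := key
    rwa [ENNReal.mul_le_mul_iff_right (ENNReal.inv_ne_zero.2 h2t) hlt] at h2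
  · filter_upwards [hoff] with y hy hyQ hyS hyE
    have h1 := hy hyQ hyS
    rw [indicator_of_mem hyE, Pi.one_apply] at h1
    have h3 : (1 : ℝ≥0∞) < 2 ^ (n + 1) := one_lt_pow₀ ENNReal.one_lt_two (by omega)
    have h2 : l < 1 := ENNReal.inv_lt_one.2 h3
    exact absurd h1 h2.not_ge

lemma measure_lt_maxFn_le {h : Rn n → ℝ≥0∞} {a V N ε : ℝ≥0∞} (ha : a ≠ ⊤)
    (hh : ∫⁻ y, h y ≤ a * V) (hNt : N ≠ ⊤) (hN0 : N ≠ 0) (hN : 5 ^ n ≤ N * ε) :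
    volume {x | N * a < maxFn volume h x} ≤ ε * V := by
  rcases eq_or_ne a 0 with rfl | ha0
  · have h0 : ∫⁻ y, h y = 0 := by simpa using hh
    have : {x | N * 0 < maxFn volume h x} = ∅ := by
      refine eq_empty_of_forall_notMem fun x hx => ?_
      rw [mem_ofPred_eq, lt_maxFn_iff] at hx
      obtain ⟨c, r, -, hx⟩ := hx
      rw [nonpos_iff_eq_zero.1 ((setLIntegral_le_lintegral (ball c r) h).trans_eq h0)] at hx
      simp at hx
    rw [this, measure_empty]
    exact zero_le
  · have h1 := maxFn_weak_type (μ := volume) (fun c r hr => volume_closedBall_five_mul_le c hr)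
      h (N * a)
    have h2 : (N * a) * volume {x | N * a < maxFn volume h x} ≤ (N * a) * (ε * V) := by
      calc _ ≤ 5 ^ n * ∫⁻ y, h y := h1
        _ ≤ (N * ε) * (a * V) := by gcongr
        _ = _ := by ring
    rwa [ENNReal.mul_le_mul_iff_right (mul_ne_zero hN0 ha0) (ENNReal.mul_ne_top hNt ha)] at h2

lemma setLIntegral_le_of_maxFn_le {h : Rn n → ℝ≥0∞} {K : ℝ≥0∞} {x c : Rn n} {r : ℝ}
    (hx : x ∈ ball c r) (hK : maxFn volume h x ≤ K) :
    ∫⁻ y in ball c r, h y ≤ K * volume (ball c r) := by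
  have hr : 0 < r := dist_nonneg.trans_lt (mem_ball.1 hx)
  have h1 := (lintegral_div_le_maxFn volume h hx).trans hK
  exact (ENNReal.div_le_iff (volume_ball_pos c hr).ne' (volume_ball_ne_top c r)).1 h1

variable {k : (Fin m → Rn n) → ℝ} {A γ δ B : ℝ}

lemma LPKernel.dil_pos [NeZero n] (hk : LPKernel k A γ δ B) : 0 < dil n B := by
  have hn : (1 : ℝ) ≤ n := by exact_mod_cast NeZero.one_le
  have := hk.two_le
  unfold dil
  positivity

lemma LPKernel.two_mul_le_dil [NeZero n] (hk : LPKernel k A γ δ B) : 2 * n ≤ dil n B := by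
  have hn : (1 : ℝ) ≤ n := by exact_mod_cast NeZero.one_le
  have := hk.two_le
  unfold dil
  nlinarith

lemma LPKernel.ball_dil_subset [NeZero n] (hk : LPKernel k A γ δ B) {c z : Rn n} {s l : ℝ}
    (hs : 0 < s) (hl : 0 < l) (hls : l ≤ s / 2) (hsub : cube z l ⊆ cube c s) :
    ball z (dil n B * l) ⊆ ball c (dil n B * s) := by
  have h1 := mem_ball.1 (cube_subset_ball c hs (hsub (center_mem_cube z hl)))
  have h2 := hk.two_mul_le_dil
  have h3 := hk.dil_pos
  refine ball_subset_ball' ?_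
  have h4 : dil n B * l ≤ dil n B * (s / 2) := mul_le_mul_of_nonneg_left hls h3.le
  have h5 : 2 * n * s ≤ dil n B * s := mul_le_mul_of_nonneg_right h2 hs.le
  linarith

lemma volume_ball_mul_eq_cube (c : Rn n) {κ s : ℝ} (hκ : 0 < κ) (hs : 0 < s) :
    volume (ball c (κ * s)) =
      ENNReal.ofReal κ ^ n * volume (ball (0 : Rn n) 1) * volume (cube c s) := by
  rw [volume_ball_eq c (by positivity), volume_cube, ENNReal.ofReal_mul hκ.le, mul_pow]
  ring

lemma LPKernel.exists_gOn_diff_le_of_half [NeZero n] [NeZero m] (hk : LPKernel k A γ δ B)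
    (hbd : GBdd k) (κ : Type) [Fintype κ] :
    ∃ C : ℝ≥0∞, C ≠ ⊤ ∧ ∀ (z : Rn n) (s : ℝ) (D E : Set (Rn n)) (F : κ → Fin m → Rn n → ℝ)
      (a : κ → Fin m → ℝ≥0∞) (G : κ → ℝ≥0∞), 0 < s → MeasurableSet D →
      ball z (dil n B * s) ⊆ D → (∀ I i, Measurable (F I i)) → (∀ I i, IntegrableOn (F I i) D) →
      (∀ I i, a I i ≠ ⊤) → 2 * volume (E ∩ cube z s) ≤ volume (cube z s) →
      (∀ x ∉ E, ∀ I, gOn k (univ.pi fun _ => D) (F I) x ≤ G I) →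
      (∀ x ∉ E, ∀ I i, maxFn volume (D.indicator fun y => ENNReal.ofReal |F I i y|) x ≤ a I i) →
      ∀ x ∈ cube z s, ∀ I,
        gOn k ((univ.pi fun _ => D) \ (univ.pi fun _ => ball z (dil n B * s))) (F I) x ≤
          G I + C * ∏ i, a I i := by
  obtain ⟨C₁, hC₁, h₁⟩ := hk.exists_gOn_diff_le
  have hdil := hk.dil_pos
  set v := volume (ball (0 : Rn n) 1) with hv
  have hvt : v ≠ ⊤ := volume_ball_ne_top _ _
  set Cq : ℝ≥0∞ := ENNReal.ofReal (dil n B) ^ n * v with hCq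
  have hCqt : Cq ≠ ⊤ := by finiteness
  set M : ℝ≥0∞ := (Fintype.card κ : ℝ≥0∞) with hM
  have hMt : M ≠ ⊤ := ENNReal.natCast_ne_top _
  set ε : ℝ≥0∞ := (4 * (1 + M * Cq))⁻¹ with hε
  have hden0 : 4 * (1 + M * Cq) ≠ 0 := by positivity
  have hdent : 4 * (1 + M * Cq) ≠ ⊤ := by finiteness
  have hε4 : 4 * (M * (ε * Cq)) ≤ 1 := by
    calc 4 * (M * (ε * Cq)) ≤ 4 * (1 + M * Cq) * ε := by
          calc _ = 4 * (M * Cq) * ε := by ring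
            _ ≤ _ := by gcongr; exact le_add_self
      _ = 1 := ENNReal.mul_inv_cancel hden0 hdent
  obtain ⟨L, hL, hweak⟩ := hk.exists_weak_type hbd (ε := ε) (ENNReal.inv_ne_zero.2 hdent)
    (ENNReal.inv_ne_top.2 hden0)
  refine ⟨L + C₁ * v ^ m, by finiteness, ?_⟩
  intro z s D E F a G hs hD hsub hF hFi ha hE hG hmax x hx I
  set V := volume (cube z s) with hV
  have hV0 : 0 < V := volume_cube_pos hs
  have hVt : V ≠ ⊤ := volume_cube_ne_top _ _
  have hzball : ball z (n * s) ⊆ ball z (dil n B * s) := ball_subset_ball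
    (mul_le_mul_of_nonneg_right (by linarith [hk.two_mul_le_dil, (Nat.cast_nonneg n : (0:ℝ) ≤ n)])
      hs.le)
  have hne : ∃ x₁ ∈ cube z s, x₁ ∉ E := by
    by_contra! hcon
    have h2 : V ≤ volume (E ∩ cube z s) := measure_mono fun y hy => ⟨hcon y hy, hy⟩
    have h3 : V + V ≤ V + 0 := by
      rw [add_zero, ← two_mul]
      exact (mul_le_mul_right h2 2).trans hE
    exact hV0.ne' (nonpos_iff_eq_zero.1 ((ENNReal.add_le_add_iff_left hVt).1 h3))
  obtain ⟨x₁, hx₁, hx₁E⟩ := hne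
  have hloc : ∀ J i, ∫⁻ y in ball z (dil n B * s), ENNReal.ofReal |F J i y| ≤
      a J i * volume (ball z (dil n B * s)) := fun J i => by
    have h2 := setLIntegral_le_of_maxFn_le (hzball (cube_subset_ball z hs hx₁))
      (hmax x₁ hx₁E J i)
    refine le_trans (le_of_eq ?_) h2
    exact setLIntegral_congr_fun measurableSet_ball fun y hy =>
      (indicator_of_mem (hsub hy) (f := fun y => ENNReal.ofReal |F J i y|)).symm
  set W : Set (Rn n) := ⋃ J, {x | L * ∏ i, a J i <
    gOn k (univ.pi fun _ => ball z (dil n B * s)) (F J) x} with hW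
  have hWv : 4 * volume W ≤ V := by
    have h2 : volume W ≤ M * (ε * Cq) * V := by
      refine (measure_iUnion_fintype_le _ _).trans ?_
      calc _ ≤ ∑ _J : κ, ε * (Cq * V) := Finset.sum_le_sum fun J _ => by
            refine (hweak z _ (F J) (a J) (by positivity) (hF J) (ha J) (hloc J)).trans_eq ?_
            rw [volume_ball_mul_eq_cube z hdil hs]
        _ = _ := by
            rw [Finset.sum_const, Finset.card_univ, nsmul_eq_mul]
            ring
    calc 4 * volume W ≤ 4 * (M * (ε * Cq) * V) := by gcongr
      _ = 4 * (M * (ε * Cq)) * V := by ring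
      _ ≤ 1 * V := by gcongr
      _ = V := one_mul _
  have hne : ∃ x' ∈ cube z s, x' ∉ E ∧ x' ∉ W := by
    by_contra! hcon
    have h2 : V ≤ volume (E ∩ cube z s) + volume W := by
      refine (measure_mono fun y hy => ?_).trans (measure_union_le _ _)
      by_cases hyE : y ∈ E
      · exact Or.inl ⟨hyE, hy⟩
      · exact Or.inr (hcon y hy hyE)
    have h3 : 3 * V + V ≤ 3 * V + 0 := by
      calc 3 * V + V = 4 * V := by ring
        _ ≤ 4 * (volume (E ∩ cube z s) + volume W) := by gcongr
        _ = 2 * (2 * volume (E ∩ cube z s)) + 4 * volume W := by ring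
        _ ≤ 2 * V + V := by gcongr
        _ = _ := by ring
    exact hV0.ne' (nonpos_iff_eq_zero.1 ((ENNReal.add_le_add_iff_left (by finiteness)).1 h3))
  obtain ⟨x', hx', hx'E, hx'W⟩ := hne
  have hxWloc : gOn k (univ.pi fun _ => ball z (dil n B * s)) (F I) x' ≤ L * ∏ i, a I i := by
    simp only [hW, mem_iUnion, not_exists, mem_ofPred_eq, not_lt] at hx'W
    exact hx'W I
  refine (h₁ z x x' s D (F I) (fun i => a I i * v) hs (cube_subset_ball z hs hx)
    (cube_subset_ball z hs hx') hD hsub (hF I) (hFi I) (fun i => by finiteness [ha I i])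
    fun i r hr => ?_).trans ?_
  · refine (setLIntegral_le_of_maxFn_le (mem_ball_self hr) (hmax x' hx'E I i)).trans_eq ?_
    rw [volume_ball_eq x' hr]
    ring
  · rw [Finset.prod_mul_distrib, Finset.prod_const, Finset.card_univ, Fintype.card_fin]
    calc _ ≤ L * ∏ i, a I i + G I + C₁ * ((∏ i, a I i) * v ^ m) := by
          gcongr
          exact hG x' hx'E I
      _ = _ := by ring

theorem LPKernel.exists_sparse_step [NeZero n] [NeZero m] (hk : LPKernel k A γ δ B)
    (hbd : GBdd k) (κ : Type) [Fintype κ] :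
    ∃ C : ℝ≥0∞, C ≠ ⊤ ∧ ∀ (c : Rn n) (s : ℝ) (F : κ → Fin m → Rn n → ℝ)
      (a : κ → Fin m → ℝ≥0∞), 0 < s → (∀ I i, Measurable (F I i)) → (∀ I i, a I i ≠ ⊤) →
      (∀ I i, ∫⁻ y in ball c (dil n B * s), ENNReal.ofReal |F I i y| ≤
        a I i * volume (ball c (dil n B * s))) →
      ∃ S : Set (Rn n × ℝ), S.Countable ∧ S.PairwiseDisjoint (fun P => cube P.1 P.2) ∧
        (∀ P ∈ S, 0 < P.2 ∧ P.2 ≤ s / 2 ∧ cube P.1 P.2 ⊆ cube c s) ∧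
        2 * volume (⋃ P ∈ S, cube P.1 P.2) ≤ volume (cube c s) ∧
        (∀ᵐ y, y ∈ cube c s → y ∉ ⋃ P ∈ S, cube P.1 P.2 → ∀ I,
          gOn k (univ.pi fun _ => ball c (dil n B * s)) (F I) y ≤ C * ∏ i, a I i) ∧
        ∀ P ∈ S, ∀ y ∈ cube P.1 P.2, ∀ I,
          gOn k ((univ.pi fun _ => ball c (dil n B * s)) \
            (univ.pi fun _ => ball P.1 (dil n B * P.2))) (F I) y ≤ C * ∏ i, a I i := by
  obtain ⟨C₁, hC₁, h₁⟩ := hk.exists_gOn_diff_le_of_half hbd κ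
  have hdil := hk.dil_pos
  set v := volume (ball (0 : Rn n) 1) with hv
  have hvt : v ≠ ⊤ := volume_ball_ne_top _ _
  set Cq : ℝ≥0∞ := ENNReal.ofReal (dil n B) ^ n * v with hCq
  have hCqt : Cq ≠ ⊤ := by finiteness
  set M : ℝ≥0∞ := (Fintype.card κ : ℝ≥0∞) with hM
  have hMt : M ≠ ⊤ := ENNReal.natCast_ne_top _
  set T : ℝ≥0∞ := 2 ^ (n + 2) * (1 + (M + M * m) * Cq) with hT
  have hT0 : T ≠ 0 := by positivity
  have hTt : T ≠ ⊤ := by finiteness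
  set ε : ℝ≥0∞ := T⁻¹ with hε
  have hεT : T * ε = 1 := ENNReal.mul_inv_cancel hT0 hTt
  obtain ⟨L, hL, hweak⟩ := hk.exists_weak_type hbd (ε := ε) (ENNReal.inv_ne_zero.2 hTt)
    (ENNReal.inv_ne_top.2 hT0)
  set N : ℝ≥0∞ := 5 ^ n * T with hN
  have hNt : N ≠ ⊤ := by finiteness
  have hN0 : N ≠ 0 := mul_ne_zero (by positivity) hT0
  refine ⟨L + C₁ * N ^ m, by finiteness, ?_⟩
  intro c s F a hs hF ha hav
  set D := ball c (dil n B * s) with hD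
  have hDm : MeasurableSet D := measurableSet_ball
  have hDv : volume D = Cq * volume (cube c s) := volume_ball_mul_eq_cube c hdil hs
  set h : κ → Fin m → Rn n → ℝ≥0∞ := fun I i => D.indicator fun y => ENNReal.ofReal |F I i y|
    with hh
  set E₁ : Set (Rn n) := ⋃ I, {x | L * ∏ i, a I i < gOn k (univ.pi fun _ => D) (F I) x} with hE₁
  set E₂ : Set (Rn n) := ⋃ I, ⋃ i, {x | N * a I i < maxFn volume (h I i) x} with hE₂
  have hE₁m : MeasurableSet E₁ := MeasurableSet.iUnion fun I =>
    measurableSet_lt measurable_const (hk.measurable_gOn _ (hF I))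
  have hE₂m : MeasurableSet E₂ := MeasurableSet.iUnion fun I => MeasurableSet.iUnion fun i =>
    measurableSet_lt measurable_const (measurable_maxFn _ _)
  have hE₁v : volume E₁ ≤ M * (ε * volume D) := by
    refine (measure_iUnion_fintype_le _ _).trans ?_
    calc _ ≤ ∑ _I : κ, ε * volume D := Finset.sum_le_sum fun I _ =>
          hweak c _ (F I) (a I) (by positivity) (hF I) (ha I) (hav I)
      _ = _ := by rw [Finset.sum_const, Finset.card_univ, nsmul_eq_mul]
  have hE₂v : volume E₂ ≤ M * (m * (ε * volume D)) := by
    refine (measure_iUnion_fintype_le _ _).trans ?_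
    calc _ ≤ ∑ _I : κ, ∑ _i : Fin m, ε * volume D := Finset.sum_le_sum fun I _ =>
          (measure_iUnion_fintype_le _ _).trans (Finset.sum_le_sum fun i _ =>
            measure_lt_maxFn_le (ha I i) (by
              rw [hh, lintegral_indicator hDm]
              exact hav I i) hNt hN0 (by rw [hN, mul_assoc, hεT, mul_one]))
      _ = _ := by
          rw [Finset.sum_const, Finset.sum_const, Finset.card_univ, Finset.card_univ,
            Fintype.card_fin, nsmul_eq_mul, nsmul_eq_mul]
  have hEv : 2 ^ (n + 2) * volume ((E₁ ∪ E₂) ∩ cube c s) ≤ volume (cube c s) := by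
    calc _ ≤ 2 ^ (n + 2) * (M * (ε * volume D) + M * (m * (ε * volume D))) := by
          gcongr
          exact (measure_mono inter_subset_left).trans ((measure_union_le _ _).trans
            (add_le_add hE₁v hE₂v))
      _ = 2 ^ (n + 2) * ((M + M * m) * Cq) * ε * volume (cube c s) := by
          rw [hDv]
          ring
      _ ≤ T * ε * volume (cube c s) := by
          rw [hT]
          gcongr
          exact le_add_self
      _ = _ := by rw [hεT, one_mul]
  obtain ⟨S, hSc, hSd, hS, hSv, hoff⟩ := exists_stopping_cubes (hE₁m.union hE₂m) c hs hEv
  have hgood : ∀ x ∉ E₁ ∪ E₂, ∀ I, gOn k (univ.pi fun _ => D) (F I) x ≤ L * ∏ i, a I i := by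
    intro x hx I
    simp only [hE₁, mem_union, mem_iUnion, not_or, not_exists, mem_ofPred_eq, not_lt] at hx
    exact hx.1 I
  have hmax : ∀ x ∉ E₁ ∪ E₂, ∀ I i, maxFn volume (h I i) x ≤ N * a I i := by
    intro x hx I i
    simp only [hE₂, mem_union, mem_iUnion, not_or, not_exists, mem_ofPred_eq, not_lt] at hx
    exact hx.2 I i
  refine ⟨S, hSc, hSd, fun P hP => ⟨(hS P hP).1, (hS P hP).2.1, (hS P hP).2.2.1⟩, hSv, ?_, ?_⟩
  · filter_upwards [hoff] with y hy hyQ hyS I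
    refine (hgood y (hy hyQ hyS) I).trans ?_
    gcongr
    exact le_self_add
  · intro P hP y hy I
    obtain ⟨h1, h2, h3, h4⟩ := hS P hP
    refine (h₁ P.1 P.2 D (E₁ ∪ E₂) F (fun I i => N * a I i) (fun I => L * ∏ i, a I i) h1 hDm
      (hk.ball_dil_subset hs h1 h2 h3) hF (fun I i => ?_) (fun I i => by finiteness [ha I i]) h4
      hgood hmax y hy I).trans_eq ?_
    · refine integral_sub_ne (ne_top_of_le_ne_top ?_ (hav I i)) (hF I i)
      exact ENNReal.mul_ne_top (ha I i) (volume_ball_ne_top _ _)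
    · rw [Finset.prod_mul_distrib, Finset.prod_const, Finset.card_univ, Fintype.card_fin]
      ring

end SparseStepMain

section CommStep

/-- The functions obtained from `f` by multiplying the components in `I` by `e i - b i`. -/
def commFam (b f : Fin m → Rn n → ℝ) (e : Fin m → ℝ) (I : Finset (Fin m)) (i : Fin m) (y : Rn n) :
    ℝ :=
  if i ∈ I then (e i - b i y) * f i y else f i y

/-- The average of a nonnegative function over a set. -/
def avgOn (D : Set (Rn n)) (h : Rn n → ℝ≥0∞) : ℝ≥0∞ := (∫⁻ y in D, h y) / volume D

/-- The local oscillation form attached to a set in the sparse domination of a commutator. -/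
def oscForm (b f : Fin m → Rn n → ℝ) (e : Fin m → ℝ) (D : Set (Rn n)) (x : Rn n) : ℝ≥0∞ :=
  ∏ i, (ENNReal.ofReal |b i x - e i| * avgOn D (fun y => ENNReal.ofReal |f i y|) +
    avgOn D fun y => ENNReal.ofReal |b i y - e i| * ENNReal.ofReal |f i y|)

lemma measurable_commFam {b f : Fin m → Rn n → ℝ} (hb : ∀ i, Measurable (b i))
    (hf : ∀ i, Measurable (f i)) (e : Fin m → ℝ) (I : Finset (Fin m)) (i : Fin m) :
    Measurable (commFam b f e I i) := by
  unfold commFam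
  split_ifs
  · exact (measurable_const.sub (hb i)).mul (hf i)
  · exact hf i

lemma prod_comm_eq_sum_commFam (b f : Fin m → Rn n → ℝ) (e : Fin m → ℝ) (x : Rn n)
    (y : Fin m → Rn n) :
    ∏ i, (b i x - b i (y i)) * f i (y i) =
      ∑ I : Finset (Fin m), (∏ i ∈ Iᶜ, (b i x - e i)) * ∏ i, commFam b f e I i (y i) := by
  have h1 : ∀ i, (b i x - b i (y i)) * f i (y i) =
      (e i - b i (y i)) * f i (y i) + (b i x - e i) * f i (y i) := fun i => by ring
  simp_rw [h1]
  rw [Finset.prod_add, Finset.powerset_univ]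
  refine Finset.sum_congr rfl fun I _ => ?_
  rw [← Finset.compl_eq_univ_sdiff, Finset.prod_mul_distrib (s := Iᶜ),
    ← Finset.prod_mul_prod_compl I (fun i => commFam b f e I i (y i))]
  have h2 : ∏ i ∈ I, commFam b f e I i (y i) = ∏ i ∈ I, (e i - b i (y i)) * f i (y i) :=
    Finset.prod_congr rfl fun i hi => if_pos hi
  have h3 : ∏ i ∈ Iᶜ, commFam b f e I i (y i) = ∏ i ∈ Iᶜ, f i (y i) :=
    Finset.prod_congr rfl fun i hi => if_neg (Finset.mem_compl.1 hi)
  rw [h2, h3]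
  ring

lemma sum_prod_avgOn_commFam (b f : Fin m → Rn n → ℝ) (e : Fin m → ℝ) (D : Set (Rn n)) (x : Rn n) :
    ∑ I : Finset (Fin m), (∏ i ∈ Iᶜ, ENNReal.ofReal |b i x - e i|) *
      ∏ i, avgOn D (fun y => ENNReal.ofReal |commFam b f e I i y|) = oscForm b f e D x := by
  unfold oscForm
  simp_rw [add_comm (ENNReal.ofReal |b _ x - e _| * _)]
  rw [Finset.prod_add, Finset.powerset_univ]
  refine Finset.sum_congr rfl fun I _ => ?_
  rw [← Finset.compl_eq_univ_sdiff, Finset.prod_mul_distrib (s := Iᶜ),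
    ← Finset.prod_mul_prod_compl I (fun i => avgOn D _)]
  have h2 : ∏ i ∈ I, avgOn D (fun y => ENNReal.ofReal |commFam b f e I i y|) =
      ∏ i ∈ I, avgOn D (fun y => ENNReal.ofReal |b i y - e i| * ENNReal.ofReal |f i y|) :=
    Finset.prod_congr rfl fun i hi => by
      refine congrArg (avgOn D) (funext fun y => ?_)
      rw [commFam, if_pos hi, abs_mul, ENNReal.ofReal_mul (abs_nonneg _), abs_sub_comm]
  have h3 : ∏ i ∈ Iᶜ, avgOn D (fun y => ENNReal.ofReal |commFam b f e I i y|) =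
      ∏ i ∈ Iᶜ, avgOn D (fun y => ENNReal.ofReal |f i y|) :=
    Finset.prod_congr rfl fun i hi => by
      refine congrArg (avgOn D) (funext fun y => ?_)
      rw [commFam, if_neg (Finset.mem_compl.1 hi)]
  rw [h2, h3]
  ring

lemma setLIntegral_eq_avgOn_mul {c : Rn n} {r : ℝ} (hr : 0 < r) (h : Rn n → ℝ≥0∞) :
    ∫⁻ y in ball c r, h y = avgOn (ball c r) h * volume (ball c r) := by
  rw [avgOn, ENNReal.div_mul_cancel (volume_ball_pos c hr).ne' (volume_ball_ne_top c r)]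

lemma avgOn_ball_ne_top {c : Rn n} {r : ℝ} (hr : 0 < r) {h : Rn n → ℝ≥0∞}
    (hh : ∫⁻ y in ball c r, h y ≠ ⊤) : avgOn (ball c r) h ≠ ⊤ :=
  (ENNReal.div_lt_top hh (volume_ball_pos c hr).ne').ne

lemma lintegral_commFam_ne_top {b f : Fin m → Rn n → ℝ} {e : Fin m → ℝ} {D : Set (Rn n)}
    (hfi : ∀ i, ∫⁻ y in D, ENNReal.ofReal |f i y| ≠ ⊤)
    (hbfi : ∀ i, ∫⁻ y in D, ENNReal.ofReal |b i y - e i| * ENNReal.ofReal |f i y| ≠ ⊤)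
    (I : Finset (Fin m)) (i : Fin m) :
    ∫⁻ y in D, ENNReal.ofReal |commFam b f e I i y| ≠ ⊤ := by
  by_cases hi : i ∈ I
  · simp only [commFam, if_pos hi, abs_mul, ENNReal.ofReal_mul (abs_nonneg _), abs_sub_comm (e i)]
    exact hbfi i
  · simp only [commFam, if_neg hi]
    exact hfi i

variable {k : (Fin m → Rn n) → ℝ} {A γ δ B : ℝ}

lemma LPKernel.gOn_comm_le (hk : LPKernel k A γ δ B) {b f : Fin m → Rn n → ℝ}
    (hb : ∀ i, Measurable (b i)) (hf : ∀ i, Measurable (f i)) {e : Fin m → ℝ} {D : Set (Rn n)}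
    {X : Set (Fin m → Rn n)} (hX : X ⊆ univ.pi fun _ => D)
    (hfi : ∀ i, ∫⁻ y in D, ENNReal.ofReal |f i y| ≠ ⊤)
    (hbfi : ∀ i, ∫⁻ y in D, ENNReal.ofReal |b i y - e i| * ENNReal.ofReal |f i y| ≠ ⊤)
    (x : Rn n) :
    gOn k X (fun i y => (b i x - b i y) * f i y) x ≤
      ∑ I : Finset (Fin m), (∏ i ∈ Iᶜ, ENNReal.ofReal |b i x - e i|) *
        gOn k X (commFam b f e I) x := by
  have hF := measurable_commFam hb hf e
  have hFi : ∀ I i, IntegrableOn (commFam b f e I i) D := fun I i =>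
    integral_sub_ne (lintegral_commFam_ne_top hfi hbfi I i) (hF I i)
  calc gOn k X (fun i y => (b i x - b i y) * f i y) x ≤ sqNorm fun t => ∑ I : Finset (Fin m),
        (∏ i ∈ Iᶜ, ENNReal.ofReal |b i x - e i|) *
          ENNReal.ofReal |∫ y in X, kt k t x y * ∏ i, commFam b f e I i (y i)| := by
        refine sqNorm_mono fun t ht => ?_
        have h1 : ∫ y in X, kt k t x y * ∏ i, (b i x - b i (y i)) * f i (y i) =
            ∑ I : Finset (Fin m), (∏ i ∈ Iᶜ, (b i x - e i)) *
              ∫ y in X, kt k t x y * ∏ i, commFam b f e I i (y i) := by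
          simp_rw [← integral_const_mul]
          rw [← integral_finsetSum _ fun I _ =>
            (hk.integrableOn ht x (D := fun _ => D) (hFi I) hX).const_mul _]
          refine integral_congr_ae (.of_forall fun y => ?_)
          simp only [prod_comm_eq_sum_commFam b f e x y, Finset.mul_sum]
          exact Finset.sum_congr rfl fun I _ => by ring
        simp only [h1]
        calc _ ≤ ENNReal.ofReal (∑ I : Finset (Fin m), |(∏ i ∈ Iᶜ, (b i x - e i)) *
              ∫ y in X, kt k t x y * ∏ i, commFam b f e I i (y i)|) :=
              ENNReal.ofReal_le_ofReal (Finset.abs_sum_le_sum_abs _ _)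
          _ = _ := by
              rw [ENNReal.ofReal_sum_of_nonneg fun _ _ => abs_nonneg _]
              refine Finset.sum_congr rfl fun I _ => ?_
              rw [abs_mul, ENNReal.ofReal_mul (abs_nonneg _), Finset.abs_prod,
                ENNReal.ofReal_prod_of_nonneg fun _ _ => abs_nonneg _]
    _ ≤ ∑ I : Finset (Fin m), sqNorm fun t => (∏ i ∈ Iᶜ, ENNReal.ofReal |b i x - e i|) *
          ENNReal.ofReal |∫ y in X, kt k t x y * ∏ i, commFam b f e I i (y i)| :=
        sqNorm_finset_sum_le _ fun I => (hk.measurable_integral_left X (hF I) x).const_mul _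
    _ = _ := by
        refine Finset.sum_congr rfl fun I _ => ?_
        rw [sqNorm_const_mul (ENNReal.prod_ne_top fun i _ => ENNReal.ofReal_ne_top)]
        rfl

lemma LPKernel.gOn_le_add_diff (hk : LPKernel k A γ δ B) {F : Fin m → Rn n → ℝ}
    (hF : ∀ i, Measurable (F i)) {D P : Set (Rn n)} (hP : MeasurableSet P) (hPD : P ⊆ D)
    (hFi : ∀ i, IntegrableOn (F i) D) (x : Rn n) :
    gOn k (univ.pi fun _ => D) F x ≤ gOn k (univ.pi fun _ => P) F x +
      gOn k ((univ.pi fun _ => D) \ (univ.pi fun _ => P)) F x := by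
  set U : Set (Fin m → Rn n) := univ.pi fun _ => D with hU
  set W : Set (Fin m → Rn n) := univ.pi fun _ => P with hW
  have hWm : MeasurableSet W := MeasurableSet.univ_pi fun _ => hP
  calc gOn k U F x ≤ sqNorm fun t => ENNReal.ofReal |∫ y in W, kt k t x y * ∏ i, F i (y i)| +
        ENNReal.ofReal |∫ y in U \ W, kt k t x y * ∏ i, F i (y i)| := by
        refine sqNorm_mono fun t ht => ?_
        have h1 := setIntegral_sdiff hWm (hk.integrableOn ht x (D := fun _ => D) hFi le_rfl)
          (Set.pi_mono fun _ _ => hPD : W ⊆ U)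
        rw [← ENNReal.ofReal_add (abs_nonneg _) (abs_nonneg _)]
        refine ENNReal.ofReal_le_ofReal ?_
        rw [h1]
        simpa using abs_add_le (∫ y in W, kt k t x y * ∏ i, F i (y i))
          ((∫ y in U, kt k t x y * ∏ i, F i (y i)) - ∫ y in W, kt k t x y * ∏ i, F i (y i))
    _ ≤ _ := sqNorm_add_le (hk.measurable_integral_left _ hF x)
        (hk.measurable_integral_left _ hF x)

theorem LPKernel.exists_comm_step [NeZero n] [NeZero m] (hk : LPKernel k A γ δ B)
    (hbd : GBdd k) :
    ∃ C : ℝ≥0∞, C ≠ ⊤ ∧ ∀ (b f : Fin m → Rn n → ℝ), (∀ i, Measurable (b i)) →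
      (∀ i, Measurable (f i)) → ∀ (c : Rn n) (s : ℝ) (e : Fin m → ℝ), 0 < s →
      (∀ i, ∫⁻ y in ball c (dil n B * s), ENNReal.ofReal |f i y| ≠ ⊤) →
      (∀ i, ∫⁻ y in ball c (dil n B * s),
        ENNReal.ofReal |b i y - e i| * ENNReal.ofReal |f i y| ≠ ⊤) →
      ∃ S : Set (Rn n × ℝ), S.Countable ∧ S.PairwiseDisjoint (fun P => cube P.1 P.2) ∧
        (∀ P ∈ S, 0 < P.2 ∧ P.2 ≤ s / 2 ∧ cube P.1 P.2 ⊆ cube c s) ∧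
        2 * volume (⋃ P ∈ S, cube P.1 P.2) ≤ volume (cube c s) ∧
        ∀ᵐ x, x ∈ cube c s →
          gOn k (univ.pi fun _ => ball c (dil n B * s)) (fun i y => (b i x - b i y) * f i y) x ≤
            C * oscForm b f e (ball c (dil n B * s)) x +
              ∑' P : S, (cube P.1.1 P.1.2).indicator (fun x =>
                gOn k (univ.pi fun _ => ball P.1.1 (dil n B * P.1.2))
                  (fun i y => (b i x - b i y) * f i y) x) x := by
  obtain ⟨C, hC, h⟩ := hk.exists_sparse_step hbd (Finset (Fin m))
  have hdil := hk.dil_pos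
  refine ⟨C, hC, ?_⟩
  intro b f hb hf c s e hs hfi hbfi
  set D := ball c (dil n B * s) with hD
  have hds : 0 < dil n B * s := by positivity
  have hF := measurable_commFam hb hf e
  have hFt := lintegral_commFam_ne_top hfi hbfi
  obtain ⟨S, hSc, hSd, hS, hSv, hoff, hdiff⟩ := h c s (commFam b f e)
    (fun I i => avgOn D fun y => ENNReal.ofReal |commFam b f e I i y|) hs hF
    (fun I i => avgOn_ball_ne_top hds (hFt I i))
    (fun I i => (setLIntegral_eq_avgOn_mul hds _).le)
  refine ⟨S, hSc, hSd, hS, hSv, ?_⟩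
  have hsum : ∀ (X : Set (Fin m → Rn n)), X ⊆ (univ.pi fun _ => D) → ∀ x,
      (∀ I, gOn k X (commFam b f e I) x ≤
        C * ∏ i, avgOn D fun y => ENNReal.ofReal |commFam b f e I i y|) →
      gOn k X (fun i y => (b i x - b i y) * f i y) x ≤ C * oscForm b f e D x := by
    intro X hX x hx
    refine (hk.gOn_comm_le hb hf hX hfi hbfi x).trans ?_
    rw [← sum_prod_avgOn_commFam, Finset.mul_sum]
    refine Finset.sum_le_sum fun I _ => ?_
    refine (mul_le_mul' le_rfl (hx I)).trans_eq ?_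
    ring
  filter_upwards [hoff] with x hx hxQ
  by_cases hxS : x ∈ ⋃ P ∈ S, cube P.1 P.2
  · simp only [mem_iUnion] at hxS
    obtain ⟨P, hP, hxP⟩ := hxS
    obtain ⟨h1, h2, h3⟩ := hS P hP
    have hcomm : ∀ i, IntegrableOn (fun y => (b i x - b i y) * f i y) D := fun i => by
      have h4 : IntegrableOn (fun y => (b i x - e i) * f i y) D :=
        (integral_sub_ne (hfi i) (hf i)).const_mul _
      have h5 : IntegrableOn (commFam b f e Finset.univ i) D :=
        integral_sub_ne (hFt Finset.univ i) (hF Finset.univ i)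
      refine (h4.add h5).congr (.of_forall fun y => ?_)
      simp only [Pi.add_apply, commFam, if_pos (Finset.mem_univ i)]
      ring
    refine (hk.gOn_le_add_diff (fun i => (measurable_const.sub (hb i)).mul (hf i))
      (measurableSet_ball (x := P.1) (ε := dil n B * P.2)) (hk.ball_dil_subset hs h1 h2 h3) hcomm
      x).trans ?_
    rw [add_comm]
    refine add_le_add (hsum _ sdiff_subset x fun I => hdiff P hP x hxP I) ?_
    refine le_trans (le_of_eq ?_) (ENNReal.le_tsum (⟨P, hP⟩ : S))
    rw [indicator_of_mem hxP]
    rfl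
  · exact (hsum _ le_rfl x (hx hxQ hxS)).trans le_self_add

end CommStep

section SparseDomination

theorem exists_sparse_of_step {Val : Rn n × ℝ → Prop} {g T : Rn n × ℝ → Rn n → ℝ≥0∞}
    (hpos : ∀ Q, Val Q → 0 < Q.2)
    (hstep : ∀ Q, Val Q → ∃ S : Set (Rn n × ℝ), S.Countable ∧
      S.PairwiseDisjoint (fun P => cube P.1 P.2) ∧
      (∀ P ∈ S, Val P ∧ cube P.1 P.2 ⊆ cube Q.1 Q.2) ∧
      2 * volume (⋃ P ∈ S, cube P.1 P.2) ≤ volume (cube Q.1 Q.2) ∧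
      ∀ᵐ x, x ∈ cube Q.1 Q.2 → g Q x ≤ T Q x +
        ∑' P : S, (cube P.1.1 P.1.2).indicator (g P.1) x)
    {Q₀ : Rn n × ℝ} (hQ₀ : Val Q₀) :
    ∃ (ι : Type) (_ : Countable ι) (Q : ι → Rn n × ℝ) (E : ι → Set (Rn n)),
      (∀ q, Val (Q q)) ∧
      (∀ q, MeasurableSet (E q) ∧ E q ⊆ cube (Q q).1 (Q q).2 ∧
        volume (cube (Q q).1 (Q q).2) ≤ 2 * volume (E q)) ∧
      Pairwise (Disjoint on E) ∧
      ∀ᵐ x, x ∈ cube Q₀.1 Q₀.2 → g Q₀ x ≤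
        ∑' q, (cube (Q q).1 (Q q).2).indicator (T (Q q)) x := by
  choose! ch hchc hchd hch hchv hchg using hstep
  let gen : ℕ → Set (Rn n × ℝ) := fun k => Nat.rec {Q₀} (fun _ G => ⋃ Q ∈ G, ch Q) k
  have hgen0 : gen 0 = {Q₀} := rfl
  have hgenS : ∀ k, gen (k + 1) = ⋃ Q ∈ gen k, ch Q := fun k => rfl
  clear_value gen
  have hmemS : ∀ {k Q P}, Q ∈ gen k → P ∈ ch Q → P ∈ gen (k + 1) := fun {k Q P} hQ hP => by
    rw [hgenS]
    exact mem_biUnion hQ hP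
  have hV : ∀ k, ∀ Q ∈ gen k, Val Q := by
    intro k
    induction k with
    | zero =>
      intro Q hQ
      rw [hgen0, mem_singleton_iff] at hQ
      rwa [hQ]
    | succ k ih =>
      intro P hP
      simp only [hgenS, mem_iUnion] at hP
      obtain ⟨Q, hQ, hP⟩ := hP
      exact (hch Q (ih Q hQ) P hP).1
  have hc : ∀ k, (gen k).Countable := by
    intro k
    induction k with
    | zero => rw [hgen0]; exact countable_singleton _
    | succ k ih => rw [hgenS]; exact ih.biUnion fun Q hQ => hchc Q (hV k Q hQ)
  have hd : ∀ k, (gen k).PairwiseDisjoint (fun P => cube P.1 P.2) := by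
    intro k
    induction k with
    | zero => rw [hgen0]; exact pairwiseDisjoint_singleton _ _
    | succ k ih =>
      intro P hP P' hP' hne
      simp only [hgenS, mem_iUnion] at hP hP'
      obtain ⟨Q, hQ, hP⟩ := hP
      obtain ⟨Q', hQ', hP'⟩ := hP'
      by_cases h : Q = Q'
      · subst h
        exact hchd Q (hV k Q hQ) hP hP' hne
      · exact (ih hQ hQ' h).mono (hch Q (hV k Q hQ) P hP).2 (hch Q' (hV k Q' hQ') P' hP').2
  set U : ℕ → Set (Rn n) := fun k => ⋃ Q ∈ gen k, cube Q.1 Q.2 with hU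
  have hmemU : ∀ {k Q x}, Q ∈ gen k → x ∈ cube Q.1 Q.2 → x ∈ U k := fun {k Q x} hQ hx =>
    mem_biUnion (x := Q) hQ hx
  have hUm : ∀ k, MeasurableSet (U k) := fun k =>
    MeasurableSet.biUnion (hc k) fun Q _ => measurableSet_cube _ _
  have hUS : ∀ k, U (k + 1) = ⋃ Q ∈ gen k, ⋃ P ∈ ch Q, cube P.1 P.2 := fun k => by
    simp only [hU, hgenS, biUnion_iUnion]
  have hUanti : Antitone U := antitone_nat_of_succ_le fun k => by
    rw [hUS]
    exact iUnion₂_mono fun Q hQ => iUnion₂_subset fun P hP => (hch Q (hV k Q hQ) P hP).2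
  have hUv : ∀ k, 2 ^ k * volume (U k) ≤ volume (cube Q₀.1 Q₀.2) := by
    intro k
    induction k with
    | zero => simp [hU, hgen0]
    | succ k ih =>
      have := (hc k).to_subtype
      refine le_trans ?_ ih
      calc 2 ^ (k + 1) * volume (U (k + 1)) = 2 ^ k * (2 * volume (U (k + 1))) := by ring
        _ ≤ 2 ^ k * (2 * ∑' Q : gen k, volume (⋃ P ∈ ch Q.1, cube P.1 P.2)) := by
            gcongr
            rw [hUS]
            exact measure_biUnion_le _ (hc k) _
        _ = 2 ^ k * ∑' Q : gen k, 2 * volume (⋃ P ∈ ch Q.1, cube P.1 P.2) := by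
            rw [ENNReal.tsum_mul_left]
        _ ≤ 2 ^ k * ∑' Q : gen k, volume (cube Q.1.1 Q.1.2) := by
            gcongr with Q
            exact hchv Q.1 (hV k Q.1 Q.2)
        _ = 2 ^ k * volume (U k) := by
            rw [hU, measure_biUnion (hc k) (hd k) fun Q _ => measurableSet_cube _ _]
  have hnull : volume (⋂ k, U k) = 0 := by
    by_contra h0
    have h1 : ∀ k : ℕ, (k : ℝ≥0∞) * volume (⋂ k, U k) ≤ volume (cube Q₀.1 Q₀.2) := fun k => by
      refine le_trans (mul_le_mul' ?_ (measure_mono (iInter_subset _ k))) (hUv k)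
      exact_mod_cast (Nat.lt_two_pow_self (n := k)).le
    obtain ⟨k, hk⟩ := ENNReal.exists_nat_mul_gt h0 (volume_cube_ne_top Q₀.1 Q₀.2)
    exact (h1 k).not_gt hk
  have hctb : ∀ k, Countable (gen k) := fun k => (hc k).to_subtype
  refine ⟨Σ k, gen k, inferInstance, fun q => q.2.1, fun q => cube q.2.1.1 q.2.1.2 \ U (q.1 + 1),
    fun q => hV q.1 _ q.2.2, fun q => ⟨(measurableSet_cube _ _).diff (hUm _), sdiff_subset, ?_⟩,
    ?_, ?_⟩
  · obtain ⟨k, Q, hQ⟩ := q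
    simp only
    have hsub : cube Q.1 Q.2 ∩ U (k + 1) ⊆ ⋃ P ∈ ch Q, cube P.1 P.2 := by
      rintro x ⟨hx, hxU⟩
      rw [hUS] at hxU
      obtain ⟨Q', hQ', hx'⟩ := mem_iUnion₂.1 hxU
      obtain ⟨P, hP, hxP⟩ := mem_iUnion₂.1 hx'
      have hxQ' := (hch Q' (hV k Q' hQ') P hP).2 hxP
      have : Q = Q' := by
        by_contra hne
        exact disjoint_left.1 (hd k hQ hQ' hne) hx hxQ'
      exact this ▸ hx'
    have h1 := measure_sdiff_add_inter (μ := volume) (cube Q.1 Q.2) (hUm (k + 1))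
    have h2 := (mul_le_mul_right (measure_mono hsub) 2).trans (hchv Q (hV k Q hQ))
    have hf := volume_cube_ne_top Q.1 Q.2
    refine (ENNReal.add_le_add_iff_right hf).1 ?_
    calc volume (cube Q.1 Q.2) + volume (cube Q.1 Q.2)
        = 2 * volume (cube Q.1 Q.2 \ U (k + 1)) + 2 * volume (cube Q.1 Q.2 ∩ U (k + 1)) := by
          rw [← mul_add, h1, two_mul]
      _ ≤ _ := by gcongr
  · have hlt : ∀ k l, k < l → ∀ Q : Rn n × ℝ, ∀ Q' ∈ gen l,
        Disjoint (cube Q.1 Q.2 \ U (k + 1)) (cube Q'.1 Q'.2 \ U (l + 1)) := by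
      intro k l hkl Q Q' hQ'
      rw [disjoint_left]
      exact fun x hx hx' => hx.2 (hUanti hkl (hmemU hQ' hx'.1))
    rintro ⟨k, Q, hQ⟩ ⟨l, Q', hQ'⟩ hne
    simp only [onFun]
    rcases lt_trichotomy k l with h | rfl | h
    · exact hlt k l h Q Q' hQ'
    · have : Q ≠ Q' := fun h => hne (by subst h; rfl)
      exact (hd k hQ hQ' this).mono sdiff_subset sdiff_subset
    · exact (hlt l k h Q' Q hQ).symm
  · have hae : ∀ᵐ x, ∀ k, ∀ Q ∈ gen k, x ∈ cube Q.1 Q.2 → g Q x ≤ T Q x +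
        ∑' P : ch Q, (cube P.1.1 P.1.2).indicator (g P.1) x :=
      ae_all_iff.2 fun k => (ae_ball_iff (hc k)).2 fun Q hQ => hchg Q (hV k Q hQ)
    have hout : ∀ᵐ x : Rn n, x ∉ ⋂ k, U k := measure_eq_zero_iff_ae_notMem.1 hnull
    filter_upwards [hae, hout] with x hx hxU hx0
    set V : ℕ → ℝ≥0∞ := fun k => ∑' Q : gen k, (cube Q.1.1 Q.1.2).indicator (T Q.1) x with hVdef
    have main : ∀ j k, ∀ Q ∈ gen k, x ∈ cube Q.1 Q.2 → x ∉ U (k + j) →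
        g Q x ≤ ∑ i ∈ Finset.range j, V (k + i) := by
      intro j
      induction j with
      | zero => exact fun k Q hQ hxQ h => absurd (hmemU hQ hxQ) h
      | succ j ih =>
        intro k Q hQ hxQ hxn
        have hTV : T Q x ≤ V k := by
          refine le_trans (le_of_eq ?_) (ENNReal.le_tsum (⟨Q, hQ⟩ : gen k))
          rw [indicator_of_mem hxQ]
        have hrest : ∑' P : ch Q, (cube P.1.1 P.1.2).indicator (g P.1) x ≤
            ∑ i ∈ Finset.range j, V (k + 1 + i) := by
          by_cases hP : ∃ P ∈ ch Q, x ∈ cube P.1 P.2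
          · obtain ⟨P, hP, hxP⟩ := hP
            rw [tsum_eq_single (⟨P, hP⟩ : ch Q) fun P' hne => indicator_of_notMem (fun hxP' =>
              disjoint_left.1 (hchd Q (hV k Q hQ) P'.2 hP fun h => hne (Subtype.ext h)) hxP' hxP) _,
              indicator_of_mem hxP]
            exact ih (k + 1) P (hmemS hQ hP) hxP (by rwa [add_assoc, add_comm 1])
          · push Not at hP
            refine le_trans (le_of_eq ?_) zero_le
            exact ENNReal.tsum_eq_zero.2 fun P => indicator_of_notMem (hP P.1 P.2) _
        rw [Finset.sum_range_succ']
        calc g Q x ≤ T Q x + ∑' P : ch Q, (cube P.1.1 P.1.2).indicator (g P.1) x := hx k Q hQ hxQ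
          _ ≤ V k + ∑ i ∈ Finset.range j, V (k + 1 + i) := add_le_add hTV hrest
          _ = _ := by
              rw [add_comm, add_zero]
              exact congrArg (· + _) (Finset.sum_congr rfl fun i _ => by
                rw [add_assoc, add_comm 1])
    simp only [mem_iInter, not_forall] at hxU
    obtain ⟨K, hK⟩ := hxU
    calc g Q₀ x ≤ ∑ i ∈ Finset.range K, V (0 + i) :=
          main K 0 Q₀ (by rw [hgen0]; exact mem_singleton _) hx0 (by rwa [zero_add])
      _ ≤ ∑' i, V i := by
          simp only [zero_add]
          exact ENNReal.sum_le_tsum _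
      _ = _ := (ENNReal.tsum_sigma' fun q : (Σ k, gen k) =>
          (cube q.2.1.1 q.2.1.2).indicator (T q.2.1) x).symm

end SparseDomination

section SparseDomination

variable {k : (Fin m → Rn n) → ℝ} {A γ δ B : ℝ}

lemma lintegral_osc_mul_ne_top {D : Set (Rn n)} {g h : Rn n → ℝ} (hh : Measurable h) {u v : ℝ}
    (h1 : ∫⁻ y in D, ENNReal.ofReal |h y| ≠ ⊤)
    (h2 : ∫⁻ y in D, ENNReal.ofReal |g y - u| * ENNReal.ofReal |h y| ≠ ⊤) :
    ∫⁻ y in D, ENNReal.ofReal |g y - v| * ENNReal.ofReal |h y| ≠ ⊤ := by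
  have hm : Measurable fun y => ENNReal.ofReal |h y| := ENNReal.measurable_ofReal.comp hh.abs
  refine ne_top_of_le_ne_top (b := (∫⁻ y in D, ENNReal.ofReal |g y - u| * ENNReal.ofReal |h y|) +
    ENNReal.ofReal |u - v| * ∫⁻ y in D, ENNReal.ofReal |h y|)
    (ENNReal.add_ne_top.2 ⟨h2, ENNReal.mul_ne_top ENNReal.ofReal_ne_top h1⟩) ?_
  rw [← lintegral_const_mul _ hm, ← lintegral_add_right _ (hm.const_mul _)]
  refine lintegral_mono fun y => ?_
  rw [← add_mul]
  refine mul_le_mul' ?_ le_rfl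
  rw [← ENNReal.ofReal_add (abs_nonneg _) (abs_nonneg _)]
  exact ENNReal.ofReal_le_ofReal (abs_sub_le _ _ _)

theorem LPKernel.exists_sparse_domination [NeZero n] [NeZero m] (hk : LPKernel k A γ δ B)
    (hbd : GBdd k) :
    ∃ C : ℝ≥0∞, C ≠ ⊤ ∧ ∀ (b f : Fin m → Rn n → ℝ), (∀ i, Measurable (b i)) →
      (∀ i, Measurable (f i)) → ∀ (e : Rn n × ℝ → Fin m → ℝ) (c : Rn n) (s : ℝ), 0 < s →
      (∀ i, ∫⁻ y in ball c (dil n B * s), ENNReal.ofReal |f i y| ≠ ⊤) →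
      (∀ i, ∫⁻ y in ball c (dil n B * s),
        ENNReal.ofReal |b i y - e (c, s) i| * ENNReal.ofReal |f i y| ≠ ⊤) →
      ∃ (ι : Type) (_ : Countable ι) (Q : ι → Rn n × ℝ) (E : ι → Set (Rn n)),
        (∀ q, 0 < (Q q).2 ∧ ball (Q q).1 (dil n B * (Q q).2) ⊆ ball c (dil n B * s)) ∧
        (∀ q, MeasurableSet (E q) ∧ E q ⊆ cube (Q q).1 (Q q).2 ∧
          volume (cube (Q q).1 (Q q).2) ≤ 2 * volume (E q)) ∧
        Pairwise (Disjoint on E) ∧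
        ∀ᵐ x, x ∈ cube c s →
          gOn k (univ.pi fun _ => ball c (dil n B * s)) (fun i y => (b i x - b i y) * f i y) x ≤
            ∑' q, (cube (Q q).1 (Q q).2).indicator
              (fun x => C * oscForm b f (e (Q q)) (ball (Q q).1 (dil n B * (Q q).2)) x) x := by
  obtain ⟨C, hC, h⟩ := hk.exists_comm_step hbd
  refine ⟨C, hC, ?_⟩
  intro b f hb hf e c s hs hfi hbfi
  obtain ⟨ι, hι, Q, E, hQ, hE, hdisj, hle⟩ := exists_sparse_of_step
    (Val := fun Q : Rn n × ℝ => 0 < Q.2 ∧ ball Q.1 (dil n B * Q.2) ⊆ ball c (dil n B * s))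
    (g := fun Q x => gOn k (univ.pi fun _ => ball Q.1 (dil n B * Q.2))
      (fun i y => (b i x - b i y) * f i y) x)
    (T := fun Q x => C * oscForm b f (e Q) (ball Q.1 (dil n B * Q.2)) x)
    (fun Q hQ => hQ.1) (by
      rintro ⟨z, l⟩ ⟨hl, hzl⟩
      obtain ⟨S, hSc, hSd, hS, hSv, hx⟩ := h b f hb hf z l (e (z, l)) hl
        (fun i => ne_top_of_le_ne_top (hfi i) (lintegral_mono_set hzl))
        (fun i => ne_top_of_le_ne_top
          (lintegral_osc_mul_ne_top (v := e (z, l) i) (hf i) (hfi i) (hbfi i))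
          (lintegral_mono_set hzl))
      exact ⟨S, hSc, hSd, fun P hP => ⟨⟨(hS P hP).1, (hk.ball_dil_subset hl (hS P hP).1
        (hS P hP).2.1 (hS P hP).2.2).trans hzl⟩, (hS P hP).2.2⟩, hSv, hx⟩)
    (Q₀ := (c, s)) ⟨hs, le_rfl⟩
  exact ⟨ι, hι, Q, E, hQ, hE, hdisj, hle⟩

end SparseDomination

section SparseSums

/-- A family of cubes with pairwise disjoint subsets of at least half of their volume. -/
structure SparseFam {ι : Type} (Q : ι → Rn n × ℝ) (E : ι → Set (Rn n)) : Prop where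
  pos : ∀ q, 0 < (Q q).2
  meas : ∀ q, MeasurableSet (E q)
  subset : ∀ q, E q ⊆ cube (Q q).1 (Q q).2
  half : ∀ q, volume (cube (Q q).1 (Q q).2) ≤ 2 * volume (E q)
  disj : Pairwise (Disjoint on E)

lemma tsum_rpow_le_tsum {ι : Type} (a : ι → ℝ≥0∞) {p : ℝ} (hp : 0 < p) (hp1 : p ≤ 1) :
    (∑' i, a i) ^ p ≤ ∑' i, a i ^ p := by
  have hfin : ∀ s : Finset ι, (∑ i ∈ s, a i) ^ p ≤ ∑ i ∈ s, a i ^ p := by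
    classical
    intro s
    induction s using Finset.induction_on with
    | empty => simp [hp]
    | insert i s hi ih =>
      rw [Finset.sum_insert hi, Finset.sum_insert hi]
      exact (ENNReal.rpow_add_le_add_rpow _ _ hp.le hp1).trans (add_le_add le_rfl ih)
  rw [← ENNReal.le_rpow_inv_iff hp, ENNReal.tsum_eq_iSup_sum]
  refine iSup_le fun s => ?_
  rw [ENNReal.le_rpow_inv_iff hp]
  exact (hfin s).trans (ENNReal.sum_le_tsum s)

/-- A function is bounded in `L^p` by its norm as a functional on the dual space. -/
lemma lintegral_rpow_le_of_dual {μ : Measure (Rn n)} (hμ : ∀ r, μ (ball 0 r) ≠ ⊤)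
    {p q : ℝ} (hpq : p.HolderConjugate q) {F : Rn n → ℝ≥0∞} (hF : Measurable F) {K : ℝ≥0∞}
    (h : ∀ g : Rn n → ℝ≥0∞, Measurable g → ∫⁻ x, F x * g x ∂μ ≤ K * (∫⁻ x, g x ^ q ∂μ) ^ (1 / q)) :
    ∫⁻ x, F x ^ p ∂μ ≤ K ^ p := by
  have hp := hpq.pos
  have hq := hpq.symm.pos
  let G : ℕ → Rn n → ℝ≥0∞ := fun j => (ball 0 (j : ℝ)).indicator fun x => min (F x) j
  have hGm : ∀ j, Measurable (G j) := fun j => (hF.min measurable_const).indicator measurableSet_ball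
  have hGF : ∀ j x, G j x ≤ F x := fun j x => by
    by_cases hx : x ∈ ball (0 : Rn n) (j : ℝ)
    · simp only [G, indicator_of_mem hx]; exact min_le_left _ _
    · simp only [G, indicator_of_notMem hx]; exact zero_le
  have hmono : ∀ x, Monotone fun j => G j x := fun x i j hij => by
    have hc : (i : ℝ) ≤ j := by exact_mod_cast hij
    by_cases hx : x ∈ ball (0 : Rn n) (i : ℝ)
    · simp only [G, indicator_of_mem hx, indicator_of_mem (ball_subset_ball hc hx)]
      exact min_le_min le_rfl (by exact_mod_cast hij)
    · simp only [G, indicator_of_notMem hx]; exact zero_le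
  have hsup : ∀ x, ⨆ j, G j x = F x := fun x => by
    refine le_antisymm (iSup_le fun j => hGF j x) ?_
    refine le_of_forall_lt fun l hl => ?_
    obtain ⟨N, hN⟩ := ENNReal.exists_nat_gt hl.ne_top
    obtain ⟨N', hN'⟩ := exists_nat_gt ‖x‖
    refine lt_of_lt_of_le ?_ (le_iSup (fun j => G j x) (max N N'))
    have hx : x ∈ ball (0 : Rn n) ((max N N' : ℕ) : ℝ) := by
      rw [mem_ball_zero_iff]
      exact hN'.trans_le (by exact_mod_cast le_max_right _ _)
    simp only [G, indicator_of_mem hx]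
    exact lt_min hl (hN.trans_le (by exact_mod_cast le_max_left _ _))
  have hbound : ∀ j, ∫⁻ x, G j x ^ p ∂μ ≤ K ^ p := by
    intro j
    set X := ∫⁻ x, G j x ^ p ∂μ with hX
    have hXt : X ≠ ⊤ := by
      refine ne_top_of_le_ne_top (b := ∫⁻ x, (ball (0 : Rn n) (j : ℝ)).indicator
        (fun _ => (j : ℝ≥0∞) ^ p) x ∂μ) ?_ (lintegral_mono fun x => ?_)
      · rw [lintegral_indicator_const measurableSet_ball]
        exact ENNReal.mul_ne_top (ENNReal.rpow_ne_top_of_nonneg hp.le (by simp)) (hμ _)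
      · by_cases hx : x ∈ ball (0 : Rn n) (j : ℝ)
        · simp only [G, indicator_of_mem hx]
          exact ENNReal.rpow_le_rpow (min_le_right _ _) hp.le
        · simp [G, indicator_of_notMem hx, hp]
    have h1 : X ≤ K * X ^ (1 / q) := by
      have h2 := h (fun x => G j x ^ (p - 1)) ((hGm j).pow_const _)
      have h3 : ∀ x, (G j x ^ (p - 1)) ^ q = G j x ^ p := fun x => by
        rw [← ENNReal.rpow_mul, hpq.sub_one_mul_conj]
      simp only [h3] at h2
      refine le_trans (lintegral_mono fun x => ?_) h2
      have h4 : G j x ^ p = G j x * G j x ^ (p - 1) := by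
        nth_rewrite 2 [← ENNReal.rpow_one (G j x)]
        rw [← ENNReal.rpow_add_of_nonneg _ _ zero_le_one (by linarith [hpq.lt])]
        simp
      rw [h4]
      exact mul_le_mul' (hGF j x) le_rfl
    rcases eq_or_ne X 0 with h0 | h0
    · rw [h0]; exact zero_le
    have hY0 : X ^ (1 / q) ≠ 0 := by simp [h0, hXt]
    have hYt : X ^ (1 / q) ≠ ⊤ := ENNReal.rpow_ne_top_of_nonneg (by positivity) hXt
    have h5 : X ^ (1 / p) ≤ K := by
      rw [← ENNReal.mul_le_mul_iff_left hY0 hYt, ← ENNReal.rpow_add _ _ h0 hXt]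
      have : 1 / p + 1 / q = 1 := by simpa using hpq.inv_add_inv_eq_one
      rwa [this, ENNReal.rpow_one]
    calc X = (X ^ (1 / p)) ^ p := by rw [← ENNReal.rpow_mul]; simp [hp.ne']
      _ ≤ K ^ p := ENNReal.rpow_le_rpow h5 hp.le
  have hlim : ∫⁻ x, F x ^ p ∂μ = ⨆ j, ∫⁻ x, G j x ^ p ∂μ := by
    rw [← lintegral_iSup (fun j => (hGm j).pow_const _)
      fun i j hij x => ENNReal.rpow_le_rpow (hmono x hij) hp.le]
    refine lintegral_congr fun x => ?_
    rw [← hsup x]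
    exact (ENNReal.orderIsoRpow p hp).map_iSup _
  rw [hlim]
  exact iSup_le hbound

variable {ι : Type} [Countable ι]

/-- The Carleson embedding for sparse families. -/
theorem IsAinfMeas.exists_tsum_average_le [NeZero n] {μ : Measure (Rn n)} (hμ : IsAinfMeas μ)
    {a : ℝ} (ha : (n : ℝ) ≤ a) {s : ℝ} (hs : 1 < s) :
    ∃ C : ℝ≥0∞, C ≠ ⊤ ∧ ∀ {ι : Type} [Countable ι] (Q : ι → Rn n × ℝ) (E : ι → Set (Rn n)),
      SparseFam Q E → ∀ h : Rn n → ℝ≥0∞, Measurable h →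
      ∑' q, ((∫⁻ y in ball (Q q).1 (a * (Q q).2), h y ∂μ) / μ (ball (Q q).1 (a * (Q q).2))) ^ s *
        μ (ball (Q q).1 (a * (Q q).2)) ≤ C * ∫⁻ x, h x ^ s ∂μ := by
  haveI := hμ.isLocallyFinite
  obtain ⟨C₁, hC₁, h1⟩ := hμ.exists_cube_le ha (M := 2) (by simp)
  obtain ⟨D, hDt, hD⟩ := hμ.exists_doubling
  obtain ⟨C₂, hC₂, h2⟩ := maxFn_strong_type (n := n) hDt hs
  refine ⟨C₁ * C₂, by finiteness, ?_⟩
  intro ι _ Q E hQE h hh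
  have hterm : ∀ q, ((∫⁻ y in ball (Q q).1 (a * (Q q).2), h y ∂μ) /
      μ (ball (Q q).1 (a * (Q q).2))) ^ s * μ (ball (Q q).1 (a * (Q q).2)) ≤
      C₁ * ∫⁻ x in E q, maxFn μ h x ^ s ∂μ := by
    intro q
    have h3 := h1 (Q q).1 (Q q).2 (hQE.pos q) (E q) (hQE.subset q) (hQE.meas q) (hQE.half q)
    refine (mul_le_mul' le_rfl h3).trans ?_
    rw [mul_left_comm]
    refine mul_le_mul' le_rfl ?_
    rw [← setLIntegral_const]
    refine setLIntegral_mono' (hQE.meas q) fun x hx => ?_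
    refine ENNReal.rpow_le_rpow (lintegral_div_le_maxFn μ h ?_) (by linarith)
    have h4 := cube_subset_ball (Q q).1 (hQE.pos q) (hQE.subset q hx)
    exact ball_subset_ball (mul_le_mul_of_nonneg_right ha (hQE.pos q).le) h4
  calc _ ≤ ∑' q, C₁ * ∫⁻ x in E q, maxFn μ h x ^ s ∂μ := ENNReal.tsum_le_tsum hterm
    _ = C₁ * ∫⁻ x in ⋃ q, E q, maxFn μ h x ^ s ∂μ := by
        rw [ENNReal.tsum_mul_left, lintegral_iUnion hQE.meas hQE.disj]
    _ ≤ C₁ * (C₂ * ∫⁻ x, h x ^ s ∂μ) :=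
        mul_le_mul' le_rfl ((setLIntegral_le_lintegral _ _).trans (h2 μ hD h hh))
    _ = _ := by rw [mul_assoc]

lemma tsum_mul_le_Lp_mul_Lq (f g : ι → ℝ≥0∞) {p q : ℝ} (hpq : p.HolderConjugate q) :
    ∑' i, f i * g i ≤ (∑' i, f i ^ p) ^ (1 / p) * (∑' i, g i ^ q) ^ (1 / q) := by
  letI : MeasurableSpace ι := ⊤
  have h := ENNReal.lintegral_mul_le_Lp_mul_Lq (Measure.count : Measure ι) hpq
    (f := f) (g := g) measurable_from_top.aemeasurable measurable_from_top.aemeasurable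
  simpa only [lintegral_count, Pi.mul_apply] using h

lemma lintegral_tsum_indicator_mul {μ : Measure (Rn n)} {D : ι → Set (Rn n)}
    (hD : ∀ q, MeasurableSet (D q)) {T : ι → Rn n → ℝ≥0∞} (hT : ∀ q, Measurable (T q))
    {g : Rn n → ℝ≥0∞} (hg : Measurable g) :
    ∫⁻ x, (∑' q, (D q).indicator (T q) x) * g x ∂μ = ∑' q, ∫⁻ x in D q, T q x * g x ∂μ := by
  simp_rw [← ENNReal.tsum_mul_right]
  rw [lintegral_tsum (f := fun q x => (D q).indicator (T q) x * g x)
    fun q => (((hT q).indicator (hD q)).mul hg).aemeasurable]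
  refine tsum_congr fun q => ?_
  rw [← lintegral_indicator (hD q)]
  refine lintegral_congr fun x => ?_
  by_cases hx : x ∈ D q <;> simp [hx]

/-- Estimate for a sum over a sparse family of functions with a bounded power average. -/
theorem IsAinfMeas.exists_sparse_sum_le [NeZero n] {μ : Measure (Rn n)} (hμ : IsAinfMeas μ)
    {a : ℝ} (ha : (n : ℝ) ≤ a) {p : ℝ} (hp : 0 < p) :
    ∃ v : ℝ, 0 < v ∧ ∀ CY : ℝ≥0∞, CY ≠ ⊤ → ∃ C : ℝ≥0∞, C ≠ ⊤ ∧
      ∀ {ι : Type} [Countable ι] (Q : ι → Rn n × ℝ) (E : ι → Set (Rn n)),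
      SparseFam Q E → ∀ (l : ι → ℝ≥0∞) (Y : ι → Rn n → ℝ≥0∞), (∀ q, Measurable (Y q)) →
      (∀ q, ∫⁻ x in ball (Q q).1 (a * (Q q).2), Y q x ^ v ∂μ ≤
        CY * μ (ball (Q q).1 (a * (Q q).2))) →
      ∫⁻ x, (∑' q, (cube (Q q).1 (Q q).2).indicator (fun x => l q * Y q x) x) ^ p ∂μ ≤
        C * ∑' q, l q ^ p * μ (ball (Q q).1 (a * (Q q).2)) := by
  have hsub : ∀ Q : Rn n × ℝ, 0 < Q.2 → cube Q.1 Q.2 ⊆ ball Q.1 (a * Q.2) := fun Q hQ =>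
    (cube_subset_ball Q.1 hQ).trans (ball_subset_ball (mul_le_mul_of_nonneg_right ha hQ.le))
  rcases le_or_gt p 1 with hp1 | hp1
  · refine ⟨p, hp, fun CY hCY => ⟨CY, hCY, ?_⟩⟩
    intro ι _ Q E hQE l Y hY hYv
    have hle : ∀ x, (∑' q, (cube (Q q).1 (Q q).2).indicator (fun x => l q * Y q x) x) ^ p ≤
        ∑' q, (cube (Q q).1 (Q q).2).indicator (fun x => l q ^ p * Y q x ^ p) x := fun x => by
      refine (tsum_rpow_le_tsum _ hp hp1).trans (ENNReal.tsum_le_tsum fun q => ?_)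
      by_cases hx : x ∈ cube (Q q).1 (Q q).2
      · simp [hx, ENNReal.mul_rpow_of_nonneg _ _ hp.le]
      · simp [hx, hp]
    refine (lintegral_mono hle).trans ?_
    rw [lintegral_tsum fun q =>
      ((((hY q).pow_const p).const_mul _).indicator (measurableSet_cube _ _)).aemeasurable,
      ← ENNReal.tsum_mul_left]
    refine ENNReal.tsum_le_tsum fun q => ?_
    rw [lintegral_indicator (measurableSet_cube _ _), lintegral_const_mul _ ((hY q).pow_const p),
      mul_left_comm]
    exact mul_le_mul' le_rfl ((lintegral_mono_set (hsub _ (hQE.pos q))).trans (hYv q))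
  · have hpq := Real.HolderConjugate.conjExponent hp1
    set p' := p.conjExponent with hp'
    have hp'1 : 1 < p' := hpq.symm.lt
    set w := (1 + p') / 2 with hw
    have hw1 : 1 < w := by rw [hw]; linarith
    have hwv := Real.HolderConjugate.conjExponent hw1
    set v := w.conjExponent with hv
    have hw0 : 0 < w := by linarith
    have hv0 : 0 < v := hwv.symm.pos
    have hp'0 : 0 < p' := by linarith
    obtain ⟨C₁, hC₁, hcar⟩ := hμ.exists_tsum_average_le ha (s := p' / w)
      (by rw [one_lt_div hw0, hw]; linarith)
    refine ⟨v, hv0, fun CY hCY => ⟨(CY ^ (1 / v) * C₁ ^ (1 / p')) ^ p, ?_, ?_⟩⟩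
    · refine ENNReal.rpow_ne_top_of_nonneg hp.le (ENNReal.mul_ne_top ?_ ?_) <;>
        exact ENNReal.rpow_ne_top_of_nonneg (by positivity) (by assumption)
    intro ι _ Q E hQE l Y hY hYv
    set Bq : ι → Set (Rn n) := fun q => ball (Q q).1 (a * (Q q).2) with hBq
    have hn : (0 : ℝ) < n := by exact_mod_cast Nat.pos_of_ne_zero (NeZero.ne n)
    have hB0 : ∀ q, μ (Bq q) ≠ 0 := fun q =>
      hμ.ball_ne_zero _ _ (mul_pos (hn.trans_le ha) (hQE.pos q))
    have hBt : ∀ q, μ (Bq q) ≠ ⊤ := fun q => hμ.ball_ne_top _ _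
    have hdual := lintegral_rpow_le_of_dual (fun r => hμ.ball_ne_top 0 r) hpq
      (F := fun x => ∑' q, (cube (Q q).1 (Q q).2).indicator (fun x => l q * Y q x) x)
      (Measurable.tsum fun q => ((hY q).const_mul _).indicator (measurableSet_cube _ _))
      (K := CY ^ (1 / v) * C₁ ^ (1 / p') * (∑' q, l q ^ p * μ (Bq q)) ^ (1 / p)) ?_
    · refine hdual.trans_eq ?_
      rw [ENNReal.mul_rpow_of_nonneg _ _ hp.le, ← ENNReal.rpow_mul _ (1 / p) p,
        one_div_mul_cancel hp.ne', ENNReal.rpow_one]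
    intro g hg
    rw [lintegral_tsum_indicator_mul (fun q => measurableSet_cube _ _)
      (fun q => (hY q).const_mul _) hg]
    set H : ι → ℝ≥0∞ := fun q => (∫⁻ y in Bq q, g y ^ w ∂μ) / μ (Bq q) with hH
    have hterm : ∀ q, ∫⁻ x in cube (Q q).1 (Q q).2, l q * Y q x * g x ∂μ ≤
        CY ^ (1 / v) * ((l q * μ (Bq q) ^ (1 / p)) * (H q ^ (1 / w) * μ (Bq q) ^ (1 / p'))) := by
      intro q
      have h1 : ∫⁻ x in Bq q, Y q x * g x ∂μ ≤
          (CY * μ (Bq q)) ^ (1 / v) * (H q * μ (Bq q)) ^ (1 / w) := by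
        refine (ENNReal.lintegral_mul_le_Lp_mul_Lq (μ.restrict (Bq q)) hwv.symm
          (hY q).aemeasurable hg.aemeasurable).trans ?_
        refine mul_le_mul' (ENNReal.rpow_le_rpow (hYv q) (by positivity)) ?_
        rw [hH]
        dsimp only
        rw [ENNReal.div_mul_cancel (hB0 q) (hBt q)]
      have h2 : μ (Bq q) ^ (1 / v) * μ (Bq q) ^ (1 / w) =
          μ (Bq q) ^ (1 / p) * μ (Bq q) ^ (1 / p') := by
        rw [← ENNReal.rpow_add _ _ (hB0 q) (hBt q), ← ENNReal.rpow_add _ _ (hB0 q) (hBt q)]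
        have e1 := hwv.symm.inv_add_inv_eq_one
        have e2 := hpq.inv_add_inv_eq_one
        simp only [one_div]
        rw [e1, e2]
      calc ∫⁻ x in cube (Q q).1 (Q q).2, l q * Y q x * g x ∂μ
          ≤ ∫⁻ x in Bq q, l q * Y q x * g x ∂μ := lintegral_mono_set (hsub _ (hQE.pos q))
        _ = l q * ∫⁻ x in Bq q, Y q x * g x ∂μ := by
            simp_rw [mul_assoc]
            rw [lintegral_const_mul (f := fun x => Y q x * g x) _ ((hY q).mul hg)]
        _ ≤ l q * ((CY * μ (Bq q)) ^ (1 / v) * (H q * μ (Bq q)) ^ (1 / w)) :=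
            mul_le_mul' le_rfl h1
        _ = CY ^ (1 / v) * l q * H q ^ (1 / w) * (μ (Bq q) ^ (1 / v) * μ (Bq q) ^ (1 / w)) := by
            rw [ENNReal.mul_rpow_of_nonneg _ _ (by positivity),
              ENNReal.mul_rpow_of_nonneg _ _ (by positivity)]
            ring
        _ = _ := by rw [h2]; ring
    refine (ENNReal.tsum_le_tsum hterm).trans ?_
    rw [ENNReal.tsum_mul_left]
    have h3 := tsum_mul_le_Lp_mul_Lq (fun q => l q * μ (Bq q) ^ (1 / p))
      (fun q => H q ^ (1 / w) * μ (Bq q) ^ (1 / p')) hpq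
    have h4 : ∀ q, (l q * μ (Bq q) ^ (1 / p)) ^ p = l q ^ p * μ (Bq q) := fun q => by
      rw [ENNReal.mul_rpow_of_nonneg _ _ hp.le, ← ENNReal.rpow_mul, one_div_mul_cancel hp.ne',
        ENNReal.rpow_one]
    have h5 : ∀ q, (H q ^ (1 / w) * μ (Bq q) ^ (1 / p')) ^ p' = H q ^ (p' / w) * μ (Bq q) :=
      fun q => by
      rw [ENNReal.mul_rpow_of_nonneg _ _ hp'0.le, ← ENNReal.rpow_mul, ← ENNReal.rpow_mul,
        one_div_mul_cancel hp'0.ne', ENNReal.rpow_one, one_div_mul_eq_div]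
    simp only [h4, h5] at h3
    have h6 := hcar Q E hQE (fun x => g x ^ w) (hg.pow_const _)
    have h7 : ∀ x, (g x ^ w) ^ (p' / w) = g x ^ p' := fun x => by
      rw [← ENNReal.rpow_mul, mul_div_cancel₀ _ hw0.ne']
    simp only [h7] at h6
    calc _ ≤ CY ^ (1 / v) * ((∑' q, l q ^ p * μ (Bq q)) ^ (1 / p) *
          (C₁ * ∫⁻ x, g x ^ p' ∂μ) ^ (1 / p')) :=
          mul_le_mul' le_rfl (h3.trans (mul_le_mul' le_rfl
            (ENNReal.rpow_le_rpow h6 (by positivity))))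
      _ = _ := by
          rw [ENNReal.mul_rpow_of_nonneg _ _ (by positivity : 0 ≤ 1 / p')]
          ring

end SparseSums

section DualWeights

lemma dualWeight_ne_zero {q : ℝ} {ω : Rn n → ℝ} (x : Rn n) (h : 0 < ω x) :
    dualWeight q ω x ≠ 0 := by
  rw [dualWeight, ENNReal.ofReal_rpow_of_pos h]
  simpa using Real.rpow_pos_of_pos h _

lemma dualWeight_ne_top {q : ℝ} {ω : Rn n → ℝ} (x : Rn n) (h : 0 < ω x) :
    dualWeight q ω x ≠ ⊤ := by
  rw [dualWeight, ENNReal.ofReal_rpow_of_pos h]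
  simp

lemma div_dualWeight_rpow_mul {q : ℝ} (hq : 1 < q) {ω : Rn n → ℝ} (x : Rn n) (h : 0 < ω x)
    (a : ℝ≥0∞) :
    (a / dualWeight q ω x) ^ q * dualWeight q ω x = a ^ q * ENNReal.ofReal (ω x) := by
  have hd0 := dualWeight_ne_zero (q := q) x h
  have hdt := dualWeight_ne_top (q := q) x h
  have hq1 : q - 1 ≠ 0 := by linarith
  have h1 : dualWeight q ω x ^ (-q) * dualWeight q ω x = ENNReal.ofReal (ω x) := by
    nth_rewrite 2 [← ENNReal.rpow_one (dualWeight q ω x)]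
    rw [← ENNReal.rpow_add _ _ hd0 hdt, dualWeight, ← ENNReal.rpow_mul,
      show -(1 / (q - 1)) * (-q + 1) = 1 by field_simp; ring, ENNReal.rpow_one]
  rw [div_eq_mul_inv, ENNReal.mul_rpow_of_nonneg _ _ (by linarith), ENNReal.inv_rpow,
    ← ENNReal.rpow_neg, mul_assoc, h1]

lemma setLIntegral_div_withDensity {d F : Rn n → ℝ≥0∞} (hd : Measurable d) (hF : Measurable F)
    (hd0 : ∀ x, d x ≠ 0) (hdt : ∀ x, d x ≠ ⊤) {D : Set (Rn n)} (hD : MeasurableSet D) :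
    ∫⁻ x in D, F x / d x ∂(volume.withDensity d) = ∫⁻ x in D, F x := by
  rw [setLIntegral_withDensity_eq_setLIntegral_mul volume hd (g := fun x => F x / d x)
    (hF.div hd) hD]
  refine lintegral_congr fun x => ?_
  simp only [Pi.mul_apply]
  exact ENNReal.mul_div_cancel (hd0 x) (hdt x)

/-- Hölder's inequality for averages. -/
lemma lintegral_mul_le_average {μ : Measure (Rn n)} {D : Set (Rn n)} (h0 : μ D ≠ 0) (ht : μ D ≠ ⊤)
    {u v : ℝ} (huv : v.HolderConjugate u) {g h : Rn n → ℝ≥0∞} (hg : Measurable g)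
    (hh : Measurable h) {C : ℝ≥0∞} (hC : ∫⁻ x in D, g x ^ v ∂μ ≤ C * μ D) :
    ∫⁻ x in D, g x * h x ∂μ ≤
      C ^ (1 / v) * (μ D * ((∫⁻ x in D, h x ^ u ∂μ) / μ D) ^ (1 / u)) := by
  have hu := huv.symm.pos
  have hv := huv.pos
  refine (ENNReal.lintegral_mul_le_Lp_mul_Lq (μ.restrict D) huv hg.aemeasurable
    hh.aemeasurable).trans ?_
  refine (mul_le_mul' (ENNReal.rpow_le_rpow hC (by positivity)) le_rfl).trans_eq ?_
  rw [ENNReal.mul_rpow_of_nonneg _ _ (by positivity), mul_assoc]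
  congr 1
  nth_rewrite 1 [← ENNReal.div_mul_cancel h0 ht (b := ∫⁻ x in D, h x ^ u ∂μ)]
  rw [ENNReal.mul_rpow_of_nonneg _ _ (by positivity), mul_left_comm, ← ENNReal.rpow_add _ _ h0 ht]
  have e : 1 / v + 1 / u = 1 := by simpa using huv.inv_add_inv_eq_one
  rw [e, ENNReal.rpow_one, mul_comm]

lemma prod_le_sum_pow [NeZero m] (z : Fin m → ℝ≥0∞) : ∏ i, z i ≤ ∑ i, z i ^ m := by
  obtain ⟨j, -, hj⟩ := Finset.exists_max_image Finset.univ z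
    ⟨⟨0, Nat.pos_of_ne_zero (NeZero.ne m)⟩, Finset.mem_univ _⟩
  calc ∏ i, z i ≤ ∏ _i : Fin m, z j := Finset.prod_le_prod' fun i hi => hj i hi
    _ = z j ^ m := by simp
    _ ≤ _ := Finset.single_le_sum (f := fun i => z i ^ m) (fun _ _ => zero_le) (Finset.mem_univ j)

lemma add_rpow_le_two_rpow_mul (a b : ℝ≥0∞) {r : ℝ} (hr : 0 ≤ r) :
    (a + b) ^ r ≤ 2 ^ r * (a ^ r + b ^ r) := by
  have h1 : a + b ≤ 2 * max a b := by
    rw [two_mul]; exact add_le_add (le_max_left _ _) (le_max_right _ _)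
  refine (ENNReal.rpow_le_rpow h1 hr).trans ?_
  rw [ENNReal.mul_rpow_of_nonneg _ _ hr]
  refine mul_le_mul' le_rfl ?_
  rcases le_total a b with h | h
  · rw [max_eq_right h]; exact le_add_self
  · rw [max_eq_left h]; exact le_self_add

/-- The multiple Muckenhoupt condition, tested against arbitrary factors. -/
lemma IsMultiAP.exists_prod_average_le [NeZero m] {p : ℝ} {ps : Fin m → ℝ}
    {ωs : Fin m → Rn n → ℝ} (hp0 : 0 < p) (hps : ∀ i, 1 < ps i) (hp : p⁻¹ = ∑ k, (ps k)⁻¹)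
    (h : IsMultiAP p ps ωs) :
    ∃ C : ℝ≥0∞, C ≠ ⊤ ∧ ∀ c r, 0 < r → ∀ α : Fin m → ℝ≥0∞,
      (∏ i, (volume.withDensity (dualWeight (ps i) (ωs i)) (ball c r) / volume (ball c r) * α i)) ^ p
        * weightMeas (nuw p ps ωs) (ball c r) ≤
      C * ∏ i, (α i ^ ps i * volume.withDensity (dualWeight (ps i) (ωs i)) (ball c r)) ^
        (p / ps i) := by
  obtain ⟨C, hC⟩ := h
  refine ⟨(C : ℝ≥0∞) ^ p, by finiteness, fun c r hr α => ?_⟩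
  set V := volume (ball c r) with hV
  have hV0 : V ≠ 0 := (volume_ball_pos c hr).ne'
  have hVt : V ≠ ⊤ := volume_ball_ne_top c r
  set a : Fin m → ℝ≥0∞ := fun i => volume.withDensity (dualWeight (ps i) (ωs i)) (ball c r) with ha
  set N := weightMeas (nuw p ps ωs) (ball c r) with hN
  have hps0 : ∀ i, 0 < ps i := fun i => by linarith [hps i]
  have h1 : V⁻¹ * N * ∏ i, (V⁻¹ * a i) ^ (p * ((ps i - 1) / ps i)) ≤ (C : ℝ≥0∞) ^ p := by
    have h2 := ENNReal.rpow_le_rpow (hC c r hr) hp0.le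
    rw [ENNReal.mul_rpow_of_nonneg _ _ hp0.le, ← ENNReal.rpow_mul, one_div_mul_cancel hp0.ne',
      ENNReal.rpow_one, ← ENNReal.prod_rpow_of_nonneg hp0.le, ← weightMeas_apply measurableSet_ball]
      at h2
    refine le_trans (le_of_eq ?_) h2
    congr 1
    refine Finset.prod_congr rfl fun i _ => ?_
    rw [APfactor, if_neg (hps i).ne', ← ENNReal.rpow_mul, mul_comm p, ha]
    dsimp only
    rw [withDensity_apply _ measurableSet_ball]
    rfl
  have hsum : ∑ i, p / ps i = 1 := by
    simp_rw [div_eq_mul_inv]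
    rw [← Finset.mul_sum, ← hp, mul_inv_cancel₀ hp0.ne']
  have h3 : ∏ i, (V⁻¹ * a i) ^ (p / ps i) = V⁻¹ * ∏ i, a i ^ (p / ps i) :=
    prod_mul_rpow_const _ _ _ (fun i => div_pos hp0 (hps0 i)) hsum
  have h4 : ∀ i, (a i / V * α i) ^ p = (V⁻¹ * a i) ^ (p * ((ps i - 1) / ps i)) *
      (V⁻¹ * a i) ^ (p / ps i) * α i ^ p := fun i => by
    have hi := hps i
    rw [ENNReal.mul_rpow_of_nonneg _ _ hp0.le, ← ENNReal.rpow_add_of_nonneg _ _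
      (mul_nonneg hp0.le (div_nonneg (by linarith) (hps0 i).le)) (div_pos hp0 (hps0 i)).le,
      div_eq_mul_inv, mul_comm (a i)]
    congr 2
    have := (hps0 i).ne'
    field_simp
    ring
  have h5 : ∀ i, (α i ^ ps i * a i) ^ (p / ps i) = α i ^ p * a i ^ (p / ps i) := fun i => by
    rw [ENNReal.mul_rpow_of_nonneg _ _ (div_pos hp0 (hps0 i)).le, ← ENNReal.rpow_mul,
      mul_div_cancel₀ _ (hps0 i).ne']
  change (∏ i, (a i / V * α i)) ^ p * N ≤ C ^ p * ∏ i, (α i ^ ps i * a i) ^ (p / ps i)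
  rw [← ENNReal.prod_rpow_of_nonneg hp0.le]
  simp_rw [h4, h5]
  simp_rw [Finset.prod_mul_distrib]
  rw [h3]
  calc _ = (V⁻¹ * N * ∏ i, (V⁻¹ * a i) ^ (p * ((ps i - 1) / ps i))) *
        ((∏ i, α i ^ p) * ∏ i, a i ^ (p / ps i)) := by ring
    _ ≤ _ := mul_le_mul' h1 le_rfl

end DualWeights

section WeightedLocal

/-- The measure whose density is the dual weight. -/
def dualMeas (q : ℝ) (ω : Rn n → ℝ) : Measure (Rn n) := volume.withDensity (dualWeight q ω)

lemma avgOn_mul_le {q : ℝ} {ω : Rn n → ℝ} (hm : Measurable ω) (hpos : ∀ x, 0 < ω x)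
    (hσ : IsAinfMeas (dualMeas q ω)) {u v : ℝ} (huv : v.HolderConjugate u) {c : Rn n} {r : ℝ}
    (hr : 0 < r) {g F : Rn n → ℝ≥0∞} (hg : Measurable g) (hF : Measurable F) {C : ℝ≥0∞}
    (hC : ∫⁻ x in ball c r, g x ^ v ∂(dualMeas q ω) ≤ C * dualMeas q ω (ball c r)) :
    avgOn (ball c r) (fun y => g y * F y) ≤ C ^ (1 / v) *
      (dualMeas q ω (ball c r) / volume (ball c r) *
        ((∫⁻ x in ball c r, (F x / dualWeight q ω x) ^ u ∂(dualMeas q ω)) /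
          dualMeas q ω (ball c r)) ^ (1 / u)) := by
  have hd := measurable_dualWeight (q := q) hm
  have h1 := lintegral_mul_le_average (hσ.ball_ne_zero c r hr) (hσ.ball_ne_top c r) huv hg
    (hF.div hd) hC
  have h2 := setLIntegral_div_withDensity hd (hg.mul hF) (fun x => dualWeight_ne_zero x (hpos x))
    (fun x => dualWeight_ne_top x (hpos x)) (measurableSet_ball (x := c) (ε := r))
  have h3 : ∫⁻ y in ball c r, g y * F y =
      ∫⁻ y in ball c r, g y * (F y / dualWeight q ω y) ∂(dualMeas q ω) := by
    rw [dualMeas]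
    refine h2.symm.trans (lintegral_congr fun x => ?_)
    simp only [Pi.mul_apply, mul_div_assoc]
  rw [avgOn, h3]
  refine (ENNReal.div_le_div_right h1 _).trans_eq ?_
  simp only [div_eq_mul_inv, Pi.div_apply]
  ring

lemma lintegral_div_dualWeight_rpow {q : ℝ} (hq : 1 < q) {ω : Rn n → ℝ} (hm : Measurable ω)
    (hpos : ∀ x, 0 < ω x) {F : Rn n → ℝ≥0∞} (hF : Measurable F) {D : Set (Rn n)}
    (hD : MeasurableSet D) :
    ∫⁻ x in D, (F x / dualWeight q ω x) ^ q ∂(dualMeas q ω) =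
      ∫⁻ x in D, F x ^ q * ENNReal.ofReal (ω x) := by
  have hd := measurable_dualWeight (q := q) hm
  rw [dualMeas, setLIntegral_withDensity_eq_setLIntegral_mul volume hd
    (g := fun x => (F x / dualWeight q ω x) ^ q) ((hF.div hd).pow_const q) hD]
  refine lintegral_congr fun x => ?_
  rw [Pi.mul_apply, mul_comm, div_dualWeight_rpow_mul hq x (hpos x)]

lemma lintegral_osc_mul_ne_top_of_weighted [NeZero n] {q : ℝ} (hq : 1 < q) {ω : Rn n → ℝ}
    (hm : Measurable ω) (hpos : ∀ x, 0 < ω x) (hσ : IsAinfMeas (dualMeas q ω)) {c : Rn n} {r : ℝ}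
    (hr : 0 < r) {F : Rn n → ℝ≥0∞} (hF : Measurable F)
    (hfin : ∫⁻ y in ball c r, F y ^ q * ENNReal.ofReal (ω y) ≠ ⊤)
    {g : Rn n → ℝ≥0∞} (hg : Measurable g) {C : ℝ≥0∞} (hC : C ≠ ⊤)
    (hgC : ∫⁻ x in ball c r, g x ^ q.conjExponent ∂(dualMeas q ω) ≤ C * dualMeas q ω (ball c r)) :
    ∫⁻ y in ball c r, g y * F y ≠ ⊤ := by
  have huv := (Real.HolderConjugate.conjExponent hq).symm
  have h := avgOn_mul_le hm hpos hσ huv hr hg hF hgC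
  rw [lintegral_div_dualWeight_rpow hq hm hpos hF measurableSet_ball] at h
  rw [setLIntegral_eq_avgOn_mul hr]
  refine ENNReal.mul_ne_top (ne_top_of_le_ne_top ?_ h) (volume_ball_ne_top c r)
  have h0 := huv.pos
  have h0' := huv.symm.pos
  refine ENNReal.mul_ne_top (ENNReal.rpow_ne_top_of_nonneg (by positivity) hC)
    (ENNReal.mul_ne_top (ENNReal.div_ne_top (hσ.ball_ne_top c r) (volume_ball_pos c hr).ne')
      (ENNReal.rpow_ne_top_of_nonneg (by positivity)
        (ENNReal.div_ne_top hfin (hσ.ball_ne_zero c r hr))))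

lemma tsum_prod_rpow_le {ι : Type} [Countable ι] (A : Fin m → ι → ℝ≥0∞) (θ : Fin m → ℝ)
    (hθ : ∀ i, 0 ≤ θ i) (hsum : ∑ i, θ i = 1) :
    ∑' q, ∏ i, A i q ^ θ i ≤ ∏ i, (∑' q, A i q) ^ θ i := by
  letI : MeasurableSpace ι := ⊤
  have h := ENNReal.lintegral_prod_norm_pow_le (μ := (Measure.count : Measure ι)) Finset.univ
    (f := A) (fun i _ => measurable_from_top.aemeasurable) hsum (fun i _ => hθ i)
  simpa only [lintegral_count] using h

/-- Power averages of the product of oscillations with respect to a measure of class `A_∞`. -/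
lemma exists_prod_osc_le [NeZero n] [NeZero m] {b : Fin m → Rn n → ℝ} (hb : ∀ i, MemBMO (b i))
    (hbm : ∀ i, Measurable (b i)) {μ : Measure (Rn n)} (hμ : IsAinfMeas μ) {v : ℝ} (hv : 0 < v)
    (κ : Fin m → ℝ≥0∞) (hκ : ∀ i, κ i ≠ ⊤) :
    ∃ C : ℝ≥0∞, C ≠ ⊤ ∧ ∀ c r, 0 < r →
      ∫⁻ x in ball c r, (∏ i, (ENNReal.ofReal |b i x - ballAvg (b i) (ball c r)| + κ i)) ^ v ∂μ ≤
        C * μ (ball c r) := by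
  have hm0 : (0 : ℝ) < m := by exact_mod_cast Nat.pos_of_ne_zero (NeZero.ne m)
  have hvm : 0 < v * m := by positivity
  choose C hCt hC using fun i => exists_weighted_jn (hb i) (hbm i) hμ hvm
  refine ⟨∑ i, 2 ^ (v * m) * (C i + κ i ^ (v * m)), ?_, fun c r hr => ?_⟩
  · refine ENNReal.sum_ne_top.2 fun i _ => ENNReal.mul_ne_top (by finiteness)
      (ENNReal.add_ne_top.2 ⟨hCt i, ENNReal.rpow_ne_top_of_nonneg hvm.le (hκ i)⟩)
  set e : Fin m → ℝ := fun i => ballAvg (b i) (ball c r)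
  have hmeas : ∀ i, Measurable fun x => ENNReal.ofReal |b i x - e i| ^ (v * m) := fun i =>
    (ENNReal.measurable_ofReal.comp ((hbm i).sub_const _).abs).pow_const _
  calc ∫⁻ x in ball c r, (∏ i, (ENNReal.ofReal |b i x - e i| + κ i)) ^ v ∂μ
      ≤ ∫⁻ x in ball c r, ∑ i, 2 ^ (v * m) *
          (ENNReal.ofReal |b i x - e i| ^ (v * m) + κ i ^ (v * m)) ∂μ := by
        refine lintegral_mono fun x => ?_
        rw [← ENNReal.prod_rpow_of_nonneg hv.le]
        refine (prod_le_sum_pow _).trans (Finset.sum_le_sum fun i _ => ?_)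
        rw [← ENNReal.rpow_natCast, ← ENNReal.rpow_mul]
        exact add_rpow_le_two_rpow_mul _ _ hvm.le
    _ = ∑ i, 2 ^ (v * m) * ((∫⁻ x in ball c r, ENNReal.ofReal |b i x - e i| ^ (v * m) ∂μ) +
          κ i ^ (v * m) * μ (ball c r)) := by
        rw [lintegral_finsetSum _ fun i _ => ((hmeas i).add_const _).const_mul _]
        refine Finset.sum_congr rfl fun i _ => ?_
        rw [lintegral_const_mul _ ((hmeas i).add_const _), lintegral_add_left (hmeas i),
          setLIntegral_const]
    _ ≤ ∑ i, 2 ^ (v * m) * (C i * μ (ball c r) + κ i ^ (v * m) * μ (ball c r)) :=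
        Finset.sum_le_sum fun i _ => mul_le_mul' le_rfl (add_le_add (hC i c r hr) le_rfl)
    _ = _ := by
        rw [Finset.sum_mul]
        exact Finset.sum_congr rfl fun i _ => by ring

variable {k : (Fin m → Rn n) → ℝ} {A γ δ B : ℝ}

set_option maxHeartbeats 800000 in
theorem LPKernel.exists_weighted_local [NeZero n] [NeZero m] (hk : LPKernel k A γ δ B)
    (hbd : GBdd k) {p : ℝ} {ps : Fin m → ℝ} {ωs : Fin m → Rn n → ℝ}
    (hm : ∀ i, Measurable (ωs i)) (hpos : ∀ i x, 0 < ωs i x) (hp0 : 0 < p)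
    (hps : ∀ i, 1 < ps i) (hp : p⁻¹ = ∑ k, (ps k)⁻¹) (hAP : IsMultiAP p ps ωs)
    {b : Fin m → Rn n → ℝ} (hb : ∀ i, MemBMO (b i)) (hbm : ∀ i, Measurable (b i)) :
    ∃ C : ℝ≥0∞, C ≠ ⊤ ∧ ∀ f : Fin m → Rn n → ℝ, (∀ i, Measurable (f i)) →
      ∀ (c : Rn n) (s : ℝ), 0 < s →
      (∀ i, ∫⁻ y in ball c (dil n B * s), ENNReal.ofReal |f i y| ^ ps i *
        ENNReal.ofReal (ωs i y) ≠ ⊤) →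
      ∫⁻ x in cube c s, gOn k (univ.pi fun _ => ball c (dil n B * s))
        (fun i y => (b i x - b i y) * f i y) x ^ p ∂(weightMeas (nuw p ps ωs)) ≤
      C * ∏ i, (∫⁻ y in ball c (dil n B * s), ENNReal.ofReal |f i y| ^ ps i *
        ENNReal.ofReal (ωs i y)) ^ (p / ps i) := by
  obtain ⟨hν, hσ⟩ := isAinfMeas_of_isMultiAP hm hpos hp0 hps hp hAP
  replace hσ : ∀ i, IsAinfMeas (dualMeas (ps i) (ωs i)) := hσ
  have hn : (0 : ℝ) < n := by exact_mod_cast Nat.pos_of_ne_zero (NeZero.ne n)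
  have hdil := hk.dil_pos
  have hdn : (n : ℝ) ≤ dil n B := by linarith [hk.two_mul_le_dil]
  set u : Fin m → ℝ := fun i => (1 + ps i) / 2 with hu
  have hu1 : ∀ i, 1 < u i := fun i => by have := hps i; simp only [hu]; linarith
  have hu0 : ∀ i, 0 < u i := fun i => by linarith [hu1 i]
  have hps0 : ∀ i, 0 < ps i := fun i => by linarith [hps i]
  have huv := fun i => (Real.HolderConjugate.conjExponent (hu1 i)).symm
  obtain ⟨C₀, hC₀, hdom⟩ := hk.exists_sparse_domination hbd
  choose Cσ hCσt hCσ using fun i => exists_weighted_jn (hb i) (hbm i) (hσ i) (huv i).pos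
  choose Cq hCqt hCq using fun i => exists_weighted_jn (hb i) (hbm i) (hσ i)
    (Real.HolderConjugate.conjExponent (hps i)).symm.pos
  set κ : Fin m → ℝ≥0∞ := fun i => Cσ i ^ (1 / (u i).conjExponent) with hκ
  have hκt : ∀ i, κ i ≠ ⊤ := fun i =>
    ENNReal.rpow_ne_top_of_nonneg (one_div_nonneg.2 (huv i).pos.le) (hCσt i)
  obtain ⟨v, hv, hsp⟩ := hν.exists_sparse_sum_le hdn hp0
  obtain ⟨CY, hCYt, hCY⟩ := exists_prod_osc_le hb hbm hν hv κ hκt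
  obtain ⟨C₁, hC₁, hsum⟩ := hsp CY hCYt
  obtain ⟨C₂, hC₂, hAPb⟩ := hAP.exists_prod_average_le hp0 hps hp
  choose Cc hCct hCc using fun i => (hσ i).exists_tsum_average_le hdn (s := ps i / u i)
    (by rw [one_lt_div (hu0 i), hu]; have := hps i; dsimp only; linarith)
  have hθ : ∀ i, 0 < p / ps i := fun i => div_pos hp0 (hps0 i)
  have hθsum : ∑ i, p / ps i = 1 := by
    simp_rw [div_eq_mul_inv]
    rw [← Finset.mul_sum, ← hp, mul_inv_cancel₀ hp0.ne']
  refine ⟨C₁ * C₀ ^ p * C₂ * ∏ i, Cc i ^ (p / ps i), ?_, ?_⟩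
  · refine ENNReal.mul_ne_top (by finiteness) (ENNReal.prod_ne_top fun i _ =>
      ENNReal.rpow_ne_top_of_nonneg (hθ i).le (hCct i))
  intro f hf c s hs hfin
  have hfm : ∀ i, Measurable fun y => ENNReal.ofReal |f i y| := fun i =>
    ENNReal.measurable_ofReal.comp (hf i).abs
  have hbme : ∀ i (a : ℝ), Measurable fun y => ENNReal.ofReal |b i y - a| := fun i a =>
    ENNReal.measurable_ofReal.comp ((hbm i).sub_const _).abs
  set e : Rn n × ℝ → Fin m → ℝ := fun Q i => ballAvg (b i) (ball Q.1 (dil n B * Q.2)) with he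
  set D₀ := ball c (dil n B * s) with hD₀
  have hds : 0 < dil n B * s := by positivity
  obtain ⟨ι, _, Q, E, hQ, hE, hdisj, hle⟩ := hdom b f hbm hf e c s hs
    (fun i => by
      have := lintegral_osc_mul_ne_top_of_weighted (hps i) (hm i) (hpos i) (hσ i) hds (hfm i)
        (hfin i) (g := fun _ => 1) measurable_const (C := 1) (by simp) (by simp)
      simpa using this)
    (fun i => lintegral_osc_mul_ne_top_of_weighted (hps i) (hm i) (hpos i) (hσ i) hds (hfm i)
      (hfin i) (hbme i _) (hCqt i) (hCq i c _ hds))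
  have hQE : SparseFam Q E := ⟨fun q => (hQ q).1, fun q => (hE q).1, fun q => (hE q).2.1,
    fun q => (hE q).2.2, hdisj⟩
  set Bq : ι → Set (Rn n) := fun q => ball (Q q).1 (dil n B * (Q q).2) with hBq
  have hrq : ∀ q, 0 < dil n B * (Q q).2 := fun q => mul_pos hdil (hQE.pos q)
  set h : Fin m → Rn n → ℝ≥0∞ := fun i => D₀.indicator fun y =>
    ENNReal.ofReal |f i y| / dualWeight (ps i) (ωs i) y with hh
  have hhm : ∀ i, Measurable (h i) := fun i =>
    ((hfm i).div (measurable_dualWeight (hm i))).indicator measurableSet_ball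
  have hhe : ∀ i q, ∫⁻ y in Bq q, (ENNReal.ofReal |f i y| / dualWeight (ps i) (ωs i) y) ^ u i
      ∂(dualMeas (ps i) (ωs i)) = ∫⁻ y in Bq q, h i y ^ u i ∂(dualMeas (ps i) (ωs i)) :=
    fun i q => setLIntegral_congr_fun measurableSet_ball fun y hy => by
      have hy' : y ∈ D₀ := (hQ q).2 hy
      simp only [hh, indicator_of_mem hy']
  set α : Fin m → ι → ℝ≥0∞ := fun i q => ((∫⁻ y in Bq q, h i y ^ u i ∂(dualMeas (ps i) (ωs i))) /
    dualMeas (ps i) (ωs i) (Bq q)) ^ (1 / u i) with hα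
  set τ : Fin m → ι → ℝ≥0∞ := fun i q =>
    dualMeas (ps i) (ωs i) (Bq q) / volume (Bq q) * α i q with hτ
  have havg1 : ∀ i q, avgOn (Bq q) (fun y => ENNReal.ofReal |f i y|) ≤ τ i q := fun i q => by
    have h1 := avgOn_mul_le (hm i) (hpos i) (hσ i) (huv i) (hrq q) (g := fun _ => 1)
      measurable_const (hfm i) (C := 1) (c := (Q q).1) (by simp)
    rw [hhe i q] at h1
    simpa only [one_mul, ENNReal.one_rpow] using h1
  have havg2 : ∀ i q, avgOn (Bq q) (fun y => ENNReal.ofReal |b i y - e (Q q) i| *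
      ENNReal.ofReal |f i y|) ≤ κ i * τ i q := fun i q => by
    have h1 := avgOn_mul_le (hm i) (hpos i) (hσ i) (huv i) (hrq q)
      (hbme i (e (Q q) i)) (hfm i) (hCσ i (Q q).1 _ (hrq q))
    rwa [hhe i q] at h1
  set Y : ι → Rn n → ℝ≥0∞ := fun q x => ∏ i, (ENNReal.ofReal |b i x - e (Q q) i| + κ i) with hY
  have hYm : ∀ q, Measurable (Y q) := fun q =>
    Finset.measurable_prod _ fun i _ => (hbme i _).add_const _
  have hosc : ∀ q x, C₀ * oscForm b f (e (Q q)) (Bq q) x ≤ (C₀ * ∏ i, τ i q) * Y q x := by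
    intro q x
    rw [mul_assoc]
    refine mul_le_mul' le_rfl ?_
    rw [oscForm, hY, ← Finset.prod_mul_distrib]
    refine Finset.prod_le_prod' fun i _ => ?_
    rw [mul_add, mul_comm (τ i q), mul_comm (τ i q)]
    exact add_le_add (mul_le_mul' le_rfl (havg1 i q)) (havg2 i q)
  have hA : ∀ i, ∑' q, α i q ^ ps i * dualMeas (ps i) (ωs i) (Bq q) ≤
      Cc i * ∫⁻ y in D₀, ENNReal.ofReal |f i y| ^ ps i * ENNReal.ofReal (ωs i y) := by
    intro i
    have h1 := hCc i Q E hQE (fun y => h i y ^ u i) ((hhm i).pow_const _)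
    have h2 : ∀ z : ℝ≥0∞, (z ^ u i) ^ (ps i / u i) = z ^ ps i := fun z => by
      rw [← ENNReal.rpow_mul, mul_div_cancel₀ _ (hu0 i).ne']
    have h3 : ∀ z : ℝ≥0∞, (z ^ (1 / u i)) ^ ps i = z ^ (ps i / u i) := fun z => by
      rw [← ENNReal.rpow_mul, one_div_mul_eq_div]
    simp only [h2] at h1
    simp only [hα, h3]
    refine h1.trans_eq ?_
    congr 1
    rw [← lintegral_div_dualWeight_rpow (hps i) (hm i) (hpos i) (hfm i) measurableSet_ball,
      ← lintegral_indicator (measurableSet_ball : MeasurableSet D₀)]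
    refine lintegral_congr fun y => ?_
    rw [← hD₀]
    by_cases hy : y ∈ D₀
    · simp only [hh, indicator_of_mem hy]
    · simp [hh, indicator_of_notMem hy, hps0 i]
  calc _ ≤ ∫⁻ x in cube c s, (∑' q, (cube (Q q).1 (Q q).2).indicator
        (fun x => (C₀ * ∏ i, τ i q) * Y q x) x) ^ p ∂(weightMeas (nuw p ps ωs)) := by
        refine lintegral_mono_ae ?_
        rw [ae_restrict_iff' (measurableSet_cube c s)]
        filter_upwards [hν.ac.ae_le hle] with x hx hxc
        refine ENNReal.rpow_le_rpow ((hx hxc).trans (ENNReal.tsum_le_tsum fun q => ?_)) hp0.le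
        exact indicator_le_indicator (hosc q x)
    _ ≤ ∫⁻ x, (∑' q, (cube (Q q).1 (Q q).2).indicator
        (fun x => (C₀ * ∏ i, τ i q) * Y q x) x) ^ p ∂(weightMeas (nuw p ps ωs)) :=
        setLIntegral_le_lintegral _ _
    _ ≤ C₁ * ∑' q, (C₀ * ∏ i, τ i q) ^ p * weightMeas (nuw p ps ωs) (Bq q) :=
        hsum Q E hQE _ Y hYm fun q => hCY (Q q).1 _ (hrq q)
    _ ≤ C₁ * ∑' q, C₀ ^ p * (C₂ * ∏ i, (α i q ^ ps i * dualMeas (ps i) (ωs i) (Bq q)) ^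
          (p / ps i)) := by
        refine mul_le_mul' le_rfl (ENNReal.tsum_le_tsum fun q => ?_)
        rw [ENNReal.mul_rpow_of_nonneg _ _ hp0.le, mul_assoc]
        exact mul_le_mul' le_rfl (hAPb (Q q).1 _ (hrq q) fun i => α i q)
    _ = C₁ * C₀ ^ p * C₂ * ∑' q, ∏ i, (α i q ^ ps i * dualMeas (ps i) (ωs i) (Bq q)) ^
          (p / ps i) := by
        rw [ENNReal.tsum_mul_left, ENNReal.tsum_mul_left]
        ring
    _ ≤ C₁ * C₀ ^ p * C₂ * ∏ i, (Cc i * ∫⁻ y in D₀, ENNReal.ofReal |f i y| ^ ps i *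
          ENNReal.ofReal (ωs i y)) ^ (p / ps i) := by
        refine mul_le_mul' le_rfl ((tsum_prod_rpow_le _ _ (fun i => (hθ i).le) hθsum).trans ?_)
        exact Finset.prod_le_prod' fun i _ => ENNReal.rpow_le_rpow (hA i) (hθ i).le
    _ = _ := by
        simp_rw [fun i => ENNReal.mul_rpow_of_nonneg (Cc i) (∫⁻ y in D₀,
          ENNReal.ofReal |f i y| ^ ps i * ENNReal.ofReal (ωs i y)) (hθ i).le]
        rw [Finset.prod_mul_distrib]
        ring

end WeightedLocal

section Nonlocal

variable {k : (Fin m → Rn n) → ℝ} {A γ δ B : ℝ}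

lemma LPKernel.ofReal_abs_kt_mul_prod_le (hk : LPKernel k A γ δ B) {t : ℝ} (ht : 0 < t)
    {x : Rn n} {R : ℝ} (hR : 0 < R) {y : Fin m → Rn n} (hy : R ≤ ∑ j, dist x (y j))
    (F : Fin m → Rn n → ℝ) :
    ENNReal.ofReal |kt k t x y * ∏ i, F i (y i)| ≤
      ENNReal.ofReal (A * 2 ^ ((m : ℝ) * n + δ)) *
        (ENNReal.ofReal (t ^ δ * (t + (R + ∑ j, dist x (y j))) ^ (-(m * n + δ))) *
          ∏ i, ENNReal.ofReal |F i (y i)|) := by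
  have hA := hk.A_pos
  have hδ := hk.δ_pos
  set D := ∑ j, dist x (y j) with hD
  have hD0 : 0 < D := hR.trans_le hy
  have he : (0 : ℝ) ≤ m * n + δ := by positivity
  have h1 : (t + D) ^ (-((m : ℝ) * n + δ)) ≤
      2 ^ ((m : ℝ) * n + δ) * (t + (R + D)) ^ (-((m : ℝ) * n + δ)) := by
    rw [Real.rpow_neg (by positivity), Real.rpow_neg (by positivity), ← div_eq_mul_inv,
      ← Real.div_rpow (by positivity) (by positivity), ← Real.inv_rpow (by positivity)]
    refine Real.rpow_le_rpow (by positivity) ?_ he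
    rw [inv_eq_one_div, div_le_div_iff₀ (by positivity) (by positivity)]
    linarith
  rw [abs_mul, ENNReal.ofReal_mul (abs_nonneg _), Finset.abs_prod,
    ENNReal.ofReal_prod_of_nonneg fun _ _ => abs_nonneg _, ← mul_assoc,
    ← ENNReal.ofReal_mul (by positivity)]
  refine mul_le_mul' (ENNReal.ofReal_le_ofReal ((hk.abs_kt_le ht x y).trans ?_)) le_rfl
  rw [mul_assoc]
  refine mul_le_mul_of_nonneg_left ?_ hA.le
  calc t ^ δ * (t + D) ^ (-((m : ℝ) * n + δ))
      ≤ t ^ δ * (2 ^ ((m : ℝ) * n + δ) * (t + (R + D)) ^ (-((m : ℝ) * n + δ))) :=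
        mul_le_mul_of_nonneg_left h1 (by positivity)
    _ = _ := by ring

lemma LPKernel.ofReal_abs_integral_kt_le (hk : LPKernel k A γ δ B) {t : ℝ} (ht : 0 < t)
    {x : Rn n} {R : ℝ} (hR : 0 < R) {S : Set (Fin m → Rn n)} (hS : MeasurableSet S)
    (hSR : ∀ y ∉ S, R ≤ ∑ j, dist x (y j)) {F : Fin m → Rn n → ℝ} (hF : ∀ i, Measurable (F i)) :
    ENNReal.ofReal |∫ y in univ, kt k t x y * ∏ i, F i (y i)| ≤
      ENNReal.ofReal |∫ y in S, kt k t x y * ∏ i, F i (y i)| +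
        ENNReal.ofReal (A * 2 ^ ((m : ℝ) * n + δ)) *
          ∑' l : ℕ, ENNReal.ofReal (t ^ δ * (t + 2 ^ l * R) ^ (-((m : ℝ) * n + δ))) *
            ∏ i, ∫⁻ y in ball x (2 ^ (l + 1) * R), ENNReal.ofReal |F i y| := by
  have hδ := hk.δ_pos
  rw [Measure.restrict_univ]
  set G : (Fin m → Rn n) → ℝ := fun y => kt k t x y * ∏ i, F i (y i) with hG
  by_cases hint : Integrable G
  · rw [← integral_add_compl hS hint]
    refine (ENNReal.ofReal_le_ofReal (abs_add_le _ _)).trans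
      ((ENNReal.ofReal_add (abs_nonneg _) (abs_nonneg _)).le.trans (add_le_add le_rfl ?_))
    refine (ofReal_abs_integral_le _ _).trans ?_
    refine (setLIntegral_mono' hS.compl fun y hy =>
      hk.ofReal_abs_kt_mul_prod_le ht hR (hSR y hy) F).trans ?_
    refine (setLIntegral_le_lintegral _ _).trans ?_
    rw [lintegral_const_mul' _ _ ENNReal.ofReal_ne_top]
    refine mul_le_mul' le_rfl ?_
    refine lintegral_antitone_mul_prod_le (R := R)
      (Φ := fun ρ => ENNReal.ofReal (t ^ δ * (t + ρ) ^ (-((m : ℝ) * n + δ))))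
      (fun i => ENNReal.measurable_ofReal.comp (hF i).abs) hR ?_ x
    intro a ha b hb hab
    have ha' : 0 < a := hR.trans_le ha
    refine ENNReal.ofReal_le_ofReal (mul_le_mul_of_nonneg_left ?_ (by positivity))
    exact Real.rpow_le_rpow_of_nonpos (by positivity) (by linarith) (by
      have : (0 : ℝ) ≤ m * n := by positivity
      linarith)
  · rw [integral_undef hint]
    simp

lemma LPKernel.exists_gOn_univ_le [NeZero n] [NeZero m] (hk : LPKernel k A γ δ B) :
    ∃ C : ℝ≥0∞, C ≠ ⊤ ∧ ∀ (x : Rn n) (R : ℝ), 0 < R → ∀ S : Set (Fin m → Rn n),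
      MeasurableSet S → (∀ y ∉ S, R ≤ ∑ j, dist x (y j)) →
      ∀ F : Fin m → Rn n → ℝ, (∀ i, Measurable (F i)) →
      (∀ (l : ℕ) i, ∫⁻ y in ball x (2 ^ (l + 1) * R), ENNReal.ofReal |F i y| ≠ ⊤) →
      gOn k univ F x ≤ gOn k S F x + C * ∑' l : ℕ,
        ENNReal.ofReal ((2 ^ l * R) ^ (-((m : ℝ) * n))) *
          ∏ i, ∫⁻ y in ball x (2 ^ (l + 1) * R), ENNReal.ofReal |F i y| := by
  have hmn : (0 : ℝ) < m * n := mul_pos (Nat.cast_pos.2 (NeZero.pos m)) (Nat.cast_pos.2 (NeZero.pos n))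
  obtain ⟨C1, hC1, hsc⟩ := sqNorm_scale_le hmn hk.δ_pos
  refine ⟨ENNReal.ofReal (A * 2 ^ ((m : ℝ) * n + δ)) * C1, by finiteness,
    fun x R hR S hS hSR F hF hfin => ?_⟩
  have hu : ∀ l : ℕ, Measurable fun t : ℝ =>
      ENNReal.ofReal (t ^ δ * (t + 2 ^ l * R) ^ (-((m : ℝ) * n + δ))) *
        ∏ i, ∫⁻ y in ball x (2 ^ (l + 1) * R), ENNReal.ofReal |F i y| := fun l =>
    Measurable.mul_const (by fun_prop) _
  calc gOn k univ F x
      ≤ sqNorm fun t => ENNReal.ofReal |∫ y in S, kt k t x y * ∏ i, F i (y i)| +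
        ENNReal.ofReal (A * 2 ^ ((m : ℝ) * n + δ)) *
          ∑' l : ℕ, ENNReal.ofReal (t ^ δ * (t + 2 ^ l * R) ^ (-((m : ℝ) * n + δ))) *
            ∏ i, ∫⁻ y in ball x (2 ^ (l + 1) * R), ENNReal.ofReal |F i y| :=
        sqNorm_mono fun t ht => hk.ofReal_abs_integral_kt_le ht hR hS hSR hF
    _ ≤ _ := sqNorm_add_le (hk.measurable_integral_left S hF x)
        ((Measurable.tsum hu).const_mul _)
    _ ≤ gOn k S F x + ENNReal.ofReal (A * 2 ^ ((m : ℝ) * n + δ)) * C1 * ∑' l : ℕ,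
        ENNReal.ofReal ((2 ^ l * R) ^ (-((m : ℝ) * n))) *
          ∏ i, ∫⁻ y in ball x (2 ^ (l + 1) * R), ENNReal.ofReal |F i y| := by
        refine add_le_add le_rfl ?_
        rw [sqNorm_const_mul ENNReal.ofReal_ne_top, mul_assoc]
        refine mul_le_mul' le_rfl ((sqNorm_tsum_le hu).trans ?_)
        rw [← ENNReal.tsum_mul_left]
        refine ENNReal.tsum_le_tsum fun l => ?_
        have hP : ∏ i, ∫⁻ y in ball x (2 ^ (l + 1) * R), ENNReal.ofReal |F i y| ≠ ⊤ :=
          ENNReal.prod_ne_top fun i _ => hfin l i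
        have := sqNorm_const_mul hP fun t : ℝ =>
          ENNReal.ofReal (t ^ δ * (t + 2 ^ l * R) ^ (-((m : ℝ) * n + δ)))
        simp only [mul_comm (∏ i, ∫⁻ y in ball x (2 ^ (l + 1) * R), ENNReal.ofReal |F i y|)] at this
        rw [this, ← mul_assoc]
        exact mul_le_mul' (hsc _ (by positivity)) le_rfl

end Nonlocal

section Tail

/-- The bound for the average of `f` on a ball obtained from the weighted norm of `f`. -/
def dualAvg (q : ℝ) (ω : Rn n → ℝ) (f : Rn n → ℝ) (c : Rn n) (r : ℝ) : ℝ≥0∞ :=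
  dualMeas q ω (ball c r) / volume (ball c r) *
    ((∫⁻ y in ball c r, ENNReal.ofReal |f y| ^ q * ENNReal.ofReal (ω y)) /
      dualMeas q ω (ball c r)) ^ (1 / q)

/-- The normalised product of the weighted norms of the `f i` on a ball. -/
def tailTerm (p : ℝ) (ps : Fin m → ℝ) (ωs f : Fin m → Rn n → ℝ) (c : Rn n) (r : ℝ) : ℝ≥0∞ :=
  weightMeas (nuw p ps ωs) (ball c r) ^ (-(1 / p)) * ∏ i, wLpNorm (ps i) (ωs i) (ball c r) (f i)

lemma setLIntegral_comm_le {q : ℝ} (hq : 1 < q) {ω : Rn n → ℝ} (hm : Measurable ω)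
    (hpos : ∀ x, 0 < ω x) (hσ : IsAinfMeas (dualMeas q ω)) {b f : Rn n → ℝ} (hb : Measurable b)
    (hf : Measurable f) {c : Rn n} {r : ℝ} (hr : 0 < r) {C : ℝ≥0∞}
    (hC : ∫⁻ y in ball c r, ENNReal.ofReal |b y - ballAvg b (ball c r)| ^ q.conjExponent
      ∂(dualMeas q ω) ≤ C * dualMeas q ω (ball c r)) (a : ℝ) :
    ∫⁻ y in ball c r, ENNReal.ofReal |(a - b y) * f y| ≤
      (ENNReal.ofReal |a - ballAvg b (ball c r)| + C ^ (1 / q.conjExponent)) *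
        dualAvg q ω f c r * volume (ball c r) := by
  have huv := (Real.HolderConjugate.conjExponent hq).symm
  set e := ballAvg b (ball c r) with he
  have hfm : Measurable fun y => ENNReal.ofReal |f y| := ENNReal.measurable_ofReal.comp hf.abs
  have hgm : Measurable fun y => ENNReal.ofReal |b y - e| :=
    ENNReal.measurable_ofReal.comp (hb.sub_const _).abs
  have h1 := avgOn_mul_le hm hpos hσ huv hr hgm hfm hC
  have h2 := avgOn_mul_le (c := c) hm hpos hσ huv hr (measurable_const (a := (1 : ℝ≥0∞))) hfm
    (C := 1) (by simp)
  simp only [one_mul, ENNReal.one_rpow] at h2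
  rw [lintegral_div_dualWeight_rpow hq hm hpos hfm measurableSet_ball] at h1 h2
  change avgOn _ _ ≤ _ * dualAvg q ω f c r at h1
  change avgOn _ _ ≤ dualAvg q ω f c r at h2
  calc ∫⁻ y in ball c r, ENNReal.ofReal |(a - b y) * f y|
      ≤ ∫⁻ y in ball c r, (ENNReal.ofReal |a - e| * ENNReal.ofReal |f y| +
          ENNReal.ofReal |b y - e| * ENNReal.ofReal |f y|) := by
        refine lintegral_mono fun y => ?_
        rw [← add_mul, abs_mul, ENNReal.ofReal_mul (abs_nonneg _),
          ← ENNReal.ofReal_add (abs_nonneg _) (abs_nonneg _)]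
        refine mul_le_mul' (ENNReal.ofReal_le_ofReal ?_) le_rfl
        rw [abs_sub_comm (b y)]
        exact abs_sub_le _ _ _
    _ = (ENNReal.ofReal |a - e| * avgOn (ball c r) (fun y => ENNReal.ofReal |f y|) +
          avgOn (ball c r) (fun y => ENNReal.ofReal |b y - e| * ENNReal.ofReal |f y|)) *
          volume (ball c r) := by
        rw [lintegral_add_left (hfm.const_mul _), lintegral_const_mul _ hfm,
          setLIntegral_eq_avgOn_mul hr, setLIntegral_eq_avgOn_mul hr]
        ring
    _ ≤ _ := by
        refine mul_le_mul' ?_ le_rfl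
        rw [add_mul]
        exact add_le_add (mul_le_mul' le_rfl h2) h1

lemma IsMultiAP.exists_prod_dualAvg_le [NeZero n] [NeZero m] {p : ℝ} {ps : Fin m → ℝ}
    {ωs : Fin m → Rn n → ℝ} (hp0 : 0 < p) (hps : ∀ i, 1 < ps i) (hp : p⁻¹ = ∑ k, (ps k)⁻¹)
    (hAP : IsMultiAP p ps ωs) (hν : IsAinfMeas (weightMeas (nuw p ps ωs)))
    (hσ : ∀ i, IsAinfMeas (dualMeas (ps i) (ωs i))) :
    ∃ C : ℝ≥0∞, C ≠ ⊤ ∧ ∀ (f : Fin m → Rn n → ℝ) c r, 0 < r →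
      ∏ i, dualAvg (ps i) (ωs i) (f i) c r ≤ C * tailTerm p ps ωs f c r := by
  obtain ⟨C, hC, h⟩ := hAP.exists_prod_average_le hp0 hps hp
  refine ⟨C ^ (1 / p), ENNReal.rpow_ne_top_of_nonneg (by positivity) hC, fun f c r hr => ?_⟩
  have h1 := h c r hr fun i => ((∫⁻ y in ball c r, ENNReal.ofReal |f i y| ^ ps i *
    ENNReal.ofReal (ωs i y)) / dualMeas (ps i) (ωs i) (ball c r)) ^ (1 / ps i)
  have hps0 : ∀ i, 0 < ps i := fun i => by linarith [hps i]
  have h2 : ∀ i, (((∫⁻ y in ball c r, ENNReal.ofReal |f i y| ^ ps i *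
      ENNReal.ofReal (ωs i y)) / dualMeas (ps i) (ωs i) (ball c r)) ^ (1 / ps i)) ^ ps i *
      dualMeas (ps i) (ωs i) (ball c r) =
      ∫⁻ y in ball c r, ENNReal.ofReal |f i y| ^ ps i * ENNReal.ofReal (ωs i y) := fun i => by
    rw [← ENNReal.rpow_mul, one_div_mul_cancel (hps0 i).ne', ENNReal.rpow_one,
      ENNReal.div_mul_cancel ((hσ i).ball_ne_zero c r hr) ((hσ i).ball_ne_top c r)]
  change (∏ i, dualAvg (ps i) (ωs i) (f i) c r) ^ p * _ ≤
    C * ∏ i, (_ * dualMeas (ps i) (ωs i) (ball c r)) ^ _ at h1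
  simp only [h2] at h1
  have hν0 := hν.ball_ne_zero c r hr
  have hνt := hν.ball_ne_top c r
  set N := weightMeas (nuw p ps ωs) (ball c r) with hN
  have h3 := ENNReal.rpow_le_rpow h1 (z := 1 / p) (by positivity)
  rw [ENNReal.mul_rpow_of_nonneg _ _ (by positivity), ENNReal.mul_rpow_of_nonneg _ _ (by positivity),
    ← ENNReal.rpow_mul, mul_one_div_cancel hp0.ne', ENNReal.rpow_one,
    ← ENNReal.prod_rpow_of_nonneg (by positivity)] at h3
  have h4 : ∏ i, ((∫⁻ y in ball c r, ENNReal.ofReal |f i y| ^ ps i * ENNReal.ofReal (ωs i y)) ^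
      (p / ps i)) ^ (1 / p) = ∏ i, wLpNorm (ps i) (ωs i) (ball c r) (f i) :=
    Finset.prod_congr rfl fun i _ => by
      rw [← ENNReal.rpow_mul, wLpNorm, wLpNormE]
      congr 1
      field_simp
  rw [h4] at h3
  have hNp0 : N ^ (1 / p) ≠ 0 := (ENNReal.rpow_pos (pos_iff_ne_zero.2 hν0) hνt).ne'
  have hNpt : N ^ (1 / p) ≠ ⊤ := ENNReal.rpow_ne_top_of_nonneg (by positivity) hνt
  rw [tailTerm, ENNReal.rpow_neg, mul_left_comm, mul_comm (_⁻¹), ← div_eq_mul_inv,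
    ENNReal.le_div_iff_mul_le (Or.inl hNp0) (Or.inl hNpt)]
  exact h3

lemma ofReal_rpow_neg_mul_prod_volume (c : Rn n) (x : ℝ) (hx : 0 < x) :
    ENNReal.ofReal (x ^ (-((m : ℝ) * n))) * ∏ _i : Fin m, volume (ball c (4 * x)) =
      (4 ^ n * volume (ball (0 : Rn n) 1)) ^ m := by
  rw [Finset.prod_const, Finset.card_univ, Fintype.card_fin, volume_ball_eq c (by positivity),
    ENNReal.ofReal_mul (by norm_num), mul_pow, mul_pow, mul_pow, mul_pow]
  have h4 : ENNReal.ofReal 4 = 4 := by simp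
  have h5 : ENNReal.ofReal (x ^ (-((m : ℝ) * n))) * (ENNReal.ofReal x ^ n) ^ m = 1 := by
    rw [← pow_mul, ← ENNReal.ofReal_pow hx.le, ← ENNReal.ofReal_mul (by positivity),
      ← Real.rpow_natCast, ← Real.rpow_add hx]
    push_cast
    rw [show -((m : ℝ) * n) + n * m = 0 by ring, Real.rpow_zero, ENNReal.ofReal_one]
  rw [h4]
  calc _ = ENNReal.ofReal (x ^ (-((m : ℝ) * n))) * (ENNReal.ofReal x ^ n) ^ m *
        ((4 ^ n) ^ m * volume (ball (0 : Rn n) 1) ^ m) := by ring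
    _ = _ := by rw [h5, one_mul]

end Tail

section Nonlocal

variable {k : (Fin m → Rn n) → ℝ} {A γ δ B : ℝ}

lemma LPKernel.one_le_dil [NeZero n] (hk : LPKernel k A γ δ B) : 1 ≤ dil n B := by
  have h := hk.two_mul_le_dil
  have hn : (1 : ℝ) ≤ n := by exact_mod_cast NeZero.one_le
  linarith

lemma LPKernel.le_sum_dist [NeZero n] (hk : LPKernel k A γ δ B) {x₀ x : Rn n} {r : ℝ}
    (hx : x ∈ ball x₀ r) {y : Fin m → Rn n}
    (hy : y ∉ univ.pi fun _ : Fin m => ball x₀ (dil n B * (2 * r))) :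
    dil n B * r ≤ ∑ j, dist x (y j) := by
  rw [mem_univ_pi] at hy
  push Not at hy
  obtain ⟨j, hj⟩ := hy
  rw [mem_ball, not_lt] at hj
  rw [mem_ball] at hx
  have hr : 0 < r := dist_nonneg.trans_lt hx
  have hΛ := hk.one_le_dil
  have h1 : dist x (y j) ≤ ∑ j, dist x (y j) :=
    Finset.single_le_sum (f := fun j => dist x (y j)) (fun _ _ => dist_nonneg) (Finset.mem_univ j)
  have h2 := dist_triangle (y j) x x₀
  rw [dist_comm (y j) x] at h2
  have h3 : r ≤ dil n B * r := le_mul_of_one_le_left hr.le hΛ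
  linarith

lemma LPKernel.ball_subset_mul_ball [NeZero n] (hk : LPKernel k A γ δ B) {x₀ x : Rn n} {r : ℝ}
    (hx : x ∈ ball x₀ r) (l : ℕ) :
    ball x (2 ^ (l + 1) * (dil n B * r)) ⊆ ball x₀ (4 * (2 ^ l * (dil n B * r))) := by
  rw [mem_ball] at hx
  have hr : 0 < r := dist_nonneg.trans_lt hx
  have h3 : r ≤ dil n B * r := le_mul_of_one_le_left hr.le hk.one_le_dil
  have h4 : dil n B * r ≤ 2 ^ l * (dil n B * r) :=
    le_mul_of_one_le_left (by linarith) (one_le_pow₀ one_le_two)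
  refine ball_subset_ball' ?_
  rw [pow_succ]
  linarith

lemma ofReal_abs_sub_ballAvg_add_le {b : Rn n → ℝ} (hb : MemBMO b) (c : Rn n) {r : ℝ} (hr : 0 < r)
    (l : ℕ) (a : ℝ) (κ : ℝ≥0∞) :
    ENNReal.ofReal |a - ballAvg b (ball c (2 ^ l * r))| + κ ≤
      (1 + l) * (ENNReal.ofReal |a - ballAvg b (ball c r)| + (κ + bmoNorm b * 2 ^ n)) := by
  have h1 := ofReal_abs_sub_le a (ballAvg b (ball c r)) (ballAvg b (ball c (2 ^ l * r)))
  have h2 := ofReal_abs_ballAvg_two_pow_le hb c hr l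
  rw [abs_sub_comm] at h2
  set u := ENNReal.ofReal |a - ballAvg b (ball c r)|
  calc _ ≤ u + l * (bmoNorm b * 2 ^ n) + κ :=
        add_le_add (h1.trans (add_le_add le_rfl h2)) le_rfl
    _ ≤ u + l * (bmoNorm b * 2 ^ n) + κ + (bmoNorm b * 2 ^ n + l * u + l * κ) := le_self_add
    _ = _ := by ring

lemma LPKernel.exists_nonlocal_le [NeZero n] [NeZero m] (hk : LPKernel k A γ δ B) {p : ℝ}
    {ps : Fin m → ℝ} {ωs : Fin m → Rn n → ℝ} (hm : ∀ i, Measurable (ωs i))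
    (hpos : ∀ i x, 0 < ωs i x) (hp0 : 0 < p) (hps : ∀ i, 1 < ps i) (hp : p⁻¹ = ∑ k, (ps k)⁻¹)
    (hAP : IsMultiAP p ps ωs) {b : Fin m → Rn n → ℝ} (hb : ∀ i, MemBMO (b i))
    (hbm : ∀ i, Measurable (b i)) :
    ∃ (C : ℝ≥0∞) (κ : Fin m → ℝ≥0∞), C ≠ ⊤ ∧ (∀ i, κ i ≠ ⊤) ∧
      ∀ f : Fin m → Rn n → ℝ, (∀ i, Measurable (f i)) → ∀ (x₀ : Rn n) (r : ℝ), 0 < r →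
      (∀ i s, 0 < s →
        ∫⁻ y in ball x₀ s, ENNReal.ofReal |f i y| ^ ps i * ENNReal.ofReal (ωs i y) ≠ ⊤) →
      ∀ x ∈ ball x₀ r, gOn k univ (fun i y => (b i x - b i y) * f i y) x ≤
        gOn k (univ.pi fun _ : Fin m => ball x₀ (dil n B * (2 * r)))
          (fun i y => (b i x - b i y) * f i y) x +
        C * (∏ i, (ENNReal.ofReal |b i x - ballAvg (b i) (ball x₀ (4 * (dil n B * r)))| + κ i)) *
          ∑' l : ℕ, (1 + l) ^ m * tailTerm p ps ωs f x₀ (2 ^ l * (4 * (dil n B * r))) := by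
  obtain ⟨hν, hσ⟩ := isAinfMeas_of_isMultiAP hm hpos hp0 hps hp hAP
  obtain ⟨C1, hC1, hg⟩ := hk.exists_gOn_univ_le
  obtain ⟨C2, hC2, htail⟩ := hAP.exists_prod_dualAvg_le hp0 hps hp hν hσ
  have huv := fun i => (Real.HolderConjugate.conjExponent (hps i)).symm
  choose C3 hC3 hjn using fun i => exists_weighted_jn (hb i) (hbm i) (hσ i) (huv i).pos
  have hV : (4 ^ n * volume (ball (0 : Rn n) 1)) ^ m ≠ ⊤ := by
    have := volume_ball_ne_top (0 : Rn n) 1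
    finiteness
  refine ⟨C1 * ((4 ^ n * volume (ball (0 : Rn n) 1)) ^ m * C2),
    fun i => C3 i ^ (1 / (ps i).conjExponent) + bmoNorm (b i) * 2 ^ n, by finiteness,
    fun i => ?_, fun f hf x₀ r hr hfin x hx => ?_⟩
  · have h1 := (huv i).pos
    exact ENNReal.add_ne_top.2 ⟨ENNReal.rpow_ne_top_of_nonneg (by positivity) (hC3 i),
      ENNReal.mul_ne_top (hb i).2.ne (by finiteness)⟩
  have hΛ : 0 < dil n B * r := mul_pos (by linarith [hk.one_le_dil]) hr
  have hR : ∀ l : ℕ, 0 < 2 ^ l * (4 * (dil n B * r)) := fun l => by positivity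
  have hRe : ∀ l : ℕ, 4 * (2 ^ l * (dil n B * r)) = 2 ^ l * (4 * (dil n B * r)) := fun l => by ring
  have hFm : ∀ i, Measurable fun y => (b i x - b i y) * f i y := fun i =>
    ((hbm i).const_sub _).mul (hf i)
  have hcomm : ∀ (l : ℕ) i, ∫⁻ y in ball x (2 ^ (l + 1) * (dil n B * r)),
      ENNReal.ofReal |(b i x - b i y) * f i y| ≤
      (1 + l) * (ENNReal.ofReal |b i x - ballAvg (b i) (ball x₀ (4 * (dil n B * r)))| +
        (C3 i ^ (1 / (ps i).conjExponent) + bmoNorm (b i) * 2 ^ n)) *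
      dualAvg (ps i) (ωs i) (f i) x₀ (2 ^ l * (4 * (dil n B * r))) *
      volume (ball x₀ (4 * (2 ^ l * (dil n B * r)))) := fun l i => by
    refine (lintegral_mono_set (hk.ball_subset_mul_ball hx l)).trans ?_
    rw [hRe]
    refine (setLIntegral_comm_le (hps i) (hm i) (hpos i) (hσ i) (hbm i) (hf i) (hR l)
      (hjn i x₀ _ (hR l)) (b i x)).trans ?_
    exact mul_le_mul' (mul_le_mul' (ofReal_abs_sub_ballAvg_add_le (hb i) x₀ (by positivity) l _ _)
      le_rfl) le_rfl
  have hfinI : ∀ (l : ℕ) i, ∫⁻ y in ball x (2 ^ (l + 1) * (dil n B * r)),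
      ENNReal.ofReal |(b i x - b i y) * f i y| ≠ ⊤ := fun l i => by
    refine ne_top_of_le_ne_top ?_ (hcomm l i)
    have h0 := (huv i).pos
    have h0' : 0 < ps i := by linarith [hps i]
    have h1 : dualAvg (ps i) (ωs i) (f i) x₀ (2 ^ l * (4 * (dil n B * r))) ≠ ⊤ :=
      ENNReal.mul_ne_top (ENNReal.div_ne_top ((hσ i).ball_ne_top _ _)
        (volume_ball_pos _ (hR l)).ne') (ENNReal.rpow_ne_top_of_nonneg (by positivity)
          (ENNReal.div_ne_top (hfin i _ (hR l)) ((hσ i).ball_ne_zero _ _ (hR l))))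
    have h2 : C3 i ^ (1 / (ps i).conjExponent) ≠ ⊤ :=
      ENNReal.rpow_ne_top_of_nonneg (by positivity) (hC3 i)
    have h3 := (hb i).2.ne
    have h4 := volume_ball_ne_top x₀ (4 * (2 ^ l * (dil n B * r)))
    finiteness
  refine (hg x _ hΛ _ (MeasurableSet.univ_pi fun _ => measurableSet_ball)
    (fun y hy => hk.le_sum_dist hx hy) _ hFm hfinI).trans (add_le_add le_rfl ?_)
  rw [mul_assoc, mul_assoc]
  refine mul_le_mul' le_rfl ?_
  rw [← ENNReal.tsum_mul_left, ← ENNReal.tsum_mul_left]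
  refine ENNReal.tsum_le_tsum fun l => ?_
  set Y := ∏ i, (ENNReal.ofReal |b i x - ballAvg (b i) (ball x₀ (4 * (dil n B * r)))| +
    (C3 i ^ (1 / (ps i).conjExponent) + bmoNorm (b i) * 2 ^ n)) with hY
  calc _ ≤ ENNReal.ofReal ((2 ^ l * (dil n B * r)) ^ (-((m : ℝ) * n))) *
        ((1 + l) ^ m * Y * (∏ i, dualAvg (ps i) (ωs i) (f i) x₀ (2 ^ l * (4 * (dil n B * r)))) *
          ∏ _i : Fin m, volume (ball x₀ (4 * (2 ^ l * (dil n B * r))))) := by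
        refine mul_le_mul' le_rfl ((Finset.prod_le_prod' fun i _ => hcomm l i).trans_eq ?_)
        simp only [Finset.prod_mul_distrib, Finset.prod_const, Finset.card_univ, Fintype.card_fin,
          hY]
    _ = (4 ^ n * volume (ball (0 : Rn n) 1)) ^ m * (Y * ((1 + l) ^ m *
          ∏ i, dualAvg (ps i) (ωs i) (f i) x₀ (2 ^ l * (4 * (dil n B * r))))) := by
        rw [← ofReal_rpow_neg_mul_prod_volume (m := m) x₀ (2 ^ l * (dil n B * r)) (by positivity)]
        ring
    _ ≤ (4 ^ n * volume (ball (0 : Rn n) 1)) ^ m * (Y * ((1 + l) ^ m *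
          (C2 * tailTerm p ps ωs f x₀ (2 ^ l * (4 * (dil n B * r)))))) :=
        mul_le_mul' le_rfl (mul_le_mul' le_rfl (mul_le_mul' le_rfl (htail f x₀ _ (hR l))))
    _ = _ := by ring

end Nonlocal

section Strong

variable {k : (Fin m → Rn n) → ℝ} {A γ δ B : ℝ}

lemma prod_rpow_eq_mul_tailTerm [NeZero n] {p : ℝ} {ps : Fin m → ℝ} {ωs : Fin m → Rn n → ℝ}
    (hp0 : 0 < p) (hν : IsAinfMeas (weightMeas (nuw p ps ωs))) (f : Fin m → Rn n → ℝ) (c : Rn n)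
    {r : ℝ} (hr : 0 < r) :
    ∏ i, (∫⁻ y in ball c r, ENNReal.ofReal |f i y| ^ ps i * ENNReal.ofReal (ωs i y)) ^ (p / ps i) =
      weightMeas (nuw p ps ωs) (ball c r) * tailTerm p ps ωs f c r ^ p := by
  have h0 := hν.ball_ne_zero c r hr
  have ht := hν.ball_ne_top c r
  rw [tailTerm, ENNReal.mul_rpow_of_nonneg _ _ hp0.le, ← ENNReal.rpow_mul,
    show -(1 / p) * p = -1 by field_simp, ENNReal.rpow_neg_one, ← mul_assoc,
    ENNReal.mul_inv_cancel h0 ht, one_mul, ← ENNReal.prod_rpow_of_nonneg hp0.le]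
  refine Finset.prod_congr rfl fun i _ => ?_
  rw [wLpNorm, wLpNormE, ← ENNReal.rpow_mul]
  congr 1
  ring

lemma LPKernel.exists_strong_le [NeZero n] [NeZero m] (hk : LPKernel k A γ δ B) (hbd : GBdd k)
    {p : ℝ} {ps : Fin m → ℝ} {ωs : Fin m → Rn n → ℝ} (hm : ∀ i, Measurable (ωs i))
    (hpos : ∀ i x, 0 < ωs i x) (hp0 : 0 < p) (hps : ∀ i, 1 < ps i) (hp : p⁻¹ = ∑ k, (ps k)⁻¹)
    (hAP : IsMultiAP p ps ωs) {b : Fin m → Rn n → ℝ} (hb : ∀ i, MemBMO (b i))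
    (hbm : ∀ i, Measurable (b i)) :
    ∃ C : ℝ≥0∞, C ≠ ⊤ ∧ ∀ f : Fin m → Rn n → ℝ, (∀ i, Measurable (f i)) → ∀ (x₀ : Rn n) (r : ℝ),
      0 < r → (∀ i s, 0 < s →
        ∫⁻ y in ball x₀ s, ENNReal.ofReal |f i y| ^ ps i * ENNReal.ofReal (ωs i y) ≠ ⊤) →
      ∫⁻ x in ball x₀ r, gOn k univ (fun i y => (b i x - b i y) * f i y) x ^ p
          ∂(weightMeas (nuw p ps ωs)) ≤
        C * weightMeas (nuw p ps ωs) (ball x₀ r) *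
          (∑' l : ℕ, (1 + l) ^ m * tailTerm p ps ωs f x₀ (2 ^ l * (4 * (dil n B * r)))) ^ p := by
  obtain ⟨hν, -⟩ := isAinfMeas_of_isMultiAP hm hpos hp0 hps hp hAP
  obtain ⟨C1, hC1, hloc⟩ := hk.exists_weighted_local hbd hm hpos hp0 hps hp hAP hb hbm
  obtain ⟨C2, κ, hC2, hκ, hnl⟩ := hk.exists_nonlocal_le hm hpos hp0 hps hp hAP hb hbm
  obtain ⟨C3, hC3, hosc⟩ := exists_prod_osc_le hb hbm hν hp0 κ hκ
  have hΛ := hk.one_le_dil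
  obtain ⟨D, hD, hball⟩ := hν.exists_ball_le (a := 4 * dil n B) (by linarith)
  refine ⟨2 ^ p * (C1 * D + C2 ^ p * (C3 * D)), ?_, fun f hf x₀ r hr hfin => ?_⟩
  · have := ENNReal.rpow_ne_top_of_nonneg hp0.le hC2
    have := ENNReal.rpow_ne_top_of_nonneg hp0.le (ENNReal.ofNat_ne_top (n := 2))
    finiteness
  have hρ : 0 < 4 * (dil n B * r) := by positivity
  have hrρ : r ≤ 4 * (dil n B * r) := by
    have : r ≤ dil n B * r := le_mul_of_one_le_left hr.le hΛ
    linarith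
  set ν := weightMeas (nuw p ps ωs) with hνdef
  set Y : Rn n → ℝ≥0∞ := fun x =>
    ∏ i, (ENNReal.ofReal |b i x - ballAvg (b i) (ball x₀ (4 * (dil n B * r)))| + κ i) with hY
  have hYm : Measurable Y := Finset.measurable_fun_prod _ fun i _ =>
    (ENNReal.measurable_ofReal.comp ((hbm i).sub_const _).abs).add_const _
  set T := ∑' l : ℕ, (1 + (l : ℝ≥0∞)) ^ m * tailTerm p ps ωs f x₀ (2 ^ l * (4 * (dil n B * r)))
    with hS
  set g₀ : Rn n → ℝ≥0∞ := fun x => gOn k (univ.pi fun _ : Fin m => ball x₀ (dil n B * (2 * r)))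
    (fun i y => (b i x - b i y) * f i y) x with hg₀
  have hνρ : ν (ball x₀ (4 * (dil n B * r))) ≤ D * ν (ball x₀ r) := by
    rw [← mul_assoc]
    exact hball x₀ x₀ r hr (ball_subset_ball (by rw [mul_assoc]; exact hrρ))
  have h0 : tailTerm p ps ωs f x₀ (4 * (dil n B * r)) ≤ T := by
    have := ENNReal.le_tsum (f := fun l : ℕ =>
      (1 + (l : ℝ≥0∞)) ^ m * tailTerm p ps ωs f x₀ (2 ^ l * (4 * (dil n B * r)))) 0
    simpa using this
  have hlocal : ∫⁻ x in ball x₀ r, g₀ x ^ p ∂ν ≤ C1 * D * ν (ball x₀ r) * T ^ p := by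
    have hsub : ball x₀ r ⊆ cube x₀ (2 * r) := by
      simpa using ball_subset_cube x₀ (2 * r)
    have hsub2 : ball x₀ (dil n B * (2 * r)) ⊆ ball x₀ (4 * (dil n B * r)) :=
      ball_subset_ball (by nlinarith)
    calc ∫⁻ x in ball x₀ r, g₀ x ^ p ∂ν ≤ ∫⁻ x in cube x₀ (2 * r), g₀ x ^ p ∂ν :=
          lintegral_mono_set hsub
      _ ≤ C1 * ∏ i, (∫⁻ y in ball x₀ (dil n B * (2 * r)),
            ENNReal.ofReal |f i y| ^ ps i * ENNReal.ofReal (ωs i y)) ^ (p / ps i) :=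
          hloc f hf x₀ (2 * r) (by positivity) fun i => hfin i _ (by positivity)
      _ ≤ C1 * ∏ i, (∫⁻ y in ball x₀ (4 * (dil n B * r)),
            ENNReal.ofReal |f i y| ^ ps i * ENNReal.ofReal (ωs i y)) ^ (p / ps i) := by
          refine mul_le_mul' le_rfl (Finset.prod_le_prod' fun i _ => ?_)
          have := hps i
          exact ENNReal.rpow_le_rpow (lintegral_mono_set hsub2) (by positivity)
      _ ≤ C1 * (D * ν (ball x₀ r) * T ^ p) := by
          rw [prod_rpow_eq_mul_tailTerm hp0 hν f x₀ hρ]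
          exact mul_le_mul' le_rfl (mul_le_mul' hνρ (ENNReal.rpow_le_rpow h0 hp0.le))
      _ = _ := by ring
  have hYint : ∫⁻ x in ball x₀ r, Y x ^ p ∂ν ≤ C3 * D * ν (ball x₀ r) := by
    refine (lintegral_mono_set (ball_subset_ball hrρ)).trans ((hosc x₀ _ hρ).trans ?_)
    rw [mul_assoc]
    exact mul_le_mul' le_rfl hνρ
  calc ∫⁻ x in ball x₀ r, gOn k univ (fun i y => (b i x - b i y) * f i y) x ^ p ∂ν
      ≤ ∫⁻ x in ball x₀ r, (2 ^ p * g₀ x ^ p + 2 ^ p * ((C2 * T) ^ p * Y x ^ p)) ∂ν := by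
        refine setLIntegral_mono' measurableSet_ball fun x hx => ?_
        refine (ENNReal.rpow_le_rpow (hnl f hf x₀ r hr hfin x hx) hp0.le).trans ?_
        refine (add_rpow_le_two_rpow_mul _ _ hp0.le).trans_eq ?_
        rw [mul_add, ← ENNReal.mul_rpow_of_nonneg _ (Y x) hp0.le]
        congr 3
        ring
    _ = 2 ^ p * (∫⁻ x in ball x₀ r, g₀ x ^ p ∂ν) +
        2 ^ p * ((C2 * T) ^ p * ∫⁻ x in ball x₀ r, Y x ^ p ∂ν) := by
        have h2 : (2 : ℝ≥0∞) ^ p ≠ ⊤ :=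
          ENNReal.rpow_ne_top_of_nonneg hp0.le (ENNReal.ofNat_ne_top (n := 2))
        rw [lintegral_add_right _ (((hYm.pow_const p).const_mul _).const_mul _),
          lintegral_const_mul' _ _ h2, lintegral_const_mul' _ _ h2,
          lintegral_const_mul _ (hYm.pow_const p)]
    _ ≤ 2 ^ p * (C1 * D * ν (ball x₀ r) * T ^ p) +
        2 ^ p * ((C2 * T) ^ p * (C3 * D * ν (ball x₀ r))) :=
        add_le_add (mul_le_mul' le_rfl hlocal) (mul_le_mul' le_rfl (mul_le_mul' le_rfl hYint))
    _ = _ := by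
        rw [ENNReal.mul_rpow_of_nonneg _ _ hp0.le]
        ring

end Strong

section MorreySum

lemma wLpNorm_ball_le_morreyNorm_mul {q : ℝ} {φ : Rn n → ℝ → ℝ} {ω f : Rn n → ℝ}
    (hM : morreyNorm q φ ω f ≠ ⊤) (hq : 0 < q) {x : Rn n} {r : ℝ} (hr : 0 < r)
    (h0 : wMeas ω (ball x r) ≠ 0) (ht : wMeas ω (ball x r) ≠ ⊤) :
    wLpNorm q ω (ball x r) f ≤
      morreyNorm q φ ω f * (ENNReal.ofReal (φ x r) * wMeas ω (ball x r) ^ (1 / q)) := by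
  have h1 : (ENNReal.ofReal (φ x r))⁻¹ * wMeas ω (ball x r) ^ (-(1 / q)) *
      wLpNorm q ω (ball x r) f ≤ morreyNorm q φ ω f :=
    le_iSup_of_le x (le_iSup_of_le r (le_iSup_of_le hr le_rfl))
  set M := morreyNorm q φ ω f
  set X := wLpNorm q ω (ball x r) f
  rw [ENNReal.rpow_neg] at h1
  set c := wMeas ω (ball x r) ^ (1 / q) with hc
  have hc0 : c ≠ 0 := (ENNReal.rpow_pos (pos_iff_ne_zero.2 h0) ht).ne'
  have hct : c ≠ ⊤ := ENNReal.rpow_ne_top_of_nonneg (by positivity) ht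
  by_cases ha : ENNReal.ofReal (φ x r) = 0
  · rw [ha, ENNReal.inv_zero, ENNReal.top_mul (ENNReal.inv_ne_zero.2 hct)] at h1
    have : X = 0 := by
      by_contra hX
      rw [ENNReal.top_mul hX] at h1
      exact hM (top_le_iff.1 h1)
    rw [this]
    exact zero_le
  · rw [← ENNReal.mul_inv (Or.inl ha) (Or.inr hc0), mul_comm, ← div_eq_mul_inv,
      ENNReal.div_le_iff (mul_ne_zero ha hc0) (ENNReal.mul_ne_top ENNReal.ofReal_ne_top hct)] at h1
    exact h1

lemma le_mul_essInf_of_forall {t : ℝ} {h : ℝ → ℝ≥0∞} {P c : ℝ≥0∞} (hc : c ≠ ⊤)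
    (hP : ∀ η, t < η → P ≤ c * h η) : P ≤ c * essInf h (volume.restrict (Ioi t)) := by
  by_cases hc0 : c = 0
  · have := hP (t + 1) (by linarith)
    rw [hc0, zero_mul] at this ⊢
    exact this
  · rw [mul_comm, ← ENNReal.div_le_iff hc0 hc]
    refine le_essInf_of_ae_le _ ?_
    refine (ae_restrict_iff' measurableSet_Ioi).2 (Eventually.of_forall fun η hη => ?_)
    rw [ENNReal.div_le_iff hc0 hc, mul_comm]
    exact hP η hη

lemma half_le_lintegral_inv {s : ℝ} (hs : 0 < s) :
    2⁻¹ ≤ ∫⁻ t in Ioo s (2 * s), (ENNReal.ofReal t)⁻¹ := by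
  calc (2⁻¹ : ℝ≥0∞) = ∫⁻ _t in Ioo s (2 * s), (ENNReal.ofReal (2 * s))⁻¹ := by
        rw [setLIntegral_const, Real.volume_Ioo, show 2 * s - s = s by ring,
          ENNReal.ofReal_mul zero_le_two, ENNReal.mul_inv (by simp) (by simp), mul_assoc,
          ENNReal.inv_mul_cancel (by simpa using hs) ENNReal.ofReal_ne_top]
        simp
    _ ≤ _ := setLIntegral_mono' measurableSet_Ioo fun t ht =>
        ENNReal.inv_le_inv.2 (ENNReal.ofReal_le_ofReal ht.2.le)

lemma one_add_natCast_le_log {r a t : ℝ} (hr : 0 < r) (hra : r ≤ a) {l : ℕ} (ht : 2 ^ l * a < t) :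
    1 + (l : ℝ≥0∞) ≤ 2 * ENNReal.ofReal (1 + Real.log (t / r)) := by
  have h1 : (2 : ℝ) ^ l ≤ t / r := by
    rw [le_div_iff₀ hr]
    exact (mul_le_mul_of_nonneg_left hra (by positivity)).trans ht.le
  have h2 := Real.log_le_log (by positivity) h1
  rw [Real.log_pow] at h2
  have h3 := Real.log_two_gt_d9
  have h4 : (l : ℝ) * (1 / 2) ≤ l * Real.log 2 :=
    mul_le_mul_of_nonneg_left (by linarith) (Nat.cast_nonneg l)
  have h5 : 1 + (l : ℝ≥0∞) = ENNReal.ofReal (1 + l) := by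
    rw [ENNReal.ofReal_add zero_le_one (Nat.cast_nonneg l), ENNReal.ofReal_one,
      ENNReal.ofReal_natCast]
  rw [h5, ← ENNReal.ofReal_ofNat 2, ← ENNReal.ofReal_mul zero_le_two]
  exact ENNReal.ofReal_le_ofReal (by linarith)

lemma exists_tsum_tailTerm_le [NeZero n] [NeZero m] {p : ℝ} {ps : Fin m → ℝ}
    {ωs : Fin m → Rn n → ℝ} (hm : ∀ i, Measurable (ωs i)) (hpos : ∀ i x, 0 < ωs i x) (hp0 : 0 < p)
    (hps : ∀ i, 1 < ps i) (hp : p⁻¹ = ∑ k, (ps k)⁻¹) (hA : ∀ i, IsAinfMeas (weightMeas (ωs i)))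
    (hν : IsAinfMeas (weightMeas (nuw p ps ωs))) (φ1 : Fin m → Rn n → ℝ → ℝ) :
    ∃ C : ℝ≥0∞, C ≠ ⊤ ∧ ∀ f : Fin m → Rn n → ℝ,
      (∀ i, morreyNorm (ps i) (φ1 i) (ωs i) (f i) ≠ ⊤) → ∀ (x : Rn n) (r a : ℝ), 0 < r → r ≤ a →
      ∑' l : ℕ, (1 + l) ^ m * tailTerm p ps ωs f x (2 ^ l * a) ≤
        C * (∏ i, morreyNorm (ps i) (φ1 i) (ωs i) (f i)) *
          ∫⁻ t in Ioi r, ENNReal.ofReal (1 + Real.log (t / r)) ^ m * essInfProd ps φ1 ωs x t *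
            (∏ i, wMeas (ωs i) (ball x t) ^ (1 / ps i))⁻¹ * (ENNReal.ofReal t)⁻¹ := by
  obtain ⟨C, hC, hprod⟩ := prod_wMeas_le_nuw hm hpos hp0 hps hp hA
  choose D hD hball using fun i => (hA i).exists_ball_le (a := 2) two_pos
  have hps0 : ∀ i, 0 < 1 / ps i := fun i => one_div_pos.2 (by linarith [hps i])
  have hps0' : ∀ i, 0 < ps i := fun i => by linarith [hps i]
  have hw0 : ∀ i (x : Rn n) s, 0 < s → wMeas (ωs i) (ball x s) ≠ 0 := fun i x s hs => by
    rw [← weightMeas_apply measurableSet_ball]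
    exact (hA i).ball_ne_zero x s hs
  have hwt : ∀ i (x : Rn n) s, wMeas (ωs i) (ball x s) ≠ ⊤ := fun i x s => by
    rw [← weightMeas_apply measurableSet_ball]
    exact (hA i).ball_ne_top x s
  have hDD : ∏ i, D i ^ (1 / ps i) ≠ ⊤ :=
    ENNReal.prod_ne_top fun i _ => ENNReal.rpow_ne_top_of_nonneg (hps0 i).le (hD i)
  refine ⟨2 * (2 ^ m * (C * ∏ i, D i ^ (1 / ps i))), by finiteness, fun f hM x r a hr hra => ?_⟩
  have ha : 0 < a := hr.trans_le hra
  set M := ∏ i, morreyNorm (ps i) (φ1 i) (ωs i) (f i) with hMdef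
  have hMt : M ≠ ⊤ := ENNReal.prod_ne_top fun i _ => hM i
  set H : ℝ → ℝ≥0∞ := fun t => ENNReal.ofReal (1 + Real.log (t / r)) ^ m *
    essInfProd ps φ1 ωs x t * (∏ i, wMeas (ωs i) (ball x t) ^ (1 / ps i))⁻¹ *
      (ENNReal.ofReal t)⁻¹ with hH
  have hpt : ∀ l : ℕ, ∀ t ∈ Ioo (2 ^ l * a) (2 * (2 ^ l * a)),
      (1 + l) ^ m * tailTerm p ps ωs f x (2 ^ l * a) * (ENNReal.ofReal t)⁻¹ ≤
        2 ^ m * (C * ∏ i, D i ^ (1 / ps i)) * M * H t := by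
    rintro l t ⟨ht1, ht2⟩
    have hs : 0 < 2 ^ l * a := by positivity
    have ht : 0 < t := hs.trans ht1
    set s := 2 ^ l * a with hsdef
    have e1 : (1 + (l : ℝ≥0∞)) ^ m ≤ 2 ^ m * ENNReal.ofReal (1 + Real.log (t / r)) ^ m := by
      rw [← mul_pow]
      exact pow_le_pow_left' (one_add_natCast_le_log hr hra ht1) m
    have e2 : ∏ i, wLpNorm (ps i) (ωs i) (ball x s) (f i) ≤ M * essInfProd ps φ1 ωs x t := by
      refine le_mul_essInf_of_forall hMt fun η hη => ?_
      rw [hMdef, ← Finset.prod_mul_distrib]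
      refine Finset.prod_le_prod' fun i _ => ?_
      refine le_trans ?_ (wLpNorm_ball_le_morreyNorm_mul (hM i) (hps0' i) (ht.trans hη)
        (hw0 i x η (ht.trans hη)) (hwt i x η))
      exact ENNReal.rpow_le_rpow (lintegral_mono_set (ball_subset_ball (ht1.trans hη).le))
        (hps0 i).le
    have e3 : ∏ i, wMeas (ωs i) (ball x t) ^ (1 / ps i) ≤
        (∏ i, D i ^ (1 / ps i)) * ∏ i, wMeas (ωs i) (ball x s) ^ (1 / ps i) := by
      rw [← Finset.prod_mul_distrib]
      refine Finset.prod_le_prod' fun i _ => ?_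
      rw [← ENNReal.mul_rpow_of_nonneg _ _ (hps0 i).le]
      refine ENNReal.rpow_le_rpow ?_ (hps0 i).le
      have := hball i x x s hs (ball_subset_ball (by linarith))
      rw [weightMeas_apply measurableSet_ball, weightMeas_apply measurableSet_ball] at this
      exact (lintegral_mono_set (ball_subset_ball ht2.le)).trans this
    have e4 : ∏ i, wMeas (ωs i) (ball x t) ^ (1 / ps i) ≤
        (C * ∏ i, D i ^ (1 / ps i)) * weightMeas (nuw p ps ωs) (ball x s) ^ (1 / p) := by
      refine e3.trans ((mul_le_mul' le_rfl (hprod x s hs)).trans_eq ?_)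
      rw [weightMeas_apply measurableSet_ball]
      ring
    have e5 : weightMeas (nuw p ps ωs) (ball x s) ^ (-(1 / p)) ≤
        (C * ∏ i, D i ^ (1 / ps i)) * (∏ i, wMeas (ωs i) (ball x t) ^ (1 / ps i))⁻¹ := by
      have hW0 : ∏ i, wMeas (ωs i) (ball x t) ^ (1 / ps i) ≠ 0 :=
        Finset.prod_ne_zero_iff.2 fun i _ =>
          (ENNReal.rpow_pos (pos_iff_ne_zero.2 (hw0 i x t ht)) (hwt i x t)).ne'
      have hWt : ∏ i, wMeas (ωs i) (ball x t) ^ (1 / ps i) ≠ ⊤ :=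
        ENNReal.prod_ne_top fun i _ => ENNReal.rpow_ne_top_of_nonneg (hps0 i).le (hwt i x t)
      have hN0 : weightMeas (nuw p ps ωs) (ball x s) ^ (1 / p) ≠ 0 :=
        (ENNReal.rpow_pos (pos_iff_ne_zero.2 (hν.ball_ne_zero x s hs)) (hν.ball_ne_top x s)).ne'
      have hNt : weightMeas (nuw p ps ωs) (ball x s) ^ (1 / p) ≠ ⊤ :=
        ENNReal.rpow_ne_top_of_nonneg (by positivity) (hν.ball_ne_top x s)
      rw [ENNReal.rpow_neg, ← div_eq_mul_inv, ENNReal.le_div_iff_mul_le (Or.inl hW0) (Or.inl hWt),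
        mul_comm, ← div_eq_mul_inv, ENNReal.div_le_iff hN0 hNt]
      exact e4
    calc (1 + l) ^ m * tailTerm p ps ωs f x s * (ENNReal.ofReal t)⁻¹
        ≤ 2 ^ m * ENNReal.ofReal (1 + Real.log (t / r)) ^ m *
          ((C * ∏ i, D i ^ (1 / ps i)) * (∏ i, wMeas (ωs i) (ball x t) ^ (1 / ps i))⁻¹ *
            (M * essInfProd ps φ1 ωs x t)) * (ENNReal.ofReal t)⁻¹ :=
          mul_le_mul' (mul_le_mul' e1 (mul_le_mul' e5 e2)) le_rfl
      _ = _ := by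
          rw [hH]
          ring
  have hterm : ∀ l : ℕ, (1 + l) ^ m * tailTerm p ps ωs f x (2 ^ l * a) ≤
      2 * (2 ^ m * (C * ∏ i, D i ^ (1 / ps i))) * M *
        ∫⁻ t in Ioo (2 ^ l * a) (2 * (2 ^ l * a)), H t := fun l => by
    have hs : 0 < 2 ^ l * a := by positivity
    calc (1 + l) ^ m * tailTerm p ps ωs f x (2 ^ l * a)
        = 2 * ((1 + l) ^ m * tailTerm p ps ωs f x (2 ^ l * a) * 2⁻¹) := by
          rw [mul_left_comm, ENNReal.mul_inv_cancel (by norm_num) (by norm_num), mul_one]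
      _ ≤ 2 * ∫⁻ t in Ioo (2 ^ l * a) (2 * (2 ^ l * a)),
            (1 + l) ^ m * tailTerm p ps ωs f x (2 ^ l * a) * (ENNReal.ofReal t)⁻¹ := by
          refine mul_le_mul' le_rfl ?_
          rw [lintegral_const_mul _ (by fun_prop)]
          exact mul_le_mul' le_rfl (half_le_lintegral_inv hs)
      _ ≤ 2 * ∫⁻ t in Ioo (2 ^ l * a) (2 * (2 ^ l * a)),
            2 ^ m * (C * ∏ i, D i ^ (1 / ps i)) * M * H t :=
          mul_le_mul' le_rfl (setLIntegral_mono' measurableSet_Ioo (hpt l))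
      _ = _ := by
          rw [lintegral_const_mul' _ _ (by finiteness)]
          ring
  refine (ENNReal.tsum_le_tsum hterm).trans ?_
  rw [ENNReal.tsum_mul_left]
  refine mul_le_mul' le_rfl ?_
  have hdisj : Pairwise (Disjoint on fun l : ℕ => Ioo (2 ^ l * a) (2 * (2 ^ l * a))) := by
    have : ∀ l l' : ℕ, l < l' →
        Disjoint (Ioo (2 ^ l * a) (2 * (2 ^ l * a))) (Ioo (2 ^ l' * a) (2 * (2 ^ l' * a))) := by
      intro l l' hl
      refine Set.disjoint_left.2 fun t ht ht' => ?_
      have h1 : (2 : ℝ) ^ (l + 1) ≤ 2 ^ l' := pow_le_pow_right₀ one_le_two hl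
      have h2 := mul_le_mul_of_nonneg_right h1 ha.le
      rw [pow_succ] at h2
      linarith [ht.2, ht'.1]
    intro l l' hl
    rcases lt_or_gt_of_ne hl with h | h
    · exact this l l' h
    · exact (this l' l h).symm
  rw [← lintegral_iUnion (fun _ => measurableSet_Ioo) hdisj]
  refine lintegral_mono_set (iUnion_subset fun l t ht => ?_)
  have : a ≤ 2 ^ l * a := le_mul_of_one_le_left ha.le (one_le_pow₀ one_le_two)
  exact (hra.trans this).trans_lt ht.1

end MorreySum

section MorreyBound

variable {k : (Fin m → Rn n) → ℝ} {A γ δ B : ℝ}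

lemma LPKernel.exists_morreyNormE_le [NeZero n] [NeZero m] (hk : LPKernel k A γ δ B)
    (hbd : GBdd k) {p : ℝ} {ps : Fin m → ℝ} {ωs : Fin m → Rn n → ℝ}
    (hm : ∀ i, Measurable (ωs i)) (hpos : ∀ i x, 0 < ωs i x) (hp0 : 0 < p)
    (hps : ∀ i, 1 < ps i) (hp : p⁻¹ = ∑ k, (ps k)⁻¹) (hAP : IsMultiAP p ps ωs)
    (hA : ∀ i, IsAinfMeas (weightMeas (ωs i))) {φ1 : Fin m → Rn n → ℝ → ℝ}
    {φ2 : Rn n → ℝ → ℝ} (hcond : phiCond m ps φ1 ωs φ2) {b : Fin m → Rn n → ℝ}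
    (hb : ∀ i, MemBMO (b i)) (hbm : ∀ i, Measurable (b i)) :
    ∃ C : ℝ≥0∞, C ≠ ⊤ ∧ ∀ f : Fin m → Rn n → ℝ, (∀ i, Measurable (f i)) →
      (∀ i, morreyNorm (ps i) (φ1 i) (ωs i) (f i) ≠ ⊤) →
      morreyNormE p φ2 (nuw p ps ωs) (fun x => gOn k univ (fun i y => (b i x - b i y) * f i y) x) ≤
        C * ∏ i, morreyNorm (ps i) (φ1 i) (ωs i) (f i) := by
  obtain ⟨hν, -⟩ := isAinfMeas_of_isMultiAP hm hpos hp0 hps hp hAP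
  obtain ⟨C1, hC1, h1⟩ := hk.exists_strong_le hbd hm hpos hp0 hps hp hAP hb hbm
  obtain ⟨C2, hC2, h2⟩ := exists_tsum_tailTerm_le hm hpos hp0 hps hp hA hν φ1
  unfold phiCond at hcond
  set Φ : ℝ≥0∞ := ⨆ (x : Rn n) (r : ℝ) (_ : 0 < r), phiCondAt m ps φ1 ωs φ2 x r with hΦ
  have hp1 : 0 ≤ 1 / p := (one_div_pos.2 hp0).le
  have hΛ := hk.one_le_dil
  refine ⟨C1 ^ (1 / p) * C2 * Φ, ENNReal.mul_ne_top (ENNReal.mul_ne_top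
    (ENNReal.rpow_ne_top_of_nonneg hp1 hC1) hC2) hcond.ne, fun f hf hM => ?_⟩
  refine iSup_le fun x => iSup_le fun r => iSup_le fun hr => ?_
  have hfin : ∀ i s, 0 < s →
      ∫⁻ y in ball x s, ENNReal.ofReal |f i y| ^ ps i * ENNReal.ofReal (ωs i y) ≠ ⊤ := by
    intro i s hs htop
    have hq : 0 < ps i := by linarith [hps i]
    have h0 := (hA i).ball_ne_zero x s hs
    have ht := (hA i).ball_ne_top x s
    rw [weightMeas_apply measurableSet_ball] at h0 ht
    have := wLpNorm_ball_le_morreyNorm_mul (hM i) hq hs h0 ht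
    rw [wLpNorm, wLpNormE, htop, ENNReal.top_rpow_of_pos (one_div_pos.2 hq), top_le_iff] at this
    exact ENNReal.mul_ne_top (hM i) (ENNReal.mul_ne_top ENNReal.ofReal_ne_top
      (ENNReal.rpow_ne_top_of_nonneg (one_div_pos.2 hq).le ht)) this
  have h3 := h1 f hf x r hr hfin
  have h4 := h2 f hM x r (4 * (dil n B * r)) hr (by nlinarith)
  set S := ∑' l : ℕ, (1 + (l : ℝ≥0∞)) ^ m * tailTerm p ps ωs f x (2 ^ l * (4 * (dil n B * r)))
  set M := ∏ i, morreyNorm (ps i) (φ1 i) (ωs i) (f i)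
  set J := ∫⁻ t in Ioi r, ENNReal.ofReal (1 + Real.log (t / r)) ^ m * essInfProd ps φ1 ωs x t *
            (∏ i, wMeas (ωs i) (ball x t) ^ (1 / ps i))⁻¹ * (ENNReal.ofReal t)⁻¹
  have hJ : (ENNReal.ofReal (φ2 x r))⁻¹ * J ≤ Φ :=
    le_iSup_of_le x (le_iSup_of_le r (le_iSup_of_le hr le_rfl))
  have hV0 := hν.ball_ne_zero x r hr
  have hVt := hν.ball_ne_top x r
  have hI : wLpNormE p (nuw p ps ωs) (ball x r)
      (fun x => gOn k univ (fun i y => (b i x - b i y) * f i y) x) ≤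
      C1 ^ (1 / p) * wMeas (nuw p ps ωs) (ball x r) ^ (1 / p) * S := by
    rw [← weightMeas_apply measurableSet_ball]
    calc _ = (∫⁻ x in ball x r, gOn k univ (fun i y => (b i x - b i y) * f i y) x ^ p
          ∂(weightMeas (nuw p ps ωs))) ^ (1 / p) := by
          rw [weightMeas, setLIntegral_withDensity_eq_setLIntegral_mul_non_measurable _
            (measurable_nuw hm).ennreal_ofReal _ measurableSet_ball
            (ae_of_all _ fun _ => ENNReal.ofReal_lt_top)]
          simp only [wLpNormE, Pi.mul_apply, mul_comm]
      _ ≤ (C1 * weightMeas (nuw p ps ωs) (ball x r) * S ^ p) ^ (1 / p) :=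
          ENNReal.rpow_le_rpow h3 hp1
      _ = _ := by
          rw [ENNReal.mul_rpow_of_nonneg _ _ hp1, ENNReal.mul_rpow_of_nonneg _ _ hp1,
            ← ENNReal.rpow_mul, mul_one_div_cancel hp0.ne', ENNReal.rpow_one]
  rw [weightMeas_apply measurableSet_ball] at hV0 hVt
  set V := wMeas (nuw p ps ωs) (ball x r)
  calc _ ≤ (ENNReal.ofReal (φ2 x r))⁻¹ * V ^ (-(1 / p)) *
        (C1 ^ (1 / p) * V ^ (1 / p) * (C2 * M * J)) :=
        mul_le_mul' le_rfl (hI.trans (mul_le_mul' le_rfl h4))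
    _ = (V ^ (-(1 / p)) * V ^ (1 / p)) * (C1 ^ (1 / p) * C2) *
        ((ENNReal.ofReal (φ2 x r))⁻¹ * J) * M := by ring
    _ ≤ 1 * (C1 ^ (1 / p) * C2) * Φ * M := by
        rw [← ENNReal.rpow_add _ _ hV0 hVt, neg_add_cancel, ENNReal.rpow_zero]
        exact mul_le_mul' (mul_le_mul' le_rfl hJ) le_rfl
    _ = _ := by rw [one_mul]

lemma gOn_congr_ae (k : (Fin m → Rn n) → ℝ) {F G : Fin m → Rn n → ℝ}
    (h : ∀ i, F i =ᵐ[volume] G i) (x : Rn n) : gOn k univ F x = gOn k univ G x := by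
  have hy : ∀ᵐ y : Fin m → Rn n, ∀ i, F i (y i) = G i (y i) := ae_all_iff.2 fun i =>
    (Measure.quasiMeasurePreserving_eval (fun _ : Fin m => (volume : Measure (Rn n))) i).ae (h i)
  have h1 : ∀ t, ∫ y in univ, kt k t x y * ∏ i, F i (y i) =
      ∫ y in univ, kt k t x y * ∏ i, G i (y i) := by
    intro t
    rw [Measure.restrict_univ]
    refine integral_congr_ae ?_
    filter_upwards [hy] with y hy
    rw [Finset.prod_congr rfl fun i _ => hy i]
  simp only [gOn, h1]

lemma wMeas_congr_ae {ω ω' : Rn n → ℝ} (h : ω =ᵐ[volume] ω') (E : Set (Rn n)) :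
    wMeas ω E = wMeas ω' E :=
  lintegral_congr_ae (ae_restrict_of_ae (h.mono fun x hx => by simp only [hx]))

lemma morreyNormE_congr_ae {p : ℝ} {φ : Rn n → ℝ → ℝ} {ω ω' : Rn n → ℝ} {g g' : Rn n → ℝ≥0∞}
    (h : ω =ᵐ[volume] ω') (hg : g =ᵐ[volume] g') :
    morreyNormE p φ ω g = morreyNormE p φ ω' g' := by
  have h1 : ∀ E, wLpNormE p ω E g = wLpNormE p ω' E g' := fun E => by
    unfold wLpNormE
    rw [lintegral_congr_ae (ae_restrict_of_ae _)]
    filter_upwards [h, hg] with x hx hgx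
    rw [hx, hgx]
  simp only [morreyNormE, h1, wMeas_congr_ae h]

lemma morreyNorm_congr_ae {p : ℝ} {φ : Rn n → ℝ → ℝ} {ω ω' f f' : Rn n → ℝ}
    (h : ω =ᵐ[volume] ω') (hf : f =ᵐ[volume] f') :
    morreyNorm p φ ω f = morreyNorm p φ ω' f' :=
  morreyNormE_congr_ae h (hf.mono fun x hx => by simp only [hx])

lemma nuw_congr_ae {p : ℝ} {ps : Fin m → ℝ} {ωs ωs' : Fin m → Rn n → ℝ}
    (h : ∀ i, ωs i =ᵐ[volume] ωs' i) : nuw p ps ωs =ᵐ[volume] nuw p ps ωs' := by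
  filter_upwards [ae_all_iff.2 h] with x hx
  simp only [nuw, hx]

lemma essInf_ofReal_congr_ae {ω ω' : Rn n → ℝ} (h : ω =ᵐ[volume] ω') (E : Set (Rn n)) :
    essInf (fun y => ENNReal.ofReal (ω y)) (volume.restrict E) =
      essInf (fun y => ENNReal.ofReal (ω' y)) (volume.restrict E) :=
  essInf_congr_ae (ae_restrict_of_ae (h.mono fun x hx => by simp only [hx]))

lemma setLIntegral_ofReal_rpow_congr_ae {ω ω' : Rn n → ℝ} (h : ω =ᵐ[volume] ω') (E : Set (Rn n))
    (s : ℝ) : ∫⁻ y in E, ENNReal.ofReal (ω y) ^ s = ∫⁻ y in E, ENNReal.ofReal (ω' y) ^ s :=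
  lintegral_congr_ae (ae_restrict_of_ae (h.mono fun x hx => by simp only [hx]))

lemma IsAinf.congr_ae {ω ω' : Rn n → ℝ} (hA : IsAinf ω) (h : ω =ᵐ[volume] ω') : IsAinf ω' := by
  simpa only [IsAinf, IsA1, IsAq, wMeas_congr_ae h, essInf_ofReal_congr_ae h,
    setLIntegral_ofReal_rpow_congr_ae h] using hA

lemma IsMultiAP.congr_ae {p : ℝ} {ps : Fin m → ℝ} {ωs ωs' : Fin m → Rn n → ℝ}
    (hA : IsMultiAP p ps ωs) (h : ∀ i, ωs i =ᵐ[volume] ωs' i) : IsMultiAP p ps ωs' := by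
  simpa only [IsMultiAP, APfactor, wMeas_congr_ae (nuw_congr_ae h),
    fun i => essInf_ofReal_congr_ae (h i), fun i => setLIntegral_ofReal_rpow_congr_ae (h i)] using hA

lemma phiCond.congr_ae {j : ℕ} {ps : Fin m → ℝ} {φ1 : Fin m → Rn n → ℝ → ℝ}
    {ωs ωs' : Fin m → Rn n → ℝ} {φ2 : Rn n → ℝ → ℝ} (hc : phiCond j ps φ1 ωs φ2)
    (h : ∀ i, ωs i =ᵐ[volume] ωs' i) : phiCond j ps φ1 ωs' φ2 := by
  simpa only [phiCond, phiCondAt, essInfProd, fun i => wMeas_congr_ae (h i)] using hc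

lemma MemBMO.congr_ae {b b' : Rn n → ℝ} (hb : MemBMO b) (h : b =ᵐ[volume] b') : MemBMO b' := by
  refine ⟨fun x => (hb.1 x).congr h, ?_⟩
  have h1 : ∀ E, ballAvg b' E = ballAvg b E := fun E => by
    rw [ballAvg, ballAvg, integral_congr_ae (ae_restrict_of_ae h)]
  have h2 : bmoNorm b' = bmoNorm b := by
    simp only [bmoNorm, h1]
    refine iSup_congr fun x => iSup_congr fun r => iSup_congr fun _ => ?_
    congr 1
    refine lintegral_congr_ae (ae_restrict_of_ae (h.mono fun y hy => ?_))
    simp only [hy]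
  rw [h2]
  exact hb.2

lemma IsWeight.exists_measurable_pos {ω : Rn n → ℝ} (hw : IsWeight ω) :
    ∃ ω' : Rn n → ℝ, Measurable ω' ∧ (∀ x, 0 < ω' x) ∧ ω =ᵐ[volume] ω' := by
  have hae := hw.1.aestronglyMeasurable
  have hg := hae.stronglyMeasurable_mk.measurable
  classical
  refine ⟨fun x => if 0 < hae.mk ω x then hae.mk ω x else 1, ?_, fun x => ?_, ?_⟩
  · exact Measurable.ite (measurableSet_lt measurable_const hg) hg measurable_const
  · dsimp only
    split_ifs with h
    exacts [h, one_pos]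
  · filter_upwards [hae.ae_eq_mk, hw.2.2] with x hx hpos
    rw [if_pos (hx ▸ hpos), hx]

lemma _root_.MeasureTheory.LocallyIntegrable.exists_measurable_ae_eq {f : Rn n → ℝ}
    (hf : LocallyIntegrable f volume) : ∃ g : Rn n → ℝ, Measurable g ∧ f =ᵐ[volume] g :=
  ⟨hf.aestronglyMeasurable.mk f, hf.aestronglyMeasurable.stronglyMeasurable_mk.measurable,
    hf.aestronglyMeasurable.ae_eq_mk⟩

lemma exists_morreyNormE_sqFn_le [NeZero n] [NeZero m] {Kc : (Fin m → Rn n) → ℝ}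
    (hker : IsMLPKernel fun (x : Rn n) (y : Fin m → Rn n) => Kc fun i => x - y i)
    (hbdd : SqBddLq fun (x : Rn n) (y : Fin m → Rn n) => Kc fun i => x - y i)
    {ps : Fin m → ℝ} {p : ℝ} (hps : ∀ k, 1 < ps k) (hp : p⁻¹ = ∑ k, (ps k)⁻¹)
    {ωs : Fin m → Rn n → ℝ} (hw : ∀ i, IsWeight (ωs i)) (hAP : IsMultiAP p ps ωs)
    (hAinf : ∀ i, IsAinf (ωs i)) {φ1 : Fin m → Rn n → ℝ → ℝ} {φ2 : Rn n → ℝ → ℝ}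
    (hcond : phiCond m ps φ1 ωs φ2) {b : Fin m → Rn n → ℝ} (hb : ∀ j, MemBMO (b j)) :
    ∃ C : ℝ≥0, ∀ f : Fin m → Rn n → ℝ,
      (∀ i, MemMorrey (ps i) (φ1 i) (ωs i) (f i)) →
      morreyNormE p φ2 (nuw p ps ωs)
        (fun x => sqFn (fun (x' : Rn n) (y : Fin m → Rn n) => Kc fun i => x' - y i)
          (fun i y => (b i x - b i y) * f i y) x) ≤
        C * ∏ i, morreyNorm (ps i) (φ1 i) (ωs i) (f i) := by
  obtain ⟨k, A, γ, δ, B, hk, hsq⟩ := hker.exists_lpKernel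
  have hbd : GBdd k := by
    obtain ⟨qs, q, C, hqs, hq, h⟩ := hbdd
    refine ⟨qs, q, C, ENNReal.coe_ne_top, hqs, hq, fun f => ?_⟩
    have := h f
    rwa [show sqFn (fun (x : Rn n) (y : Fin m → Rn n) => Kc fun i => x - y i) f = gOn k univ f from
      funext (hsq f)] at this
  simp only [hsq]
  have hp0 : 0 < p := by
    rw [← inv_pos, hp]
    exact Finset.sum_pos (fun i _ => inv_pos.2 (by linarith [hps i])) Finset.univ_nonempty
  choose ω' hωm hωpos hω using fun i => (hw i).exists_measurable_pos
  choose b' hbm hbb using fun i => (hb i).1.exists_measurable_ae_eq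
  have hA : ∀ i, IsAinfMeas (weightMeas (ω' i)) := fun i =>
    isAinfMeas_of_isAinf (hωm i) (hωpos i) (fun x => ((hw i).1 x).congr (hω i))
      ((hAinf i).congr_ae (hω i))
  obtain ⟨C, hC, h⟩ := hk.exists_morreyNormE_le hbd hωm hωpos hp0 hps hp (hAP.congr_ae hω) hA
    (hcond.congr_ae hω) (fun i => (hb i).congr_ae (hbb i)) hbm
  refine ⟨C.toNNReal, fun f hf => ?_⟩
  rw [ENNReal.coe_toNNReal hC]
  choose f' hfm hff using fun i => (hf i).1.exists_measurable_ae_eq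
  have hM : ∀ i, morreyNorm (ps i) (φ1 i) (ωs i) (f i) =
      morreyNorm (ps i) (φ1 i) (ω' i) (f' i) := fun i => morreyNorm_congr_ae (hω i) (hff i)
  have h1 := h f' hfm fun i => by
    rw [← hM i]
    exact (hf i).2.ne
  simp only [hM]
  refine le_of_eq_of_le (morreyNormE_congr_ae (nuw_congr_ae hω) ?_) h1
  filter_upwards [ae_all_iff.2 hbb] with x hx
  refine gOn_congr_ae k (fun i => ?_) x
  filter_upwards [hbb i, hff i] with y hy hfy
  rw [hx, hy, hfy]

end MorreyBound

section DegenerateCases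

lemma lintegral_Ioi_inv_eq_top (r : ℝ) (hr : 0 < r) :
    ∫⁻ t in Ioi r, (ENNReal.ofReal t)⁻¹ = ⊤ := by
  by_contra h
  refine not_integrableOn_Ioi_inv (a := r) ⟨measurable_inv.aestronglyMeasurable, ?_⟩
  refine lt_of_eq_of_lt (setLIntegral_congr_fun measurableSet_Ioi fun t ht => ?_)
    (lt_top_iff_ne_top.2 h)
  have ht0 : 0 < t := hr.trans ht
  dsimp only
  rw [← ENNReal.ofReal_inv_of_pos ht0, Real.enorm_eq_ofReal (inv_nonneg.2 ht0.le)]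

lemma not_phiCond_zero {ps : Fin 0 → ℝ} {φ1 : Fin 0 → Rn n → ℝ → ℝ} {ωs : Fin 0 → Rn n → ℝ}
    {φ2 : Rn n → ℝ → ℝ} : ¬ phiCond 0 ps φ1 ωs φ2 := by
  intro h
  have hne : ∀ t : ℝ, (volume.restrict (Ioi t)) ≠ 0 := fun t h0 => by
    have := congrArg (fun μ : Measure ℝ => μ univ) h0
    simp at this
  have h1 : phiCondAt 0 ps φ1 ωs φ2 0 1 = ⊤ := by
    simp only [phiCondAt, essInfProd, pow_zero, Finset.univ_eq_empty, Finset.prod_empty, inv_one,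
      mul_one, one_mul, essInf_const _ (hne _), lintegral_Ioi_inv_eq_top 1 one_pos]
    exact ENNReal.mul_top (ENNReal.inv_ne_zero.2 ENNReal.ofReal_ne_top)
  unfold phiCond at h
  refine h.ne (top_le_iff.1 ?_)
  rw [← h1]
  exact le_iSup_of_le 0 (le_iSup_of_le 1 (le_iSup_of_le one_pos le_rfl))

lemma morreyNormE_sqFn_eq_zero [NeZero m] (K : Rn 0 → (Fin m → Rn 0) → ℝ) {p : ℝ} (hp : 0 < p)
    (φ : Rn 0 → ℝ → ℝ) (ω : Rn 0 → ℝ) (b f : Fin m → Rn 0 → ℝ) :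
    morreyNormE p φ ω (fun x => sqFn K (fun i y => (b i x - b i y) * f i y) x) = 0 := by
  have h1 : ∀ x, sqFn K (fun i y => (b i x - b i y) * f i y) x = 0 := fun x => by
    have h2 : ∀ y : Fin m → Rn 0, ∏ i, (b i x - b i (y i)) * f i (y i) = 0 := fun y =>
      Finset.prod_eq_zero (Finset.mem_univ 0) (by
        rw [Subsingleton.elim (y 0) x, sub_self, zero_mul])
    simp [sqFn, h2]
  have h3 : (0 : ℝ) < p⁻¹ := inv_pos.2 hp
  simp [morreyNormE, wLpNormE, h1, hp, h3]

end DegenerateCases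

/-- Theorem 4.5: boundedness on generalized weighted Morrey spaces of the
iterated commutator `𝒢_{Πb⃗}` of the multilinear Littlewood–Paley `g`-function with
convolution-type multilinear Littlewood–Paley kernel, for `b⃗ ∈ (BMO)^m`, under
`[φ⃗₁,φ₂]₂ < ∞`. -/
theorem stmt15 {n m : ℕ} (Kc : (Fin m → Rn n) → ℝ)
    (hker : IsMLPKernel fun (x : Rn n) (y : Fin m → Rn n) => Kc fun i => x - y i)
    (hbdd : SqBddLq fun (x : Rn n) (y : Fin m → Rn n) => Kc fun i => x - y i)
    (ps : Fin m → ℝ) (p : ℝ)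
    (hps : ∀ k, 1 < ps k) (hp : p⁻¹ = ∑ k, (ps k)⁻¹)
    (ωs : Fin m → Rn n → ℝ)
    (hw : ∀ i, IsWeight (ωs i)) (hAP : IsMultiAP p ps ωs) (hAinf : ∀ i, IsAinf (ωs i))
    (φ1 : Fin m → Rn n → ℝ → ℝ) (φ2 : Rn n → ℝ → ℝ)
    (hφ1m : ∀ i, Measurable fun q : Rn n × ℝ => φ1 i q.1 q.2)
    (hφ2m : Measurable fun q : Rn n × ℝ => φ2 q.1 q.2)
    (hφ1 : ∀ i x r, 0 ≤ φ1 i x r) (hφ2 : ∀ x r, 0 ≤ φ2 x r)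
    (hcond : phiCond m ps φ1 ωs φ2)
    (b : Fin m → Rn n → ℝ) (hb : ∀ j, MemBMO (b j)) :
    ∃ C : ℝ≥0, ∀ f : Fin m → Rn n → ℝ,
      (∀ i, MemMorrey (ps i) (φ1 i) (ωs i) (f i)) →
      morreyNormE p φ2 (nuw p ps ωs)
        (fun x => sqFn (fun (x' : Rn n) (y : Fin m → Rn n) => Kc fun i => x' - y i)
          (fun i y => (b i x - b i y) * f i y) x) ≤
        C * ∏ i, morreyNorm (ps i) (φ1 i) (ωs i) (f i) := by
  rcases Nat.eq_zero_or_pos m with rfl | hm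
  · exact absurd hcond not_phiCond_zero
  have : NeZero m := ⟨hm.ne'⟩
  rcases Nat.eq_zero_or_pos n with rfl | hn
  · have hp0 : 0 < p := by
      rw [← inv_pos, hp]
      exact Finset.sum_pos (fun i _ => inv_pos.2 (by linarith [hps i])) Finset.univ_nonempty
    refine ⟨0, fun f _ => ?_⟩
    rw [morreyNormE_sqFn_eq_zero _ hp0]
    exact zero_le
  have : NeZero n := ⟨hn.ne'⟩
  exact exists_morreyNormE_sqFn_le hker hbdd hps hp hw hAP hAinf hcond hb
end GWM
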